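/- Let n ≥ 4 and let ρ be an injective group endomorphism of B_n/Z(B_n). Then there exist an element c ∈ B_n/Z(B_n) and e ∈ {0,1} such that ρ(x) = c·χ̄^e(x)·c^{−1} for all x ∈ B_n/Z(B_n), where χ̄ is the automorphism of B_n/Z(B_n) induced by the inversion automorphism χ of B_n. (This is the algebraic form of the statement that ρ is induced by a homeomorphism h of the n-punctured disk, with ρ(H_a) = H_{h(a)}^{ε(h)} for every half-twist H_a.) -/

import Mathlib

/-- Relators for the braid group with generators `σ_0, …, σ_{m-1}`:
the braid relations `σ_i σ_j σ_i = σ_j σ_i σ_j` for `j = i+1`, and the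
commutation relations `σ_i σ_j = σ_j σ_i` for `j ≥ i+2`. -/
def braidRels (m : ℕ) : Set (FreeGroup (Fin m)) :=
  { r | ∃ i j : Fin m,
      ((i : ℕ) + 1 = (j : ℕ) ∧
        r = FreeGroup.of i * FreeGroup.of j * FreeGroup.of i *
            (FreeGroup.of j * FreeGroup.of i * FreeGroup.of j)⁻¹) ∨
      ((i : ℕ) + 2 ≤ (j : ℕ) ∧
        r = FreeGroup.of i * FreeGroup.of j * (FreeGroup.of j * FreeGroup.of i)⁻¹) }

/-- The braid group on `n` strands: the presented group with generators
`σ_1, …, σ_{n-1}` (indexed by `Fin (n-1)`) and the braid relators. -/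
abbrev BraidGroup (n : ℕ) : Type := PresentedGroup (braidRels (n - 1))

/-- The standard generator `σ_{i+1}` of the braid group (0-indexed). -/
def braidσ (n : ℕ) (i : Fin (n - 1)) : BraidGroup n := PresentedGroup.of i

/-- The element `δ = σ_1 σ_2 ⋯ σ_{n-1}` of the braid group. -/
def braidδ (n : ℕ) : BraidGroup n := (List.ofFn (braidσ n)).prod

/-- The full twist `z = (σ_1 σ_2 ⋯ σ_{n-1})^n`. -/
def fullTwist (n : ℕ) : BraidGroup n := braidδ n ^ n

namespace BraidInj

open FreeGroup in
theorem mem_zpowers_of_commute_of {α : Type*} [DecidableEq α] (a : α) :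
    ∀ (k : ℕ) (f : FreeGroup α), f.norm ≤ k → Commute f (of a) → f ∈ Subgroup.zpowers (of a) := by
  intro k
  induction k with
  | zero =>
    intro f hf _
    rw [Nat.le_zero, FreeGroup.norm_eq_zero] at hf
    subst hf; exact one_mem _
  | succ k ih =>
    intro f hf hc
    rcases hL : f.toWord with _ | ⟨⟨c, b⟩, L⟩
    · rw [toWord_eq_nil_iff] at hL
      subst hL; exact one_mem _
    · have hred : IsReduced ((c, b) :: L) := hL ▸ isReduced_toWord
      have hmk : f = mk ((c, b) :: L) := by rw [← hL, mk_toWord]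
      by_cases hca : c = a
      · subst hca
        have hsplit : f = mk [(c, b)] * mk L := by rw [hmk, mul_mk]; rfl
        have hx : mk [(c, b)] ∈ Subgroup.zpowers (of c) := by
          cases b
          · exact ⟨-1, by simp only [zpow_neg_one]; rfl⟩
          · exact ⟨1, by simp only [zpow_one]; rfl⟩
        have hxc : Commute (mk [(c, b)]) (of c) := by
          obtain ⟨j, hj⟩ := hx
          rw [← hj]; exact (Commute.refl _).zpow_left j
        have h2 : mk L = (mk [(c, b)])⁻¹ * f := by rw [hsplit]; group
        have hm := ih (mk L) (norm_mk_le.trans (by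
          have : f.norm = L.length + 1 := by simp [FreeGroup.norm, hL]
          omega)) (by rw [h2]; exact hxc.inv_left.mul_left hc)
        rw [hsplit]; exact mul_mem hx hm
      · exfalso
        have h1 : mk (((c, b) :: L) ++ [(a, true)]) = mk ((a, true) :: (c, b) :: L) := by
          have := hc.eq
          rw [hmk] at this
          exact this
        have hr : IsReduced ((a, true) :: (c, b) :: L) := by
          rw [isReduced_cons_cons]
          exact ⟨fun h => absurd h.symm hca, hred⟩
        have h2 := reduce.sound h1
        rw [hr.reduce_eq] at h2
        have h3 : Red (((c, b) :: L) ++ [(a, true)]) ((a, true) :: (c, b) :: L) := by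
          rw [← h2]; exact reduce.red
        have h4 := h3.sublist.eq_of_length (by simp)
        simp at h4
        exact hca h4.1.1.symm

theorem zpowers_of_commute_of {α : Type*} {a : α} {f : FreeGroup α}
    (h : Commute f (FreeGroup.of a)) : f ∈ Subgroup.zpowers (FreeGroup.of a) := by
  classical
  exact mem_zpowers_of_commute_of a _ f le_rfl h

/-- The exponent sum of the letter `a`. -/
def expo {α : Type*} [DecidableEq α] (a : α) : FreeGroup α →* Multiplicative ℤ :=
  FreeGroup.lift fun b => if b = a then Multiplicative.ofAdd 1 else 1

@[simp] theorem expo_of {α : Type*} [DecidableEq α] (a b : α) :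
    expo a (FreeGroup.of b) = if b = a then Multiplicative.ofAdd 1 else 1 := by
  simp [expo]

theorem zpow_of_injective {α : Type*} (a : α) : Function.Injective fun k : ℤ => FreeGroup.of a ^ k := by
  classical
  intro j k h
  have := congrArg (expo a) h
  simpa [← ofAdd_zsmul] using this

theorem subsingleton_of_central {α : Type*} {f : FreeGroup α} (h1 : f ≠ 1)
    (h : ∀ g, Commute f g) : Subsingleton α := by
  classical
  refine ⟨fun a b => ?_⟩
  by_contra hab
  obtain ⟨j, hj⟩ := zpowers_of_commute_of (h (FreeGroup.of a))
  obtain ⟨k, hk⟩ := zpowers_of_commute_of (h (FreeGroup.of b))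
  have := congrArg (expo a) (hj.trans hk.symm)
  have hj0 : j = 0 := by simpa [← ofAdd_zsmul, Ne.symm hab] using this
  subst hj0
  exact h1 (by simpa using hj.symm)

/-- In a free group the centralizer of a nontrivial element is cyclic. -/
theorem exists_root_of_centralizer {F : Type*} [Group F] [IsFreeGroup F] {g : F} (hg : g ≠ 1) :
    ∃ r : F, Commute r g ∧ ∀ f, Commute f g → f ∈ Subgroup.zpowers r := by
  classical
  let K := Subgroup.centralizer {g}
  let e := IsFreeGroup.toFreeGroup K
  have hmem : ∀ f : F, f ∈ K ↔ Commute f g := fun f => by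
    rw [Subgroup.mem_centralizer_singleton_iff, Commute, SemiconjBy]
  have hgK : g ∈ K := (hmem g).2 (Commute.refl g)
  have hsub : Subsingleton (IsFreeGroup.Generators K) := by
    apply subsingleton_of_central (f := e ⟨g, hgK⟩)
    · intro h
      apply hg
      have := e.injective (h.trans (map_one e).symm)
      exact congrArg Subtype.val this
    · intro x
      obtain ⟨⟨y, hy⟩, rfl⟩ := e.surjective x
      apply Commute.map
      apply Subtype.ext
      exact ((hmem y).1 hy).symm.eq
  rcases isEmpty_or_nonempty (IsFreeGroup.Generators K) with hE | ⟨⟨a⟩⟩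
  · exfalso
    apply hg
    have := e.injective (Subsingleton.elim (e ⟨g, hgK⟩) (e 1))
    exact congrArg Subtype.val this
  · refine ⟨(e.symm (FreeGroup.of a) : K), (hmem _).1 (e.symm (FreeGroup.of a)).2, fun f hf => ?_⟩
    have h1 : e ⟨f, (hmem f).2 hf⟩ ∈ Subgroup.zpowers (FreeGroup.of a) := by
      have : ∀ x : FreeGroup (IsFreeGroup.Generators K), x ∈ Subgroup.zpowers (FreeGroup.of a) := by
        intro x
        induction x using FreeGroup.induction_on with
        | C1 => exact one_mem _
        | of x => rw [Subsingleton.elim x a]; exact Subgroup.mem_zpowers _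
        | inv_of x hx => exact inv_mem hx
        | mul x y hx hy => exact mul_mem hx hy
      exact this _
    obtain ⟨k, hk⟩ := h1
    refine ⟨k, ?_⟩
    have : e.symm (FreeGroup.of a) ^ k = ⟨f, (hmem f).2 hf⟩ := by
      apply e.injective
      rw [map_zpow, MulEquiv.apply_symm_apply]; exact hk
    simpa using congrArg Subtype.val this

theorem commute_trans {F : Type*} [Group F] [IsFreeGroup F] {f g h : F} (hg : g ≠ 1)
    (h1 : Commute f g) (h2 : Commute h g) : Commute f h := by
  obtain ⟨r, -, hr⟩ := exists_root_of_centralizer hg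
  obtain ⟨j, hj⟩ := hr f h1
  obtain ⟨k, hk⟩ := hr h h2
  rw [← hj, ← hk]
  exact ((Commute.refl r).zpow_left j).zpow_right k

end BraidInj

namespace BraidInj

open FreeGroup (of lift)

/-- A sequence whose first `n - 1` terms satisfy the braid relations of `B_n`. -/
structure BraidTuple {H : Type*} [Group H] (n : ℕ) (s : ℕ → H) : Prop where
  braid : ∀ i, i + 2 < n → s i * s (i + 1) * s i = s (i + 1) * s i * s (i + 1)
  comm : ∀ i j, i + 2 ≤ j → j + 1 < n → Commute (s i) (s j)

namespace BraidTuple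

variable {H : Type*} [Group H] {n m : ℕ} {s y : ℕ → H}

theorem mono (h : BraidTuple n s) (hmn : m ≤ n) : BraidTuple m s :=
  ⟨fun i hi => h.braid i (by omega), fun i j hij hj => h.comm i j hij (by omega)⟩

theorem map {K : Type*} [Group K] (h : BraidTuple n s) (f : H →* K) :
    BraidTuple n fun i => f (s i) :=
  ⟨fun i hi => by simp only [← map_mul, h.braid i hi], fun i j hij hj => (h.comm i j hij hj).map f⟩

end BraidTuple

/-- The subgroup generated by the first `n - 1` terms of a sequence. -/
def gens {H : Type*} [Group H] (n : ℕ) (s : ℕ → H) : Subgroup H :=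
  Subgroup.closure {g | ∃ i, i + 1 < n ∧ s i = g}

section gens

variable {H : Type*} [Group H] {n m : ℕ} {s : ℕ → H}

theorem mem_gens {i : ℕ} (hi : i + 1 < n) : s i ∈ gens n s :=
  Subgroup.subset_closure ⟨i, hi, rfl⟩

theorem gens_le {K : Subgroup H} : gens n s ≤ K ↔ ∀ i, i + 1 < n → s i ∈ K := by
  rw [gens, Subgroup.closure_le]
  exact ⟨fun h i hi => h ⟨i, hi, rfl⟩, fun h g ⟨i, hi, hg⟩ => hg ▸ h i hi⟩

theorem gens_mono (hmn : m ≤ n) : gens m s ≤ gens n s :=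
  gens_le.2 fun _ hi => mem_gens (by omega)

theorem gens_induction {p : H → Prop} (hs : ∀ i, i + 1 < n → p (s i)) (h1 : p 1)
    (hm : ∀ x y, p x → p y → p (x * y)) (hi : ∀ x, p x → p x⁻¹) {g : H} (hg : g ∈ gens n s) :
    p g := by
  induction hg using Subgroup.closure_induction with
  | mem x hx => obtain ⟨i, hi, rfl⟩ := hx; exact hs i hi
  | one => exact h1
  | mul x y _ _ hx hy => exact hm x y hx hy
  | inv x _ hx => exact hi x hx

theorem commute_gens {x : H} (h : ∀ i, i + 1 < n → Commute (s i) x) {g : H} (hg : g ∈ gens n s) :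
    Commute g x :=
  gens_induction (p := fun g => Commute g x) h (Commute.one_left x)
    (fun _ _ h1 h2 => h1.mul_left h2) (fun _ h1 => h1.inv_left) hg

end gens

/-- The subgroup of the free group generated by the first `n` letters. -/
def Fr (n : ℕ) : Subgroup (FreeGroup ℕ) :=
  Subgroup.closure {g | ∃ i, i < n ∧ of i = g}

theorem of_mem_Fr {n i : ℕ} (hi : i < n) : of i ∈ Fr n := Subgroup.subset_closure ⟨i, hi, rfl⟩

theorem Fr_le {n : ℕ} {K : Subgroup (FreeGroup ℕ)} : Fr n ≤ K ↔ ∀ i, i < n → of i ∈ K := by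
  rw [Fr, Subgroup.closure_le]
  exact ⟨fun h i hi => h ⟨i, hi, rfl⟩, fun h g ⟨i, hi, hg⟩ => hg ▸ h i hi⟩

theorem Fr_mono {m n : ℕ} (hmn : m ≤ n) : Fr m ≤ Fr n :=
  Fr_le.2 fun _ hi => of_mem_Fr (by omega)

theorem Fr_induction {n : ℕ} {p : FreeGroup ℕ → Prop} (hs : ∀ i, i < n → p (of i)) (h1 : p 1)
    (hm : ∀ x y, p x → p y → p (x * y)) (hi : ∀ x, p x → p x⁻¹) {g : FreeGroup ℕ}
    (hg : g ∈ Fr n) : p g := by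
  induction hg using Subgroup.closure_induction with
  | mem x hx => obtain ⟨i, hi, rfl⟩ := hx; exact hs i hi
  | one => exact h1
  | mul x y _ _ hx hy => exact hm x y hx hy
  | inv x _ hx => exact hi x hx

theorem eqOn_Fr {n : ℕ} {K : Type*} [Group K] {f f' : FreeGroup ℕ →* K}
    (h : ∀ i, i < n → f (of i) = f' (of i)) {g : FreeGroup ℕ} (hg : g ∈ Fr n) : f g = f' g :=
  Fr_induction (p := fun g => f g = f' g) h (by simp)
    (fun _ _ h1 h2 => by simp [h1, h2]) (fun _ h1 => by simp [h1]) hg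

theorem map_Fr_le {n : ℕ} {K : Type*} [Group K] {f : FreeGroup ℕ →* K} {S : Subgroup K}
    (h : ∀ i, i < n → f (of i) ∈ S) {g : FreeGroup ℕ} (hg : g ∈ Fr n) : f g ∈ S :=
  (Fr_le (K := S.comap f)).2 h hg

/-- Artin's automorphism attached to the `i`-th standard generator. -/
def artin (i : ℕ) : MulAut (FreeGroup ℕ) :=
  MonoidHom.toMulEquiv
    (lift fun j => if j = i then of i * of (i + 1) * (of i)⁻¹ else if j = i + 1 then of i else of j)
    (lift fun j =>
      if j = i then of (i + 1) else if j = i + 1 then (of (i + 1))⁻¹ * of i * of (i + 1) else of j)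
    (by
      ext j
      by_cases h : j = i
      · subst h; simp [mul_assoc]
      · by_cases h' : j = i + 1
        · subst h'; simp
        · simp [h, h'])
    (by
      ext j
      by_cases h : j = i
      · subst h; simp
      · by_cases h' : j = i + 1
        · subst h'; simp [mul_assoc]
        · simp [h, h'])

theorem artin_of (i j : ℕ) : artin i (of j) =
    if j = i then of i * of (i + 1) * (of i)⁻¹ else if j = i + 1 then of i else of j := by
  simp [artin]

@[simp] theorem artin_self (i : ℕ) : artin i (of i) = of i * of (i + 1) * (of i)⁻¹ := by
  simp [artin_of]

@[simp] theorem artin_succ (i : ℕ) : artin i (of (i + 1)) = of i := by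
  simp [artin_of]

theorem artin_of_ne {i j : ℕ} (h1 : j ≠ i) (h2 : j ≠ i + 1) : artin i (of j) = of j := by
  simp [artin_of, h1, h2]

theorem mulAut_ext {α : Type*} {f g : MulAut (FreeGroup α)} (h : ∀ j, f (of j) = g (of j)) :
    f = g := by
  apply MulEquiv.toMonoidHom_injective
  exact FreeGroup.ext_hom _ _ h

theorem braidTuple_artin (n : ℕ) : BraidTuple n artin := by
  constructor
  · intro i _
    apply mulAut_ext
    intro j
    simp only [MulAut.mul_apply]
    have h : j = i ∨ j = i + 1 ∨ j = i + 2 ∨ (j ≠ i ∧ j ≠ i + 1 ∧ j ≠ i + 2) := by omega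
    rcases h with rfl | rfl | rfl | ⟨h1, h2, h3⟩
    · simp [artin_of, mul_assoc, show j ≠ j + 1 + 1 by omega, show j + 1 + 1 ≠ j by omega]
    · simp [artin_of, mul_assoc, show i ≠ i + 1 + 1 by omega, show i + 1 + 1 ≠ i by omega]
    · simp [artin_of, show i ≠ i + 1 + 1 by omega]
    · simp [artin_of, h1, h2, h3]
  · intro i k hik _
    apply mulAut_ext
    intro j
    simp only [MulAut.mul_apply]
    have h : j = i ∨ j = i + 1 ∨ j = k ∨ j = k + 1 ∨
      (j ≠ i ∧ j ≠ i + 1 ∧ j ≠ k ∧ j ≠ k + 1) := by omega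
    have e1 : i ≠ k := by omega
    have e2 : i ≠ k + 1 := by omega
    have e3 : i + 1 ≠ k := by omega
    rcases h with rfl | rfl | rfl | rfl | ⟨h1, h2, h3, h4⟩
    · simp [artin_of, e1, e2, e3]
    · simp [artin_of, e1, e2, e3]
    · simp [artin_of, Ne.symm e1, Ne.symm e2, Ne.symm e3]
    · simp [artin_of, Ne.symm e1, Ne.symm e2, Ne.symm e3]
    · simp [artin_of, h1, h2, h3, h4]

theorem artin_mem_Fr {n i : ℕ} (hi : i + 1 < n) {f : FreeGroup ℕ} (hf : f ∈ Fr n) :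
    artin i f ∈ Fr n := by
  refine map_Fr_le (f := (artin i).toMonoidHom) (fun j hj => ?_) hf
  change artin i (of j) ∈ Fr n
  rw [artin_of]
  split_ifs
  · exact mul_mem (mul_mem (of_mem_Fr (by omega)) (of_mem_Fr hi)) (inv_mem (of_mem_Fr (by omega)))
  · exact of_mem_Fr (by omega)
  · exact of_mem_Fr hj

theorem artin_symm_mem_Fr {n i : ℕ} (hi : i + 1 < n) {f : FreeGroup ℕ} (hf : f ∈ Fr n) :
    (artin i)⁻¹ f ∈ Fr n := by
  refine map_Fr_le (f := ((artin i)⁻¹).toMonoidHom) (fun j hj => ?_) hf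
  change (artin i)⁻¹ (of j) ∈ Fr n
  have : (artin i)⁻¹ (of j) =
    if j = i then of (i + 1) else if j = i + 1 then (of (i + 1))⁻¹ * of i * of (i + 1) else of j := by
    change (artin i).symm (of j) = _
    simp [artin]
  rw [this]
  split_ifs
  · exact of_mem_Fr hi
  · exact mul_mem (mul_mem (inv_mem (of_mem_Fr hi)) (of_mem_Fr (by omega))) (of_mem_Fr hi)
  · exact of_mem_Fr hj

/-- A family produced from one element by descending conjugation, on which the braid tuple `s`
acts by Artin's formulas. -/
structure ArtinFamily {H : Type*} [Group H] (k : ℕ) (s y : ℕ → H) : Prop where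
  tuple : BraidTuple k s
  rec_ : ∀ i, i + 1 < k → y i = s i * y (i + 1) * (s i)⁻¹
  comm : ∀ i j, i + 1 < j → j + 1 = k → Commute (s i) (y j)
  last : ∀ i, i + 2 = k → Commute (y (i + 1)) (s i * (y (i + 1))⁻¹ * s i)

namespace ArtinFamily

variable {H : Type*} [Group H] {k : ℕ} {s y : ℕ → H}

theorem commute_above (h : ArtinFamily k s y) :
    ∀ d i j, i + d + 1 = k → j + 1 < i → Commute (s j) (y i) := by
  intro d
  induction d with
  | zero => intro i j hi hj; exact h.comm j i (by omega) (by omega)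
  | succ d ih =>
    intro i j hi hj
    rw [h.rec_ i (by omega)]
    have h1 := h.tuple.comm j i (by omega) (by omega)
    exact (h1.mul_right (ih (i + 1) j (by omega) (by omega))).mul_right h1.inv_right

theorem commute_below (h : ArtinFamily k s y) :
    ∀ d i j, i + d + 1 = k → i < j → j + 1 < k → Commute (s j) (y i) := by
  intro d
  induction d with
  | zero => intro i j hi hj hk; omega
  | succ d ih =>
    intro i j hi hj hk
    rw [h.rec_ i (by omega)]
    rcases Nat.lt_or_ge (i + 1) j with hj' | hj'
    · have h1 := (h.tuple.comm i j (by omega) (by omega)).symm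
      exact (h1.mul_right (ih (i + 1) j (by omega) (by omega) hk)).mul_right h1.inv_right
    · obtain rfl : j = i + 1 := by omega
      rw [h.rec_ (i + 1) (by omega)]
      have h1 := h.tuple.braid i (by omega)
      have h2 := h.commute_above (d - 1) (i + 2) i (by omega) (by omega)
      generalize s i = a at *
      generalize s (i + 1) = b at *
      have e : y (i + 1 + 1) = y (i + 2) := rfl
      rw [e]
      generalize y (i + 2) = z at *
      have h3 : a * b * z * b⁻¹ * a⁻¹ = (a * b) * z * (a * b)⁻¹ := by group
      have h4 : b * (a * b) = (a * b) * a := by rw [← mul_assoc, ← h1]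
      have : b * ((a * b) * z * (a * b)⁻¹) = ((a * b) * z * (a * b)⁻¹) * b := by
        have h5 : b = (a * b) * a * (a * b)⁻¹ := by rw [← h4]; group
        calc b * ((a * b) * z * (a * b)⁻¹) = (b * (a * b)) * z * (a * b)⁻¹ := by group
          _ = (a * b) * (a * z) * (a * b)⁻¹ := by rw [h4]; group
          _ = (a * b) * z * (a * b)⁻¹ * ((a * b) * a * (a * b)⁻¹) := by rw [h2.eq]; group
          _ = _ := by rw [← h5]
      rw [Commute, SemiconjBy]
      convert this using 1 <;> group

theorem pair (h : ArtinFamily k s y) :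
    ∀ d i, i + d + 2 = k → s i * y (i + 1) * (s i)⁻¹ * y (i + 1) =
      y (i + 1) * (s i)⁻¹ * y (i + 1) * s i := by
  intro d
  induction d with
  | zero =>
    intro i hi
    have h1 := (h.last i (by omega)).inv_right.eq
    generalize s i = a at *
    generalize y (i + 1) = z at *
    have h2 : z * a⁻¹ * z * a⁻¹ = a⁻¹ * z * a⁻¹ * z := by
      convert h1 using 1 <;> group
    calc a * z * a⁻¹ * z = a * a * (a⁻¹ * z * a⁻¹ * z) := by group
      _ = a * a * (z * a⁻¹ * z * a⁻¹) := by rw [h2]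
      _ = a * (a * (z * a⁻¹ * z * a⁻¹) * a) * a⁻¹ := by group
      _ = a * (a * (a⁻¹ * z * a⁻¹ * z) * a) * a⁻¹ := by rw [h2]
      _ = a * (z * a⁻¹ * z * a⁻¹ * (a * a)) * a⁻¹ := by group
      _ = a * (a⁻¹ * z * a⁻¹ * z * (a * a)) * a⁻¹ := by rw [h2]
      _ = z * a⁻¹ * z * a := by group
  | succ d ih =>
    intro i hi
    have h0 := ih (i + 1) (by omega)
    have h1 := h.tuple.braid i (by omega)
    have h2 := h.commute_above d (i + 2) i (by omega) (by omega)
    have h3 := h.rec_ (i + 1) (by omega)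
    generalize s i = a at *
    generalize s (i + 1) = b at *
    have e : y (i + 1 + 1) = y (i + 2) := rfl
    rw [e] at h0 h3
    generalize y (i + 1) = w at *
    generalize y (i + 2) = z at *
    have ha : a = MulAut.conj (b * a) b := by
      rw [MulAut.conj_apply, eq_mul_inv_iff_mul_eq, ← mul_assoc, h1]
    have hw : w = MulAut.conj (b * a) z := by
      rw [MulAut.conj_apply, h3, eq_mul_inv_iff_mul_eq, mul_assoc b a z, h2.eq]; group
    generalize MulAut.conj (b * a) = c at ha hw
    have := congrArg c h0
    simp only [map_mul, map_inv, ← ha, ← hw] at this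
    exact this

theorem conj_of (h : ArtinFamily k s y) {i j : ℕ} (hi : i + 1 < k) (hj : j < k) :
    s i * y j * (s i)⁻¹ = lift y (artin i (of j)) := by
  rw [artin_of]
  split_ifs with h1 h2
  · subst h1
    have h3 := h.pair (k - j - 2) j (by omega)
    have h4 := h.rec_ j hi
    simp only [map_mul, map_inv, FreeGroup.lift_apply_of]
    rw [h4]
    generalize s j = a at *
    generalize y (j + 1) = z at *
    calc a * (a * z * a⁻¹) * a⁻¹ = a * (a * z * a⁻¹ * z) * z⁻¹ * a⁻¹ := by group
      _ = a * (z * a⁻¹ * z * a) * z⁻¹ * a⁻¹ := by rw [h3]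
      _ = _ := by group
  · subst h2
    rw [FreeGroup.lift_apply_of, h.rec_ i hi]
  · rw [FreeGroup.lift_apply_of, mul_inv_eq_iff_eq_mul]
    rcases Nat.lt_or_ge i j with hij | hij
    · exact (h.commute_above (k - j - 1) j i (by omega) (by omega)).eq
    · exact (h.commute_below (k - j - 1) j i (by omega) (by omega) hi).eq

theorem conj_lift (h : ArtinFamily k s y) {i : ℕ} (hi : i + 1 < k) {f : FreeGroup ℕ}
    (hf : f ∈ Fr k) : s i * lift y f * (s i)⁻¹ = lift y (artin i f) := by
  have := eqOn_Fr (f := (MulAut.conj (s i)).toMonoidHom.comp (lift y))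
    (f' := (lift y).comp (artin i).toMonoidHom) (n := k)
    (fun j hj => by simpa using h.conj_of hi hj) hf
  simpa using this

/-- Equivariance for every element of the group generated by the tuple. -/
theorem conj_gens (h : ArtinFamily k s y) (p : H →* MulAut (FreeGroup ℕ))
    (hp : ∀ i, i + 1 < k → p (s i) = artin i) {g : H} (hg : g ∈ gens k s) :
    ∀ f ∈ Fr k, p g f ∈ Fr k ∧ g * lift y f * g⁻¹ = lift y (p g f) := by
  suffices ∀ f ∈ Fr k, (p g f ∈ Fr k ∧ g * lift y f * g⁻¹ = lift y (p g f)) ∧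
      (p g⁻¹ f ∈ Fr k ∧ g⁻¹ * lift y f * g = lift y (p g⁻¹ f)) from fun f hf => (this f hf).1
  refine gens_induction (p := fun g => ∀ f ∈ Fr k,
      (p g f ∈ Fr k ∧ g * lift y f * g⁻¹ = lift y (p g f)) ∧
      (p g⁻¹ f ∈ Fr k ∧ g⁻¹ * lift y f * g = lift y (p g⁻¹ f))) ?_ ?_ ?_ ?_ hg
  · intro i hi f hf
    rw [map_inv, hp i hi]
    refine ⟨⟨artin_mem_Fr hi hf, h.conj_lift hi hf⟩, artin_symm_mem_Fr hi hf, ?_⟩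
    have := h.conj_lift hi (artin_symm_mem_Fr hi hf)
    rw [← MulAut.mul_apply, mul_inv_cancel, MulAut.one_apply] at this
    rw [← this]; group
  · intro f hf; simpa using hf
  · intro a b ha hb f hf
    refine ⟨⟨?_, ?_⟩, ?_, ?_⟩
    · rw [map_mul, MulAut.mul_apply]; exact (ha _ (hb f hf).1.1).1.1
    · rw [map_mul, MulAut.mul_apply, ← (ha _ (hb f hf).1.1).1.2, ← (hb f hf).1.2]; group
    · rw [mul_inv_rev, map_mul, MulAut.mul_apply]; exact (hb _ (ha f hf).2.1).2.1
    · rw [mul_inv_rev, map_mul, MulAut.mul_apply, ← (hb _ (ha f hf).2.1).2.2, ← (ha f hf).2.2]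
      group
  · intro a ha f hf
    rw [inv_inv]
    exact ⟨(ha f hf).2, (ha f hf).1⟩

end ArtinFamily

end BraidInj

namespace BraidInj

open FreeGroup (of lift)

section cosets

variable {H : Type*} [Group H] {l : ℕ} {s r : ℕ → H}

theorem coset_commute (h : BraidTuple (l + 2) s) (r1 : r (l + 1) = 1)
    (hr : ∀ j ≤ l, r j = r (j + 1) * s j) :
    ∀ d i j, j + d = l + 1 → i + 1 < j → Commute (s i) (r j) := by
  intro d
  induction d with
  | zero => intro i j hj _; obtain rfl : j = l + 1 := by omega
            rw [r1]; exact Commute.one_right _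
  | succ d ih =>
    intro i j hj hi
    rw [hr j (by omega)]
    exact (ih i (j + 1) (by omega) (by omega)).mul_right (h.comm i j (by omega) (by omega))

theorem coset_shift (h : BraidTuple (l + 2) s) (r1 : r (l + 1) = 1)
    (hr : ∀ j ≤ l, r j = r (j + 1) * s j) :
    ∀ d i j, j + d = i → i + 1 ≤ l → r j * s (i + 1) = s i * r j := by
  intro d
  induction d with
  | zero =>
    rintro i j rfl hi
    simp only [Nat.add_zero] at *
    rw [hr j (by omega), hr (j + 1) (by omega)]
    have h1 := h.braid j (by omega)
    have h2 := (coset_commute h r1 hr (l - 1 - j) j (j + 2) (by omega) (by omega)).eq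
    have e : r (j + 1 + 1) = r (j + 2) := rfl
    rw [e]
    generalize r (j + 2) = z at *
    generalize s j = a at *
    generalize s (j + 1) = b at *
    calc z * b * a * b = z * (b * a * b) := by group
      _ = (z * a) * b * a := by rw [← h1]; group
      _ = a * (z * b * a) := by rw [← h2]; group
  | succ d ih =>
    intro i j hj hi
    rw [hr j (by omega), mul_assoc, (h.comm j (i + 1) (by omega) (by omega)).eq, ← mul_assoc,
      ih i (j + 1) (by omega) hi, mul_assoc]

theorem coset_sq (h : BraidTuple (l + 2) s) (r1 : r (l + 1) = 1)
    (hr : ∀ j ≤ l, r j = r (j + 1) * s j) {S : Subgroup H} (hS : ∀ i < l, s i ∈ S)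
    (h2 : s l * s l ∈ S) :
    ∀ d j, j + d = l → r (j + 1) * (s j * s j) * (r (j + 1))⁻¹ ∈ S := by
  intro d
  induction d with
  | zero => intro j hj; obtain rfl : j = l := by omega
            rw [r1]; simpa using h2
  | succ d ih =>
    intro j hj
    have h3 := ih (j + 1) (by omega)
    have h1 := h.braid j (by omega)
    have hc := (coset_commute h r1 hr d j (j + 2) (by omega) (by omega))
    rw [hr (j + 1) (by omega)]
    have e : r (j + 1 + 1) = r (j + 2) := rfl
    rw [e] at *
    have hj' := hS j (by omega)
    generalize r (j + 2) = z at *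
    generalize s j = a at *
    generalize s (j + 1) = b at *
    have key : b * (a * a) * b⁻¹ = a⁻¹ * (b * b) * a := by
      rw [eq_comm, mul_assoc, inv_mul_eq_iff_eq_mul]
      calc b * b * a = b * (b * a * b) * b⁻¹ := by group
        _ = b * (a * b * a) * b⁻¹ := by rw [h1]
        _ = (b * a * b) * a * b⁻¹ := by group
        _ = (a * b * a) * a * b⁻¹ := by rw [h1]
        _ = a * (b * (a * a) * b⁻¹) := by group
    have : z * b * (a * a) * (z * b)⁻¹ = a⁻¹ * (z * (b * b) * z⁻¹) * a := by
      calc z * b * (a * a) * (z * b)⁻¹ = z * (b * (a * a) * b⁻¹) * z⁻¹ := by group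
        _ = (z * a⁻¹) * (b * b) * (a * z⁻¹) := by rw [key]; group
        _ = _ := by rw [hc.symm.inv_right.eq, hc.inv_right.eq]; group
    rw [this]
    exact mul_mem (mul_mem (inv_mem hj') h3) hj'

/-- A subgroup containing the first generators and the square of the last one has at most
`l + 2` cosets, represented by the descending products `r j`. -/
theorem exists_coset (h : BraidTuple (l + 2) s) (r1 : r (l + 1) = 1)
    (hr : ∀ j ≤ l, r j = r (j + 1) * s j) {S : Subgroup H} (hS : ∀ i < l, s i ∈ S)
    (h2 : s l * s l ∈ S) {g : H} (hg : g ∈ gens (l + 2) s) :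
    ∃ j ≤ l + 1, g * (r j)⁻¹ ∈ S := by
  have step : ∀ i j, i ≤ l → j ≤ l + 1 →
      (∃ j' ≤ l + 1, r j * s i * (r j')⁻¹ ∈ S) ∧ ∃ j' ≤ l + 1, r j * (s i)⁻¹ * (r j')⁻¹ ∈ S := by
    intro i j hi hj
    have : i + 1 < j ∨ j = i + 1 ∨ j = i ∨ ∃ i', i = i' + 1 ∧ j ≤ i' := by
      rcases Nat.lt_or_ge j i with h | h
      · exact .inr (.inr (.inr ⟨i - 1, by omega, by omega⟩))
      · omega
    rcases this with h3 | rfl | rfl | ⟨i, rfl, h3⟩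
    · have hc := coset_commute h r1 hr (l + 1 - j) i j (by omega) h3
      refine ⟨⟨j, hj, ?_⟩, j, hj, ?_⟩
      · rw [← hc.eq]; simpa using hS i (by omega)
      · rw [← hc.inv_left.eq]; simpa using hS i (by omega)
    · refine ⟨⟨i, by omega, ?_⟩, i, by omega, ?_⟩
      · rw [← hr i hi]; simp
      · have := inv_mem (coset_sq h r1 hr hS h2 (l - i) i (by omega))
        convert this using 1
        rw [hr i hi]; group
    · refine ⟨⟨j + 1, by omega, ?_⟩, j + 1, by omega, ?_⟩
      · have := coset_sq h r1 hr hS h2 (l - j) j (by omega)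
        convert this using 1
        rw [hr j hi]; group
      · rw [hr j hi]; simp
    · have hs := coset_shift h r1 hr (i - j) i j (by omega) hi
      refine ⟨⟨j, hj, ?_⟩, j, hj, ?_⟩
      · rw [hs]; simpa using hS i (by omega)
      · have : r j * (s (i + 1))⁻¹ = (s i)⁻¹ * r j := by
          rw [mul_inv_eq_iff_eq_mul, mul_assoc, hs]; group
        rw [this]; simpa using hS i (by omega)
  suffices ∀ j ≤ l + 1, (∃ j' ≤ l + 1, r j * g * (r j')⁻¹ ∈ S) ∧
      ∃ j' ≤ l + 1, r j * g⁻¹ * (r j')⁻¹ ∈ S by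
    have := (this (l + 1) le_rfl).1
    simpa [r1] using this
  refine gens_induction (p := fun g => ∀ j ≤ l + 1, (∃ j' ≤ l + 1, r j * g * (r j')⁻¹ ∈ S) ∧
      ∃ j' ≤ l + 1, r j * g⁻¹ * (r j')⁻¹ ∈ S) ?_ ?_ ?_ ?_ hg
  · intro i hi j hj; exact step i j (by omega) hj
  · intro j hj
    simp only [inv_one, mul_one, and_self]
    exact ⟨j, hj, by simp⟩
  · intro a b ha hb j hj
    constructor
    · obtain ⟨j1, hj1, h1⟩ := (ha j hj).1
      obtain ⟨j2, hj2, h2⟩ := (hb j1 hj1).1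
      exact ⟨j2, hj2, by convert mul_mem h1 h2 using 1; group⟩
    · obtain ⟨j1, hj1, h1⟩ := (hb j hj).2
      obtain ⟨j2, hj2, h2⟩ := (ha j1 hj1).2
      exact ⟨j2, hj2, by convert mul_mem h1 h2 using 1; group⟩
  · intro a ha j hj
    rw [inv_inv]
    exact ⟨(ha j hj).2, (ha j hj).1⟩

end cosets

section descend

variable {H : Type*} [Group H] {k m : ℕ} {s : ℕ → H} {z : H}

/-- The family `y` with `y (k - 1) = z` and `y i = s i * y (i + 1) * (s i)⁻¹`. -/
def descend (s : ℕ → H) (k : ℕ) (z : H) (i : ℕ) : H :=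
  Nat.rec z (fun d w => s (k - 2 - d) * w * (s (k - 2 - d))⁻¹) (k - 1 - i)

theorem descend_last {i : ℕ} (hi : i + 1 = k) : descend s k z i = z := by
  have : k - 1 - i = 0 := by omega
  simp [descend, this]

theorem descend_rec {i : ℕ} (hi : i + 1 < k) :
    descend s k z i = s i * descend s k z (i + 1) * (s i)⁻¹ := by
  have h1 : k - 1 - i = (k - 1 - (i + 1)) + 1 := by omega
  have h2 : k - 2 - (k - 1 - (i + 1)) = i := by omega
  rw [descend, h1]
  simp only [h2]
  rfl

theorem artinFamily_descend (h : BraidTuple k s) (hc : ∀ i, i + 2 < k → Commute (s i) z)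
    (hl : ∀ i, i + 2 = k → Commute z (s i * z⁻¹ * s i)) : ArtinFamily k s (descend s k z) := by
  refine ⟨h, fun i hi => descend_rec hi, fun i j hij hj => ?_, fun i hi => ?_⟩
  · rw [descend_last hj]; exact hc i (by omega)
  · rw [descend_last (by omega)]; exact hl i hi

/-- The free family in the group of braids fixing the last strand. -/
def pureFam (s : ℕ → H) (m : ℕ) : ℕ → H := descend s m (s (m - 1) * s (m - 1))⁻¹

theorem pureFam_last {i : ℕ} (hi : i + 1 = k) : pureFam s k i = (s i * s i)⁻¹ := by
  subst hi; exact descend_last rfl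

theorem pureFam_rec {i : ℕ} (hi : i + 1 < k) :
    pureFam s k i = s i * pureFam s k (i + 1) * (s i)⁻¹ :=
  descend_rec hi

theorem artinFamily_pureFam (h : BraidTuple (m + 1) s) : ArtinFamily m s (pureFam s m) := by
  apply artinFamily_descend (h.mono (by omega))
  · intro i hi
    have := h.comm i (m - 1) (by omega) (by omega)
    exact (this.mul_right this).inv_right
  · intro i hi
    have := h.braid i (by omega)
    have e : m - 1 = i + 1 := by omega
    rw [e, inv_inv]
    generalize s i = a at *
    generalize s (i + 1) = b at *
    apply Commute.inv_left
    have h1 : b * (a * b * b * a) = (a * b * b * a) * b := by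
      calc b * (a * b * b * a) = (b * a * b) * b * a := by group
        _ = (a * b * a) * b * a := by rw [this]
        _ = a * b * (a * b * a) := by group
        _ = a * b * (b * a * b) := by rw [this]
        _ = _ := by group
    have h2 : Commute b (a * b * b * a) := h1
    have e : a * (b * b) * a = a * b * b * a := by group
    rw [e]; exact h2.mul_left h2

end descend

/-- The endomorphism deleting the letter `m`. -/
def kill (m : ℕ) : FreeGroup ℕ →* FreeGroup ℕ := lift fun i => if i = m then 1 else of i

@[simp] theorem kill_self (m : ℕ) : kill m (of m) = 1 := by simp [kill]

theorem kill_of_ne {m i : ℕ} (h : i ≠ m) : kill m (of i) = of i := by simp [kill, h]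

theorem kill_of_mem_Fr {m : ℕ} {f : FreeGroup ℕ} (hf : f ∈ Fr m) : kill m f = f :=
  eqOn_Fr (f := kill m) (f' := MonoidHom.id _) (fun i hi => by
    simp [kill_of_ne (show i ≠ m by omega)]) hf

theorem kill_artin {m i : ℕ} (hi : i + 1 < m) (f : FreeGroup ℕ) :
    kill m (artin i f) = artin i (kill m f) := by
  have : (kill m).comp (artin i).toMonoidHom = (artin i).toMonoidHom.comp (kill m) := by
    ext j
    by_cases h1 : j = i
    · subst h1; simp [kill_of_ne (show j ≠ m by omega), kill_of_ne (show j + 1 ≠ m by omega)]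
    · by_cases h2 : j = i + 1
      · subst h2; simp [kill_of_ne (show i ≠ m by omega), kill_of_ne (show i + 1 ≠ m by omega)]
      · by_cases h3 : j = m
        · subst h3; simp [artin_of_ne h1 h2]
        · simp [artin_of_ne h1 h2, kill_of_ne h3]
  exact DFunLike.congr_fun this f

theorem kill_artin_symm {m i : ℕ} (hi : i + 1 < m) (f : FreeGroup ℕ) :
    kill m ((artin i)⁻¹ f) = (artin i)⁻¹ (kill m f) := by
  apply (artin i).injective
  rw [← kill_artin hi, ← MulAut.mul_apply, ← MulAut.mul_apply, mul_inv_cancel]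
  rfl

/-- Elements of `g` commuting with killing the last letter. -/
theorem kill_gens {m : ℕ} {H : Type*} [Group H] {s : ℕ → H} {p : H →* MulAut (FreeGroup ℕ)}
    (hp : ∀ i, i + 1 < m → p (s i) = artin i) {g : H} (hg : g ∈ gens m s) :
    ∀ f, kill m (p g f) = p g (kill m f) := by
  suffices ∀ f, kill m (p g f) = p g (kill m f) ∧ kill m (p g⁻¹ f) = p g⁻¹ (kill m f) from
    fun f => (this f).1
  refine gens_induction (p := fun g => ∀ f, kill m (p g f) = p g (kill m f) ∧
    kill m (p g⁻¹ f) = p g⁻¹ (kill m f)) ?_ ?_ ?_ ?_ hg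
  · intro i hi f
    rw [map_inv, hp i hi]
    exact ⟨kill_artin hi f, kill_artin_symm hi f⟩
  · simp
  · intro a b ha hb f
    simp only [mul_inv_rev, map_mul, MulAut.mul_apply]
    exact ⟨by rw [(ha _).1, (hb _).1], by rw [(hb _).2, (ha _).2]⟩
  · intro a ha f
    rw [inv_inv]; exact (ha f).symm

theorem fix_gens {m i : ℕ} (hmi : m ≤ i) {H : Type*} [Group H] {s : ℕ → H}
    {p : H →* MulAut (FreeGroup ℕ)}
    (hp : ∀ i, i + 1 < m → p (s i) = artin i) {g : H} (hg : g ∈ gens m s) :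
    p g (of i) = of i := by
  refine gens_induction (p := fun g => p g (of i) = of i) ?_ ?_ ?_ ?_ hg
  · intro j hj; rw [hp j hj]; exact artin_of_ne (by omega) (by omega)
  · simp
  · intro a b ha hb; simp [ha, hb]
  · intro a ha
    rw [map_inv]
    apply (p a).injective
    rw [← MulAut.mul_apply, mul_inv_cancel, ha]; rfl

theorem artin_sq_inv_self (i : ℕ) : (artin i * artin i)⁻¹ (of (i + 1)) =
    (of i * of (i + 1))⁻¹ * of (i + 1) * (of i * of (i + 1)) := by
  apply (artin i * artin i).injective
  rw [← MulAut.mul_apply, mul_inv_cancel]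
  simp [mul_assoc]

theorem kill_artin_sq_inv (i : ℕ) (f : FreeGroup ℕ) :
    kill (i + 1) ((artin i * artin i)⁻¹ f) = kill (i + 1) f := by
  have h : ∀ f, kill (i + 1) ((artin i * artin i) f) = kill (i + 1) f := by
    intro f
    have : (kill (i + 1)).comp (artin i * artin i).toMonoidHom = kill (i + 1) := by
      ext j
      by_cases h1 : j = i
      · subst h1; simp
      · by_cases h2 : j = i + 1
        · subst h2; simp
        · simp [artin_of_ne h1 h2]
    exact DFunLike.congr_fun this f
  rw [← h, ← MulAut.mul_apply, mul_inv_cancel]; rfl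

/-- The subgroup of all products of a value of a family by an element of the group normalizing
it. -/
def spanSubgroup {H : Type*} [Group H] {k : ℕ} {s y : ℕ → H} (p : H →* MulAut (FreeGroup ℕ))
    (hE : ∀ {g : H}, g ∈ gens k s → ∀ f ∈ Fr k, p g f ∈ Fr k ∧
      g * lift y f * g⁻¹ = lift y (p g f)) : Subgroup H where
  carrier := {x | ∃ f ∈ Fr k, ∃ b ∈ gens k s, x = lift y f * b}
  one_mem' := ⟨1, one_mem _, 1, one_mem _, by simp⟩
  mul_mem' := by
    rintro _ _ ⟨f, hf, b, hb, rfl⟩ ⟨f', hf', b', hb', rfl⟩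
    obtain ⟨h1, h2⟩ := hE hb f' hf'
    refine ⟨f * p b f', mul_mem hf h1, b * b', mul_mem hb hb', ?_⟩
    rw [map_mul, ← h2]; group
  inv_mem' := by
    rintro _ ⟨f, hf, b, hb, rfl⟩
    obtain ⟨h1, h2⟩ := hE (inv_mem hb) f⁻¹ (inv_mem hf)
    refine ⟨_, h1, b⁻¹, inv_mem hb, ?_⟩
    rw [← h2, map_inv]; group

section pure

variable {H : Type*} [Group H] {m : ℕ} {s : ℕ → H} {p : H →* MulAut (FreeGroup ℕ)}

theorem kill_pureFam (hp : ∀ i, i + 1 < m + 1 → p (s i) = artin i) :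
    ∀ d i, i + d + 1 = m → (∀ f, kill m (p (pureFam s m i) f) = kill m f) ∧
      ∃ c, p (pureFam s m i) (of m) = c⁻¹ * of m * c ∧ kill m c = of i := by
  intro d
  induction d with
  | zero =>
    intro i hi
    rw [pureFam_last (by omega)]
    obtain rfl : m = i + 1 := by omega
    simp only [map_inv, map_mul, hp i (by omega)]
    refine ⟨kill_artin_sq_inv i, of i * of (i + 1), artin_sq_inv_self i, ?_⟩
    simp [kill_of_ne]
  | succ d ih =>
    intro i hi
    obtain ⟨h1, c, h2, h3⟩ := ih (i + 1) (by omega)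
    rw [pureFam_rec (by omega)]
    simp only [map_mul, map_inv, hp i (by omega), MulAut.mul_apply]
    constructor
    · intro f
      rw [kill_artin (by omega), h1, ← kill_artin (by omega), ← MulAut.mul_apply, mul_inv_cancel]
      rfl
    · refine ⟨artin i c, ?_, ?_⟩
      · have : (artin i)⁻¹ (of m) = of m := by
          apply (artin i).injective
          rw [← MulAut.mul_apply, mul_inv_cancel, artin_of_ne (by omega) (by omega)]; rfl
        rw [this, h2]
        simp only [map_mul, map_inv, artin_of_ne (show m ≠ i by omega) (show m ≠ i + 1 by omega)]
      · rw [kill_artin (by omega), h3, artin_succ]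

theorem kill_lift_pureFam (hp : ∀ i, i + 1 < m + 1 → p (s i) = artin i) {f : FreeGroup ℕ}
    (hf : f ∈ Fr m) : (∀ w, kill m (p (lift (pureFam s m) f) w) = kill m w) ∧
      ∃ c, p (lift (pureFam s m) f) (of m) = c⁻¹ * of m * c ∧ kill m c = f := by
  refine Fr_induction (p := fun f => (∀ w, kill m (p (lift (pureFam s m) f) w) = kill m w) ∧
      ∃ c, p (lift (pureFam s m) f) (of m) = c⁻¹ * of m * c ∧ kill m c = f) ?_ ?_ ?_ ?_ hf
  · intro i hi
    simp only [FreeGroup.lift_apply_of]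
    exact kill_pureFam hp (m - 1 - i) i (by omega)
  · exact ⟨by simp, 1, by simp, by simp⟩
  · rintro a b ⟨ha, c, hc, hc'⟩ ⟨hb, d, hd, hd'⟩
    simp only [map_mul, MulAut.mul_apply]
    refine ⟨fun w => by rw [ha, hb], c * p (lift (pureFam s m) a) d, ?_, ?_⟩
    · rw [hd]; simp only [map_mul, map_inv, hc]; group
    · rw [map_mul, ha, hc', hd']
  · rintro a ⟨ha, c, hc, hc'⟩
    have e : ∀ w, p (lift (pureFam s m) a) ((p (lift (pureFam s m) a))⁻¹ w) = w := by
      intro w; rw [← MulAut.mul_apply, mul_inv_cancel]; rfl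
    have h1 : ∀ w, kill m ((p (lift (pureFam s m) a))⁻¹ w) = kill m w := by
      intro w; rw [← ha, e]
    simp only [map_inv]
    refine ⟨h1, ((p (lift (pureFam s m) a))⁻¹ c)⁻¹, ?_, ?_⟩
    · apply (p (lift (pureFam s m) a)).injective
      simp only [map_mul, map_inv, e, hc, inv_inv]
      group
    · rw [map_inv, h1, hc']

/-- Elements preserving the exponent of the last letter decompose as a free part times an element
of the group on fewer strands. -/
theorem exists_decomp (h : BraidTuple (m + 1) s) (hp : ∀ i, i + 1 < m + 1 → p (s i) = artin i)
    {g : H} (hg : g ∈ gens (m + 1) s) (hx : expo m (p g (of m)) ≠ 1) :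
    ∃ f ∈ Fr m, ∃ b ∈ gens m s, g = lift (pureFam s m) f * b := by
  rcases m with _ | l
  · refine ⟨1, one_mem _, 1, one_mem _, ?_⟩
    have : gens (0 + 1) s ≤ (⊥ : Subgroup H) := gens_le.2 fun i hi => by omega
    simpa using this hg
  have hp' : ∀ i, i + 1 < l + 1 → p (s i) = artin i := fun i hi => hp i (by omega)
  let S := spanSubgroup p ((artinFamily_pureFam h).conj_gens p hp')
  let r : ℕ → H := fun j => Nat.rec 1 (fun d w => w * s (l - d)) (l + 1 - j)
  have r1 : r (l + 1) = 1 := by simp [r]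
  have hr : ∀ j ≤ l, r j = r (j + 1) * s j := by
    intro j hj
    have e1 : l + 1 - j = (l + 1 - (j + 1)) + 1 := by omega
    have e2 : l - (l + 1 - (j + 1)) = j := by omega
    simp only [r, e1, e2]
  let K : Subgroup H :=
    { carrier := {g | ∀ w, expo (l + 1) (p g w) = expo (l + 1) w}
      one_mem' := by simp
      mul_mem' := by
        intro a b ha hb w
        rw [map_mul, MulAut.mul_apply, ha, hb]
      inv_mem' := by
        intro a ha w
        rw [← ha, ← MulAut.mul_apply, ← map_mul, mul_inv_cancel, map_one, MulAut.one_apply] }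
  have hK : ∀ i < l, s i ∈ K := by
    intro i hi w
    have : (expo (l + 1)).comp (p (s i)).toMonoidHom = expo (l + 1) := by
      rw [hp i (by omega)]
      ext j
      simp only [MonoidHom.comp_apply, MulEquiv.coe_toMonoidHom, artin_of]
      split_ifs with h1 h2
      · subst h1; simp [show j ≠ l + 1 by omega, show j ≠ l by omega]
      · subst h2; simp [show i ≠ l + 1 by omega, show i ≠ l by omega]
      · rfl
    exact DFunLike.congr_fun this w
  have hK2 : s l * s l ∈ K := by
    intro w
    have : (expo (l + 1)).comp (p (s l * s l)).toMonoidHom = expo (l + 1) := by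
      rw [map_mul, hp l (by omega)]
      ext j
      by_cases h1 : j = l
      · subst h1; simp
      · by_cases h2 : j = l + 1
        · subst h2; simp
        · simp [artin_of_ne h1 h2]
    exact DFunLike.congr_fun this w
  obtain ⟨j, hj, hjS, hjK⟩ := exists_coset h r1 hr (S := S ⊓ K)
    (fun i hi => ⟨⟨1, one_mem _, s i, mem_gens (by omega), by simp⟩, hK i hi⟩)
    ⟨⟨(of l)⁻¹, inv_mem (of_mem_Fr (by omega)), 1, one_mem _, by
      simp [pureFam_last]⟩, hK2⟩ hg
  rcases Nat.lt_or_ge l j with h1 | h1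
  · obtain rfl : j = l + 1 := by omega
    obtain ⟨f, hf, b, hb, hgb⟩ := hjS
    exact ⟨f, hf, b, hb, by simpa [r1] using hgb⟩
  · exfalso
    apply hx
    have hrj : ∀ d j, j + d = l → p (r j) (of (l + 1)) = of l := by
      intro d
      induction d with
      | zero => intro j hj
                obtain rfl : j = l := by omega
                rw [hr j le_rfl, r1, one_mul, hp j (by omega), artin_succ]
      | succ d ih =>
        intro j hj
        rw [hr j (by omega), map_mul, MulAut.mul_apply, hp j (by omega),
          artin_of_ne (by omega) (by omega), ih (j + 1) (by omega)]
    have := hjK (p (r j) (of (l + 1)))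
    rw [← MulAut.mul_apply, ← map_mul, inv_mul_cancel_right, hrj (l - j) j (by omega)] at this
    rw [this]; simp

theorem eq_one_of_decomp (hp : ∀ i, i + 1 < m + 1 → p (s i) = artin i) {f : FreeGroup ℕ}
    (hf : f ∈ Fr m) {b : H} (hb : b ∈ gens m s)
    (h1 : p (lift (pureFam s m) f * b) (of m) = of m) : f = 1 := by
  obtain ⟨h2, c, h3, h4⟩ := kill_lift_pureFam hp hf
  rw [map_mul, MulAut.mul_apply, fix_gens le_rfl (fun i hi => hp i (by omega)) hb, h3] at h1
  have hc : Commute c (of m) := by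
    have : of m * c = c * of m := by
      rw [mul_assoc, inv_mul_eq_iff_eq_mul] at h1; exact h1
    exact this.symm
  obtain ⟨k, hk⟩ := zpowers_of_commute_of hc
  rw [← h4, ← hk]; simp

/-- Artin's representation is faithful. -/
theorem artin_faithful : ∀ (n : ℕ), BraidTuple n s → (∀ i, i + 1 < n → p (s i) = artin i) →
    ∀ g ∈ gens n s, p g = 1 → g = 1 := by
  intro n
  induction n with
  | zero =>
    intro _ _ g hg _
    have : gens 0 s ≤ (⊥ : Subgroup H) := gens_le.2 fun i hi => by omega
    simpa using this hg
  | succ m ih =>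
    intro h hp g hg hg1
    have hp' : ∀ i, i + 1 < m → p (s i) = artin i := fun i hi => hp i (by omega)
    obtain ⟨f, hf, b, hb, rfl⟩ := exists_decomp h hp hg (by rw [hg1]; simp)
    have hf1 := eq_one_of_decomp hp hf hb (by rw [hg1]; rfl)
    subst hf1
    rw [map_one, one_mul] at hg1 ⊢
    exact ih (h.mono (by omega)) hp' b hb hg1

end pure

end BraidInj

namespace BraidInj

open FreeGroup (of lift)

/-- The braid relators on infinitely many generators. -/
def infBraidRels : Set (FreeGroup ℕ) :=
  { r | ∃ i j : ℕ, (i + 1 = j ∧ r = of i * of j * of i * (of j * of i * of j)⁻¹) ∨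
      (i + 2 ≤ j ∧ r = of i * of j * (of j * of i)⁻¹) }

/-- The braid group on infinitely many strands. -/
abbrev Br : Type := PresentedGroup infBraidRels

/-- The standard generators. -/
def σ (i : ℕ) : Br := PresentedGroup.of i

/-- The homomorphism from `Br` given by an infinite braid tuple. -/
def Br.hom {H : Type*} [Group H] (s : ℕ → H) (h : ∀ n, BraidTuple n s) : Br →* H :=
  PresentedGroup.toGroup (f := s) (by
    rintro r ⟨i, j, ⟨rfl, rfl⟩ | ⟨hij, rfl⟩⟩
    · have := (h (i + 3)).braid i (by omega)
      simp [this]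
    · have := ((h (j + 2)).comm i j hij (by omega)).eq
      simp [this])

@[simp] theorem Br.hom_σ {H : Type*} [Group H] (s : ℕ → H) (h : ∀ n, BraidTuple n s) (i : ℕ) :
    Br.hom s h (σ i) = s i :=
  PresentedGroup.toGroup.of _

theorem Br.hom_ext {H : Type*} [Group H] {f g : Br →* H} (h : ∀ i, f (σ i) = g (σ i)) : f = g :=
  PresentedGroup.ext h

theorem braidTuple_σ (n : ℕ) : BraidTuple n σ := by
  constructor
  · intro i _
    have : (PresentedGroup.mk infBraidRels) (of i * of (i + 1) * of i *
        (of (i + 1) * of i * of (i + 1))⁻¹) = 1 :=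
      PresentedGroup.one_of_mem ⟨i, i + 1, .inl ⟨rfl, rfl⟩⟩
    rw [map_mul, map_inv, mul_inv_eq_one] at this
    exact this
  · intro i j hij _
    have : (PresentedGroup.mk infBraidRels) (of i * of j * (of j * of i)⁻¹) = 1 :=
      PresentedGroup.one_of_mem ⟨i, j, .inr ⟨hij, rfl⟩⟩
    rw [map_mul, map_inv, mul_inv_eq_one] at this
    exact this

/-- The subgroup of braids on the first `n` strands. -/
abbrev Bn (n : ℕ) : Subgroup Br := gens n σ

theorem σ_mem {n i : ℕ} (h : i + 1 < n) : σ i ∈ Bn n := mem_gens h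

theorem Br.induction {p : Br → Prop} (hs : ∀ i, p (σ i)) (h1 : p 1)
    (hm : ∀ x y, p x → p y → p (x * y)) (hi : ∀ x, p x → p x⁻¹) (g : Br) : p g := by
  have : g ∈ Subgroup.closure (Set.range (PresentedGroup.of (rels := infBraidRels))) := by
    rw [PresentedGroup.closure_range_of]; trivial
  induction this using Subgroup.closure_induction with
  | mem x hx => obtain ⟨i, rfl⟩ := hx; exact hs i
  | one => exact h1
  | mul x y _ _ hx hy => exact hm x y hx hy
  | inv x _ hx => exact hi x hx

theorem exists_mem_Bn (g : Br) : ∃ n, g ∈ Bn n := by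
  induction g using Br.induction with
  | hs i => exact ⟨i + 2, σ_mem (by omega)⟩
  | h1 => exact ⟨0, one_mem _⟩
  | hm x y hx hy =>
    obtain ⟨a, ha⟩ := hx
    obtain ⟨b, hb⟩ := hy
    exact ⟨max a b, mul_mem (gens_mono (le_max_left _ _) ha) (gens_mono (le_max_right _ _) hb)⟩
  | hi x hx => obtain ⟨a, ha⟩ := hx; exact ⟨a, inv_mem ha⟩

/-- Artin's action. -/
def act : Br →* MulAut (FreeGroup ℕ) := Br.hom artin braidTuple_artin

@[simp] theorem act_σ (i : ℕ) : act (σ i) = artin i := Br.hom_σ _ _ _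

theorem act_injective : Function.Injective act := by
  rw [injective_iff_map_eq_one]
  intro g hg
  obtain ⟨n, hn⟩ := exists_mem_Bn g
  exact artin_faithful n (braidTuple_σ n) (fun i _ => act_σ i) g hn hg

theorem act_mem_Fr {n : ℕ} {g : Br} (hg : g ∈ Bn n) {f : FreeGroup ℕ} (hf : f ∈ Fr n) :
    act g f ∈ Fr n := by
  suffices ∀ f ∈ Fr n, act g f ∈ Fr n ∧ act g⁻¹ f ∈ Fr n from (this f hf).1
  refine gens_induction (p := fun g => ∀ f ∈ Fr n, act g f ∈ Fr n ∧ act g⁻¹ f ∈ Fr n) ?_ ?_ ?_ ?_ hg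
  · intro i hi f hf
    rw [map_inv, act_σ]
    exact ⟨artin_mem_Fr hi hf, artin_symm_mem_Fr hi hf⟩
  · intro f hf; simpa using hf
  · intro a b ha hb f hf
    rw [mul_inv_rev, map_mul, map_mul, MulAut.mul_apply, MulAut.mul_apply]
    exact ⟨(ha _ (hb f hf).1).1, (hb _ (ha f hf).2).2⟩
  · intro a ha f hf
    rw [inv_inv]; exact (ha f hf).symm

theorem act_of_le {n i : ℕ} (hi : n ≤ i) {g : Br} (hg : g ∈ Bn n) : act g (of i) = of i :=
  fix_gens hi (fun i _ => act_σ i) hg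

theorem kill_act {m : ℕ} {g : Br} (hg : g ∈ Bn m) (f : FreeGroup ℕ) :
    kill m (act g f) = act g (kill m f) :=
  kill_gens (fun i _ => act_σ i) hg f

theorem act_inv_apply (g : Br) (f : FreeGroup ℕ) : act g (act g⁻¹ f) = f := by
  rw [← MulAut.mul_apply, ← map_mul, mul_inv_cancel, map_one, MulAut.one_apply]

theorem inv_act_apply (g : Br) (f : FreeGroup ℕ) : act g⁻¹ (act g f) = f := by
  rw [← MulAut.mul_apply, ← map_mul, inv_mul_cancel, map_one, MulAut.one_apply]

/-- Two elements of `Bn n` agreeing on the first `n` letters are equal. -/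
theorem eq_of_act {n : ℕ} {g h : Br} (hg : g ∈ Bn n) (hh : h ∈ Bn n)
    (he : ∀ i < n, act g (of i) = act h (of i)) : g = h := by
  apply act_injective
  apply mulAut_ext
  intro i
  rcases Nat.lt_or_ge i n with hi | hi
  · exact he i hi
  · rw [act_of_le hi hg, act_of_le hi hh]

section hom

variable {H : Type*} [Group H] {n : ℕ} {s : ℕ → H}

theorem braidTuple_braidσ (n : ℕ) :
    BraidTuple n fun i => if h : i < n - 1 then braidσ n ⟨i, h⟩ else 1 := by
  constructor
  · intro i hi
    have : (PresentedGroup.mk (braidRels (n - 1))) (of ⟨i, by omega⟩ * of ⟨i + 1, by omega⟩ *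
        of ⟨i, by omega⟩ * (of ⟨i + 1, by omega⟩ * of ⟨i, by omega⟩ * of ⟨i + 1, by omega⟩)⁻¹) = 1 :=
      PresentedGroup.one_of_mem ⟨_, _, .inl ⟨rfl, rfl⟩⟩
    rw [map_mul, map_inv, mul_inv_eq_one] at this
    simp only [show i < n - 1 by omega, show i + 1 < n - 1 by omega, dif_pos]
    exact this
  · intro i j hij hj
    have : (PresentedGroup.mk (braidRels (n - 1))) (of ⟨i, by omega⟩ * of ⟨j, by omega⟩ *
        (of ⟨j, by omega⟩ * of ⟨i, by omega⟩)⁻¹) = 1 :=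
      PresentedGroup.one_of_mem ⟨_, _, .inr ⟨hij, rfl⟩⟩
    rw [map_mul, map_inv, mul_inv_eq_one] at this
    simp only [show i < n - 1 by omega, show j < n - 1 by omega, dif_pos]
    exact this

/-- The homomorphism from the presented braid group given by a braid tuple. -/
def presHom (h : BraidTuple n s) : BraidGroup n →* H :=
  PresentedGroup.toGroup (f := fun i : Fin (n - 1) => s i) (by
    rintro r ⟨i, j, ⟨hij, rfl⟩ | ⟨hij, rfl⟩⟩
    · have := h.braid i (by omega)
      rw [hij] at this
      simp [this]
    · have := (h.comm i j hij (by omega)).eq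
      simp [this])

@[simp] theorem presHom_braidσ (h : BraidTuple n s) (i : Fin (n - 1)) :
    presHom h (braidσ n i) = s i :=
  PresentedGroup.toGroup.of _

theorem presHom_σ_injective (n : ℕ) : Function.Injective (presHom (braidTuple_σ n)) := by
  rw [injective_iff_map_eq_one]
  intro g hg
  have hgen : g ∈ gens n fun i => if h : i < n - 1 then braidσ n ⟨i, h⟩ else 1 := by
    have : g ∈ Subgroup.closure (Set.range (PresentedGroup.of (rels := braidRels (n - 1)))) := by
      rw [PresentedGroup.closure_range_of]; trivial
    refine Subgroup.closure_mono ?_ this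
    rintro _ ⟨i, rfl⟩
    exact ⟨i, by omega, by simp [braidσ]⟩
  refine artin_faithful (p := act.comp (presHom (braidTuple_σ n))) n (braidTuple_braidσ n) ?_ g
    hgen (by simp [hg])
  intro i hi
  simp [show i < n - 1 by omega]

theorem range_presHom_σ (n : ℕ) : (presHom (braidTuple_σ n)).range = Bn n := by
  apply le_antisymm
  · rintro _ ⟨g, rfl⟩
    have : g ∈ Subgroup.closure (Set.range (PresentedGroup.of (rels := braidRels (n - 1)))) := by
      rw [PresentedGroup.closure_range_of]; trivial
    induction this using Subgroup.closure_induction with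
    | mem x hx =>
      obtain ⟨i, rfl⟩ := hx
      have := presHom_braidσ (braidTuple_σ n) i
      rw [braidσ] at this
      rw [this]; exact σ_mem (by omega)
    | one => simp
    | mul x y _ _ hx hy => rw [map_mul]; exact mul_mem hx hy
    | inv x _ hx => rw [map_inv]; exact inv_mem hx
  · exact gens_le.2 fun i hi => ⟨braidσ n ⟨i, by omega⟩, presHom_braidσ _ _⟩

/-- The presented braid group is isomorphic to `Bn n`. -/
noncomputable def presEquiv (n : ℕ) : BraidGroup n ≃* Bn n :=
  (MonoidHom.ofInjective (presHom_σ_injective n)).trans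
    (MulEquiv.subgroupCongr (range_presHom_σ n))

theorem presEquiv_braidσ (n : ℕ) (i : Fin (n - 1)) :
    presEquiv n (braidσ n i) = ⟨σ i, σ_mem (by omega)⟩ :=
  Subtype.ext (presHom_braidσ (braidTuple_σ n) i)

/-- The homomorphism from `Bn n` given by a braid tuple. -/
noncomputable def tupleHom (h : BraidTuple n s) : Bn n →* H :=
  (presHom h).comp (presEquiv n).symm.toMonoidHom

theorem tupleHom_σ (h : BraidTuple n s) {i : ℕ} (hi : i + 1 < n) :
    tupleHom h ⟨σ i, σ_mem hi⟩ = s i := by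
  have := presEquiv_braidσ n ⟨i, by omega⟩
  rw [tupleHom, MonoidHom.comp_apply, ← this]
  simp

end hom

/-- The permutation of the strands. -/
def perm : Br →* Equiv.Perm ℕ := Br.hom (fun i => Equiv.swap i (i + 1)) fun _ => by
  constructor
  · intro i _
    ext j
    simp only [Equiv.Perm.mul_apply, Equiv.swap_apply_def]
    grind
  · intro i k _ _
    ext j
    simp only [Equiv.Perm.mul_apply, Equiv.swap_apply_def]
    grind

@[simp] theorem perm_σ (i : ℕ) : perm (σ i) = Equiv.swap i (i + 1) := Br.hom_σ _ _ _

/-- The exponent sum. -/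
def expSum : Br →* Multiplicative ℤ := Br.hom (fun _ => Multiplicative.ofAdd 1) fun _ =>
  ⟨fun _ _ => rfl, fun _ _ _ _ => Commute.refl _⟩

@[simp] theorem expSum_σ (i : ℕ) : expSum (σ i) = Multiplicative.ofAdd 1 := Br.hom_σ _ _ _

theorem BraidTuple.inv {H : Type*} [Group H] {n : ℕ} {s : ℕ → H} (h : BraidTuple n s) :
    BraidTuple n fun i => (s i)⁻¹ := by
  constructor
  · intro i hi
    have := congrArg (·⁻¹) (h.braid i hi)
    simpa [mul_assoc] using this
  · intro i j hij hj
    exact (h.comm i j hij hj).inv_inv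

/-- The mirror automorphism, as an endomorphism. -/
def mirror : Br →* Br := Br.hom (fun i => (σ i)⁻¹) fun n => (braidTuple_σ n).inv

@[simp] theorem mirror_σ (i : ℕ) : mirror (σ i) = (σ i)⁻¹ := Br.hom_σ _ _ _

@[simp] theorem mirror_mirror (g : Br) : mirror (mirror g) = g := by
  have : mirror.comp mirror = MonoidHom.id Br := Br.hom_ext fun i => by simp
  exact DFunLike.congr_fun this g

theorem mirror_mem {n : ℕ} {g : Br} (hg : g ∈ Bn n) : mirror g ∈ Bn n := by
  have : Bn n ≤ (Bn n).comap mirror := gens_le.2 fun i hi => by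
    rw [Subgroup.mem_comap, mirror_σ]; exact inv_mem (σ_mem hi)
  exact this hg

theorem perm_lt {n : ℕ} {g : Br} (hg : g ∈ Bn n) : ∀ i, n ≤ i → perm g i = i := by
  refine gens_induction (p := fun g => ∀ i, n ≤ i → perm g i = i) ?_ ?_ ?_ ?_ hg
  · intro i hi j hj
    rw [perm_σ, Equiv.swap_apply_of_ne_of_ne (by omega) (by omega)]
  · simp
  · intro a b ha hb i hi
    rw [map_mul, Equiv.Perm.mul_apply, hb i hi, ha i hi]
  · intro a ha i hi
    rw [map_inv, Equiv.Perm.inv_eq_iff_eq, ha i hi]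

theorem perm_lt_iff {n : ℕ} {g : Br} (hg : g ∈ Bn n) (i : ℕ) : perm g i < n ↔ i < n := by
  constructor
  · intro h
    by_contra hi
    rw [perm_lt hg i (by omega)] at h; omega
  · intro h
    by_contra hi
    have := perm_lt hg (perm g i) (by omega)
    have := (perm g).injective this
    omega

/-- Braids map letters to conjugates of letters. -/
theorem act_of_conj (g : Br) (i : ℕ) : ∃ c, act g (of i) = c * of (perm g i) * c⁻¹ := by
  revert i
  induction g using Br.induction with
  | hs j =>
    intro i
    rw [act_σ, perm_σ]
    by_cases h1 : i = j
    · subst h1; exact ⟨of i, by simp⟩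
    · by_cases h2 : i = j + 1
      · subst h2; exact ⟨1, by simp⟩
      · exact ⟨1, by simp [artin_of_ne h1 h2, Equiv.swap_apply_of_ne_of_ne h1 h2]⟩
  | h1 => exact fun i => ⟨1, by simp⟩
  | hm x y hx hy =>
    intro i
    obtain ⟨c, hc⟩ := hy i
    obtain ⟨d, hd⟩ := hx (perm y i)
    refine ⟨act x c * d, ?_⟩
    rw [map_mul, MulAut.mul_apply, hc, map_mul, map_mul, hd, map_inv, map_mul,
      Equiv.Perm.mul_apply]
    group
  | hi x hx =>
    intro i
    obtain ⟨c, hc⟩ := hx ((perm x)⁻¹ i)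
    refine ⟨act x⁻¹ c⁻¹, ?_⟩
    have := congrArg (act x⁻¹) hc
    have hx : perm x ((perm x)⁻¹ i) = i := (perm x).apply_symm_apply i
    rw [inv_act_apply, map_mul, map_mul, hx] at this
    rw [show perm x⁻¹ i = (perm x)⁻¹ i by rw [map_inv], this, map_inv (act x⁻¹) c]
    group

end BraidInj

namespace BraidInj

open FreeGroup (of lift)

/-- The product of the first `k` letters. -/
def D : ℕ → FreeGroup ℕ
  | 0 => 1
  | k + 1 => D k * of k

@[simp] theorem D_zero : D 0 = 1 := rfl

theorem D_succ (k : ℕ) : D (k + 1) = D k * of k := rfl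

theorem D_mem_Fr (k : ℕ) : D k ∈ Fr k := by
  induction k with
  | zero => exact one_mem _
  | succ k ih => exact mul_mem (Fr_mono (by omega) ih) (of_mem_Fr (by omega))

theorem artin_D_of_lt {i k : ℕ} (h : i + 1 < k) : artin i (D k) = D k := by
  induction k with
  | zero => omega
  | succ k ih =>
    rcases Nat.lt_or_ge (i + 1) k with h1 | h1
    · rw [D_succ, map_mul, ih h1, artin_of_ne (by omega) (by omega)]
    · obtain rfl : k = i + 1 := by omega
      have : ∀ j ≤ i, artin i (D j) = D j := by
        intro j
        induction j with
        | zero => simp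
        | succ j ihj =>
          intro hj
          rw [D_succ, map_mul, ihj (by omega), artin_of_ne (by omega) (by omega)]
      simp only [D_succ, map_mul, this i le_rfl, artin_self, artin_succ]
      group

theorem act_D {k : ℕ} {g : Br} (hg : g ∈ Bn k) : act g (D k) = D k := by
  refine gens_induction (p := fun g => act g (D k) = D k) ?_ ?_ ?_ ?_ hg
  · intro i hi; rw [act_σ, artin_D_of_lt hi]
  · simp
  · intro a b ha hb; rw [map_mul, MulAut.mul_apply, hb, ha]
  · intro a ha; conv_lhs => rw [← ha]
    exact inv_act_apply a _

theorem eqOn_Fr_conj {k : ℕ} {c : FreeGroup ℕ} {φ : MulAut (FreeGroup ℕ)}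
    (h : ∀ i < k, φ (of i) = c * of i * c⁻¹) {f : FreeGroup ℕ} (hf : f ∈ Fr k) :
    φ f = c * f * c⁻¹ :=
  eqOn_Fr (f := φ.toMonoidHom) (f' := (MulAut.conj c).toMonoidHom) h hf

/-- `J k` is the pure braid in which the last of `k + 1` strands encircles the others. -/
def J : ℕ → Br
  | 0 => 1
  | k + 1 => σ k * J k * σ k

@[simp] theorem J_zero : J 0 = 1 := rfl

theorem J_succ (k : ℕ) : J (k + 1) = σ k * J k * σ k := rfl

theorem J_mem (k : ℕ) : J k ∈ Bn (k + 1) := by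
  induction k with
  | zero => exact one_mem _
  | succ k ih =>
    exact mul_mem (mul_mem (σ_mem (by omega)) (gens_mono (by omega) ih)) (σ_mem (by omega))

theorem act_J (k : ℕ) : (∀ f ∈ Fr k, act (J k) f =
    D k * of k * (D k)⁻¹ * f * (D k * of k * (D k)⁻¹)⁻¹) ∧
    act (J k) (of k) = D k * of k * (D k)⁻¹ := by
  suffices h : (∀ i < k, act (J k) (of i) =
      D k * of k * (D k)⁻¹ * of i * (D k * of k * (D k)⁻¹)⁻¹) ∧
      act (J k) (of k) = D k * of k * (D k)⁻¹ by
    refine ⟨fun f hf => ?_, h.2⟩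
    exact eqOn_Fr_conj h.1 hf
  induction k with
  | zero => simp
  | succ k ih =>
    have hc : artin k (D k * of k * (D k)⁻¹) = D (k + 1) * of (k + 1) * (D (k + 1))⁻¹ := by
      have := artin_D_of_lt (show k + 1 < k + 2 by omega)
      have h2 : artin k (D k) = D k := by
        simp only [D_succ, map_mul, artin_self, artin_succ] at this
        have h3 : artin k (D k) * (of k * of (k + 1)) = D k * (of k * of (k + 1)) := by
          calc _ = artin k (D k) * (of k * of (k + 1) * (of k)⁻¹) * of k := by group
            _ = D k * of k * of (k + 1) := this
            _ = _ := by group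
        exact mul_right_cancel h3
      rw [map_mul, map_mul, map_inv, h2, artin_self, D_succ]; group
    have hJ : ∀ w, act (J (k + 1)) w = artin k (act (J k) (artin k w)) := by
      intro w; rw [J_succ, map_mul, map_mul, MulAut.mul_apply, MulAut.mul_apply, act_σ]
    constructor
    · intro i hi
      rcases Nat.lt_or_ge i k with h | h
      · rw [hJ, artin_of_ne (by omega) (by omega), ih.1 i h]
        simp only [map_mul (artin k) _ (_⁻¹), map_mul (artin k) _ (of i), map_inv (artin k) (_ * _),
          artin_of_ne (show i ≠ k by omega) (show i ≠ k + 1 by omega)]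
        rw [← hc]; simp only [map_mul, map_inv]
      · obtain rfl : i = k := by omega
        rw [hJ, artin_self, map_mul (act _), map_mul (act _), map_inv (act _), ih.2,
          act_of_le (n := i + 1) (by omega) (J_mem i), map_mul (artin _) (_ * of (i + 1)),
          map_mul (artin _) _ (of (i + 1)), map_inv (artin _) (_ * _), hc, artin_succ]
    · rw [hJ, artin_succ, ih.2, hc]

/-- The full twist on `k` strands. -/
def T : ℕ → Br
  | 0 => 1
  | k + 1 => T k * J k

theorem T_succ (k : ℕ) : T (k + 1) = T k * J k := rfl

theorem T_mem (k : ℕ) : T k ∈ Bn k := by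
  induction k with
  | zero => exact one_mem _
  | succ k ih => exact mul_mem (gens_mono (by omega) ih) (J_mem k)

theorem act_T_of (k : ℕ) : ∀ i < k, act (T k) (of i) = D k * of i * (D k)⁻¹ := by
  induction k with
  | zero => omega
  | succ k ih =>
    intro i hi
    have h1 : act (T k) (D k * of k * (D k)⁻¹) = D k * of k * (D k)⁻¹ := by
      rw [map_mul, map_mul, map_inv, act_D (T_mem k), act_of_le le_rfl (T_mem k)]
    rw [T_succ, map_mul, MulAut.mul_apply]
    rcases Nat.lt_or_ge i k with h | h
    · rw [(act_J k).1 _ (of_mem_Fr h), map_mul, map_mul, map_inv, h1, ih i h, D_succ]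
      group
    · obtain rfl : i = k := by omega
      rw [(act_J i).2, h1, D_succ]; group

theorem act_T {k : ℕ} {f : FreeGroup ℕ} (hf : f ∈ Fr k) :
    act (T k) f = D k * f * (D k)⁻¹ := by
  exact eqOn_Fr_conj (act_T_of k) hf

theorem commute_T {n : ℕ} {g : Br} (hg : g ∈ Bn n) : Commute g (T n) := by
  refine eq_of_act (mul_mem hg (T_mem n)) (mul_mem (T_mem n) hg) fun i hi => ?_
  rw [map_mul, map_mul, MulAut.mul_apply, MulAut.mul_apply, act_T (of_mem_Fr hi),
    act_T (act_mem_Fr hg (of_mem_Fr hi)), map_mul, map_mul, map_inv, act_D hg]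

theorem commute_J {n : ℕ} {g : Br} (hg : g ∈ Bn n) : Commute g (J n) := by
  have h1 : Commute g (T (n + 1)) := commute_T (gens_mono (by omega) hg)
  have : J n = (T n)⁻¹ * T (n + 1) := by rw [T_succ]; group
  rw [this]; exact (commute_T hg).inv_right.mul_right h1

theorem commute_J_T (n : ℕ) : Commute (J n) (T n) := (commute_J (T_mem n)).symm

theorem expSum_J (k : ℕ) : expSum (J k) = Multiplicative.ofAdd (2 * k : ℤ) := by
  induction k with
  | zero => simp
  | succ k ih =>
    rw [J_succ, map_mul, map_mul, ih, expSum_σ, ← ofAdd_add, ← ofAdd_add]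
    congr 1; push_cast; ring

theorem expSum_T (k : ℕ) : expSum (T k) = Multiplicative.ofAdd (k * (k - 1) : ℤ) := by
  induction k with
  | zero => simp [T]
  | succ k ih =>
    rw [T_succ, map_mul, ih, expSum_J, ← ofAdd_add]
    congr 1; push_cast; ring

@[simp] theorem perm_J (k : ℕ) : perm (J k) = 1 := by
  induction k with
  | zero => simp
  | succ k ih => simp [J_succ, ih]

@[simp] theorem perm_T (k : ℕ) : perm (T k) = 1 := by
  induction k with
  | zero => simp [T]
  | succ k ih => simp [T_succ, ih]

end BraidInj

namespace BraidInj

open FreeGroup (of lift)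

theorem expo_act (g : Br) (i j : ℕ) :
    expo i (act g (of j)) = if perm g j = i then Multiplicative.ofAdd 1 else 1 := by
  obtain ⟨c, hc⟩ := act_of_conj g j
  rw [hc, map_mul, map_mul, map_inv, mul_inv_cancel_comm, expo_of]

/-- The family in `B_{m+1}` of braids in which one strand encircles all the others. -/
def encFam (m : ℕ) : ℕ → Br := descend σ (m + 1) (J m)

theorem encFam_last (m : ℕ) : encFam m m = J m := descend_last rfl

theorem encFam_rec {m i : ℕ} (hi : i < m) : encFam m i = σ i * encFam m (i + 1) * (σ i)⁻¹ :=
  descend_rec (by omega)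

theorem artinFamily_encFam (m : ℕ) : ArtinFamily (m + 1) σ (encFam m) := by
  apply artinFamily_descend (braidTuple_σ _)
  · intro i hi; exact commute_J (σ_mem (by omega))
  · intro i hi
    obtain rfl : m = i + 1 := by omega
    have : σ i * (J (i + 1))⁻¹ * σ i = (J i)⁻¹ := by rw [J_succ]; group
    rw [this]
    exact (commute_J (J_mem i)).symm.inv_right

/-- The homomorphism given by `encFam`. -/
def enc (m : ℕ) : FreeGroup ℕ →* Br := lift (encFam m)

@[simp] theorem enc_of (m i : ℕ) : enc m (of i) = encFam m i := FreeGroup.lift_apply_of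

theorem conj_enc {m : ℕ} {g : Br} (hg : g ∈ Bn (m + 1)) {f : FreeGroup ℕ} (hf : f ∈ Fr (m + 1)) :
    g * enc m f * g⁻¹ = enc m (act g f) :=
  ((artinFamily_encFam m).conj_gens act (fun i _ => act_σ i) hg f hf).2

theorem encFam_mem (m : ℕ) : ∀ d i, i + d = m → encFam m i ∈ Bn (m + 1) := by
  intro d
  induction d with
  | zero => rintro i rfl; simp only [Nat.add_zero, encFam_last]; exact J_mem _
  | succ d ih =>
    intro i hi
    rw [encFam_rec (by omega)]
    exact mul_mem (mul_mem (σ_mem (by omega)) (ih _ (by omega))) (inv_mem (σ_mem (by omega)))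

theorem enc_mem {m : ℕ} {f : FreeGroup ℕ} (hf : f ∈ Fr (m + 1)) : enc m f ∈ Bn (m + 1) :=
  map_Fr_le (fun i hi => by rw [enc_of]; exact encFam_mem m (m - i) i (by omega)) hf

theorem commute_enc_D {m : ℕ} {g : Br} (hg : g ∈ Bn (m + 1)) :
    Commute g (enc m (D (m + 1))) := by
  have := conj_enc hg (D_mem_Fr (m + 1))
  rw [act_D hg, mul_inv_eq_iff_eq_mul] at this
  exact this

theorem enc_D_eq (m : ℕ) : enc m (D (m + 1)) = enc m (D m) * J m := by
  rw [D_succ, map_mul, enc_of, encFam_last]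

theorem exists_enc_decomp {m : ℕ} {g : Br} (hg : g ∈ Bn (m + 1)) (hp : perm g m = m) :
    ∃ f ∈ Fr m, ∃ b ∈ Bn m, g = enc m f * b := by
  obtain ⟨f, hf, b, hb, rfl⟩ := exists_decomp (braidTuple_σ (m + 1)) (fun i _ => act_σ i) hg
    (by rw [expo_act, if_pos hp]; simp)
  let S := spanSubgroup (k := m) (s := σ) (y := encFam m) act fun {g} hg f hf =>
    ⟨act_mem_Fr hg hf, conj_enc (gens_mono (by omega) hg) (Fr_mono (by omega) hf)⟩
  have hS : Bn m ≤ S := fun b hb => ⟨1, one_mem _, b, hb, by simp⟩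
  have hpure : ∀ d i, i + d + 1 = m → pureFam σ m i ∈ S := by
    intro d
    induction d with
    | zero =>
      intro i hi
      obtain rfl : m = i + 1 := by omega
      rw [pureFam_last rfl]
      apply inv_mem
      have : σ i * σ i = encFam (i + 1) i * (J i)⁻¹ := by
        rw [encFam_rec (by omega), encFam_last, J_succ]; group
      rw [this]
      refine mul_mem ⟨of i, of_mem_Fr (by omega), 1, one_mem _, ?_⟩ (inv_mem (hS (J_mem i)))
      simp
    | succ d ih =>
      intro i hi
      rw [pureFam_rec (by omega)]
      have := hS (σ_mem (n := m) (i := i) (by omega))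
      exact mul_mem (mul_mem this (ih _ (by omega))) (inv_mem this)
  have : lift (pureFam σ m) f * b ∈ S := by
    refine mul_mem (map_Fr_le (fun i hi => ?_) hf) (hS hb)
    rw [FreeGroup.lift_apply_of]
    exact hpure (m - 1 - i) i (by omega)
  exact this

/-- The retraction killing `D (m + 1)`. -/
def retr (m : ℕ) : FreeGroup ℕ →* FreeGroup ℕ := lift fun i => if i = m then (D m)⁻¹ else of i

@[simp] theorem retr_self (m : ℕ) : retr m (of m) = (D m)⁻¹ := by simp [retr]

theorem retr_of_ne {m i : ℕ} (h : i ≠ m) : retr m (of i) = of i := by simp [retr, h]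

theorem retr_of_mem {m : ℕ} {f : FreeGroup ℕ} (hf : f ∈ Fr m) : retr m f = f :=
  eqOn_Fr (f := retr m) (f' := MonoidHom.id _) (fun i hi => by simp [retr_of_ne hi.ne]) hf

theorem retr_mem {m : ℕ} {f : FreeGroup ℕ} (hf : f ∈ Fr (m + 1)) : retr m f ∈ Fr m := by
  refine map_Fr_le (fun i hi => ?_) hf
  rcases eq_or_ne i m with rfl | h
  · rw [retr_self]; exact inv_mem (D_mem_Fr _)
  · rw [retr_of_ne h]; exact of_mem_Fr (by omega)

@[simp] theorem retr_D (m : ℕ) : retr m (D (m + 1)) = 1 := by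
  rw [D_succ, map_mul, retr_of_mem (D_mem_Fr m), retr_self, mul_inv_cancel]

theorem retr_act_retr {m : ℕ} {g : Br} (hg : g ∈ Bn (m + 1)) {f : FreeGroup ℕ}
    (hf : f ∈ Fr (m + 1)) : retr m (act g (retr m f)) = retr m (act g f) := by
  refine eqOn_Fr (f := ((retr m).comp (act g).toMonoidHom).comp (retr m))
    (f' := (retr m).comp (act g).toMonoidHom) (fun i hi => ?_) hf
  change retr m (act g (retr m (of i))) = retr m (act g (of i))
  rcases eq_or_ne i m with rfl | h
  · have : retr i (act g (D (i + 1))) = 1 := by rw [act_D hg, retr_D]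
    rw [D_succ, map_mul, map_mul] at this
    rw [retr_self, map_inv, map_inv, inv_eq_of_mul_eq_one_right this]
  · rw [retr_of_ne h]

theorem retr_act_encFam (m : ℕ) : ∀ d i, i + d = m → ∀ w ∈ Fr (m + 1),
    retr m (act (encFam m i) w) = retr m (of i * w * (of i)⁻¹) := by
  intro d
  induction d with
  | zero =>
    rintro i rfl w hw
    have hc : retr i (D i * of i * (D i)⁻¹) = (D i)⁻¹ := by
      rw [map_mul, map_mul, map_inv, retr_of_mem (D_mem_Fr i), retr_self]; group
    simp only [Nat.add_zero, encFam_last]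
    refine eqOn_Fr (f := (retr i).comp (act (J i)).toMonoidHom)
      (f' := (retr i).comp (MulAut.conj (of i)).toMonoidHom) (fun j hj => ?_) hw
    change retr i (act (J i) (of j)) = retr i (of i * of j * (of i)⁻¹)
    rcases eq_or_ne j i with rfl | h
    · rw [(act_J j).2, hc, mul_inv_cancel_right, retr_self]
    · rw [(act_J i).1 _ (of_mem_Fr (by omega)), map_mul, map_mul, map_inv, hc]
      simp
  | succ d ih =>
    intro i hi w hw
    have hσ := σ_mem (n := m + 1) (i := i) (by omega)
    have hw' := act_mem_Fr (inv_mem hσ) hw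
    rw [encFam_rec (by omega), map_mul, map_mul, MulAut.mul_apply, MulAut.mul_apply,
      ← retr_act_retr hσ (act_mem_Fr (encFam_mem m d (i + 1) (by omega)) hw'),
      ih (i + 1) (by omega) _ hw', retr_act_retr hσ
        (mul_mem (mul_mem (of_mem_Fr (by omega)) hw') (inv_mem (of_mem_Fr (by omega)))),
      map_mul (act _), map_mul (act _), map_inv (act _), act_inv_apply, act_σ, artin_succ]

theorem retr_act_enc {m : ℕ} {f : FreeGroup ℕ} (hf : f ∈ Fr (m + 1)) :
    ∀ w ∈ Fr (m + 1), retr m (act (enc m f) w) = retr m (f * w * f⁻¹) := by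
  suffices h : ∀ w ∈ Fr (m + 1), retr m (act (enc m f) w) = retr m (f * w * f⁻¹) ∧
      retr m (act (enc m f)⁻¹ w) = retr m (f⁻¹ * w * f) from fun w hw => (h w hw).1
  have key : ∀ (g : Br) (f : FreeGroup ℕ), g ∈ Bn (m + 1) → f ∈ Fr (m + 1) →
      (∀ w ∈ Fr (m + 1), retr m (act g w) = retr m (f * w * f⁻¹)) →
      ∀ w ∈ Fr (m + 1), retr m (act g⁻¹ w) = retr m (f⁻¹ * w * f) := by
    intro g f hg hf h w hw
    have h1 := h (act g⁻¹ w) (act_mem_Fr (inv_mem hg) hw)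
    rw [act_inv_apply] at h1
    simp only [map_mul, map_inv] at h1 ⊢
    rw [h1]; group
  refine (Fr_induction (p := fun f => f ∈ Fr (m + 1) ∧ ∀ w ∈ Fr (m + 1),
    retr m (act (enc m f) w) = retr m (f * w * f⁻¹) ∧
      retr m (act (enc m f)⁻¹ w) = retr m (f⁻¹ * w * f)) ?_ ?_ ?_ ?_ hf).2
  · intro i hi
    have h := retr_act_encFam m (m - i) i (by omega)
    exact ⟨of_mem_Fr hi, fun w hw => ⟨by rw [enc_of]; exact h w hw, by
      rw [enc_of]; exact key _ _ (encFam_mem m (m - i) i (by omega)) (of_mem_Fr hi) h w hw⟩⟩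
  · exact ⟨one_mem _, fun w _ => by simp⟩
  · rintro a b ⟨ha, iha⟩ ⟨hb, ihb⟩
    have : ∀ w ∈ Fr (m + 1), retr m (act (enc m (a * b)) w) = retr m (a * b * w * (a * b)⁻¹) := by
      intro w hw
      rw [map_mul, map_mul, MulAut.mul_apply, (iha _ (act_mem_Fr (enc_mem hb) hw)).1, map_mul,
        map_mul, (ihb w hw).1]
      simp only [map_mul, map_inv]; group
    exact ⟨mul_mem ha hb, fun w hw => ⟨this w hw, by
      have := key _ _ (enc_mem (mul_mem ha hb)) (mul_mem ha hb) this w hw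
      simpa using this⟩⟩
  · rintro a ⟨ha, iha⟩
    refine ⟨inv_mem ha, fun w hw => ?_⟩
    have := iha w hw
    simp only [map_inv, inv_inv] at this ⊢
    exact ⟨this.2, this.1⟩

end BraidInj

namespace BraidInj

open FreeGroup (of lift)

theorem eq_one_of_commute_of {α : Type*} {i j : α} (hij : i ≠ j) {f : FreeGroup α}
    (hi : Commute f (of i)) (hj : Commute f (of j)) : f = 1 := by
  classical
  obtain ⟨a, rfl⟩ := zpowers_of_commute_of hi
  obtain ⟨b, hb⟩ := zpowers_of_commute_of hj
  change of j ^ b = of i ^ a at hb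
  change of i ^ a = 1
  have := congrArg (expo i) hb
  simp only [map_zpow, expo_of, if_neg hij.symm, if_true, one_zpow] at this
  rw [← ofAdd_zsmul, smul_eq_mul, mul_one] at this
  have : a = 0 := by simpa using this.symm
  simp [this]

theorem expo_D {i k : ℕ} : expo i (D k) = if i < k then Multiplicative.ofAdd 1 else 1 := by
  induction k with
  | zero => simp
  | succ k ih =>
    rw [D_succ, map_mul, ih, expo_of]
    split_ifs <;> first | omega | simp

theorem D_ne_one {k : ℕ} (hk : 0 < k) : D k ≠ 1 := by
  intro h
  have := congrArg (expo 0) h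
  simp [expo_D, hk] at this

theorem mem_zpowers_D {k : ℕ} (hk : 0 < k) {f : FreeGroup ℕ} (h : Commute f (D k)) :
    f ∈ Subgroup.zpowers (D k) := by
  obtain ⟨r, -, hr⟩ := exists_root_of_centralizer (D_ne_one hk)
  obtain ⟨a, ha⟩ := hr _ (Commute.refl _)
  obtain ⟨b, rfl⟩ := hr _ h
  have := congrArg (fun x => Multiplicative.toAdd (expo 0 x)) ha
  simp only [map_zpow, expo_D, hk, if_true, toAdd_zpow, toAdd_ofAdd, smul_eq_mul] at this
  have : a * a = 1 := by
    rcases Int.eq_one_or_neg_one_of_mul_eq_one this with h | h <;> simp [h]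
  refine ⟨a * b, ?_⟩
  change (D k) ^ (a * b) = r ^ b
  rw [← ha, ← zpow_mul, ← mul_assoc, this, one_mul]

/-- Elements of `B_n` commuting with all of `B_n`. -/
def Central (n : ℕ) (g : Br) : Prop := g ∈ Bn n ∧ ∀ h ∈ Bn n, Commute g h

theorem central_T (n : ℕ) : Central n (T n) := ⟨T_mem n, fun _ h => (commute_T h).symm⟩

theorem Central.mul {n : ℕ} {g h : Br} (hg : Central n g) (hh : Central n h) :
    Central n (g * h) :=
  ⟨mul_mem hg.1 hh.1, fun x hx => (hg.2 x hx).mul_left (hh.2 x hx)⟩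

theorem Central.inv {n : ℕ} {g : Br} (hg : Central n g) : Central n g⁻¹ :=
  ⟨inv_mem hg.1, fun x hx => (hg.2 x hx).inv_left⟩

theorem central_one (n : ℕ) : Central n 1 := ⟨one_mem _, fun x _ => Commute.one_left x⟩

theorem Central.zpow {n : ℕ} {g : Br} (hg : Central n g) (k : ℤ) : Central n (g ^ k) :=
  ⟨zpow_mem hg.1 k, fun x hx => (hg.2 x hx).zpow_left k⟩

section

variable {m : ℕ}

theorem retr_act_central (hm : 2 ≤ m) {c : Br} (hc : Central (m + 1) c) {w : FreeGroup ℕ}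
    (hw : w ∈ Fr (m + 1)) : retr m (act c w) = retr m w := by
  refine eqOn_Fr (f := (retr m).comp (act c).toMonoidHom) (f' := retr m) (fun i hi => ?_) hw
  change retr m (act c (of i)) = _
  rw [← inv_mul_eq_one]
  have key : ∀ j < m, Commute ((retr m (act c (of i)))⁻¹ * retr m (of i)) (of j) := by
    intro j hj
    have hw' := act_mem_Fr (inv_mem hc.1) (of_mem_Fr (show j < m + 1 by omega))
    have hy := encFam_mem m (m - i) i (by omega)
    have h1 : retr m (act (c * encFam m i) (act c⁻¹ (of j))) =
        retr m (act (encFam m i * c) (act c⁻¹ (of j))) := by rw [(hc.2 _ hy).eq]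
    rw [map_mul act, map_mul act, MulAut.mul_apply, MulAut.mul_apply, act_inv_apply,
      retr_act_encFam m (m - i) i (by omega) _ (of_mem_Fr (by omega)),
      ← retr_act_retr hc.1 (act_mem_Fr hy hw'),
      retr_act_encFam m (m - i) i (by omega) _ hw', retr_act_retr hc.1
        (mul_mem (mul_mem (of_mem_Fr hi) hw') (inv_mem (of_mem_Fr hi))), map_mul (act _),
      map_mul (act _), map_inv (act _), act_inv_apply, map_mul, map_mul, map_mul, map_mul, map_inv,
      map_inv, retr_of_ne hj.ne] at h1
    generalize retr m (act c (of i)) = a at *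
    generalize retr m (of i) = b at *
    rw [Commute, SemiconjBy]
    calc a⁻¹ * b * of j = a⁻¹ * (b * of j * b⁻¹) * b := by group
      _ = a⁻¹ * (a * of j * a⁻¹) * b := by rw [h1]
      _ = _ := by group
  exact eq_one_of_commute_of zero_ne_one (key 0 (by omega)) (key 1 (by omega))

theorem eq_one_of_central_enc (hm : 2 ≤ m) {f : FreeGroup ℕ} (hf : f ∈ Fr m)
    (hc : Central (m + 1) (enc m f)) : f = 1 := by
  have key : ∀ j < m, Commute f (of j) := by
    intro j hj
    have h := retr_act_central hm hc (of_mem_Fr (show j < m + 1 by omega))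
    rw [retr_act_enc (Fr_mono (by omega) hf) _ (of_mem_Fr (by omega)), map_mul, map_mul, map_inv,
      retr_of_mem hf, retr_of_ne hj.ne, mul_inv_eq_iff_eq_mul] at h
    exact h
  exact eq_one_of_commute_of zero_ne_one (key 0 (by omega)) (key 1 (by omega))

theorem eq_of_central_enc (hm : 2 ≤ m) {f f' : FreeGroup ℕ} (hf : f ∈ Fr m) (hf' : f' ∈ Fr m)
    (hc : Central (m + 1) (enc m f * (enc m f')⁻¹)) : f = f' := by
  rw [← map_inv, ← map_mul] at hc
  exact mul_inv_eq_one.1 (eq_one_of_central_enc hm (mul_mem hf (inv_mem hf')) hc)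

theorem central_enc_D (m : ℕ) : Central (m + 1) (enc m (D (m + 1))) :=
  ⟨enc_mem (D_mem_Fr _), fun _ hh => (commute_enc_D hh).symm⟩

/-- Modulo the center, `enc` factors through `retr`. -/
theorem central_enc_retr {f : FreeGroup ℕ} (hf : f ∈ Fr (m + 1)) :
    Central (m + 1) (enc m f * (enc m (retr m f))⁻¹) := by
  refine Fr_induction (p := fun f => f ∈ Fr (m + 1) ∧
    Central (m + 1) (enc m f * (enc m (retr m f))⁻¹)) ?_ ?_ ?_ ?_ hf |>.2
  · intro i hi
    refine ⟨of_mem_Fr hi, ?_⟩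
    rcases eq_or_ne i m with rfl | h
    · have h1 := central_enc_D i
      have h2 := h1.2 _ (enc_mem (Fr_mono (Nat.le_succ i) (D_mem_Fr i)))
      have h3 : enc i (of i) * (enc i (retr i (of i)))⁻¹ = enc i (D (i + 1)) := by
        rw [retr_self, map_inv, inv_inv]
        rw [D_succ, map_mul] at h2 ⊢
        have := h2.eq
        rw [mul_assoc] at this
        exact mul_left_cancel this
      rw [h3]; exact h1
    · rw [retr_of_ne h, mul_inv_cancel]; exact central_one _
  · exact ⟨one_mem _, by simpa using central_one _⟩
  · rintro a b ⟨ha, iha⟩ ⟨hb, ihb⟩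
    refine ⟨mul_mem ha hb, ?_⟩
    have h1 := ihb.2 _ (enc_mem (Fr_mono (Nat.le_succ m) (retr_mem ha)))
    have h2 := iha.mul ihb
    have : enc m (a * b) * (enc m (retr m (a * b)))⁻¹ =
        enc m a * (enc m (retr m a))⁻¹ * (enc m b * (enc m (retr m b))⁻¹) := by
      have h3 := h1.inv_right.eq
      calc _ = enc m a * ((enc m b * (enc m (retr m b))⁻¹) * (enc m (retr m a))⁻¹) := by
            simp only [map_mul]; group
        _ = _ := by rw [h3]; group
    rw [this]; exact h2
  · rintro a ⟨ha, iha⟩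
    refine ⟨inv_mem ha, ?_⟩
    have h1 := iha.inv.2 _ (enc_mem (Fr_mono (Nat.le_succ m) (retr_mem ha)))
    have : enc m a⁻¹ * (enc m (retr m a⁻¹))⁻¹ = (enc m a * (enc m (retr m a))⁻¹)⁻¹ := by
      have h2 := h1.eq
      rw [mul_inv_rev, inv_inv, mul_assoc, mul_left_cancel_iff] at h2
      simp only [map_inv, inv_inv, mul_inv_rev, h2]
    rw [this]; exact iha.inv

theorem centralizer_enc_aux (hm : 2 ≤ m) {g : Br} (hg : g ∈ Bn (m + 1))
    (h : ∀ i ≤ m, Central (m + 1) (g * encFam m i * g⁻¹ * (encFam m i)⁻¹)) :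
    g ∈ Subgroup.zpowers (enc m (D m) * (T m)⁻¹) := by
  have hr : ∀ f ∈ Fr (m + 1), Central (m + 1) (g * enc m f * g⁻¹ * (enc m f)⁻¹) →
      retr m (act g f) = retr m f := by
    intro f hf hc
    have hgf := act_mem_Fr hg hf
    apply eq_of_central_enc hm (retr_mem hgf) (retr_mem hf)
    rw [conj_enc hg hf] at hc
    have h1 := central_enc_retr (m := m) hgf
    have h2 := central_enc_retr (m := m) hf
    have h3 := (h1.inv.mul hc).mul h2
    convert h3 using 1
    have h4 := (h1.inv.2 _ (enc_mem (Fr_mono (Nat.le_succ m) (retr_mem hgf)))).eq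
    calc _ = enc m (act g f) * ((enc m (act g f) * (enc m (retr m (act g f)))⁻¹)⁻¹ *
          (enc m (retr m f))⁻¹) := by
          have := (h1.inv.2 _ (enc_mem hgf)).eq
          rw [← mul_assoc, ← this]; group
      _ = _ := by
          rw [← mul_assoc, ← (h1.inv.2 _ (enc_mem hgf)).eq]; group
  have hr' : ∀ i ≤ m, retr m (act g (of i)) = retr m (of i) := fun i hi =>
    hr _ (of_mem_Fr (by omega)) (by simpa using h i hi)
  have hp : perm g m = m := by
    by_contra hne
    have hlt : perm g m < m := by
      have := (perm_lt_iff hg m).2 (by omega)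
      omega
    have h1 := hr' m le_rfl
    obtain ⟨c, hc⟩ := act_of_conj g m
    rw [hc, map_mul, map_mul, map_inv, retr_of_ne hne, retr_self] at h1
    have h2 := congrArg (expo (perm g m)) h1
    simp only [map_mul, map_inv, expo_D, hlt, mul_inv_cancel_comm, expo_of, if_true] at h2
    exact absurd h2 (by decide)
  obtain ⟨f, hf, b, hb, rfl⟩ := exists_enc_decomp hg hp
  have hfb : ∀ i < m, f * act b (of i) * f⁻¹ = of i := by
    intro i hi
    have h1 := hr' i hi.le
    have h2 := act_mem_Fr hb (of_mem_Fr hi)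
    rwa [map_mul, MulAut.mul_apply, retr_act_enc (Fr_mono (Nat.le_succ m) hf) _
      (Fr_mono (Nat.le_succ m) h2), retr_of_mem (mul_mem (mul_mem hf h2) (inv_mem hf)),
      retr_of_ne hi.ne] at h1
  have hD : f * D m * f⁻¹ = D m := by
    have := eqOn_Fr (f := ((MulAut.conj f).toMonoidHom).comp (act b).toMonoidHom)
      (f' := MonoidHom.id _) (n := m) (fun i hi => hfb i hi) (D_mem_Fr m)
    have h2 : f * act b (D m) * f⁻¹ = D m := this
    rwa [act_D hb] at h2
  obtain ⟨j, hj⟩ := mem_zpowers_D (by omega) (show Commute f (D m) from mul_inv_eq_iff_eq_mul.1 hD)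
  change D m ^ j = f at hj
  have hbT : b = (T m) ^ (-j) := by
    apply eq_of_act hb (zpow_mem (T_mem m) _)
    intro i hi
    have h1 : act b (of i) = f⁻¹ * of i * f := by
      calc _ = f⁻¹ * (f * act b (of i) * f⁻¹) * f := by group
        _ = _ := by rw [hfb i hi]
    have h2 : act (T m ^ j) (f⁻¹ * of i * f) = of i := by
      have h3 : ∀ (k : ℤ) (w : FreeGroup ℕ), w ∈ Fr m →
          act (T m ^ k) w = D m ^ k * w * (D m ^ k)⁻¹ := by
        intro k w hw
        induction k with
        | zero => simp
        | succ k ih =>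
          rw [zpow_add_one, (Commute.zpow_self (T m) k).eq, map_mul, MulAut.mul_apply, ih, act_T
            (mul_mem (mul_mem (zpow_mem (D_mem_Fr m) _) hw) (inv_mem (zpow_mem (D_mem_Fr m) _))),
            zpow_add_one]
          group
        | pred k ih =>
          have : act (T m) (D m ^ (-(k : ℤ) - 1) * w * (D m ^ (-(k : ℤ) - 1))⁻¹) =
              act (T m) (act (T m ^ (-(k : ℤ) - 1)) w) := by
            rw [act_T (mul_mem (mul_mem (zpow_mem (D_mem_Fr m) _) hw)
              (inv_mem (zpow_mem (D_mem_Fr m) _))), ← MulAut.mul_apply, ← map_mul, ← zpow_one_add,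
              show (1 : ℤ) + (-k - 1) = -k by ring, ih]
            group
          exact ((act (T m)).injective this).symm
      rw [h3 j _ (mul_mem (mul_mem (inv_mem hf) (of_mem_Fr hi)) hf), ← hj]; group
    rw [h1, zpow_neg]
    conv_rhs => rw [← h2]
    exact (inv_act_apply _ _).symm
  refine ⟨j, ?_⟩
  change (enc m (D m) * (T m)⁻¹) ^ j = _
  rw [hbT, ← hj, map_zpow, zpow_neg, ← inv_zpow, Commute.mul_zpow]
  have := conj_enc (gens_mono (Nat.le_succ m) (T_mem m)) (Fr_mono (Nat.le_succ m) (D_mem_Fr m))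
  rw [act_D (T_mem m), mul_inv_eq_iff_eq_mul] at this
  exact (show Commute (T m) _ from this).symm.inv_right

theorem expSum_encFam (m : ℕ) : ∀ d i, i + d = m →
    expSum (encFam m i) = Multiplicative.ofAdd (2 * m : ℤ) := by
  intro d
  induction d with
  | zero => rintro i rfl; simp only [Nat.add_zero, encFam_last, expSum_J]
  | succ d ih =>
    intro i hi
    rw [encFam_rec (by omega), map_mul, map_mul, map_inv, mul_inv_cancel_comm, ih _ (by omega)]

theorem expSum_enc_D (m : ℕ) : ∀ k ≤ m + 1,
    expSum (enc m (D k)) = Multiplicative.ofAdd (2 * m * k : ℤ) := by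
  intro k
  induction k with
  | zero => simp
  | succ k ih =>
    intro hk
    rw [D_succ, map_mul, map_mul, enc_of, expSum_encFam m (m - k) k (by omega), ih (by omega),
      ← ofAdd_add]
    congr 1

/-- An element centralizing the encircling braids modulo the center is central. -/
theorem centralizer_enc (hm : 2 ≤ m) {g : Br} (hg : g ∈ Bn (m + 1))
    (h : ∀ i ≤ m, Central (m + 1) (g * encFam m i * g⁻¹ * (encFam m i)⁻¹)) :
    g ∈ Subgroup.zpowers (T (m + 1)) := by
  have h1 : T (m + 1) ∈ Subgroup.zpowers (enc m (D m) * (T m)⁻¹) := by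
    refine centralizer_enc_aux hm (T_mem _) fun i hi => ?_
    rw [← (commute_T (encFam_mem m (m - i) i (by omega))).eq, mul_inv_cancel_right, mul_inv_cancel]
    exact central_one _
  obtain ⟨j, hj⟩ := h1
  change (enc m (D m) * (T m)⁻¹) ^ j = _ at hj
  have h2 := congrArg (fun x => Multiplicative.toAdd (expSum x)) hj
  simp only [map_zpow, map_mul, map_inv, expSum_enc_D m m (by omega), expSum_T, ← ofAdd_neg,
    ← ofAdd_add, toAdd_zpow, toAdd_ofAdd, smul_eq_mul] at h2
  have hm' : (2 : ℤ) ≤ m := by exact_mod_cast hm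
  have h3 : j = 1 := by
    have h4 : (j - 1) * ((m : ℤ) * (m + 1)) = 0 := by push_cast at h2; linarith
    rcases mul_eq_zero.1 h4 with h | h
    · omega
    · exact absurd h (by positivity)
  rw [h3, zpow_one] at hj
  rw [← hj]
  exact centralizer_enc_aux hm hg h

theorem Central.mem_zpowers {n : ℕ} (hn : 3 ≤ n) {g : Br} (hg : Central n g) :
    g ∈ Subgroup.zpowers (T n) := by
  obtain ⟨m, rfl⟩ : ∃ m, n = m + 1 := ⟨n - 1, by omega⟩
  refine centralizer_enc (by omega) hg.1 fun i hi => ?_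
  rw [(hg.2 _ (encFam_mem m (m - i) i (by omega))).eq, mul_inv_cancel_right, mul_inv_cancel]
  exact central_one _

theorem Central.eq_one {n : ℕ} (hn : 3 ≤ n) {g : Br} (hg : Central n g) (h : expSum g = 1) :
    g = 1 := by
  obtain ⟨j, rfl⟩ := hg.mem_zpowers hn
  change expSum (T n ^ j) = 1 at h
  rw [map_zpow, expSum_T, ← ofAdd_zsmul, ofAdd_eq_one, smul_eq_mul] at h
  have hn' : (3 : ℤ) ≤ n := by exact_mod_cast hn
  have : j = 0 := by
    rcases mul_eq_zero.1 h with h | h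
    · exact h
    · rcases mul_eq_zero.1 h with h | h <;> omega
  simp [this]

end

end BraidInj

namespace BraidInj

open FreeGroup (of lift norm)

/-- A letter or the inverse of a letter. -/
def IsLetter {α : Type*} (e : FreeGroup α) : Prop := ∃ a, e = of a ∨ e = (of a)⁻¹

theorem IsLetter.inv {α : Type*} {e : FreeGroup α} (he : IsLetter e) : IsLetter e⁻¹ := by
  obtain ⟨a, rfl | rfl⟩ := he
  · exact ⟨a, .inr rfl⟩
  · exact ⟨a, .inl (by simp)⟩

theorem isLetter_of {α : Type*} (a : α) : IsLetter (of a) := ⟨a, .inl rfl⟩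

section norm

variable {α : Type*} [DecidableEq α] {u v w : FreeGroup α}

theorem norm_mul_eq_iff : norm (u * v) = norm u + norm v ↔
    FreeGroup.IsReduced (u.toWord ++ v.toWord) := by
  rw [FreeGroup.isReduced_iff_reduce_eq, ← FreeGroup.toWord_mul]
  constructor
  · intro h
    exact (FreeGroup.toWord_mul_sublist u v).eq_of_length (by
      rw [List.length_append]; exact h)
  · intro h
    rw [FreeGroup.norm, h, List.length_append]; rfl

theorem norm_overlap (hv : v ≠ 1) (h1 : norm (u * v) = norm u + norm v)
    (h2 : norm (v * w) = norm v + norm w) : norm (u * v * w) = norm u + norm v + norm w := by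
  have h3 := norm_mul_eq_iff.1 h1
  have h4 := h3.append_overlap (norm_mul_eq_iff.1 h2) (by simpa using hv)
  rw [← h1, norm_mul_eq_iff]
  rwa [FreeGroup.toWord_mul, h3.reduce_eq]

theorem norm_mod_two (u : FreeGroup α) :
    Multiplicative.toAdd (lift (fun _ => Multiplicative.ofAdd (1 : ZMod 2)) u) = norm u := by
  have h : ∀ L : List (α × Bool), Multiplicative.toAdd
      (lift (fun _ => Multiplicative.ofAdd (1 : ZMod 2)) (FreeGroup.mk L)) = L.length := by
    intro L
    rw [FreeGroup.lift_mk]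
    induction L with
    | nil => simp
    | cons a L ih =>
      have h1 : (bif a.2 then Multiplicative.ofAdd (1 : ZMod 2)
          else (Multiplicative.ofAdd 1)⁻¹) = Multiplicative.ofAdd 1 := by
        cases a.2 <;> decide
      rw [List.map_cons, List.prod_cons, h1, toAdd_mul, ih, List.length_cons, toAdd_ofAdd]
      push_cast
      ring
  conv_lhs => rw [← FreeGroup.mk_toWord (x := u)]
  exact h _

theorem IsLetter.norm_eq {e : FreeGroup α} (he : IsLetter e) : norm e = 1 := by
  obtain ⟨a, rfl | rfl⟩ := he <;> simp

theorem IsLetter.ne_one {e : FreeGroup α} (he : IsLetter e) : e ≠ 1 := by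
  rintro rfl
  simpa using he.norm_eq

theorem norm_mul_letter (u : FreeGroup α) {e : FreeGroup α} (he : IsLetter e) :
    norm (u * e) = norm u + 1 ∨ norm (u * e) + 1 = norm u := by
  have h1 := FreeGroup.norm_mul_le u e
  have h2 := FreeGroup.norm_mul_le (u * e) e⁻¹
  rw [mul_inv_cancel_right, he.inv.norm_eq] at h2
  rw [he.norm_eq] at h1
  have h3 : ((norm (u * e) : ℕ) : ZMod 2) = (norm u + 1 : ℕ) := by
    push_cast
    rw [← norm_mod_two, ← norm_mod_two, map_mul, toAdd_mul, norm_mod_two e, he.norm_eq]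
    simp
  rw [ZMod.natCast_eq_natCast_iff'] at h3
  omega

theorem norm_letter_mul (u : FreeGroup α) {e : FreeGroup α} (he : IsLetter e) :
    norm (e * u) = norm u + 1 ∨ norm (e * u) + 1 = norm u := by
  have := norm_mul_letter u⁻¹ he.inv
  rwa [← mul_inv_rev, FreeGroup.norm_inv_eq, FreeGroup.norm_inv_eq] at this

end norm

section artinThm

variable {m : ℕ}

theorem D_eq_mk (k : ℕ) : D k = FreeGroup.mk ((List.range k).map fun i => (i, true)) := by
  induction k with
  | zero => rfl
  | succ k ih => rw [List.range_succ, List.map_append, ← FreeGroup.mul_mk, ← ih]; rfl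

theorem lift_of_D_eq_mk (p : ℕ → ℕ) (k : ℕ) : lift (fun i => of (p i)) (D k) =
    FreeGroup.mk ((List.range k).map fun i => (p i, true)) := by
  induction k with
  | zero => rfl
  | succ k ih =>
    rw [List.range_succ, List.map_append, ← FreeGroup.mul_mk, ← ih, D_succ, map_mul]
    rfl

theorem eq_of_lift_of_D {p : ℕ → ℕ} {k : ℕ} (h : lift (fun i => of (p i)) (D k) = D k) :
    ∀ i < k, p i = i := by
  rw [lift_of_D_eq_mk, D_eq_mk] at h
  have hr : ∀ q : ℕ → ℕ, FreeGroup.IsReduced ((List.range k).map fun i => (q i, true)) := by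
    intro q
    rw [FreeGroup.IsReduced, List.isChain_map]
    exact List.Pairwise.isChain (List.pairwise_of_forall fun _ _ _ => rfl)
  have h2 := congrArg FreeGroup.toWord h
  rw [FreeGroup.toWord_mk, FreeGroup.toWord_mk, (hr _).reduce_eq, (hr fun i => i).reduce_eq,
    List.map_inj_left] at h2
  intro i hi
  simpa using h2 i (List.mem_range.2 hi)

theorem lift_mem_Fr_eq {y : ℕ → FreeGroup ℕ} {b : Br} (h : ∀ i < m, y i = act b (of i))
    {f : FreeGroup ℕ} (hf : f ∈ Fr m) : lift y f = act b f :=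
  eqOn_Fr (f := lift y) (f' := (act b).toMonoidHom) (fun i hi => by simpa using h i hi) hf

theorem norm_D (k : ℕ) : norm (D k) = k := by
  rw [D_eq_mk, FreeGroup.norm, FreeGroup.toWord_mk, FreeGroup.IsReduced.reduce_eq]
  · simp
  · rw [FreeGroup.IsReduced, List.isChain_map]
    exact List.Pairwise.isChain (List.pairwise_of_forall fun _ _ _ => rfl)

/-- If no Hurwitz move shortens a factorization of `D m`, then the conjugators are trivial. -/
theorem trivial_of_irreducible {g : ℕ → FreeGroup ℕ} {p : ℕ → ℕ}
    (hD : lift (fun i => g i * of (p i) * (g i)⁻¹) (D m) = D m)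
    (h1 : ∀ i < m, norm (g i * of (p i)) = norm (g i) + 1)
    (h2 : ∀ i, i + 1 < m →
      norm (of (p i) * ((g i)⁻¹ * g (i + 1))) = norm ((g i)⁻¹ * g (i + 1)) + 1)
    (h3 : ∀ i, i + 1 < m →
      norm ((g i)⁻¹ * g (i + 1) * of (p (i + 1))) = norm ((g i)⁻¹ * g (i + 1)) + 1)
    (h4 : ∀ i < m, norm (g i * (of (p i))⁻¹) = norm (g i) + 1) :
    ∀ i < m, g i = 1 := by
  set y := fun i => g i * of (p i) * (g i)⁻¹ with hy
  have key : ∀ k, k < m → norm (lift y (D k) * g k * of (p k)) =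
      norm (lift y (D k) * g k) + 1 ∧ k + norm (g 0) ≤ norm (lift y (D k) * g k) ∧
      (norm (lift y (D k) * g k) = k → ∀ i ≤ k, g i = 1) := by
    intro k
    induction k with
    | zero => exact fun hk => ⟨by simpa using h1 0 hk, by simp, fun h i hi => by
        obtain rfl : i = 0 := by omega
        simpa using h⟩
    | succ k ih =>
      intro hk
      obtain ⟨i1, i2, i3⟩ := ih (by omega)
      set r := (g k)⁻¹ * g (k + 1) with hr
      have e1 : lift y (D (k + 1)) * g (k + 1) = lift y (D k) * g k * of (p k) * r := by
        rw [D_succ, map_mul, FreeGroup.lift_apply_of, hr, hy]; group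
      have hl : ∀ j, norm (of (p j)) = 1 := fun j => FreeGroup.norm_of _
      have h2' := h2 k hk
      have h3' := h3 k hk
      rw [← hr] at h2' h3'
      have n1 : norm (lift y (D (k + 1)) * g (k + 1)) =
          norm (lift y (D k) * g k) + 1 + norm r := by
        rw [e1, norm_overlap (isLetter_of _).ne_one (by rw [i1, hl])
          (by rw [h2', hl, add_comm]), hl]
      have n2 : norm (of (p k) * r * of (p (k + 1))) = 1 + norm r + 1 := by
        by_cases hr1 : r = 1
        · rw [hr1, mul_one, FreeGroup.norm_one]
          have : FreeGroup.norm (of (p k) * of (p (k + 1))) =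
              norm (of (p k)) + norm (of (p (k + 1))) := by
            rw [norm_mul_eq_iff]
            simp [FreeGroup.IsReduced]
          rw [this]; simp
        · rw [norm_overlap hr1 (by rw [h2', hl, add_comm]) (by rw [h3', hl]), hl, hl]
      refine ⟨?_, by omega, fun h => ?_⟩
      · rw [n1, e1, mul_assoc, norm_overlap (v := of (p k)) (isLetter_of _).ne_one
          (by rw [i1, hl]) (by rw [← mul_assoc, n2, h3', hl]; omega), h3', hl]
        omega
      · have hr0 : norm r = 0 := by omega
        rw [FreeGroup.norm_eq_zero, hr, inv_mul_eq_one] at hr0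
        intro i hi
        have := i3 (by omega)
        rcases Nat.lt_or_ge i (k + 1) with h | h
        · exact this i (by omega)
        · obtain rfl : i = k + 1 := by omega
          rw [← hr0]; exact this k le_rfl
  rcases m with _ | k
  · simp
  obtain ⟨i1, i2, i3⟩ := key k (by omega)
  have hl : norm (of (p k)) = 1 := FreeGroup.norm_of _
  have n1 : norm (D (k + 1)) = norm (lift y (D k) * g k) + 1 + norm (g k) := by
    conv_lhs => rw [← hD, D_succ, map_mul, FreeGroup.lift_apply_of, hy]
    simp only
    rw [← mul_assoc, ← mul_assoc, norm_overlap (isLetter_of _).ne_one (by rw [← hy, i1, hl]) (by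
      have := h4 k (by omega)
      rw [← FreeGroup.norm_inv_eq, mul_inv_rev, inv_inv] at this
      rw [this, FreeGroup.norm_inv_eq, hl, add_comm]), hl, FreeGroup.norm_inv_eq]
  rw [norm_D] at n1
  intro i hi
  exact i3 (by omega) i (by omega)

theorem sum_lt_of_pair {a b : ℕ → ℕ} {i : ℕ} (hi : i + 1 < m)
    (h : ∀ j, j ≠ i → j ≠ i + 1 → a j = b j) (hlt : a i + a (i + 1) < b i + b (i + 1)) :
    ∑ j ∈ Finset.range m, a j < ∑ j ∈ Finset.range m, b j := by
  have key : ∀ c : ℕ → ℕ, ∑ j ∈ Finset.range m, c j =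
      c i + (c (i + 1) + ∑ j ∈ ((Finset.range m).erase i).erase (i + 1), c j) := by
    intro c
    rw [Finset.add_sum_erase _ _ (by simp; omega), Finset.add_sum_erase _ _ (by simp; omega)]
  have hc : ∑ j ∈ ((Finset.range m).erase i).erase (i + 1), a j =
      ∑ j ∈ ((Finset.range m).erase i).erase (i + 1), b j :=
    Finset.sum_congr rfl fun j hj => h j (by simp at hj; omega) (by simp at hj; omega)
  rw [key a, key b, hc]
  omega

/-- Artin's theorem characterizing braid automorphisms. -/
theorem exists_braid_of_conj (N : ℕ) : ∀ (g : ℕ → FreeGroup ℕ) (p : ℕ → ℕ),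
    lift (fun i => g i * of (p i) * (g i)⁻¹) (D m) = D m →
    ∑ i ∈ Finset.range m, norm (g i) = N →
    ∃ b ∈ Bn m, ∀ i < m, g i * of (p i) * (g i)⁻¹ = act b (of i) := by
  induction N using Nat.strong_induction_on with
  | _ N ih =>
  intro g p hD hN
  have letter : ∀ (i : ℕ) (e : FreeGroup ℕ), i < m → IsLetter e → Commute e (of (p i)) →
      norm (g i * e) ≠ norm (g i) + 1 →
      ∃ b ∈ Bn m, ∀ i < m, g i * of (p i) * (g i)⁻¹ = act b (of i) := by
    intro i e hi he hc hne
    have hlt := (norm_mul_letter (g i) he).resolve_left hne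
    set g' := Function.update g i (g i * e) with hg'
    have hyy : ∀ j, g' j * of (p j) * (g' j)⁻¹ = g j * of (p j) * (g j)⁻¹ := by
      intro j
      by_cases hj : j = i
      · subst hj
        rw [hg', Function.update_self, mul_inv_rev, mul_assoc (g j), hc.eq]; group
      · rw [hg', Function.update_of_ne hj]
    have := ih (∑ i ∈ Finset.range m, norm (g' i)) (by
      rw [← hN]
      refine Finset.sum_lt_sum (fun j _ => ?_) ⟨i, Finset.mem_range.2 hi, ?_⟩
      · by_cases hj : j = i
        · subst hj; rw [hg', Function.update_self]; omega
        · rw [hg', Function.update_of_ne hj]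
      · rw [hg', Function.update_self]; omega) g' p (by simpa only [hyy] using hD) rfl
    simpa only [hyy] using this
  have hurwitz : ∀ (b : Br), b ∈ Bn m → ∀ (g' : ℕ → FreeGroup ℕ) (p' : ℕ → ℕ),
      (∀ j < m, g' j * of (p' j) * (g' j)⁻¹ =
        lift (fun i => g i * of (p i) * (g i)⁻¹) (act b (of j))) →
      ∑ i ∈ Finset.range m, norm (g' i) < N →
      ∃ b ∈ Bn m, ∀ i < m, g i * of (p i) * (g i)⁻¹ = act b (of i) := by
    intro b hb g' p' hyy hlt
    set y := fun i => g i * of (p i) * (g i)⁻¹ with hy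
    have hl : ∀ f ∈ Fr m, lift (fun i => g' i * of (p' i) * (g' i)⁻¹) f = lift y (act b f) :=
      fun f hf => eqOn_Fr (f' := (lift y).comp (act b).toMonoidHom)
        (fun i hi => by simpa using hyy i hi) hf
    obtain ⟨c, hc, hcy⟩ := ih _ hlt g' p' (by rw [hl _ (D_mem_Fr m), act_D hb, hD]) rfl
    refine ⟨c * b⁻¹, mul_mem hc (inv_mem hb), fun i hi => ?_⟩
    have hm := act_mem_Fr (inv_mem hb) (of_mem_Fr hi)
    rw [map_mul, MulAut.mul_apply, ← lift_mem_Fr_eq hcy hm, hl _ hm, act_inv_apply,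
      FreeGroup.lift_apply_of]
  by_cases ha : ∃ i < m, norm (g i * of (p i)) ≠ norm (g i) + 1
  · obtain ⟨i, hi, h⟩ := ha
    exact letter i _ hi (isLetter_of _) (Commute.refl _) h
  by_cases ha' : ∃ i < m, norm (g i * (of (p i))⁻¹) ≠ norm (g i) + 1
  · obtain ⟨i, hi, h⟩ := ha'
    exact letter i _ hi (isLetter_of _).inv (Commute.refl _).inv_left h
  push Not at ha ha'
  by_cases hb : ∃ i, i + 1 < m ∧
      norm (of (p i) * ((g i)⁻¹ * g (i + 1))) ≠ norm ((g i)⁻¹ * g (i + 1)) + 1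
  · obtain ⟨i, hi, h⟩ := hb
    have hlt := (norm_letter_mul _ (isLetter_of _)).resolve_left h
    set r := (g i)⁻¹ * g (i + 1) with hr
    refine hurwitz (σ i) (σ_mem hi)
      (fun j => if j = i then g i * of (p i) * r else if j = i + 1 then g i else g j)
      (fun j => if j = i then p (i + 1) else if j = i + 1 then p i else p j) (fun j hj => ?_) ?_
    · by_cases h1 : j = i
      · subst h1; simp [hr]; group
      · by_cases h2 : j = i + 1
        · subst h2; simp
        · simp [h1, h2, artin_of_ne h1 h2]
    · rw [← hN]
      refine sum_lt_of_pair hi (fun j h1 h2 => by simp [h1, h2]) ?_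
      have e1 : norm (g (i + 1)) = norm (g i) + 1 + norm (of (p i) * r) := by
        have := norm_overlap (u := g i) (v := (of (p i))⁻¹) (w := of (p i) * r)
          (isLetter_of _).inv.ne_one (by rw [ha' i (by omega)]; simp)
          (by rw [inv_mul_cancel_left, FreeGroup.norm_inv_eq, FreeGroup.norm_of]; omega)
        rw [FreeGroup.norm_inv_eq, FreeGroup.norm_of] at this
        rw [← this, hr]; congr 1; group
      have e2 := FreeGroup.norm_mul_le (g i) (of (p i) * r)
      rw [← mul_assoc] at e2
      simp only [if_true, Nat.succ_ne_self, if_false]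
      omega
  by_cases hc : ∃ i, i + 1 < m ∧
      norm ((g i)⁻¹ * g (i + 1) * of (p (i + 1))) ≠ norm ((g i)⁻¹ * g (i + 1)) + 1
  · obtain ⟨i, hi, h⟩ := hc
    have hlt := (norm_mul_letter _ (isLetter_of _)).resolve_left h
    set r := (g i)⁻¹ * g (i + 1) with hr
    refine hurwitz (σ i)⁻¹ (inv_mem (σ_mem hi))
      (fun j => if j = i then g (i + 1) else if j = i + 1 then
        g (i + 1) * (r * of (p (i + 1)))⁻¹ else g j)
      (fun j => if j = i then p (i + 1) else if j = i + 1 then p i else p j) (fun j hj => ?_) ?_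
    · have hinv : ∀ (f f' : FreeGroup ℕ), artin i f = f' → act (σ i)⁻¹ f' = f := by
        rintro f _ rfl; rw [← act_σ]; exact inv_act_apply _ _
      by_cases h1 : j = i
      · subst h1
        rw [hinv _ _ (artin_succ j)]; simp
      · by_cases h2 : j = i + 1
        · subst h2
          rw [hinv ((of (i + 1))⁻¹ * of i * of (i + 1)) (of (i + 1)) (by simp [mul_assoc])]
          simp [hr, mul_assoc]
        · rw [hinv _ _ (artin_of_ne h1 h2)]; simp [h1, h2]
    · rw [← hN]
      refine sum_lt_of_pair hi (fun j h1 h2 => by simp [h1, h2]) ?_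
      have e1 : norm (g i) = norm (g (i + 1)) + 1 + norm (r * of (p (i + 1))) := by
        have := norm_overlap (u := g (i + 1)) (v := of (p (i + 1))) (w := (r * of (p (i + 1)))⁻¹)
          (isLetter_of _).ne_one (by rw [ha (i + 1) (by omega)]; simp)
          (by rw [mul_inv_rev, mul_inv_cancel_left, FreeGroup.norm_inv_eq, ← mul_inv_rev,
            FreeGroup.norm_inv_eq, FreeGroup.norm_of]; omega)
        rw [FreeGroup.norm_inv_eq, FreeGroup.norm_of] at this
        rw [← this, hr]; congr 1; group
      have e2 := FreeGroup.norm_mul_le (g (i + 1)) (r * of (p (i + 1)))⁻¹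
      rw [FreeGroup.norm_inv_eq] at e2
      simp only [if_true, Nat.succ_ne_self, if_false]
      omega
  push Not at hb hc
  have hg := trivial_of_irreducible hD ha hb hc ha'
  have hy : ∀ i < m, g i * of (p i) * (g i)⁻¹ = of (p i) := fun i hi => by simp [hg i hi]
  have hD' : lift (fun i => of (p i)) (D m) = D m := by
    rw [eqOn_Fr (f := lift (fun i => of (p i)))
      (f' := lift (fun i => g i * of (p i) * (g i)⁻¹))
      (fun i hi => by simpa using (hy i hi).symm) (D_mem_Fr m), hD]
  have hp := eq_of_lift_of_D hD'
  exact ⟨1, one_mem _, fun i hi => by rw [hy i hi, hp i hi]; simp⟩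

end artinThm

end BraidInj

namespace BraidInj

open FreeGroup (of lift norm)

/-- A function which is multiplicative on a subgroup. -/
def HomOn {G H : Type*} [Group G] [Group H] (K : Subgroup G) (ρ : G → H) : Prop :=
  ∀ g ∈ K, ∀ h ∈ K, ρ (g * h) = ρ g * ρ h

namespace HomOn

variable {G H : Type*} [Group G] [Group H] {K : Subgroup G} {ρ : G → H}

theorem one (h : HomOn K ρ) : ρ 1 = 1 := by
  have := h 1 (one_mem _) 1 (one_mem _)
  rwa [mul_one, left_eq_mul] at this

theorem inv (h : HomOn K ρ) {g : G} (hg : g ∈ K) : ρ g⁻¹ = (ρ g)⁻¹ := by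
  have := h g hg g⁻¹ (inv_mem hg)
  rw [mul_inv_cancel, h.one] at this
  exact eq_inv_of_mul_eq_one_right this.symm

theorem conj (h : HomOn K ρ) {g x : G} (hg : g ∈ K) (hx : x ∈ K) :
    ρ (g * x * g⁻¹) = ρ g * ρ x * (ρ g)⁻¹ := by
  rw [h _ (mul_mem hg hx) _ (inv_mem hg), h _ hg _ hx, h.inv hg]

/-- The restriction as a homomorphism. -/
def toHom (h : HomOn K ρ) : K →* H where
  toFun x := ρ x
  map_one' := h.one
  map_mul' x y := h x x.2 y y.2

theorem zpow (h : HomOn K ρ) {g : G} (hg : g ∈ K) (k : ℤ) : ρ (g ^ k) = ρ g ^ k :=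
  map_zpow h.toHom ⟨g, hg⟩ k

theorem comp_hom {F : Type*} [Group F] (h : HomOn K ρ) {f : F →* G} {L : Subgroup F}
    (hf : ∀ g ∈ L, f g ∈ K) : HomOn L fun x => ρ (f x) := fun g hg k hk => by
  simp only [map_mul, h _ (hf g hg) _ (hf k hk)]

theorem conjBy (h : HomOn K ρ) (c : H) : HomOn K fun x => c * ρ x * c⁻¹ := fun g hg k hk => by
  simp only [h g hg k hk]; group

theorem map {L : Type*} [Group L] (h : HomOn K ρ) (f : H →* L) : HomOn K fun x => f (ρ x) :=
  fun g hg k hk => by simp only [h g hg k hk, map_mul]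

end HomOn

theorem HomOn.eqOn_gens {H : Type*} [Group H] {n : ℕ} {ρ ρ' : Br → H} (h : HomOn (Bn n) ρ)
    (h' : HomOn (Bn n) ρ') (hs : ∀ i, i + 1 < n → ρ (σ i) = ρ' (σ i)) {g : Br} (hg : g ∈ Bn n) :
    ρ g = ρ' g := by
  have : Bn n ≤ (h.toHom.eqLocus h'.toHom).map (Bn n).subtype :=
    gens_le.2 fun i hi => ⟨⟨σ i, σ_mem hi⟩, hs i hi, rfl⟩
  obtain ⟨x, hx, rfl⟩ := this hg
  exact hx

theorem HomOn.eqOn_Fr {H : Type*} [Group H] {n : ℕ} {ρ : FreeGroup ℕ → H} (h : HomOn (Fr n) ρ)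
    {f : FreeGroup ℕ} (hf : f ∈ Fr n) : ρ f = lift (fun i => ρ (of i)) f := by
  have : Fr n ≤ (h.toHom.eqLocus ((lift fun i => ρ (of i)).comp (Fr n).subtype)).map
      (Fr n).subtype := Fr_le.2 fun i hi => ⟨⟨of i, of_mem_Fr hi⟩, (by simp :
        ρ (of i) = lift (fun i => ρ (of i)) (of i)), rfl⟩
  obtain ⟨x, hx, rfl⟩ := this hf
  exact hx

/-- The braid group on `n` strands modulo its center. -/
abbrev Qn (n : ℕ) : Type := Bn n ⧸ Subgroup.center (Bn n)

open Classical in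
/-- The class of a braid modulo the center. -/
noncomputable def q (n : ℕ) (g : Br) : Qn n :=
  if hg : g ∈ Bn n then QuotientGroup.mk ⟨g, hg⟩ else 1

theorem q_of_mem {n : ℕ} {g : Br} (hg : g ∈ Bn n) : q n g = QuotientGroup.mk ⟨g, hg⟩ :=
  dif_pos hg

theorem homOn_q (n : ℕ) : HomOn (Bn n) (q n) := fun g hg h hh => by
  rw [q_of_mem hg, q_of_mem hh, q_of_mem (mul_mem hg hh)]; rfl

theorem exists_q {n : ℕ} (x : Qn n) : ∃ g ∈ Bn n, q n g = x := by
  obtain ⟨⟨g, hg⟩, rfl⟩ := QuotientGroup.mk_surjective x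
  exact ⟨g, hg, q_of_mem hg⟩

theorem central_iff_mem_center {n : ℕ} {g : Br} (hg : g ∈ Bn n) :
    Central n g ↔ (⟨g, hg⟩ : Bn n) ∈ Subgroup.center (Bn n) := by
  rw [Subgroup.mem_center_iff]
  exact ⟨fun h x => Subtype.ext (h.2 x x.2).symm,
    fun h => ⟨hg, fun x hx => (congrArg Subtype.val (h ⟨x, hx⟩)).symm⟩⟩

theorem q_eq_one_iff {n : ℕ} {g : Br} (hg : g ∈ Bn n) : q n g = 1 ↔ Central n g := by
  rw [q_of_mem hg, QuotientGroup.eq_one_iff, central_iff_mem_center hg]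

theorem q_eq_iff {n : ℕ} {g h : Br} (hg : g ∈ Bn n) (hh : h ∈ Bn n) :
    q n g = q n h ↔ Central n (g * h⁻¹) := by
  rw [← q_eq_one_iff (mul_mem hg (inv_mem hh)), homOn_q n g hg _ (inv_mem hh), (homOn_q n).inv hh,
    mul_inv_eq_one]

theorem q_T (n : ℕ) : q n (T n) = 1 := (q_eq_one_iff (T_mem n)).2 (central_T n)

theorem encFam_mem' {m i : ℕ} (hi : i ≤ m) : encFam m i ∈ Bn (m + 1) :=
  encFam_mem m (m - i) i (by omega)

theorem q_enc_retr {m : ℕ} {f : FreeGroup ℕ} (hf : f ∈ Fr (m + 1)) :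
    q (m + 1) (enc m f) = q (m + 1) (enc m (retr m f)) :=
  (q_eq_iff (enc_mem hf) (enc_mem (Fr_mono (by omega) (retr_mem hf)))).2 (central_enc_retr hf)

/-- A homomorphism to the quotient fixing the images of the strand-pushing family is the identity. -/
theorem eq_q_of_fix {m : ℕ} (hm : 2 ≤ m) {ρ : Br → Qn (m + 1)} (h : HomOn (Bn (m + 1)) ρ)
    (hfix : ∀ i ≤ m, ρ (encFam m i) = q (m + 1) (encFam m i)) {x : Br} (hx : x ∈ Bn (m + 1)) :
    ρ x = q (m + 1) x := by
  have hq := homOn_q (m + 1)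
  have henc : ∀ f ∈ Fr (m + 1), ρ (enc m f) = q (m + 1) (enc m f) := by
    intro f hf
    rw [(h.comp_hom (f := enc m) (L := Fr (m + 1)) fun _ => enc_mem).eqOn_Fr hf,
      (hq.comp_hom (f := enc m) (L := Fr (m + 1)) fun _ => enc_mem).eqOn_Fr hf]
    exact BraidInj.eqOn_Fr (fun i hi => by simpa using hfix i (by omega)) hf
  obtain ⟨x', hx', e⟩ := exists_q (ρ x)
  have key : ∀ i ≤ m, q (m + 1) (x' * encFam m i * x'⁻¹) = q (m + 1) (x * encFam m i * x⁻¹) := by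
    intro i hi
    have hy := encFam_mem' hi
    have hof := of_mem_Fr (show i < m + 1 by omega)
    have e1 := conj_enc hx hof
    rw [enc_of] at e1
    rw [hq.conj hx' hy, e, ← hfix i hi, ← h.conj hx hy, e1, henc _ (act_mem_Fr hx hof)]
  have hg : x⁻¹ * x' ∈ Bn (m + 1) := mul_mem (inv_mem hx) hx'
  have := centralizer_enc hm hg fun i hi => by
    have hy := encFam_mem' hi
    rw [← q_eq_iff (mul_mem (mul_mem hg hy) (inv_mem hg)) hy]
    have k := key i hi
    rw [hq.conj hx' hy, hq.conj hx hy] at k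
    rw [hq.conj hg hy, hq _ (inv_mem hx) _ hx', hq.inv hx]
    calc _ = (q (m + 1) x)⁻¹ * (q (m + 1) x' * q (m + 1) (encFam m i) * (q (m + 1) x')⁻¹) *
        q (m + 1) x := by group
      _ = _ := by rw [k]; group
  obtain ⟨j, hj⟩ := this
  change T (m + 1) ^ j = x⁻¹ * x' at hj
  rw [← e, q_eq_iff hx' hx]
  have : x' = T (m + 1) ^ j * x := by
    rw [((commute_T hx).symm.zpow_left j).eq, hj]; group
  rw [this, mul_inv_cancel_right]
  exact (central_T _).zpow j

/-- The total exponent. -/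
def tot : FreeGroup ℕ →* Multiplicative ℤ := lift fun _ => Multiplicative.ofAdd 1

@[simp] theorem tot_of (i : ℕ) : tot (of i) = Multiplicative.ofAdd 1 := by simp [tot]

@[simp] theorem tot_D (k : ℕ) : tot (D k) = Multiplicative.ofAdd (k : ℤ) := by
  induction k with
  | zero => simp
  | succ k ih => rw [D_succ, map_mul, ih, tot_of, ← ofAdd_add]; simp

/-- Two elements of order dividing `k` whose product does not have order dividing `k`. -/
theorem exists_torsion_pair {k : ℤ} (hk : 2 ≤ k.natAbs) :
    ∃ a b : Equiv.Perm ℂ, a ^ k = 1 ∧ b ^ k = 1 ∧ (a * b) ^ k ≠ 1 := by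
  have hz := Complex.isPrimitiveRoot_exp k.natAbs (by omega)
  set ζ := Complex.exp (2 * Real.pi * Complex.I / k.natAbs)
  have hz0 : ζ ≠ 0 := hz.ne_zero (by omega)
  have hz1 : ζ - 1 ≠ 0 := sub_ne_zero.2 (hz.ne_one (by omega))
  let a : Equiv.Perm ℂ := Equiv.mulLeft₀ ζ hz0
  let t : Equiv.Perm ℂ := Equiv.addRight 1
  have ha : ∀ j : ℕ, ∀ z, (a ^ j) z = ζ ^ j * z := by
    intro j z
    induction j with
    | zero => simp
    | succ j ih => rw [pow_succ', Equiv.Perm.mul_apply, ih, pow_succ']; simp [a, mul_assoc]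
  have hak : a ^ k = 1 := by
    have h1 : a ^ k.natAbs = 1 := by
      ext1 z; rw [ha, hz.pow_eq_one]; simp
    rcases Int.natAbs_eq k with h | h
    · rw [h, zpow_natCast, h1]
    · rw [h, zpow_neg, zpow_natCast, h1, inv_one]
  have hab : a * (t * a⁻¹ * t⁻¹) = Equiv.addRight (ζ - 1) := by
    ext1 z
    have : ∀ w, a⁻¹ w = ζ⁻¹ * w := fun w => rfl
    have h2 : ∀ w, t⁻¹ w = w + -1 := fun w => rfl
    rw [Equiv.Perm.mul_apply, Equiv.Perm.mul_apply, Equiv.Perm.mul_apply, this, h2]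
    change ζ * (ζ⁻¹ * (z + -1) + 1) = z + (ζ - 1)
    field_simp; ring
  have hadd : ∀ (c : ℂ) (j : ℕ) z, ((Equiv.addRight c : Equiv.Perm ℂ) ^ j) z = z + j * c := by
    intro c j z
    induction j with
    | zero => simp
    | succ j ih => rw [pow_succ', Equiv.Perm.mul_apply, ih]; simp; ring
  refine ⟨a, t * a⁻¹ * t⁻¹, hak, ?_, ?_⟩
  · rw [conj_zpow, inv_zpow, hak]; group
  · rw [hab]
    intro h
    have h1 : (Equiv.addRight (ζ - 1) : Equiv.Perm ℂ) ^ k.natAbs = 1 := by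
      rcases Int.natAbs_eq k with e | e
      · rw [e, zpow_natCast] at h; exact h
      · rw [e, zpow_neg, zpow_natCast, inv_eq_one] at h; exact h
    have h2 := congrArg (fun f : Equiv.Perm ℂ => f 0) h1
    simp only [hadd, zero_add, Equiv.Perm.one_apply] at h2
    rcases mul_eq_zero.1 h2 with h3 | h3
    · have : k.natAbs = 0 := by exact_mod_cast h3
      omega
    · exact hz1 h3

/-- A product of conjugates of `k`-th powers of letters is a `k`-th power of `D m` only if `k` is
trivial. -/
theorem eq_one_or_of_lift_eq {m : ℕ} (hm : 2 ≤ m) {k : ℤ} (hk : k ≠ 0) {φ u : ℕ → FreeGroup ℕ}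
    {p : ℕ → ℕ} (hφ : ∀ i < m, φ i = u i * of (p i) ^ k * (u i)⁻¹)
    (h : lift φ (D m) = D m ^ k) : k = 1 ∨ k = -1 := by
  by_contra hcon
  obtain ⟨a, b, ha, hb, hab⟩ := exists_torsion_pair (k := k) (by omega)
  let f : FreeGroup ℕ →* Equiv.Perm ℂ := lift fun i => if i = 0 then a else if i = 1 then b else 1
  have hf : ∀ i, f (of i) ^ k = 1 := by
    intro i
    simp only [f, FreeGroup.lift_apply_of]
    split_ifs <;> simp [ha, hb]
  have h1 : f (lift φ (D m)) = 1 := by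
    rw [← MonoidHom.comp_apply, eqOn_Fr (f' := 1) (fun i hi => ?_) (D_mem_Fr m)]
    · simp
    · simp [hφ i hi, hf (p i)]
  have h2 : ∀ j, 2 ≤ j → f (D j) = a * b := by
    intro j hj
    induction j, hj using Nat.le_induction with
    | base => simp [D_succ, f]
    | succ j hj ih =>
      rw [D_succ, map_mul, ih]
      simp [f, show j ≠ 0 by omega, show j ≠ 1 by omega]
  rw [h, map_zpow, h2 m hm] at h1
  exact hab h1

theorem mirror_J (k : ℕ) : mirror (J k) = (J k)⁻¹ := by
  induction k with
  | zero => simp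
  | succ k ih => rw [J_succ, map_mul, map_mul, ih, mirror_σ]; group

theorem mirror_T (k : ℕ) : mirror (T k) = (T k)⁻¹ := by
  induction k with
  | zero => simp [T]
  | succ k ih => rw [T_succ, map_mul, ih, mirror_J, ← mul_inv_rev, (commute_J_T k).eq]

theorem exists_perm_eq {m : ℕ} : ∀ d i, i + d = m → ∃ c ∈ Bn (m + 1),
    c * J m * c⁻¹ = encFam m i := by
  intro d
  induction d with
  | zero => exact fun i hi => ⟨1, one_mem _, by
      have : i = m := by omega
      rw [this, encFam_last]; group⟩
  | succ d ih =>
    intro i hi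
    obtain ⟨c, hc, e⟩ := ih (i + 1) (by omega)
    refine ⟨σ i * c, mul_mem (σ_mem (by omega)) hc, ?_⟩
    rw [encFam_rec (by omega), ← e]; group

theorem q_J (m : ℕ) : q (m + 1) (J m) = (q (m + 1) (T m))⁻¹ := by
  have h := q_T (m + 1)
  rw [T_succ, homOn_q _ _ (gens_mono (by omega) (T_mem m)) _ (J_mem m)] at h
  exact eq_inv_of_mul_eq_one_right h

theorem finish_aux {m : ℕ} (hm : 2 ≤ m) {ρ : Br → Qn (m + 1)} (h : HomOn (Bn (m + 1)) ρ)
    {k : ℤ} (hk : k ≠ 0) (hJ : ρ (J m) = q (m + 1) (J m) ^ k)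
    (hD : ρ (enc m (D (m + 1))) = 1) :
    (k = 1 ∨ k = -1) ∧ (k = 1 → ∃ b ∈ Bn (m + 1), ∀ x ∈ Bn (m + 1),
      ρ x = q (m + 1) (b * x * b⁻¹)) := by
  have hq := homOn_q (m + 1)
  have hle : Bn m ≤ Bn (m + 1) := gens_mono (by omega)
  have hFle : Fr m ≤ Fr (m + 1) := Fr_mono (by omega)
  have key : ∀ i ≤ m, ∃ u v : FreeGroup ℕ, ∃ p ≤ m, v ∈ Fr m ∧
      v = u * retr m (of p) ^ k * u⁻¹ ∧ ρ (encFam m i) = q (m + 1) (enc m v) := by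
    intro i hi
    obtain ⟨c, hc, e⟩ := exists_perm_eq (m - i) i (show _ = m by omega)
    obtain ⟨g, hg, eg⟩ := exists_q (ρ c)
    obtain ⟨w, hw⟩ := act_of_conj g m
    have hom := of_mem_Fr (show m < m + 1 by omega)
    have hv := act_mem_Fr hg (zpow_mem hom k)
    refine ⟨retr m w, retr m (act g (of m ^ k)), perm g m, ?_, retr_mem hv, ?_, ?_⟩
    · have := (perm_lt_iff hg m).2 (by omega); omega
    · rw [map_zpow, hw]; simp only [map_zpow, map_mul, map_inv, conj_zpow]
    · rw [← q_enc_retr hv, ← conj_enc hg (zpow_mem hom k), hq.conj hg (enc_mem (zpow_mem hom k)),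
        map_zpow, hq.zpow (enc_mem hom), enc_of, encFam_last, ← hJ, eg, ← h.conj hc (J_mem m), e]
  choose! u φ p hp hφm hφ hρ using key
  have hqenc : HomOn (Fr (m + 1)) fun f => q (m + 1) (enc m f) := hq.comp_hom fun _ => enc_mem
  have hqe : ∀ f ∈ Fr m, lift (fun i => ρ (encFam m i)) f = q (m + 1) (enc m (lift φ f)) := by
    intro f hf
    have hmem : ∀ f ∈ Fr m, lift φ f ∈ Fr (m + 1) := fun f hf =>
      hFle (map_Fr_le (fun i hi => by simpa using hφm i (by omega)) hf)
    rw [(hqenc.comp_hom (f := lift φ) (L := Fr m) hmem).eqOn_Fr hf]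
    exact eqOn_Fr (fun i hi => by simpa using hρ i (by omega)) hf
  have hprod : lift φ (D m) = D m ^ k := by
    have h1 := (h.comp_hom (f := enc m) (L := Fr (m + 1)) fun _ => enc_mem).eqOn_Fr
      (D_mem_Fr (m + 1))
    simp only [enc_of] at h1
    rw [hD, D_succ, map_mul, FreeGroup.lift_apply_of, encFam_last, hJ, hqe _ (D_mem_Fr m)] at h1
    have hφD : lift φ (D m) ∈ Fr m :=
      map_Fr_le (fun i hi => by simpa using hφm i (by omega)) (D_mem_Fr m)
    refine eq_of_central_enc hm hφD (zpow_mem (D_mem_Fr m) k) ?_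
    rw [← q_eq_iff (enc_mem (hFle hφD)) (enc_mem (hFle (zpow_mem (D_mem_Fr m) k)))]
    have h2 : q (m + 1) (enc m (D m)) = (q (m + 1) (J m))⁻¹ := by
      have := (q_eq_one_iff (enc_mem (D_mem_Fr (m + 1)))).2 (central_enc_D m)
      rw [enc_D_eq, hq _ (enc_mem (hFle (D_mem_Fr m))) _ (J_mem m)] at this
      exact eq_inv_of_mul_eq_one_left this
    rw [map_zpow, hq.zpow (enc_mem (hFle (D_mem_Fr m))), h2, inv_zpow]
    exact eq_inv_of_mul_eq_one_left h1.symm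
  have hpm : ∀ i < m, p i < m := by
    have ht : ∀ i < m, tot (φ i) = Multiplicative.ofAdd
        (k - if p i = m then k * (m + 1) else 0) := by
      intro i hi
      rw [hφ i (by omega), map_mul, map_mul, map_inv, mul_inv_cancel_comm, map_zpow]
      by_cases h : p i = m
      · rw [h, retr_self, map_inv, tot_D, ← ofAdd_neg, ← ofAdd_zsmul]
        congr 1; simp; ring
      · rw [retr_of_ne h, tot_of, ← ofAdd_zsmul, if_neg h]; simp
    have hs : ∀ j ≤ m, tot (lift φ (D j)) = Multiplicative.ofAdd
        (j * k - k * (m + 1) * ((Finset.range j).filter fun i => p i = m).card) := by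
      intro j
      induction j with
      | zero => simp
      | succ j ih =>
        intro hj
        rw [D_succ, map_mul, map_mul, ih (by omega), FreeGroup.lift_apply_of, ht j (by omega),
          ← ofAdd_add, Finset.range_add_one, Finset.filter_insert]
        split_ifs with h
        · rw [Finset.card_insert_of_notMem (by simp)]
          congr 1; push_cast; ring
        · congr 1; push_cast; ring
    have h1 := hs m le_rfl
    rw [hprod, map_zpow, tot_D, ← ofAdd_zsmul, smul_eq_mul, Multiplicative.ofAdd.injective.eq_iff]
      at h1
    have h2 : k * ((m + 1 : ℤ) * ((Finset.range m).filter fun i => p i = m).card) = 0 := by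
      linarith
    rw [mul_eq_zero, mul_eq_zero] at h2
    have h3 : ((Finset.range m).filter fun i => p i = m).card = 0 := by
      rcases h2 with h2 | h2 | h2
      · exact absurd h2 hk
      · omega
      · exact_mod_cast h2
    intro i hi
    have := Finset.filter_eq_empty_iff.1 (Finset.card_eq_zero.1 h3) (Finset.mem_range.2 hi)
    have := hp i (by omega)
    omega
  have hφ' : ∀ i < m, φ i = u i * of (p i) ^ k * (u i)⁻¹ := fun i hi => by
    rw [hφ i (by omega), retr_of_ne (hpm i hi).ne]
  refine ⟨eq_one_or_of_lift_eq hm hk hφ' hprod, ?_⟩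
  rintro rfl
  simp only [zpow_one] at hφ' hprod hJ
  obtain ⟨b, hb, hbφ⟩ := exists_braid_of_conj (m := m) _ u p ((eqOn_Fr (f' := lift φ)
    (fun i hi => by simp [hφ' i hi]) (D_mem_Fr m)).trans hprod) rfl
  refine ⟨b, hle hb, fun x hx => ?_⟩
  have hb' := inv_mem (hle hb)
  have := eq_q_of_fix hm (h.conjBy (q (m + 1) b⁻¹)) (fun i hi => ?_) hx
  · rw [hq.conj (hle hb) hx, ← this, hq.inv (hle hb)]; group
  · rw [hq.inv (hle hb)]
    rcases Nat.lt_or_ge i m with him | him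
    · rw [hρ i hi, hφ' i him, hbφ i him, ← conj_enc (hle hb) (of_mem_Fr (by omega)), enc_of,
        hq.conj (hle hb) (encFam_mem' hi)]
      group
    · obtain rfl : i = m := by omega
      rw [encFam_last, hJ, ← hq.inv (hle hb), ← hq.inv hb', ← hq _ hb' _ (J_mem i),
        ← hq _ (mul_mem hb' (J_mem i)) _ (inv_mem hb'), inv_inv]
      congr 1
      rw [mul_assoc, ← (commute_J hb).eq]; group

/-- A homomorphism sending the twist `T m` to a conjugate of a nontrivial power of it is geometric. -/
theorem finish {m : ℕ} (hm : 2 ≤ m) {ρ : Br → Qn (m + 1)} (h : HomOn (Bn (m + 1)) ρ)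
    {k : ℤ} (hk : k ≠ 0) (hT : ρ (T (m + 1)) = 1) {g : Qn (m + 1)}
    (hTm : ρ (T m) = g * q (m + 1) (T m) ^ k * g⁻¹) :
    ∃ b : Qn (m + 1), (∀ x ∈ Bn (m + 1), ρ x = b * q (m + 1) x * b⁻¹) ∨
      ∀ x ∈ Bn (m + 1), ρ x = b * q (m + 1) (mirror x) * b⁻¹ := by
  have hq := homOn_q (m + 1)
  have hTm' : T m ∈ Bn (m + 1) := gens_mono (by omega) (T_mem m)
  have hρJ : ρ (J m) = (ρ (T m))⁻¹ := by
    rw [T_succ, h _ hTm' _ (J_mem m)] at hT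
    exact eq_inv_of_mul_eq_one_right hT
  have hD : ∀ ρ' : Br → Qn (m + 1), HomOn (Bn (m + 1)) ρ' → ρ' (T (m + 1)) = 1 →
      ρ' (enc m (D (m + 1))) = 1 := by
    intro ρ' h' hT'
    obtain ⟨j, hj⟩ := (central_enc_D m).mem_zpowers (by omega)
    change T (m + 1) ^ j = _ at hj
    rw [← hj, h'.zpow (T_mem _), hT', one_zpow]
  have hJ : g⁻¹ * ρ (J m) * g = q (m + 1) (J m) ^ k := by
    rw [hρJ, hTm, q_J, inv_zpow]; group
  have h1 := h.conjBy g⁻¹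
  rw [inv_inv] at h1
  obtain ⟨hk1, hc⟩ := finish_aux hm h1 hk hJ (hD _ h1 (by simp [hT]))
  rcases hk1 with rfl | rfl
  · obtain ⟨b, hb, hx⟩ := hc rfl
    refine ⟨g * q (m + 1) b, .inl fun x hx' => ?_⟩
    have := hx x hx'
    rw [hq.conj hb hx'] at this
    calc ρ x = g * (g⁻¹ * ρ x * g) * g⁻¹ := by group
      _ = _ := by rw [this]; group
  · have h2 := h1.comp_hom (f := mirror) (L := Bn (m + 1)) fun _ => mirror_mem
    have hJ2 : g⁻¹ * ρ (mirror (J m)) * g = q (m + 1) (J m) ^ (1 : ℤ) := by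
      rw [mirror_J, h.inv (J_mem m), zpow_one]
      calc _ = (g⁻¹ * ρ (J m) * g)⁻¹ := by group
        _ = _ := by rw [hJ]; group
    obtain ⟨-, hc⟩ := finish_aux hm h2 one_ne_zero hJ2 (hD _ h2 (by
      rw [mirror_T, h.inv (T_mem _), hT]; simp))
    obtain ⟨b, hb, hx⟩ := hc rfl
    refine ⟨g * q (m + 1) b, .inr fun x hx' => ?_⟩
    have := hx _ (mirror_mem hx')
    rw [hq.conj hb (mirror_mem hx'), mirror_mirror] at this
    calc ρ x = g * (g⁻¹ * ρ x * g) * g⁻¹ := by group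
      _ = _ := by rw [this]; group

end BraidInj

namespace BraidInj

open FreeGroup (of lift norm)

section words

variable {α : Type*} [DecidableEq α]

/-- The elements of the free group whose letters lie in a given set. -/
def lettersIn (S : Set α) : Subgroup (FreeGroup α) where
  carrier := {f | ∀ x ∈ f.toWord, x.1 ∈ S}
  one_mem' := by simp
  mul_mem' {f g} hf hg x hx := by
    rcases List.mem_append.1 ((FreeGroup.toWord_mul_sublist f g).subset hx) with h | h
    · exact hf x h
    · exact hg x h
  inv_mem' {f} hf x hx := by
    rw [FreeGroup.toWord_inv, FreeGroup.invRev] at hx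
    simp only [List.mem_reverse, List.mem_map] at hx
    obtain ⟨y, hy, rfl⟩ := hx
    exact hf y hy

theorem of_mem_lettersIn {S : Set α} {a : α} (h : a ∈ S) : of a ∈ lettersIn S := by
  intro x hx
  rw [FreeGroup.toWord_of, List.mem_singleton] at hx
  rw [hx]; exact h

theorem norm_mul_of_disjoint {S S' : Set α} (h : Disjoint S S') {u v : FreeGroup α}
    (hu : u ∈ lettersIn S) (hv : v ∈ lettersIn S') : norm (u * v) = norm u + norm v := by
  rw [norm_mul_eq_iff]
  refine (FreeGroup.isReduced_toWord).append FreeGroup.isReduced_toWord fun x hx y hy hxy => ?_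
  exact absurd (hu x (List.mem_of_getLast? hx))
    (hxy ▸ Set.disjoint_right.1 h (hv y (List.mem_of_head? hy)))

end words

theorem Fr_le_lettersIn (k : ℕ) : Fr k ≤ lettersIn {i | i < k} :=
  Fr_le.2 fun _ hi => of_mem_lettersIn hi

theorem finite_norm_le (k C : ℕ) : {f | f ∈ Fr k ∧ norm f ≤ C}.Finite := by
  refine ((List.finite_length_le (Fin k × Bool) C).image fun l =>
    FreeGroup.mk (l.map fun x => (x.1.1, x.2))).subset ?_
  rintro f ⟨hf, hC⟩
  have : ∃ l : List (Fin k × Bool), l.map (fun x => (x.1.1, x.2)) = f.toWord := by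
    have hl := Fr_le_lettersIn k hf
    change ∀ x ∈ f.toWord, x.1 < k at hl
    refine ⟨f.toWord.pmap (fun x hx => (⟨x.1, hx⟩, x.2)) hl, ?_⟩
    rw [List.map_pmap]; simp
  obtain ⟨l, hl⟩ := this
  refine ⟨l, ?_, by simp [hl, FreeGroup.mk_toWord]⟩
  change l.length ≤ C
  have := congrArg List.length hl
  rw [List.length_map] at this
  rw [this]; exact hC

/-- The alternating product attached to a list of syllables. -/
def syl (k : ℕ) (L : List (FreeGroup ℕ × ℤ)) : FreeGroup ℕ :=
  (L.map fun x => x.1 * of k ^ x.2).prod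

/-- All syllables are nontrivial. -/
def GoodSyl (k : ℕ) (L : List (FreeGroup ℕ × ℤ)) : Prop :=
  ∀ x ∈ L, x.1 ∈ Fr k ∧ x.1 ≠ 1 ∧ x.2 ≠ 0

theorem syl_cons (k : ℕ) (x : FreeGroup ℕ × ℤ) (L : List (FreeGroup ℕ × ℤ)) :
    syl k (x :: L) = x.1 * of k ^ x.2 * syl k L := by simp [syl]

theorem syl_append (k : ℕ) (L M : List (FreeGroup ℕ × ℤ)) :
    syl k (L ++ M) = syl k L * syl k M := by simp [syl]

/-- The total length of the syllables. -/
def sylLen (k : ℕ) (L : List (FreeGroup ℕ × ℤ)) : ℕ :=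
  (L.map fun x => FreeGroup.norm x.1 + FreeGroup.norm (of k ^ x.2)).sum

theorem norm_syl_aux (k : ℕ) (L : List (FreeGroup ℕ × ℤ)) (hL : GoodSyl k L) :
    norm (syl k L) = sylLen k L ∧ ∀ e : ℤ,
      norm (of k ^ e * syl k L) = norm (of k ^ e) + norm (syl k L) := by
  have hd : Disjoint {i | i < k} {k} := by
    rw [Set.disjoint_singleton_right]; simp
  have ht : ∀ e : ℤ, of k ^ e ∈ lettersIn {k} := fun e =>
    zpow_mem (of_mem_lettersIn (Set.mem_singleton k)) e
  induction L with
  | nil => exact ⟨rfl, fun e => by simp [syl]⟩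
  | cons x L ih =>
    obtain ⟨i1, i2⟩ := ih fun y hy => hL y (List.mem_cons_of_mem _ hy)
    obtain ⟨h1, h2, h3⟩ := hL x List.mem_cons_self
    have hx := Fr_le_lettersIn k h1
    have hne : of k ^ x.2 ≠ 1 := by
      intro h
      exact h3 (zpow_of_injective k (by simpa using h))
    have n1 : norm (syl k (x :: L)) = norm x.1 + norm (of k ^ x.2) + norm (syl k L) := by
      rw [syl_cons, norm_overlap hne (norm_mul_of_disjoint hd hx (ht _)) (i2 _)]
    refine ⟨by rw [n1, i1]; simp [sylLen], fun e => ?_⟩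
    have e1 : norm (x.1 * (of k ^ x.2 * syl k L)) = norm x.1 + norm (of k ^ x.2 * syl k L) := by
      rw [← mul_assoc, ← syl_cons, n1, i2, add_assoc]
    rw [syl_cons, mul_assoc, ← mul_assoc (of k ^ e),
      norm_overlap h2 (norm_mul_of_disjoint hd.symm (ht _) hx) e1, e1, add_assoc]

theorem norm_syl {k : ℕ} {L : List (FreeGroup ℕ × ℤ)} (hL : GoodSyl k L) :
    norm (syl k L) = sylLen k L := (norm_syl_aux k L hL).1

theorem norm_syl_pow {k : ℕ} {L : List (FreeGroup ℕ × ℤ)} (hL : GoodSyl k L) (N : ℕ) :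
    norm (syl k L ^ N) = N * norm (syl k L) := by
  have : ∀ N : ℕ, ∃ M, GoodSyl k M ∧ syl k M = syl k L ^ N ∧ sylLen k M = N * sylLen k L := by
    intro N
    induction N with
    | zero => exact ⟨[], by simp [GoodSyl], by simp [syl], by simp [sylLen]⟩
    | succ N ih =>
      obtain ⟨M, h1, h2, h3⟩ := ih
      refine ⟨M ++ L, fun x hx => (List.mem_append.1 hx).elim (h1 x) (hL x), ?_, ?_⟩
      · rw [syl_append, h2, pow_succ]
      · rw [add_mul, ← h3]; simp [sylLen]
  obtain ⟨M, h1, h2, h3⟩ := this N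
  rw [← h2, norm_syl h1, h3, norm_syl hL]

/-- Elements whose powers have additive length are shortest in their conjugacy class. -/
theorem norm_le_of_isConj {u w : FreeGroup ℕ} (hu : ∀ N : ℕ, norm (u ^ N) = N * norm u)
    (h : IsConj w u) : norm u ≤ norm w := by
  obtain ⟨c, rfl⟩ := isConj_iff.1 h
  by_contra hlt
  have h1 : ∀ N : ℕ, norm (w ^ N) ≤ N * norm w := by
    intro N
    induction N with
    | zero => simp
    | succ N ih =>
      have := FreeGroup.norm_mul_le (w ^ N) w
      rw [pow_succ, add_mul, one_mul]; omega
  set N := 2 * norm c + 1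
  have h2 := hu N
  rw [conj_pow] at h2
  have h3 := FreeGroup.norm_mul_le (c * w ^ N) c⁻¹
  have h4 := FreeGroup.norm_mul_le c (w ^ N)
  rw [FreeGroup.norm_inv_eq] at h3
  have h5 := h1 N
  have h6 : N * (norm w + 1) ≤ N * norm (c * w * c⁻¹) := Nat.mul_le_mul le_rfl (by omega)
  rw [mul_add] at h6
  omega

theorem isConj_syl_rotate (k : ℕ) (L M : List (FreeGroup ℕ × ℤ)) :
    IsConj (syl k (L ++ M)) (syl k (M ++ L)) :=
  isConj_iff.2 ⟨syl k M, by rw [syl_append, syl_append]; group⟩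

/-- Every element of `Fr (k + 1)` is conjugate to an alternating product in normal form. -/
theorem exists_goodSyl {k : ℕ} {w : FreeGroup ℕ} (hw : w ∈ Fr (k + 1)) :
    (∃ a ∈ Fr k, IsConj w a) ∨ (∃ e : ℤ, IsConj w (of k ^ e)) ∨
      ∃ L, GoodSyl k L ∧ IsConj w (syl k L) := by
  have hsyl : ∃ L : List (FreeGroup ℕ × ℤ), (∀ x ∈ L, x.1 ∈ Fr k) ∧ w = syl k L := by
    have hlet : ∀ i < k + 1, ∃ L : List (FreeGroup ℕ × ℤ), (∀ x ∈ L, x.1 ∈ Fr k) ∧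
        of i = syl k L := by
      intro i hi
      rcases Nat.lt_or_ge i k with h | h
      · exact ⟨[(of i, 0)], by simpa using of_mem_Fr h, by simp [syl]⟩
      · obtain rfl : i = k := by omega
        exact ⟨[(1, 1)], by simp [one_mem], by simp [syl]⟩
    refine Fr_induction (p := fun w => ∃ L : List (FreeGroup ℕ × ℤ), (∀ x ∈ L, x.1 ∈ Fr k) ∧
      w = syl k L) hlet ⟨[], by simp, rfl⟩ ?_ ?_ hw
    · rintro _ _ ⟨L, hL, rfl⟩ ⟨M, hM, rfl⟩
      exact ⟨L ++ M, fun x hx => (List.mem_append.1 hx).elim (hL x) (hM x),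
        (syl_append _ _ _).symm⟩
    · rintro _ ⟨L, hL, rfl⟩
      induction L with
      | nil => exact ⟨[], by simp, by simp [syl]⟩
      | cons x L ih =>
        obtain ⟨M, hM, e⟩ := ih fun y hy => hL y (List.mem_cons_of_mem _ hy)
        refine ⟨M ++ [(1, -x.2), (x.1⁻¹, 0)], fun y hy => ?_, ?_⟩
        · rcases List.mem_append.1 hy with hy | hy
          · exact hM y hy
          · have := hL x List.mem_cons_self
            simp only [List.mem_cons, List.not_mem_nil, or_false] at hy
            rcases hy with rfl | rfl
            · exact one_mem _
            · exact inv_mem this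
        · rw [syl_cons, syl_append, mul_inv_rev, e]; simp [syl]
  obtain ⟨L, hL, hwL⟩ := hsyl
  have hconj : IsConj w (syl k L) := hwL ▸ IsConj.refl _
  clear hwL
  induction hr : L.length using Nat.strong_induction_on generalizing L with
  | _ r ih =>
  subst hr
  by_cases hgood : GoodSyl k L
  · exact .inr (.inr ⟨L, hgood, hconj⟩)
  rw [GoodSyl] at hgood
  push Not at hgood
  obtain ⟨x, hx, hbad⟩ := hgood
  obtain ⟨L1, L2, rfl⟩ := List.append_of_mem hx
  have hx1 := hL x hx
  have e1 : IsConj w (syl k (x :: (L2 ++ L1))) := hconj.trans (isConj_syl_rotate k L1 (x :: L2))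
  by_cases h0 : L2 ++ L1 = []
  · rw [h0] at e1
    by_cases h1 : x.1 = 1
    · exact .inr (.inl ⟨x.2, by simpa [syl, h1] using e1⟩)
    · exact .inl ⟨x.1, hx1, by simpa [syl, hbad hx1 h1] using e1⟩
  have hmem : ∀ z ∈ L2 ++ L1, z.1 ∈ Fr k := by
    intro z hz
    rw [List.mem_append] at hz
    apply hL z
    simp only [List.mem_append, List.mem_cons]
    tauto
  by_cases h1 : x.1 = 1
  · obtain ⟨L', y, h⟩ := (List.eq_nil_or_concat (L2 ++ L1)).resolve_left h0
    rw [List.concat_eq_append] at h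
    have hlen := congrArg List.length h
    rw [h] at hmem e1
    simp only [List.length_append, List.length_cons, List.length_nil] at hlen
    refine ih _ ?_ (L' ++ [(y.1, y.2 + x.2)]) ?_ ?_ rfl
    · simp only [List.length_append, List.length_cons, List.length_nil]; omega
    · intro z hz
      rcases List.mem_append.1 hz with hz | hz
      · exact hmem z (List.mem_append_left _ hz)
      · rw [List.mem_singleton] at hz
        rw [hz]; exact hmem y (by simp)
    · refine e1.trans (isConj_iff.2 ⟨(of k ^ x.2)⁻¹, ?_⟩)
      have hs : ∀ z : FreeGroup ℕ × ℤ, syl k [z] = z.1 * of k ^ z.2 := fun z => by simp [syl]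
      simp only [syl_cons, syl_append, h1, one_mul, zpow_add, hs]
      group
  · have h2 := hbad hx1 h1
    obtain ⟨y, L', h⟩ := List.exists_cons_of_ne_nil h0
    have hlen := congrArg List.length h
    simp only [List.length_append, List.length_cons] at hlen
    rw [h] at hmem e1
    refine ih _ ?_ ((x.1 * y.1, y.2) :: L') ?_ ?_ rfl
    · simp only [List.length_append, List.length_cons]; omega
    · intro z hz
      rcases List.mem_cons.1 hz with rfl | hz
      · exact mul_mem hx1 (hmem y (by simp))
      · exact hmem z (List.mem_cons_of_mem _ hz)
    · have e2 : syl k ((x.1 * y.1, y.2) :: L') = syl k (x :: y :: L') := by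
        simp [syl_cons, h2, mul_assoc]
      rw [e2]
      exact e1

/-- Elements of the first factor whose conjugates by powers of `P` have bounded length commute
with `P`. -/
theorem commute_of_norm_bounded {k C : ℕ} {a P : FreeGroup ℕ} (ha : a ∈ Fr k) (hP : P ∈ Fr k)
    (hP1 : P ≠ 1) (h : ∀ N : ℕ, norm (P ^ N * a * (P ^ N)⁻¹) ≤ C) : Commute a P := by
  have hmaps : ∀ N ∈ (Set.univ : Set ℕ), P ^ N * a * (P ^ N)⁻¹ ∈ {f | f ∈ Fr k ∧ norm f ≤ C} :=
    fun N _ => ⟨mul_mem (mul_mem (pow_mem hP N) ha) (inv_mem (pow_mem hP N)), h N⟩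
  obtain ⟨i, -, j, -, hij, e⟩ := Set.infinite_univ.exists_lt_map_eq_of_mapsTo hmaps
    (finite_norm_le k C)
  obtain ⟨d, rfl⟩ := Nat.exists_eq_add_of_lt hij
  have hd : P ^ (d + 1) ≠ 1 := fun hd => hP1 (by simpa using hd)
  refine commute_trans hd ?_ ((Commute.refl P).pow_right _)
  rw [add_assoc, pow_add] at e
  have e2 : a = P ^ (d + 1) * a * (P ^ (d + 1))⁻¹ := by
    calc a = (P ^ i)⁻¹ * (P ^ i * a * (P ^ i)⁻¹) * P ^ i := by group
      _ = _ := by rw [e]; group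
  exact (mul_inv_eq_iff_eq_mul.1 e2.symm).symm

/-- The braid shifting the letters. -/
def shiftBraid : ℕ → Br
  | 0 => 1
  | k + 1 => shiftBraid k * (σ k)⁻¹

theorem act_inv_σ_self (i : ℕ) : act (σ i)⁻¹ (of i) = of (i + 1) := by
  rw [← inv_act_apply (σ i) (of (i + 1)), act_σ, artin_succ]

theorem act_inv_σ_of_ne {i j : ℕ} (h1 : j ≠ i) (h2 : j ≠ i + 1) :
    act (σ i)⁻¹ (of j) = of j := by
  conv_rhs => rw [← inv_act_apply (σ i) (of j), act_σ, artin_of_ne h1 h2]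

theorem shiftBraid_mem (k : ℕ) : shiftBraid k ∈ Bn (k + 1) := by
  induction k with
  | zero => exact one_mem _
  | succ k ih => exact mul_mem (gens_mono (by omega) ih) (inv_mem (σ_mem (by omega)))

theorem act_shiftBraid (k : ℕ) : ∀ i < k, act (shiftBraid k) (of i) = of (i + 1) := by
  induction k with
  | zero => omega
  | succ k ih =>
    intro i hi
    rw [shiftBraid, map_mul, MulAut.mul_apply]
    rcases Nat.lt_or_ge i k with h | h
    · rw [act_inv_σ_of_ne (by omega) (by omega), ih i h]
    · obtain rfl : i = k := by omega
      rw [act_inv_σ_self, act_of_le (by omega) (shiftBraid_mem i)]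

theorem isConj_hom {G H : Type*} [Group G] [Group H] (f : G →* H) {a b : G} (h : IsConj a b) :
    IsConj (f a) (f b) := f.map_isConj h

theorem isConj_kill_of_isConj_Fr {k : ℕ} {w a : FreeGroup ℕ} (hw : w ∈ Fr (k + 1))
    (h : ∀ g ∈ Bn (k + 1), IsConj w (act g w)) (ha : a ∈ Fr k) (hwa : IsConj w a) : w = 1 := by
  have key : ∀ d i, i + d = k → IsConj w (kill i w) := by
    intro d
    induction d with
    | zero =>
      rintro i hi
      have hi : i = k := by omega
      have := isConj_hom (kill k) hwa
      rw [kill_of_mem_Fr ha] at this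
      rw [hi]; exact hwa.trans this.symm
    | succ d ih =>
      intro i hi
      have h1 := ih (i + 1) (by omega)
      have h2 : kill i (act (σ i)⁻¹ (kill (i + 1) w)) = act (σ i)⁻¹ (kill (i + 1) w) := by
        have : ((kill i).comp (act (σ i)⁻¹).toMonoidHom).comp (kill (i + 1)) =
            (act (σ i)⁻¹).toMonoidHom.comp (kill (i + 1)) := by
          refine FreeGroup.ext_hom _ _ fun j => ?_
          simp only [MonoidHom.comp_apply, MulEquiv.coe_toMonoidHom]
          by_cases hj : j = i + 1
          · rw [hj, kill_self, map_one, map_one]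
          · rw [kill_of_ne hj]
            by_cases hj' : j = i
            · rw [hj', act_inv_σ_self, kill_of_ne (by omega)]
            · rw [act_inv_σ_of_ne hj' hj, kill_of_ne hj']
        exact DFunLike.congr_fun this w
      have h3 : IsConj w (act (σ i)⁻¹ (kill (i + 1) w)) :=
        (h _ (inv_mem (σ_mem (by omega)))).trans (isConj_hom (act (σ i)⁻¹).toMonoidHom h1)
      have h4 := isConj_hom (kill i) h3
      rw [h2] at h4
      exact h3.trans h4.symm
  have hall : ∀ j ≤ k + 1, IsConj w (lift (fun i => if i < j then 1 else of i) w) := by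
    intro j
    induction j with
    | zero =>
      intro _
      have : lift (fun i => if i < 0 then 1 else of i) = MonoidHom.id (FreeGroup ℕ) :=
        FreeGroup.ext_hom _ _ fun i => by simp
      rw [this]
      exact IsConj.refl _
    | succ j ih =>
      intro hj
      refine (key (k - j) j (by omega)).trans ?_
      have : lift (fun i => if i < j + 1 then 1 else of i) =
          (kill j).comp (lift (fun i => if i < j then (1 : FreeGroup ℕ) else of i)) := by
        refine FreeGroup.ext_hom _ _ fun i => ?_
        simp only [MonoidHom.comp_apply, FreeGroup.lift_apply_of]
        rcases lt_trichotomy i j with h | rfl | h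
        · rw [if_pos (by omega), if_pos h, map_one]
        · rw [if_pos (by omega), if_neg (by omega), kill_self]
        · rw [if_neg (by omega), if_neg (by omega), kill_of_ne (by omega)]
      rw [this]
      exact isConj_hom (kill j) (ih (by omega))
  have h1 : lift (fun i => if i < k + 1 then 1 else of i) w = (1 : FreeGroup ℕ) :=
    eqOn_Fr (f' := 1) (fun i hi => by
      rw [FreeGroup.lift_apply_of, if_pos hi, MonoidHom.one_apply]) hw
  have := hall (k + 1) le_rfl
  rw [h1] at this
  exact isConj_one_left.1 this

theorem lift_mem_zpowers {G : Type*} [Group G] {r : G} {f : ℕ → G}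
    (h : ∀ i, f i ∈ Subgroup.zpowers r) (V : FreeGroup ℕ) : lift f V ∈ Subgroup.zpowers r :=
  FreeGroup.range_lift_le (by rintro _ ⟨i, rfl⟩; exact h i) ⟨V, rfl⟩

theorem isConj_pair_of_isConj {k : ℕ} (hk : 0 < k) {w : FreeGroup ℕ} (hw : w ∈ Fr (k + 1))
    (h : ∀ g ∈ Bn (k + 1), IsConj w (act g w)) :
    ∃ V : FreeGroup ℕ, IsConj w (lift (fun j => if j = 0 then D k else of k) V) := by
  rcases exists_goodSyl hw with ⟨a, ha, hwa⟩ | ⟨e, he⟩ | ⟨L, hL, hwL⟩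
  · exact ⟨1, by rw [isConj_kill_of_isConj_Fr hw h ha hwa, map_one]⟩
  · exact ⟨of 1 ^ e, by simpa using he⟩
  · have hT : ∀ N : ℕ, IsConj w
        (syl k (L.map fun x => (D k ^ N * x.1 * (D k ^ N)⁻¹, x.2))) := by
      intro N
      have e1 : ∀ f ∈ Fr k, act (T k ^ N) f = D k ^ N * f * (D k ^ N)⁻¹ := by
        intro f hf
        induction N with
        | zero => simp
        | succ N ih =>
          rw [pow_succ', map_mul, MulAut.mul_apply, ih, act_T, pow_succ']
          · group
          · exact mul_mem (mul_mem (pow_mem (D_mem_Fr k) N) hf) (inv_mem (pow_mem (D_mem_Fr k) N))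
      have e2 : act (T k ^ N) (of k) = of k := act_of_le le_rfl (pow_mem (T_mem k) N)
      have e3 : ∀ L : List (FreeGroup ℕ × ℤ), (∀ x ∈ L, x.1 ∈ Fr k) →
          act (T k ^ N) (syl k L) =
            syl k (L.map fun x => (D k ^ N * x.1 * (D k ^ N)⁻¹, x.2)) := by
        intro L hL
        induction L with
        | nil => exact map_one _
        | cons x L ih =>
          rw [List.map_cons, syl_cons, syl_cons, map_mul, map_mul, map_zpow, e2,
            ih fun y hy => hL y (List.mem_cons_of_mem _ hy), e1 _ (hL x List.mem_cons_self)]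
      rw [← e3 L fun x hx => (hL x hx).1]
      exact (h _ (pow_mem (gens_mono (by omega) (T_mem k)) N)).trans
        (isConj_hom (act (T k ^ N)).toMonoidHom hwL)
    have hpow : ∀ x ∈ L, x.1 ∈ Subgroup.zpowers (D k) := by
      intro x hx
      refine mem_zpowers_D hk (commute_of_norm_bounded (C := norm w) (hL x hx).1 (D_mem_Fr k)
        (D_ne_one hk) fun N => ?_)
      have hg : GoodSyl k (L.map fun x => (D k ^ N * x.1 * (D k ^ N)⁻¹, x.2)) := by
        intro y hy
        obtain ⟨z, hz, rfl⟩ := List.mem_map.1 hy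
        obtain ⟨h1, h2, h3⟩ := hL z hz
        refine ⟨mul_mem (mul_mem (pow_mem (D_mem_Fr k) N) h1) (inv_mem (pow_mem (D_mem_Fr k) N)),
          fun h4 => h2 ?_, h3⟩
        exact conj_eq_one_iff.1 h4
      refine le_trans ?_ (norm_le_of_isConj (norm_syl_pow hg) (hT N))
      rw [norm_syl hg, sylLen, List.map_map]
      exact le_trans (Nat.le_add_right _ _) (List.le_sum_of_mem (List.mem_map_of_mem hx))
    have hV : ∀ L : List (FreeGroup ℕ × ℤ), (∀ x ∈ L, x.1 ∈ Subgroup.zpowers (D k)) →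
        ∃ V : FreeGroup ℕ, syl k L = lift (fun j => if j = 0 then D k else of k) V := by
      intro L hL
      induction L with
      | nil => exact ⟨1, (map_one _).symm⟩
      | cons x L ih =>
        obtain ⟨V, hV⟩ := ih fun y hy => hL y (List.mem_cons_of_mem _ hy)
        obtain ⟨c, hc⟩ := hL x List.mem_cons_self
        change D k ^ c = x.1 at hc
        refine ⟨of 0 ^ c * of 1 ^ x.2 * V, ?_⟩
        rw [syl_cons, hV, map_mul, map_mul, map_zpow, map_zpow, FreeGroup.lift_apply_of,
          FreeGroup.lift_apply_of, if_pos rfl, if_neg one_ne_zero, hc]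
    obtain ⟨V, hV⟩ := hV L hpow
    exact ⟨V, hV ▸ hwL⟩

/-- A conjugacy class of the free group of rank at least three which is invariant under the braid
group is the class of a power of the boundary word. -/
theorem isConj_D_zpow {k : ℕ} (hk : 2 ≤ k) {w : FreeGroup ℕ} (hw : w ∈ Fr (k + 1))
    (h : ∀ g ∈ Bn (k + 1), IsConj w (act g w)) : ∃ c : ℤ, IsConj w (D (k + 1) ^ c) := by
  obtain ⟨V, hV⟩ := isConj_pair_of_isConj (by omega) hw h
  set c := shiftBraid k
  let θ : FreeGroup ℕ →* FreeGroup ℕ :=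
    lift fun j => if j = 1 then D k else if j = k then of k else 1
  have hθ : ∀ j, θ (of j) = if j = 1 then D k else if j = k then of k else 1 := fun j => by
    simp only [θ, FreeGroup.lift_apply_of]
  have hP : θ (D k) = D k := by
    have : ∀ d, d + 2 ≤ k → θ (D (d + 2)) = D k := by
      intro d
      induction d with
      | zero =>
        intro _
        rw [zero_add, D_succ, D_succ, D_zero, one_mul, map_mul, hθ, hθ, if_neg (by omega),
          if_neg (by omega), if_pos rfl, one_mul]
      | succ d ih =>
        intro hd
        rw [D_succ, map_mul, ih (by omega), hθ, if_neg (by omega), if_neg (by omega), mul_one]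
    obtain ⟨d, rfl⟩ := Nat.exists_eq_add_of_le' hk
    exact this d le_rfl
  have ht : θ (of k) = of k := by rw [hθ, if_neg (by omega), if_pos rfl]
  have hcP : θ (act c (D k)) = D (k + 1) := by
    have : ∀ d, d + 2 ≤ k → θ (act c (D (d + 1))) = D k := by
      intro d
      induction d with
      | zero =>
        intro _
        rw [zero_add, D_succ, D_zero, one_mul, act_shiftBraid k 0 (by omega), hθ, if_pos rfl]
      | succ d ih =>
        intro hd
        rw [D_succ, map_mul, map_mul, ih (by omega), act_shiftBraid k _ (by omega), hθ,
          if_neg (by omega), if_neg (by omega), mul_one]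
    obtain ⟨d, rfl⟩ := Nat.exists_eq_add_of_le' hk
    have e := this d le_rfl
    rw [D_succ (d + 1), map_mul, map_mul, e, act_shiftBraid _ _ (by omega), ht, ← D_succ]
  have hct : θ (act c (of k)) = 1 := by
    have e := congrArg θ (act_D (shiftBraid_mem k))
    rw [D_succ, map_mul, map_mul, map_mul, hP, ht] at e
    change θ (act c (D k)) * _ = _ at e
    rw [hcP, ← D_succ] at e
    exact mul_eq_left.1 e
  have e1 := isConj_hom θ (hV.symm.trans ((h c (shiftBraid_mem k)).trans
    (isConj_hom (act c).toMonoidHom hV)))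
  have e2 : θ.comp (lift (fun j => if j = 0 then D k else of k)) =
      lift (fun j => if j = 0 then D k else of k) := by
    refine FreeGroup.ext_hom _ _ fun j => ?_
    simp only [MonoidHom.comp_apply, FreeGroup.lift_apply_of]
    split_ifs
    · exact hP
    · exact ht
  have e3 : (θ.comp (act c).toMonoidHom).comp (lift (fun j => if j = 0 then D k else of k)) =
      lift (fun j => if j = 0 then D (k + 1) else 1) := by
    refine FreeGroup.ext_hom _ _ fun j => ?_
    simp only [MonoidHom.comp_apply, FreeGroup.lift_apply_of, MulEquiv.coe_toMonoidHom]
    split_ifs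
    · exact hcP
    · exact hct
  have e2' := DFunLike.congr_fun e2 V
  have e3' := DFunLike.congr_fun e3 V
  simp only [MonoidHom.comp_apply] at e2' e3'
  rw [e2', e3'] at e1
  obtain ⟨z, hz⟩ : lift (fun j => if j = 0 then D (k + 1) else 1) V ∈
      Subgroup.zpowers (D (k + 1)) := lift_mem_zpowers (fun i => by
        split_ifs
        · exact Subgroup.mem_zpowers _
        · exact one_mem _) V
  exact ⟨z, by
    have hz : D (k + 1) ^ z = _ := hz
    rw [hz]; exact hV.trans e1⟩

end BraidInj

namespace BraidInj

open FreeGroup (of lift norm)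

section linking

/-- The indicator of an unordered pair. -/
def pairInd (p q i j : ℕ) : ℤ := if (i = p ∧ j = q) ∨ (i = q ∧ j = p) then 1 else 0

/-- The crossing indicator of the `a`-th generator. -/
def crossing (a i j : ℕ) : ℤ := pairInd a (a + 1) i j

theorem pairInd_swap (a b p q i j : ℕ) :
    pairInd p q (Equiv.swap a b i) (Equiv.swap a b j) =
      pairInd (Equiv.swap a b p) (Equiv.swap a b q) i j := by
  simp only [pairInd, Equiv.swap_apply_eq_iff]

theorem pairInd_comm (p q : ℕ) : pairInd p q = pairInd q p := by
  funext i j; simp only [pairInd, or_comm]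

theorem crossing_swap (a i j : ℕ) :
    crossing a (Equiv.swap a (a + 1) i) (Equiv.swap a (a + 1) j) = crossing a i j := by
  rw [crossing, crossing, pairInd_swap, Equiv.swap_apply_left, Equiv.swap_apply_right,
    pairInd_comm]

/-- The permutation of marked pairs of strands induced by the `a`-th generator. -/
def crossPerm (a : ℕ) : Equiv.Perm (ℕ × ℕ × ℤ) where
  toFun x := (Equiv.swap a (a + 1) x.1, Equiv.swap a (a + 1) x.2.1, x.2.2 + crossing a x.1 x.2.1)
  invFun x := (Equiv.swap a (a + 1) x.1, Equiv.swap a (a + 1) x.2.1, x.2.2 - crossing a x.1 x.2.1)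
  left_inv x := by simp [crossing_swap]
  right_inv x := by simp [crossing_swap]

theorem crossPerm_apply (a i j : ℕ) (x : ℤ) : crossPerm a (i, j, x) =
    (Equiv.swap a (a + 1) i, Equiv.swap a (a + 1) j, x + crossing a i j) := rfl

theorem swap_braid (a i : ℕ) : Equiv.swap a (a + 1) (Equiv.swap (a + 1) (a + 2)
    (Equiv.swap a (a + 1) i)) = Equiv.swap (a + 1) (a + 2) (Equiv.swap a (a + 1)
      (Equiv.swap (a + 1) (a + 2) i)) := by
  simp only [Equiv.swap_apply_def]
  split_ifs <;> omega

/-- The action of braids on marked pairs of strands. -/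
def crossHom : Br →* Equiv.Perm (ℕ × ℕ × ℤ) := Br.hom crossPerm fun _ => by
  constructor
  · intro a _
    refine Equiv.ext fun ⟨i, j, x⟩ => ?_
    simp only [Equiv.Perm.mul_apply, crossPerm_apply, swap_braid, Prod.mk.injEq, true_and]
    simp only [crossing, pairInd_swap]
    have h1 : Equiv.swap a (a + 1) (a + 1 + 1) = a + 2 :=
      Equiv.swap_apply_of_ne_of_ne (by omega) (by omega)
    have h2 : Equiv.swap (a + 1) (a + 2) a = a :=
      Equiv.swap_apply_of_ne_of_ne (by omega) (by omega)
    simp only [add_assoc, Nat.reduceAdd, Equiv.swap_apply_left, Equiv.swap_apply_right, h2] at h1 ⊢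
    have h3 : Equiv.swap (a + 1) (a + 2) (a + 2) = a + 1 := Equiv.swap_apply_right _ _
    rw [h1, h3]
    ring
  · intro a b hab _
    refine Equiv.ext fun ⟨i, j, x⟩ => ?_
    simp only [Equiv.Perm.mul_apply, crossPerm_apply, Prod.mk.injEq]
    refine ⟨?_, ?_, ?_⟩
    · simp only [Equiv.swap_apply_def]; split_ifs <;> omega
    · simp only [Equiv.swap_apply_def]; split_ifs <;> omega
    · have h1 : ∀ i, (i = a ∨ i = a + 1) → Equiv.swap b (b + 1) i = i := fun i hi =>
        Equiv.swap_apply_of_ne_of_ne (by omega) (by omega)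
      have h2 : ∀ i, (i = b ∨ i = b + 1) → Equiv.swap a (a + 1) i = i := fun i hi =>
        Equiv.swap_apply_of_ne_of_ne (by omega) (by omega)
      simp only [crossing, pairInd_swap]
      rw [h1 _ (.inl rfl), h1 _ (.inr rfl), h2 _ (.inl rfl), h2 _ (.inr rfl)]
      ring

/-- The algebraic number of crossings of two strands of a braid. -/
def lk (g : Br) (i j : ℕ) : ℤ := (crossHom g (i, j, 0)).2.2

theorem crossHom_apply (g : Br) : ∀ i j x, crossHom g (i, j, x) =
    (perm g i, perm g j, x + lk g i j) := by
  have : ∀ i j x, (crossHom g (i, j, x)).1 = perm g i ∧ (crossHom g (i, j, x)).2.1 = perm g j ∧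
      ∀ y, (crossHom g (i, j, x + y)).2.2 = (crossHom g (i, j, x)).2.2 + y := by
    induction g using Br.induction with
    | hs a =>
      intro i j x
      simp only [crossHom, Br.hom_σ, crossPerm_apply, perm_σ, true_and]
      intro y; ring
    | h1 => intro i j x; simp
    | hm g h hg hh =>
      intro i j x
      obtain ⟨h1, h2, h3⟩ := hh i j x
      simp only [map_mul, Equiv.Perm.mul_apply]
      obtain ⟨x', hx'⟩ : ∃ x', crossHom h (i, j, x) = (perm h i, perm h j, x') :=
        ⟨_, Prod.ext h1 (Prod.ext h2 rfl)⟩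
      rw [hx'] at h3 ⊢
      refine ⟨(hg _ _ _).1, (hg _ _ _).2.1, fun y => ?_⟩
      have : crossHom h (i, j, x + y) = (perm h i, perm h j, x' + y) :=
        Prod.ext (hh _ _ _).1 (Prod.ext (hh _ _ _).2.1 (h3 y))
      rw [this, (hg _ _ _).2.2]
    | hi g hg =>
      intro i j x
      have key : ∀ i j x, ∃ x', crossHom g⁻¹ (i, j, x) = (perm g⁻¹ i, perm g⁻¹ j, x') ∧
          ∀ y, crossHom g⁻¹ (i, j, x + y) = (perm g⁻¹ i, perm g⁻¹ j, x' + y) := by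
        intro i j x
        have e1 : crossHom g (perm g⁻¹ i, perm g⁻¹ j, 0) =
            (i, j, (crossHom g (perm g⁻¹ i, perm g⁻¹ j, 0)).2.2) :=
          Prod.ext (by rw [(hg _ _ _).1]; simp) (Prod.ext (by rw [(hg _ _ _).2.1]; simp) rfl)
        set r := (crossHom g (perm g⁻¹ i, perm g⁻¹ j, 0)).2.2
        have e2 : ∀ z, crossHom g⁻¹ (i, j, z) = (perm g⁻¹ i, perm g⁻¹ j, z - r) := by
          intro z
          rw [map_inv crossHom, Equiv.Perm.inv_eq_iff_eq]
          refine Prod.ext ?_ (Prod.ext ?_ ?_)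
          · rw [(hg _ _ _).1]; simp
          · rw [(hg _ _ _).2.1]; simp
          · have := (hg (perm g⁻¹ i) (perm g⁻¹ j) 0).2.2 (z - r)
            rw [zero_add] at this
            rw [this]; simp [r]
        exact ⟨x - r, e2 _, fun y => by rw [e2]; congr 2; ring⟩
      obtain ⟨x', h1, h2⟩ := key i j x
      refine ⟨by rw [h1], by rw [h1], fun y => by rw [h1, h2]⟩
  intro i j x
  refine Prod.ext (this i j x).1 (Prod.ext (this i j x).2.1 ?_)
  have := (this i j 0).2.2 x
  rw [zero_add] at this
  rw [this, lk, add_comm]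

theorem lk_mul (g h : Br) (i j : ℕ) : lk (g * h) i j = lk h i j + lk g (perm h i) (perm h j) := by
  have := crossHom_apply (g * h) i j 0
  rw [map_mul, Equiv.Perm.mul_apply, crossHom_apply, crossHom_apply] at this
  simpa using (congrArg (fun x => x.2.2) this).symm

@[simp] theorem lk_one (i j : ℕ) : lk 1 i j = 0 := by simp [lk]

theorem lk_σ (a i j : ℕ) : lk (σ a) i j = crossing a i j := by
  simp [lk, crossHom, crossPerm_apply]

theorem lk_inv (g : Br) (i j : ℕ) : lk g⁻¹ i j = -lk g (perm g⁻¹ i) (perm g⁻¹ j) := by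
  have := lk_mul g g⁻¹ i j
  rw [mul_inv_cancel, lk_one] at this
  omega

theorem lk_symm (g : Br) : ∀ i j, lk g i j = lk g j i := by
  induction g using Br.induction with
  | hs a => intro i j; simp only [lk_σ, crossing, pairInd]; split_ifs <;> omega
  | h1 => intro i j; simp
  | hm g h hg hh => intro i j; rw [lk_mul, lk_mul, hg, hh]
  | hi g hg => intro i j; rw [lk_inv, lk_inv, hg]

theorem even_lk_iff (g : Br) : ∀ i j, i < j → (Even (lk g i j) ↔ perm g i < perm g j) := by
  have sym : ∀ (g : Br), (∀ i j, i < j → (Even (lk g i j) ↔ perm g i < perm g j)) →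
      ∀ i j, i ≠ j → (Even (lk g i j) ↔ (i < j ↔ perm g i < perm g j)) := by
    intro g h i j hij
    rcases lt_or_gt_of_ne hij with h1 | h1
    · rw [h i j h1]; simp [h1]
    · rw [lk_symm, h j i h1]
      have : perm g i ≠ perm g j := fun e => hij ((perm g).injective e)
      omega
  induction g using Br.induction with
  | hs a =>
    intro i j hij
    simp only [lk_σ, crossing, pairInd, perm_σ, Equiv.swap_apply_def]
    split_ifs <;> simp <;> omega
  | h1 => intro i j hij; simp [hij]
  | hm g h hg hh =>
    intro i j hij
    have hne : perm h i ≠ perm h j := fun e => hij.ne ((perm h).injective e)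
    rw [lk_mul, Int.even_add, hh i j hij, sym g hg _ _ hne, map_mul, Equiv.Perm.mul_apply,
      Equiv.Perm.mul_apply]
    tauto
  | hi g hg =>
    intro i j hij
    have hne : perm g⁻¹ i ≠ perm g⁻¹ j := fun e => hij.ne ((perm g⁻¹).injective e)
    have e : ∀ i, perm g (perm g⁻¹ i) = i := fun i => by simp
    rw [lk_inv, even_neg, sym g hg _ _ hne, e, e]
    simp [hij]

theorem lk_mul_of_pure {g h : Br} (hh : perm h = 1) (i j : ℕ) :
    lk (g * h) i j = lk g i j + lk h i j := by
  rw [lk_mul, hh, add_comm]; rfl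

theorem lk_conj {g h : Br} (hh : perm h = 1) (i j : ℕ) :
    lk (g * h * g⁻¹) i j = lk h (perm g⁻¹ i) (perm g⁻¹ j) := by
  rw [lk_mul, lk_mul, hh, lk_inv]
  simp

theorem lk_zpow {g : Br} (hg : perm g = 1) (k : ℤ) (i j : ℕ) : lk (g ^ k) i j = k * lk g i j := by
  have hp : ∀ k : ℤ, perm (g ^ k) = 1 := fun k => by rw [map_zpow, hg, one_zpow]
  induction k using Int.induction_on with
  | zero => simp
  | succ k ih => rw [zpow_add_one, lk_mul_of_pure hg, ih]; ring
  | pred k ih =>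
    have : lk g⁻¹ i j = -lk g i j := by rw [lk_inv, map_inv, hg]; simp
    rw [zpow_sub_one, lk_mul_of_pure (by rw [map_inv, hg, inv_one]), ih, this]; ring

theorem lk_J (k : ℕ) : ∀ i j, i < j → lk (J k) i j = if j = k then 2 else 0 := by
  induction k with
  | zero => intro i j hij; rw [J_zero, lk_one, if_neg (by omega)]
  | succ k ih =>
    intro i j hij
    rw [J_succ, lk_mul, lk_mul, lk_σ, lk_σ, perm_J, perm_σ]
    have h : ∀ a b, a ≠ b → lk (J k) a b = if a = k ∨ b = k then (if a < k ∨ b < k then 2 else 0) else 0 := by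
      intro a b hab
      rcases lt_or_gt_of_ne hab with h | h
      · rw [ih a b h]; split_ifs <;> omega
      · rw [lk_symm, ih b a h]; split_ifs <;> omega
    rw [h _ _ (fun e => hij.ne ((Equiv.swap k (k + 1)).injective e))]
    simp only [crossing, pairInd, Equiv.Perm.one_apply, Equiv.swap_apply_def]
    split_ifs <;> omega

theorem lk_T (k : ℕ) : ∀ i j, i < j → lk (T k) i j = if j < k then 2 else 0 := by
  induction k with
  | zero => intro i j hij; simp [T]
  | succ k ih =>
    intro i j hij
    rw [T_succ, lk_mul_of_pure (perm_J k), ih i j hij, lk_J k i j hij]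
    split_ifs <;> omega

end linking

end BraidInj

namespace BraidInj

open FreeGroup (of lift norm)

section forgetting

variable {m : ℕ}

/-- The pure braids in which only the `m`-th strand moves. -/
def push (m : ℕ) : FreeGroup ℕ →* Br := lift (pureFam σ m)

theorem pureFam_mem : ∀ d i, i + d + 1 = m → pureFam σ m i ∈ Bn (m + 1) := by
  intro d
  induction d with
  | zero =>
    intro i hi
    rw [pureFam_last hi]
    exact inv_mem (mul_mem (σ_mem (by omega)) (σ_mem (by omega)))
  | succ d ih =>
    intro i hi
    rw [pureFam_rec (by omega)]
    exact mul_mem (mul_mem (σ_mem (by omega)) (ih _ (by omega))) (inv_mem (σ_mem (by omega)))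

theorem push_of (i : ℕ) : push m (of i) = pureFam σ m i := by simp [push]

theorem push_mem {f : FreeGroup ℕ} (hf : f ∈ Fr m) : push m f ∈ Bn (m + 1) := by
  have : Fr m ≤ (Bn (m + 1)).comap (push m) := Fr_le.2 fun i hi => by
    rw [Subgroup.mem_comap, push_of]; exact pureFam_mem (m - 1 - i) i (by omega)
  exact this hf

theorem conj_push {b : Br} (hb : b ∈ Bn m) {f : FreeGroup ℕ} (hf : f ∈ Fr m) :
    b * push m f * b⁻¹ = push m (act b f) :=
  ((artinFamily_pureFam (braidTuple_σ (m + 1))).conj_gens act (fun i _ => act_σ i) hb f hf).2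

theorem kill_push {f : FreeGroup ℕ} (hf : f ∈ Fr m) (w : FreeGroup ℕ) :
    kill m (act (push m f) w) = kill m w :=
  (kill_lift_pureFam (fun i _ => act_σ i) hf).1 w

theorem act_push_self {f : FreeGroup ℕ} (hf : f ∈ Fr m) :
    ∃ c, act (push m f) (of m) = c⁻¹ * of m * c ∧ kill m c = f :=
  (kill_lift_pureFam (fun i _ => act_σ i) hf).2

theorem perm_pureFam : ∀ d i, i + d + 1 = m → perm (pureFam σ m i) = 1 := by
  intro d
  induction d with
  | zero => intro i hi; rw [pureFam_last hi, map_inv, map_mul, perm_σ, Equiv.swap_mul_self, inv_one]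
  | succ d ih =>
    intro i hi
    rw [pureFam_rec (by omega), map_mul, map_mul, ih _ (by omega), mul_one, map_inv, mul_inv_cancel]

theorem perm_push {f : FreeGroup ℕ} (hf : f ∈ Fr m) : perm (push m f) = 1 := by
  have : Fr m ≤ (perm.comp (push m)).ker := Fr_le.2 fun i hi => by
    rw [MonoidHom.mem_ker, MonoidHom.comp_apply, push_of]
    exact perm_pureFam (m - 1 - i) i (by omega)
  exact this hf

theorem exists_push {g : Br} (hg : g ∈ Bn (m + 1)) (hm : perm g m = m) :
    ∃ f ∈ Fr m, ∃ b ∈ Bn m, g = push m f * b :=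
  exists_decomp (braidTuple_σ (m + 1)) (p := act) (fun i _ => act_σ i) hg
    (by rw [expo_act, if_pos hm]; simp)

theorem perm_self {b : Br} (hb : b ∈ Bn m) : perm b m = m := perm_lt hb m le_rfl

/-- The braid obtained by forgetting the `m`-th strand. -/
noncomputable def forget (m : ℕ) (g : Br) : Br :=
  open Classical in
  if h : ∃ b ∈ Bn m, ∀ w, kill m (act g w) = act b (kill m w) then h.choose else 1

theorem forget_eq {g b : Br} (hb : b ∈ Bn m) (h : ∀ w, kill m (act g w) = act b (kill m w)) :
    forget m g = b := by
  have he : ∃ b ∈ Bn m, ∀ w, kill m (act g w) = act b (kill m w) := ⟨b, hb, h⟩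
  rw [forget, dif_pos he]
  refine eq_of_act he.choose_spec.1 hb fun i hi => ?_
  have h1 := he.choose_spec.2 (of i)
  rw [h, kill_of_ne (by omega)] at h1
  exact h1.symm

theorem forget_push_mul {f : FreeGroup ℕ} (hf : f ∈ Fr m) {b : Br} (hb : b ∈ Bn m) :
    forget m (push m f * b) = b :=
  forget_eq hb fun w => by rw [map_mul, MulAut.mul_apply, kill_push hf, kill_act hb]

theorem forget_of_mem {b : Br} (hb : b ∈ Bn m) : forget m b = b := by
  have := forget_push_mul (one_mem (Fr m)) hb
  rwa [map_one, one_mul] at this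

/-- The braids on `m + 1` strands fixing the last point. -/
def fixLast (m : ℕ) : Subgroup Br where
  carrier := {g | g ∈ Bn (m + 1) ∧ perm g m = m}
  one_mem' := ⟨one_mem _, by simp⟩
  mul_mem' := fun ⟨h1, h2⟩ ⟨h3, h4⟩ =>
    ⟨mul_mem h1 h3, by rw [map_mul, Equiv.Perm.mul_apply, h4, h2]⟩
  inv_mem' := fun ⟨h1, h2⟩ => ⟨inv_mem h1, by rw [map_inv, Equiv.Perm.inv_eq_iff_eq, h2]⟩

theorem Bn_le_fixLast : Bn m ≤ fixLast m := fun _ hb => ⟨gens_mono (by omega) hb, perm_self hb⟩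

theorem exists_forget {g : Br} (hg : g ∈ fixLast m) :
    ∃ f ∈ Fr m, g = push m f * forget m g := by
  obtain ⟨f, hf, b, hb, rfl⟩ := exists_push hg.1 hg.2
  exact ⟨f, hf, by rw [forget_push_mul hf hb]⟩

theorem forget_mem {g : Br} (hg : g ∈ fixLast m) : forget m g ∈ Bn m := by
  obtain ⟨f, hf, b, hb, rfl⟩ := exists_push hg.1 hg.2
  rwa [forget_push_mul hf hb]

theorem perm_forget {g : Br} (hg : g ∈ fixLast m) : perm (forget m g) = perm g := by
  obtain ⟨f, hf, b, hb, rfl⟩ := exists_push hg.1 hg.2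
  rw [forget_push_mul hf hb, map_mul, perm_push hf, one_mul]

theorem homOn_forget : HomOn (fixLast m) (forget m) := by
  rintro g hg h hh
  obtain ⟨f, hf, b, hb, rfl⟩ := exists_push hg.1 hg.2
  obtain ⟨f', hf', b', hb', rfl⟩ := exists_push hh.1 hh.2
  have : push m f * b * (push m f' * b') = push m (f * act b f') * (b * b') := by
    rw [map_mul, ← conj_push hb hf']; group
  rw [this, forget_push_mul (mul_mem hf (act_mem_Fr hb hf')) (mul_mem hb hb'),
    forget_push_mul hf hb, forget_push_mul hf' hb']

theorem kill_act_of_mem {g : Br} (hg : g ∈ fixLast m) (w : FreeGroup ℕ) :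
    kill m (act g w) = act (forget m g) (kill m w) := by
  obtain ⟨f, hf, b, hb, rfl⟩ := exists_push hg.1 hg.2
  rw [forget_push_mul hf hb, map_mul, MulAut.mul_apply, kill_push hf, kill_act hb]

theorem exists_of_forget_eq_one {g : Br} (hg : g ∈ fixLast m) (h : forget m g = 1) :
    ∃ f ∈ Fr m, g = push m f := by
  obtain ⟨f, hf, hgf⟩ := exists_forget hg
  exact ⟨f, hf, by rw [hgf, h, mul_one]⟩

theorem push_injOn {f : FreeGroup ℕ} (hf : f ∈ Fr m) (h : push m f = 1) : f = 1 := by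
  obtain ⟨c, h1, h2⟩ := act_push_self hf
  rw [h, map_one, MulAut.one_apply] at h1
  have hc : Commute c (of m) := by
    show c * of m = of m * c
    conv_lhs => rw [h1]
    group
  obtain ⟨k, hk⟩ := zpowers_of_commute_of hc
  change of m ^ k = c at hk
  rw [← h2, ← hk, map_zpow, kill_self, one_zpow]

theorem lk_pureFam : ∀ d i, i + d + 1 = m → ∀ a < m, ∀ b < m, lk (pureFam σ m i) a b = 0 := by
  intro d
  induction d with
  | zero =>
    intro i hi a ha b hb
    rw [pureFam_last hi, lk_inv, lk_mul, lk_σ, lk_σ]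
    have hp : perm (σ i * σ i)⁻¹ = 1 := by
      rw [map_inv, map_mul, perm_σ, Equiv.swap_mul_self, inv_one]
    rw [hp, Equiv.Perm.one_apply, Equiv.Perm.one_apply, perm_σ, crossing_swap, crossing, pairInd,
      if_neg (by omega)]
    rfl
  | succ d ih =>
    intro i hi a ha b hb
    rw [pureFam_rec (by omega), lk_conj (perm_pureFam d _ (by omega))]
    have hs : (σ i)⁻¹ ∈ Bn m := inv_mem (σ_mem (by omega))
    exact ih _ (by omega) _ ((perm_lt_iff hs a).2 ha) _ ((perm_lt_iff hs b).2 hb)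

theorem lk_push {f : FreeGroup ℕ} (hf : f ∈ Fr m) {a b : ℕ} (ha : a < m) (hb : b < m) :
    lk (push m f) a b = 0 := by
  have key : perm (push m f) = 1 ∧ ∀ a < m, ∀ b < m, lk (push m f) a b = 0 := by
    refine Fr_induction (p := fun f => perm (push m f) = 1 ∧
      ∀ a < m, ∀ b < m, lk (push m f) a b = 0) ?_ ?_ ?_ ?_ hf
    · intro i hi
      rw [push_of]
      exact ⟨perm_pureFam (m - 1 - i) i (by omega), lk_pureFam (m - 1 - i) i (by omega)⟩
    · exact ⟨by simp, fun a _ b _ => by rw [map_one, lk_one]⟩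
    · rintro x y ⟨h1, h2⟩ ⟨h3, h4⟩
      refine ⟨by rw [map_mul, map_mul, h1, h3, one_mul], fun a ha b hb => ?_⟩
      rw [map_mul, lk_mul_of_pure h3, h2 a ha b hb, h4 a ha b hb, add_zero]
    · rintro x ⟨h1, h2⟩
      refine ⟨by rw [map_inv, map_inv, h1, inv_one], fun a ha b hb => ?_⟩
      rw [map_inv, lk_inv, map_inv, h1, inv_one]
      simp [h2 a ha b hb]
  exact key.2 a ha b hb

theorem lk_forget {g : Br} (hg : g ∈ fixLast m) {a b : ℕ} (ha : a < m) (hb : b < m) :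
    lk (forget m g) a b = lk g a b := by
  obtain ⟨f, hf, c, hc, rfl⟩ := exists_push hg.1 hg.2
  rw [forget_push_mul hf hc, lk_mul, lk_push hf ((perm_lt_iff hc a).2 ha)
    ((perm_lt_iff hc b).2 hb), add_zero]

theorem J_mem_fixLast (m : ℕ) : J m ∈ fixLast m := ⟨J_mem m, by rw [perm_J]; rfl⟩

theorem T_mem_fixLast (m : ℕ) : T (m + 1) ∈ fixLast m := ⟨T_mem _, by rw [perm_T]; rfl⟩

theorem J_eq_push : J m = push m (D m)⁻¹ := by
  have h1 : forget m (J m) = 1 := by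
    have hJ := J_mem_fixLast m
    refine eq_of_act (forget_mem hJ) (one_mem _) fun i hi => ?_
    have h := kill_act_of_mem hJ (of i)
    rw [kill_of_ne (by omega), (act_J m).1 _ (of_mem_Fr hi)] at h
    simpa [kill_of_ne (show i ≠ m by omega)] using h.symm
  obtain ⟨f, hf, hJ⟩ := exists_of_forget_eq_one (J_mem_fixLast m) h1
  obtain ⟨c, h2, h3⟩ := act_push_self hf
  rw [← hJ, (act_J m).2] at h2
  have hc : Commute (c * D m) (of m) := by
    show c * D m * of m = of m * (c * D m)
    have : c * D m * of m = c * (D m * of m * (D m)⁻¹) * D m := by group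
    rw [this, h2]; group
  obtain ⟨k, hk⟩ := zpowers_of_commute_of hc
  change of m ^ k = c * D m at hk
  have := congrArg (kill m) hk
  rw [map_zpow, kill_self, one_zpow, map_mul, h3, kill_of_mem_Fr (D_mem_Fr m)] at this
  rw [hJ, eq_inv_of_mul_eq_one_left this.symm]

theorem forget_T : forget m (T (m + 1)) = T m := by
  rw [T_succ, (commute_J (T_mem m)).eq, J_eq_push,
    forget_push_mul (inv_mem (D_mem_Fr m)) (T_mem m)]

end forgetting
end BraidInj

namespace BraidInj

open FreeGroup (of lift norm)

section evaluation

variable {H : Type*} [Group H] {n : ℕ} {s : ℕ → H}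

open Classical in
/-- The homomorphism defined by a braid tuple, as a function on all braids. -/
noncomputable def evalTuple (h : BraidTuple n s) (g : Br) : H :=
  if hg : g ∈ Bn n then tupleHom h ⟨g, hg⟩ else 1

theorem homOn_evalTuple (h : BraidTuple n s) : HomOn (Bn n) (evalTuple h) := fun g hg k hk => by
  rw [evalTuple, evalTuple, evalTuple, dif_pos hg, dif_pos hk, dif_pos (mul_mem hg hk), ← map_mul]
  rfl

theorem evalTuple_σ (h : BraidTuple n s) {i : ℕ} (hi : i + 1 < n) : evalTuple h (σ i) = s i := by
  rw [evalTuple, dif_pos (σ_mem hi), tupleHom_σ h hi]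

theorem HomOn.mem {ρ : Br → H} (h : HomOn (Bn n) ρ) {K : Subgroup H}
    (hs : ∀ i, i + 1 < n → ρ (σ i) ∈ K) {g : Br} (hg : g ∈ Bn n) : ρ g ∈ K := by
  have : Bn n ≤ (K.comap h.toHom).map (Bn n).subtype :=
    gens_le.2 fun i hi => ⟨⟨σ i, σ_mem hi⟩, hs i hi, rfl⟩
  obtain ⟨x, hx, rfl⟩ := this hg
  exact hx

theorem homOn_monoidHom (f : Br →* H) (K : Subgroup Br) : HomOn K f := fun g _ k _ => map_mul f g k

theorem HomOn.braidTuple {ρ : Br → H} (h : HomOn (Bn n) ρ) : BraidTuple n fun i => ρ (σ i) := by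
  have hσ := braidTuple_σ n
  constructor
  · intro i hi
    have h1 := σ_mem (n := n) (i := i) (by omega)
    have h2 := σ_mem (n := n) (i := i + 1) (by omega)
    simp only [← h _ h1 _ h2, ← h _ h2 _ h1, ← h _ (mul_mem h1 h2) _ h1,
      ← h _ (mul_mem h2 h1) _ h2, hσ.braid i hi]
  · intro i j hij hj
    have h1 := σ_mem (n := n) (i := i) (by omega)
    have h2 := σ_mem (n := n) (i := j) (by omega)
    show ρ (σ i) * ρ (σ j) = ρ (σ j) * ρ (σ i)
    rw [← h _ h1 _ h2, ← h _ h2 _ h1, (hσ.comm i j hij hj).eq]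

end evaluation

/-- Homomorphic images in an abelian group of the terms of a braid tuple agree. -/
theorem BraidTuple.eq_zero_of_comm {A : Type*} [CommGroup A] {n : ℕ} {s : ℕ → A}
    (h : BraidTuple n s) : ∀ i, i + 1 < n → s i = s 0 := by
  intro i
  induction i with
  | zero => exact fun _ => rfl
  | succ i ih =>
    intro hi
    have h1 := h.braid i (by omega)
    rw [← ih (by omega)]
    rw [mul_comm (s i * s (i + 1)), mul_assoc (s (i + 1))] at h1
    exact (mul_right_cancel h1).symm

theorem BraidTuple.mul_central {H : Type*} [Group H] {n : ℕ} {s : ℕ → H} {z : H}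
    (h : BraidTuple n s) (hz : ∀ i, i + 1 < n → Commute (s i) z) :
    BraidTuple n fun i => s i * z := by
  have key : ∀ x y w : H, Commute y z → Commute w z → x * z * (y * z) * (w * z) =
      x * y * w * z * z * z := by
    intro x y w hy hw
    calc x * z * (y * z) * (w * z) = x * (z * y) * (z * w) * z := by group
      _ = x * y * (z * w) * z * z := by rw [← hy.eq, ← hw.eq]; simp only [mul_assoc, hw.eq]
      _ = _ := by rw [← hw.eq]; group
  constructor
  · intro i hi
    have h1 := hz i (by omega)
    have h2 := hz (i + 1) (by omega)
    simp only [key _ _ _ h1 h2, key _ _ _ h2 h1, h.braid i hi]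
  · intro i j hij hj
    have h1 := hz i (by omega)
    have h2 := hz j (by omega)
    exact ((h.comm i j hij hj).mul_right h1).mul_left (h2.symm.mul_right (Commute.refl z))

/-- Tuples conjugate, up to sign and central twists, to the standard one. -/
def Geo (n : ℕ) (s : ℕ → Br) : Prop :=
  ∃ c ∈ Bn n, ∃ t e : ℤ, (e = 1 ∨ e = -1) ∧ ∀ i, i + 1 < n → s i = c * σ i ^ e * c⁻¹ * T n ^ t

theorem T_zpow_comm {n : ℕ} {g : Br} (hg : g ∈ Bn n) (t : ℤ) : Commute g (T n ^ t) :=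
  (commute_T hg).zpow_right t

theorem Geo.inv {n : ℕ} {s : ℕ → Br} (h : Geo n fun i => (s i)⁻¹) : Geo n s := by
  obtain ⟨c, hc, t, e, he, h⟩ := h
  refine ⟨c, hc, -t, -e, by omega, fun i hi => ?_⟩
  have hx : c * σ i ^ e * c⁻¹ ∈ Bn n := mul_mem (mul_mem hc (zpow_mem (σ_mem hi) _)) (inv_mem hc)
  have h1 : (s i)⁻¹ = c * σ i ^ e * c⁻¹ * T n ^ t := h i hi
  rw [← inv_inv (s i), h1, (T_zpow_comm hx t).eq, mul_inv_rev, zpow_neg, zpow_neg]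
  group

theorem Geo.conj_twist {n : ℕ} {s : ℕ → Br} {b : Br} (hb : b ∈ Bn n) {t : ℤ}
    (h : Geo n fun i => b⁻¹ * s i * b * T n ^ t) : Geo n s := by
  obtain ⟨c, hc, t', e, he, h⟩ := h
  refine ⟨b * c, mul_mem hb hc, t' - t, e, he, fun i hi => ?_⟩
  have h1 : b⁻¹ * s i * b * T n ^ t = c * σ i ^ e * c⁻¹ * T n ^ t' := h i hi
  have : s i = b * (b⁻¹ * s i * b * T n ^ t) * T n ^ (-t) * b⁻¹ := by group
  rw [this, h1]
  have h2 : b⁻¹ * T n ^ (t' - t) = T n ^ (t' - t) * b⁻¹ := T_zpow_comm (inv_mem hb) _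
  calc b * (c * σ i ^ e * c⁻¹ * T n ^ t') * T n ^ (-t) * b⁻¹
      = b * c * σ i ^ e * c⁻¹ * (T n ^ (t' - t) * b⁻¹) := by group
    _ = _ := by rw [← h2]; group

/-- A homomorphism which is geometric modulo the center is given by a geometric tuple. -/
theorem geo_of_quotient {n : ℕ} (hn : 3 ≤ n) {ρ : Br → Br} (h : HomOn (Bn n) ρ)
    (hρ : ∀ g ∈ Bn n, ρ g ∈ Bn n) {b : Qn n}
    (hb : (∀ x ∈ Bn n, q n (ρ x) = b * q n x * b⁻¹) ∨
      ∀ x ∈ Bn n, q n (ρ x) = b * q n (mirror x) * b⁻¹) : Geo n fun i => ρ (σ i) := by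
  obtain ⟨c, hc, rfl⟩ := exists_q b
  have hq := homOn_q n
  obtain ⟨e, he, hqe⟩ : ∃ e : ℤ, (e = 1 ∨ e = -1) ∧ ∀ i, i + 1 < n →
      q n (ρ (σ i)) = q n (c * σ i ^ e * c⁻¹) := by
    rcases hb with hb | hb
    · exact ⟨1, Or.inl rfl, fun i hi => by
        rw [hb _ (σ_mem hi), zpow_one, hq.conj hc (σ_mem hi)]⟩
    · exact ⟨-1, Or.inr rfl, fun i hi => by
        rw [hb _ (σ_mem hi), mirror_σ, zpow_neg_one, hq.conj hc (inv_mem (σ_mem hi))]⟩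
  have hmem : ∀ i, i + 1 < n → c * σ i ^ e * c⁻¹ ∈ Bn n := fun i hi =>
    mul_mem (mul_mem hc (zpow_mem (σ_mem hi) _)) (inv_mem hc)
  have ht : ∀ i, i + 1 < n → ∃ t : ℤ, ρ (σ i) = c * σ i ^ e * c⁻¹ * T n ^ t := by
    intro i hi
    obtain ⟨t, ht⟩ := ((q_eq_iff (hρ _ (σ_mem hi)) (hmem i hi)).1 (hqe i hi)).mem_zpowers hn
    change T n ^ t = _ at ht
    exact ⟨t, by rw [(T_zpow_comm (hmem i hi) t).eq, ht]; group⟩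
  choose! t ht using ht
  refine ⟨c, hc, t 0, e, he, fun i hi => ?_⟩
  have h1 : expSum (ρ (σ i)) = expSum (ρ (σ 0)) :=
    (h.braidTuple.map expSum).eq_zero_of_comm i hi
  rw [ht i hi, ht 0 (by omega)] at h1
  simp only [map_mul, map_inv, mul_inv_cancel_comm, map_zpow expSum (σ _), expSum_σ] at h1
  have h2 : T n ^ (t i) = T n ^ (t 0) := by
    have h3 := mul_left_cancel h1
    rw [map_zpow, map_zpow] at h3
    have hz : expSum (T n ^ (t i - t 0)) = 1 := by
      rw [map_zpow, zpow_sub, h3, mul_inv_cancel]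
    have := ((central_T n).zpow (t i - t 0)).eq_one hn hz
    rw [zpow_sub] at this
    exact mul_inv_eq_one.1 this
  show ρ (σ i) = _
  rw [ht i hi, h2]

section extension

variable {m : ℕ}

theorem exists_retract (m : ℕ) : ∃ r : FreeGroup ℕ →* FreeGroup ℕ,
    (∀ f, r f ∈ Fr m) ∧ ∀ f ∈ Fr m, r f = f := by
  refine ⟨lift fun i => if i < m then of i else 1, fun f => ?_, fun f hf =>
    eqOn_Fr (f' := MonoidHom.id _) (fun i hi => by simp [hi]) hf⟩
  have : (⊤ : Subgroup (FreeGroup ℕ)) ≤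
      (Fr m).comap (lift fun i => if i < m then of i else 1) := by
    rw [← FreeGroup.closure_range_of, Subgroup.closure_le]
    rintro _ ⟨i, rfl⟩
    rw [SetLike.mem_coe, Subgroup.mem_comap, FreeGroup.lift_apply_of]
    split_ifs with hi
    · exact of_mem_Fr hi
    · exact one_mem _
  exact this trivial

/-- A braid killed by forgetting and commuting with a lift of all braids on fewer strands is
conjugate to a power of `J m`. -/
theorem exists_conj_J (hm : 3 ≤ m) {ρ : Br → Br} (hmem : ∀ g ∈ Bn m, ρ g ∈ fixLast m)
    (hfor : ∀ g ∈ Bn m, forget m (ρ g) = g) {z : Br} (hz : z ∈ fixLast m)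
    (hz1 : forget m z = 1) (hc : ∀ g ∈ Bn m, Commute z (ρ g)) :
    ∃ k : ℤ, ∃ u ∈ Fr m, z = push m u * J m ^ k * (push m u)⁻¹ := by
  obtain ⟨w, hw, rfl⟩ := exists_of_forget_eq_one hz hz1
  obtain ⟨l, rfl⟩ : ∃ l, m = l + 1 := ⟨m - 1, by omega⟩
  have hconj : ∀ g ∈ Bn (l + 1), IsConj w (act g w) := by
    intro g hg
    obtain ⟨f, hf, h1⟩ := exists_forget (hmem g hg)
    rw [hfor g hg] at h1
    have h2 := (hc g hg).eq
    rw [h1] at h2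
    have h3 : push (l + 1) (w⁻¹ * (f * act g w * f⁻¹)) = 1 := by
      rw [map_mul, map_mul, map_mul, ← conj_push hg hw, map_inv, map_inv]
      have : push (l + 1) f * (g * push (l + 1) w * g⁻¹) * (push (l + 1) f)⁻¹ =
          (push (l + 1) f * g * push (l + 1) w) * g⁻¹ * (push (l + 1) f)⁻¹ := by group
      rw [this, ← h2]
      group
    have h4 := push_injOn (mul_mem (inv_mem hw)
      (mul_mem (mul_mem hf (act_mem_Fr hg hw)) (inv_mem hf))) h3
    have h5 : f * act g w * f⁻¹ = w := (inv_mul_eq_one.1 h4).symm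
    exact (isConj_iff.2 ⟨f, h5⟩).symm
  obtain ⟨c, hcw⟩ := isConj_D_zpow (by omega) hw hconj
  obtain ⟨u, hu⟩ := isConj_iff.1 hcw.symm
  obtain ⟨r, hr1, hr2⟩ := exists_retract (l + 1)
  have h6 : w = r u * (D (l + 1) ^ c) * (r u)⁻¹ := by
    rw [← hr2 w hw, ← hu, map_mul, map_mul, map_inv, hr2 _ (zpow_mem (D_mem_Fr _) _)]
  refine ⟨-c, r u, hr1 u, ?_⟩
  rw [J_eq_push, ← map_zpow, ← map_inv, ← map_mul, ← map_mul, inv_zpow, zpow_neg, inv_inv, ← h6]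

/-- The total linking number with the last strand. -/
def lkLast (m : ℕ) (g : Br) : Multiplicative ℤ :=
  Multiplicative.ofAdd (∑ i ∈ Finset.range m, lk g i m)

theorem homOn_lkLast : HomOn (fixLast m) (lkLast m) := by
  rintro g hg h hh
  have hlt : ∀ i, i ∈ Finset.range m ↔ perm h i ∈ Finset.range m := fun i => by
    have h1 := perm_lt_iff hh.1 i
    have h2 : perm h i = m ↔ i = m :=
      ⟨fun h3 => (perm h).injective (h3.trans hh.2.symm), fun h3 => by rw [h3, hh.2]⟩
    rw [Finset.mem_range, Finset.mem_range]
    omega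
  have h1 : ∑ i ∈ Finset.range m, lk g i m = ∑ i ∈ Finset.range m, lk g (perm h i) m :=
    (Finset.sum_equiv (perm h) hlt fun _ _ => rfl).symm
  rw [lkLast, lkLast, lkLast, ← ofAdd_add, h1, add_comm, ← Finset.sum_add_distrib]
  exact congrArg _ (Finset.sum_congr rfl fun i _ => by rw [lk_mul, hh.2])

/-- The braid tuples lifting the standard transpositions. -/
structure Std (n : ℕ) (s : ℕ → Br) : Prop where
  tuple : BraidTuple n s
  mem : ∀ i, i + 1 < n → s i ∈ Bn n
  perm_eq : ∀ i, i + 1 < n → perm (s i) = Equiv.swap i (i + 1)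

namespace Std

variable {n : ℕ} {s : ℕ → Br}

theorem perm_evalTuple (h : Std n s) {g : Br} (hg : g ∈ Bn n) :
    perm (evalTuple h.tuple g) = perm g :=
  ((homOn_evalTuple h.tuple).map perm).eqOn_gens (homOn_monoidHom perm _) (fun i hi => by
    simp only [evalTuple_σ h.tuple hi, h.perm_eq i hi, perm_σ]) hg

theorem evalTuple_mem (h : Std n s) {g : Br} (hg : g ∈ Bn n) : evalTuple h.tuple g ∈ Bn n :=
  (homOn_evalTuple h.tuple).mem (fun i hi => by
    rw [evalTuple_σ h.tuple hi]; exact h.mem i hi) hg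

theorem evalTuple_mem_fixLast (h : Std (m + 1) s) {g : Br} (hg : g ∈ Bn m) :
    evalTuple h.tuple g ∈ fixLast m :=
  ⟨h.evalTuple_mem (gens_mono (by omega) hg), by
    rw [h.perm_evalTuple (gens_mono (by omega) hg), perm_self hg]⟩

theorem forget_evalTuple (h : Std (m + 1) s) (hf : ∀ i, i + 1 < m → forget m (s i) = σ i) {g : Br}
    (hg : g ∈ Bn m) : forget m (evalTuple h.tuple g) = g := by
  have h1 : HomOn (Bn m) fun g => forget m (evalTuple h.tuple g) := fun x hx y hy => by
    simp only [homOn_evalTuple h.tuple x (gens_mono (by omega) hx) y (gens_mono (by omega) hy)]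
    exact homOn_forget _ (h.evalTuple_mem_fixLast hx) _ (h.evalTuple_mem_fixLast hy)
  exact h1.eqOn_gens (homOn_monoidHom (MonoidHom.id Br) _) (fun i hi => by
    simp only [evalTuple_σ h.tuple (show i + 1 < m + 1 by omega), hf i hi, MonoidHom.id_apply]) hg

theorem evalTuple_T (hm : 3 ≤ m) (h : Std (m + 1) s)
    (hf : ∀ i, i + 1 < m → forget m (s i) = σ i) :
    ∃ j : ℤ, evalTuple h.tuple (T (m + 1)) = T (m + 1) ^ j := by
  set ρ := evalTuple h.tuple
  have hρ : HomOn (Bn (m + 1)) ρ := homOn_evalTuple h.tuple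
  have hle : Bn m ≤ Bn (m + 1) := gens_mono (by omega)
  have hζp : perm (ρ (T (m + 1))) = 1 := by rw [h.perm_evalTuple (T_mem _), perm_T]
  have hζ : ρ (T (m + 1)) ∈ fixLast m := ⟨h.evalTuple_mem (T_mem _), by rw [hζp]; rfl⟩
  have hcomm : ∀ g ∈ Bn (m + 1), Commute (ρ (T (m + 1))) (ρ g) := fun g hg => by
    show _ * _ = _ * _
    rw [← hρ _ (T_mem _) _ hg, ← hρ _ hg _ (T_mem _), (commute_T hg).eq]
  have hcen : Central m (forget m (ρ (T (m + 1)))) := ⟨forget_mem hζ, fun g hg => by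
    have h1 := hcomm g (hle hg)
    have h2 := h.evalTuple_mem_fixLast hg
    have h3 : forget m (ρ g) = g := h.forget_evalTuple hf hg
    show _ * _ = _ * _
    rw [← h3, ← homOn_forget _ hζ _ h2, ← homOn_forget _ h2 _ hζ, h1.eq]⟩
  obtain ⟨j, hj⟩ := hcen.mem_zpowers (by omega)
  change T m ^ j = _ at hj
  have hTj : T (m + 1) ^ (-j) ∈ fixLast m := zpow_mem (T_mem_fixLast m) _
  obtain ⟨k, u, hu, hz⟩ := exists_conj_J hm (fun g hg => h.evalTuple_mem_fixLast hg)
    (fun g hg => h.forget_evalTuple hf hg) (mul_mem hζ hTj) (by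
      rw [homOn_forget _ hζ _ hTj, ← hj, homOn_forget.zpow (T_mem_fixLast m), forget_T, zpow_neg,
        mul_inv_cancel]) (fun g hg => (hcomm g (hle hg)).mul_left
      (T_zpow_comm (h.evalTuple_mem (hle hg)) _).symm)
  refine ⟨j, ?_⟩
  have hz' : ρ (T (m + 1)) = push m u * J m ^ k * (push m u)⁻¹ * T (m + 1) ^ j := by
    rw [← hz]; group
  have hJp : perm (J m ^ k) = 1 := by rw [map_zpow, perm_J, one_zpow]
  have hTp : perm (T (m + 1) ^ j) = 1 := by rw [map_zpow, perm_T, one_zpow]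
  have hlk : ∀ a b, a < b → b < m + 1 →
      lk (ρ (T (m + 1))) a b = k * (if b = m then 2 else 0) + j * 2 := by
    intro a b hab hb
    rw [hz', lk_mul_of_pure hTp, lk_conj hJp, map_inv, perm_push hu, inv_one,
      Equiv.Perm.one_apply, Equiv.Perm.one_apply, lk_zpow (perm_J m), lk_zpow (perm_T _),
      lk_J _ _ _ hab, lk_T _ _ _ hab, if_pos hb]
  have hr : lk (ρ (σ (m - 1)) * ρ (T (m + 1)) * (ρ (σ (m - 1)))⁻¹) 0 m =
      lk (ρ (T (m + 1))) 0 m := by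
    rw [← (hcomm (σ (m - 1)) (σ_mem (by omega))).eq]; simp
  rw [lk_conj hζp, map_inv, h.perm_evalTuple (σ_mem (by omega)), perm_σ, Equiv.swap_inv,
    Equiv.swap_apply_of_ne_of_ne (by omega) (by omega), Nat.sub_add_cancel (by omega),
    Equiv.swap_apply_right, hlk _ _ (by omega) (by omega), hlk _ _ (by omega) (by omega),
    if_neg (by omega), if_pos rfl] at hr
  obtain rfl : k = 0 := by omega
  rw [hz']; simp

theorem lkLast_zero (hm : 4 ≤ m) (h : Std (m + 1) s)
    (hf : ∀ i, i + 1 < m → forget m (s i) = σ i) : lkLast m (s 0) = 1 := by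
  have hs0 : s 0 ∈ fixLast m := ⟨h.mem 0 (by omega), by
    rw [h.perm_eq 0 (by omega), Equiv.swap_apply_of_ne_of_ne (by omega) (by omega)]⟩
  have hv : ∀ a < m, ∀ b < m, lk (s 0) a b = crossing 0 a b := fun a ha b hb => by
    rw [← lk_forget hs0 ha hb, hf 0 (by omega), lk_σ]
  have hc : ∀ l, 2 ≤ l → l < m → ∀ a b,
      lk (s l) a b + lk (s 0) (Equiv.swap l (l + 1) a) (Equiv.swap l (l + 1) b) =
      lk (s 0) a b + lk (s l) (Equiv.swap 0 1 a) (Equiv.swap 0 1 b) := by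
    intro l hl hlm a b
    have h1 := lk_mul (s 0) (s l) a b
    rw [(h.tuple.comm 0 l (by omega) (by omega)).eq, lk_mul, h.perm_eq l (by omega),
      h.perm_eq 0 (by omega)] at h1
    exact h1.symm
  have h0 : ∀ a, a < m → 2 ≤ a → a < m - 1 → lk (s 0) a m = 0 := by
    intro a _ ha ha'
    have h1 := hc (m - 1) (by omega) (by omega) a (m - 1)
    rw [Nat.sub_add_cancel (by omega), Equiv.swap_apply_left,
      Equiv.swap_apply_of_ne_of_ne (by omega) (by omega),
      Equiv.swap_apply_of_ne_of_ne (by omega) (by omega),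
      Equiv.swap_apply_of_ne_of_ne (by omega) (by omega), hv a (by omega) (m - 1) (by omega),
      crossing, pairInd, if_neg (by omega)] at h1
    omega
  have h2 : ∀ a, 2 ≤ a → a < m → lk (s 0) a m = 0 := by
    intro a ha ham
    rcases Nat.lt_or_ge a (m - 1) with h1 | h1
    · exact h0 a ham ha h1
    · obtain rfl : a = m - 1 := by omega
      have h1 := hc (m - 2) (by omega) (by omega) (m - 2) m
      rw [show m - 2 + 1 = m - 1 by omega, Equiv.swap_apply_left,
        Equiv.swap_apply_of_ne_of_ne (by omega) (by omega),
        Equiv.swap_apply_of_ne_of_ne (by omega) (by omega),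
        Equiv.swap_apply_of_ne_of_ne (by omega) (by omega), h0 (m - 2) (by omega) (by omega)
          (by omega)] at h1
      omega
  have h3 : lk (s 0) 0 m + lk (s 0) 1 m = 0 := by
    have ha := hc (m - 1) (by omega) (by omega) 0 (m - 1)
    have hb := hc (m - 1) (by omega) (by omega) 1 (m - 1)
    have hs : Equiv.swap 0 1 (m - 1) = m - 1 :=
      Equiv.swap_apply_of_ne_of_ne (by omega) (by omega)
    rw [Nat.sub_add_cancel (by omega), Equiv.swap_apply_left, hs,
      Equiv.swap_apply_of_ne_of_ne (by omega) (by omega)] at ha hb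
    rw [hv 0 (by omega) (m - 1) (by omega), crossing, pairInd, if_neg (by omega),
      Equiv.swap_apply_left] at ha
    rw [hv 1 (by omega) (m - 1) (by omega), crossing, pairInd, if_neg (by omega),
      Equiv.swap_apply_right] at hb
    omega
  obtain ⟨l, rfl⟩ : ∃ l, m = l + 2 := ⟨m - 2, by omega⟩
  rw [lkLast, Finset.sum_range_succ', Finset.sum_range_succ', Finset.sum_eq_zero fun i hi => ?_,
    zero_add, zero_add, add_comm, h3, ofAdd_zero]
  rw [Finset.mem_range] at hi
  exact h2 _ (by omega) (by omega)

theorem geo_of_forget (hm : 4 ≤ m) (h : Std (m + 1) s)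
    (hf : ∀ i, i + 1 < m → forget m (s i) = σ i) : Geo (m + 1) s := by
  set ρ := evalTuple h.tuple with hρdef
  have hρ : HomOn (Bn (m + 1)) ρ := homOn_evalTuple h.tuple
  have hle : Bn m ≤ Bn (m + 1) := gens_mono (by omega)
  have hmem : ∀ g ∈ Bn (m + 1), ρ g ∈ Bn (m + 1) := fun g hg => h.evalTuple_mem hg
  have hfor : ∀ g ∈ Bn m, forget m (ρ g) = g := fun g hg => h.forget_evalTuple hf hg
  have hfix : ∀ g ∈ Bn m, ρ g ∈ fixLast m := fun g hg => h.evalTuple_mem_fixLast hg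
  have hTi : (T (m + 1))⁻¹ ∈ fixLast m := inv_mem (T_mem_fixLast m)
  obtain ⟨k, u, hu, hz⟩ := exists_conj_J (by omega) hfix hfor
    (mul_mem (hfix _ (T_mem m)) hTi) (by
      rw [homOn_forget _ (hfix _ (T_mem m)) _ hTi, hfor _ (T_mem m),
        homOn_forget.inv (T_mem_fixLast m), forget_T, mul_inv_cancel]) (fun g hg => by
      refine Commute.mul_left ?_ (commute_T (hmem g (hle hg))).symm.inv_left
      show _ * _ = _ * _
      rw [← hρ _ (hle (T_mem m)) _ (hle hg), ← hρ _ (hle hg) _ (hle (T_mem m)),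
        (commute_T hg).eq])
  have hk : k ≠ 0 := by
    rintro rfl
    rw [zpow_zero, mul_one, mul_inv_cancel, mul_inv_eq_one] at hz
    have h1 : HomOn (Bn m) fun g => lkLast m (ρ g) := fun x hx y hy => by
      simp only [hρ x (hle hx) y (hle hy)]
      exact homOn_lkLast _ (hfix x hx) _ (hfix y hy)
    have h2 : lkLast m (ρ (T m)) = 1 := by
      refine h1.eqOn_gens (homOn_monoidHom (1 : Br →* Multiplicative ℤ) _) (fun i hi => ?_)
        (T_mem m)
      have h3 : lkLast m (ρ (σ i)) = lkLast m (ρ (σ 0)) := h1.braidTuple.eq_zero_of_comm i hi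
      show lkLast m (ρ (σ i)) = 1
      rw [h3, hρdef, evalTuple_σ h.tuple (show 0 + 1 < m + 1 by omega), lkLast_zero hm h hf]
    rw [hz, lkLast, Finset.sum_congr rfl fun i hi => by
      rw [lk_T _ _ _ (Finset.mem_range.1 hi), if_pos (by omega)], ofAdd_eq_one] at h2
    simp at h2
    omega
  obtain ⟨j, hj⟩ := h.evalTuple_T (by omega) hf
  have hq := homOn_q (m + 1)
  have hqρ : HomOn (Bn (m + 1)) fun g => q (m + 1) (ρ g) := fun x hx y hy => by
    simp only [hρ x hx y hy, hq _ (hmem x hx) _ (hmem y hy)]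
  have hz' : ρ (T m) = push m u * J m ^ k * (push m u)⁻¹ * T (m + 1) := by
    rw [← hz]; group
  have hpu := push_mem hu
  have hJk : J m ^ k ∈ Bn (m + 1) := zpow_mem (J_mem m) k
  obtain ⟨b, hb⟩ := finish (by omega) hqρ (k := -k) (by omega) (g := q (m + 1) (push m u))
    (by
      show q (m + 1) (evalTuple h.tuple _) = 1
      rw [hj, hq.zpow (T_mem _), q_T, one_zpow])
    (by
      show q (m + 1) (ρ (T m)) = _
      rw [hz', hq _ (mul_mem (mul_mem hpu hJk) (inv_mem hpu)) _ (T_mem _), q_T, mul_one,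
        hq.conj hpu hJk, hq.zpow (J_mem m), q_J, inv_zpow, zpow_neg])
  have hgeo := geo_of_quotient (by omega) hρ hmem hb
  obtain ⟨c, hc, t, e, he, h5⟩ := hgeo
  exact ⟨c, hc, t, e, he, fun i hi => by
    rw [← h5 i hi]; exact (evalTuple_σ h.tuple hi).symm⟩

theorem perm_eq_one_of_swap {c : Br} (hc : c ∈ Bn n) (hn : 3 ≤ n)
    (h : ∀ i, i + 1 < n → perm c * Equiv.swap i (i + 1) * (perm c)⁻¹ = Equiv.swap i (i + 1)) :
    perm c = 1 := by
  have h1 : ∀ i, i + 1 < n → Equiv.swap (perm c i) (perm c (i + 1)) = Equiv.swap i (i + 1) :=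
    fun i hi => by rw [← h i hi, ← Equiv.swap_apply_apply]
  have h2 : ∀ i, i + 1 < n → perm c i = i ∨ perm c i = i + 1 := by
    intro i hi
    by_contra! hcon
    have h3 := congrArg (fun e : Equiv.Perm ℕ => e (perm c i)) (h1 i hi)
    simp only [Equiv.swap_apply_left] at h3
    rw [Equiv.swap_apply_of_ne_of_ne hcon.1 hcon.2] at h3
    have := (perm c).injective h3
    omega
  have h4 : ∀ i, i + 1 < n → perm c (i + 1) = i ∨ perm c (i + 1) = i + 1 := by
    intro i hi
    by_contra! hcon
    have h3 := congrArg (fun e : Equiv.Perm ℕ => e (perm c (i + 1))) (h1 i hi)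
    simp only [Equiv.swap_apply_right] at h3
    rw [Equiv.swap_apply_of_ne_of_ne hcon.1 hcon.2] at h3
    have := (perm c).injective h3
    omega
  ext i
  rw [Equiv.Perm.one_apply]
  rcases Nat.lt_or_ge i n with hi | hi
  · rcases Nat.lt_trichotomy i 0 with h5 | rfl | h5
    · omega
    · have ha := h2 0 (by omega)
      have hb := h4 0 (by omega)
      have hc := h2 1 (by omega)
      have hd : perm c 0 ≠ perm c 1 := fun h6 => by
        have := (perm c).injective h6; omega
      rw [zero_add] at ha hb
      omega
    · obtain ⟨j, rfl⟩ : ∃ j, i = j + 1 := ⟨i - 1, by omega⟩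
      have hb := h4 j (by omega)
      rcases Nat.lt_or_ge (j + 2) n with h6 | h6
      · have := h2 (j + 1) (by omega); omega
      · obtain ⟨l, rfl⟩ : ∃ l, j = l + 1 := ⟨j - 1, by omega⟩
        have ha := h2 (l + 1) (by omega)
        have hc := h4 l (by omega)
        have hd : perm c (l + 1) ≠ perm c (l + 2) := fun h6 => by
          have := (perm c).injective h6; omega
        have he : l + 1 + 1 = l + 2 := rfl
        rw [he] at hb ⊢
        omega
  · exact perm_lt hc i hi

theorem inv (h : Std n s) : Std n fun i => (s i)⁻¹ :=
  ⟨h.tuple.inv, fun i hi => inv_mem (h.mem i hi), fun i hi => by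
    rw [map_inv, h.perm_eq i hi, Equiv.swap_inv]⟩

theorem conj_twist (h : Std n s) {b : Br} (hb : b ∈ Bn n) (hp : perm b = 1) (t : ℤ) :
    Std n fun i => b⁻¹ * s i * b * T n ^ t := by
  have hmem : ∀ i, i + 1 < n → b⁻¹ * s i * b ∈ Bn n := fun i hi =>
    mul_mem (mul_mem (inv_mem hb) (h.mem i hi)) hb
  have h1 : BraidTuple n fun i => b⁻¹ * s i * b := by
    simpa only [MulAut.conj_apply, inv_inv, MulEquiv.coe_toMonoidHom] using
      h.tuple.map (MulAut.conj b⁻¹).toMonoidHom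
  exact ⟨h1.mul_central fun i hi => T_zpow_comm (hmem i hi) t, fun i hi =>
    mul_mem (hmem i hi) (zpow_mem (T_mem n) _), fun i hi => by
      rw [map_mul, map_mul, map_mul, map_inv, hp, map_zpow, perm_T, h.perm_eq i hi]; simp⟩

theorem step (hm : 4 ≤ m) (IH : ∀ s, Std m s → Geo m s) (h : Std (m + 1) s) : Geo (m + 1) s := by
  have hfix : ∀ i, i + 1 < m → s i ∈ fixLast m := fun i hi => ⟨h.mem i (by omega), by
    rw [h.perm_eq i (by omega), Equiv.swap_apply_of_ne_of_ne (by omega) (by omega)]⟩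
  have hβ : Std m fun i => forget m (s i) := by
    refine ⟨⟨fun i hi => ?_, fun i j hij hj => ?_⟩, fun i hi => forget_mem (hfix i hi),
      fun i hi => by rw [perm_forget (hfix i hi), h.perm_eq i (by omega)]⟩
    · have h1 := hfix i (by omega)
      have h2 := hfix (i + 1) (by omega)
      simp only [← homOn_forget _ h1 _ h2, ← homOn_forget _ h2 _ h1,
        ← homOn_forget _ (mul_mem h1 h2) _ h1, ← homOn_forget _ (mul_mem h2 h1) _ h2,
        h.tuple.braid i (by omega)]
    · have h1 := hfix i (by omega)
      have h2 := hfix j (by omega)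
      show _ * _ = _ * _
      rw [← homOn_forget _ h1 _ h2, ← homOn_forget _ h2 _ h1,
        (h.tuple.comm i j hij (by omega)).eq]
  obtain ⟨c, hc, t, e, he, hg⟩ := IH _ hβ
  have hc' : c ∈ Bn (m + 1) := gens_mono (by omega) hc
  have hpc : perm c = 1 := by
    refine perm_eq_one_of_swap hc (by omega) fun i hi => ?_
    have h0 : forget m (s i) = c * σ i ^ e * c⁻¹ * T m ^ t := hg i hi
    have h1 : perm (forget m (s i)) = _ := hβ.perm_eq i hi
    rw [h0, map_mul, map_mul, map_mul, map_inv, map_zpow, map_zpow, perm_T, one_zpow, mul_one,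
      perm_σ] at h1
    rcases he with rfl | rfl
    · rwa [zpow_one] at h1
    · rwa [zpow_neg_one, Equiv.swap_inv] at h1
  have hstd := h.conj_twist hc' hpc (-t)
  have hforget : ∀ i, i + 1 < m →
      forget m (c⁻¹ * s i * c * T (m + 1) ^ (-t)) = σ i ^ e := by
    intro i hi
    have hcf := Bn_le_fixLast hc
    have hTf : T (m + 1) ^ (-t) ∈ fixLast m := zpow_mem (T_mem_fixLast m) _
    have h1 : forget m (s i) = c * σ i ^ e * c⁻¹ * T m ^ t := hg i hi
    rw [homOn_forget _ (mul_mem (mul_mem (inv_mem hcf) (hfix i hi)) hcf) _ hTf,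
      homOn_forget _ (mul_mem (inv_mem hcf) (hfix i hi)) _ hcf,
      homOn_forget _ (inv_mem hcf) _ (hfix i hi), homOn_forget.zpow (T_mem_fixLast m), forget_T,
      forget_of_mem hc, forget_of_mem (inv_mem hc), h1]
    have h2 : c⁻¹ * (c * σ i ^ e * c⁻¹ * T m ^ t) * c * T m ^ (-t) =
      σ i ^ e * c⁻¹ * (T m ^ t * c) * T m ^ (-t) := by group
    rw [h2, ← (T_zpow_comm hc t).eq]
    group
  rcases he with rfl | rfl
  · exact Geo.conj_twist hc' (hstd.geo_of_forget hm fun i hi => by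
      rw [hforget i hi, zpow_one])
  · refine Geo.conj_twist hc' (t := -t) (Geo.inv (hstd.inv.geo_of_forget hm fun i hi => ?_))
    rw [homOn_forget.inv, hforget i hi, zpow_neg_one, inv_inv]
    exact mul_mem (mul_mem (mul_mem (inv_mem (Bn_le_fixLast hc)) (hfix i hi)) (Bn_le_fixLast hc))
      (zpow_mem (T_mem_fixLast m) _)

end Std

end extension

end BraidInj

namespace BraidInj

open FreeGroup (of lift norm)

section rankTwo

/-- The automorphisms of the free group of rank two induced by conjugation in `B_4`. -/
def rankTwoEven : MulAut (FreeGroup (Fin 2)) :=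
  MonoidHom.toMulEquiv (lift ![of 0 * of 1, of 1]) (lift ![of 0 * (of 1)⁻¹, of 1])
    (by ext i; fin_cases i <;> simp) (by ext i; fin_cases i <;> simp)

def rankTwoOdd : MulAut (FreeGroup (Fin 2)) :=
  MonoidHom.toMulEquiv (lift ![of 0 * of 1 * of 0, (of 0)⁻¹])
    (lift ![(of 1)⁻¹, of 1 * of 0 * of 1])
    (by ext i; fin_cases i <;> simp [mul_assoc]) (by ext i; fin_cases i <;> simp [mul_assoc])

def rankTwoLast : MulAut (FreeGroup (Fin 2)) :=
  MonoidHom.toMulEquiv (lift ![of 1 * of 0, of 1]) (lift ![(of 1)⁻¹ * of 0, of 1])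
    (by ext i; fin_cases i <;> simp) (by ext i; fin_cases i <;> simp)

theorem rankTwoEven_apply (f : FreeGroup (Fin 2)) :
    rankTwoEven f = lift ![of 0 * of 1, of 1] f := rfl

theorem rankTwoOdd_apply (f : FreeGroup (Fin 2)) :
    rankTwoOdd f = lift ![of 0 * of 1 * of 0, (of 0)⁻¹] f := rfl

theorem rankTwoLast_apply (f : FreeGroup (Fin 2)) :
    rankTwoLast f = lift ![of 1 * of 0, of 1] f := rfl

/-- The sequence of automorphisms of the free group of rank two corresponding to `σ 0, σ 1, σ 2`. -/
def rankTwo : ℕ → MulAut (FreeGroup (Fin 2))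
  | 0 => rankTwoEven
  | 1 => rankTwoOdd
  | _ => rankTwoLast

theorem mulAut_ext' {α : Type*} {f g : MulAut (FreeGroup α)} (h : ∀ i, f (of i) = g (of i)) :
    f = g := by
  have : f.toMonoidHom = g.toMonoidHom := FreeGroup.ext_hom _ _ h
  exact MulEquiv.ext fun x => DFunLike.congr_fun this x

theorem braidTuple_rankTwo : BraidTuple 4 rankTwo := by
  constructor
  · intro i hi
    have : i = 0 ∨ i = 1 := by omega
    rcases this with rfl | rfl <;> refine mulAut_ext' fun j => ?_ <;> fin_cases j <;>
      simp [rankTwo, rankTwoEven_apply, rankTwoOdd_apply, rankTwoLast_apply, mul_assoc]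
  · intro i j hij hj
    obtain ⟨rfl, rfl⟩ : i = 0 ∧ j = 2 := by omega
    refine mulAut_ext' fun j => ?_
    fin_cases j <;>
      simp [rankTwo, rankTwoEven_apply, rankTwoLast_apply, mul_assoc]

/-- The action of `B_4` on the free group of rank two. -/
noncomputable def Θ : Br → MulAut (FreeGroup (Fin 2)) := evalTuple braidTuple_rankTwo

theorem homOn_Θ : HomOn (Bn 4) Θ := homOn_evalTuple _

theorem Θ_zero : Θ (σ 0) = rankTwoEven := evalTuple_σ braidTuple_rankTwo (by norm_num)
theorem Θ_one : Θ (σ 1) = rankTwoOdd := evalTuple_σ braidTuple_rankTwo (by norm_num)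
theorem Θ_two : Θ (σ 2) = rankTwoLast := evalTuple_σ braidTuple_rankTwo (by norm_num)

/-- The free normal subgroup of rank two of `B_4`. -/
def κ : FreeGroup (Fin 2) →* Br :=
  lift ![σ 1 * (σ 0 * (σ 2)⁻¹) * (σ 1)⁻¹, σ 2 * (σ 0)⁻¹]

@[simp] theorem κ_zero : κ (of 0) = σ 1 * (σ 0 * (σ 2)⁻¹) * (σ 1)⁻¹ := by simp [κ]
@[simp] theorem κ_one : κ (of 1) = σ 2 * (σ 0)⁻¹ := by simp [κ]

theorem κ_mem (f : FreeGroup (Fin 2)) : κ f ∈ Bn 4 := by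
  have h0 : σ 0 ∈ Bn 4 := σ_mem (by norm_num)
  have h1 : σ 1 ∈ Bn 4 := σ_mem (by norm_num)
  have h2 : σ 2 ∈ Bn 4 := σ_mem (by norm_num)
  induction f using FreeGroup.induction_on with
  | C1 => rw [map_one]; exact one_mem _
  | of i =>
    fin_cases i
    · simpa using mul_mem (mul_mem h1 (mul_mem h0 (inv_mem h2))) (inv_mem h1)
    · simpa using mul_mem h2 (inv_mem h0)
  | inv_of i h => rw [map_inv]; exact inv_mem h
  | mul x y hx hy => rw [map_mul]; exact mul_mem hx hy

theorem artin_symm_self (i : ℕ) : (artin i).symm (of i) = of (i + 1) := by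
  rw [MulEquiv.symm_apply_eq, artin_succ]

theorem artin_symm_succ (i : ℕ) :
    (artin i).symm (of (i + 1)) = (of (i + 1))⁻¹ * of i * of (i + 1) := by
  rw [MulEquiv.symm_apply_eq]
  simp [mul_assoc]

theorem artin_symm_of_ne {i j : ℕ} (h1 : j ≠ i) (h2 : j ≠ i + 1) :
    (artin i).symm (of j) = of j := by
  rw [MulEquiv.symm_apply_eq, artin_of_ne h1 h2]

theorem κ_conj_σ (i : ℕ) (hi : i + 1 < 4) (j : Fin 2) :
    σ i * κ (of j) * (σ i)⁻¹ = κ (rankTwo i (of j)) := by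
  have h : σ i ∈ Bn 4 := σ_mem hi
  have a : ∀ i j, j = i + 1 → artin i (of j) = of i := fun i _ h => h ▸ artin_succ i
  have b : ∀ i j, j = i + 1 → (artin i).symm (of j) = (of j)⁻¹ * of i * of j := fun i _ h =>
    h ▸ artin_symm_succ i
  refine eq_of_act (n := 4) (mul_mem (mul_mem h (κ_mem _)) (inv_mem h)) (κ_mem _) fun k hk => ?_
  obtain rfl | rfl | rfl : i = 0 ∨ i = 1 ∨ i = 2 := by omega
  all_goals fin_cases j <;> interval_cases k <;>
    simp [rankTwo, rankTwoEven_apply, rankTwoOdd_apply, rankTwoLast_apply, a, b, artin_of_ne, artin_symm_of_ne, artin_symm_self, mul_assoc]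

theorem κ_conj {g : Br} (hg : g ∈ Bn 4) : ∀ f, g * κ f * g⁻¹ = κ (Θ g f) := by
  refine gens_induction (p := fun g => g ∈ Bn 4 ∧ ∀ f, g * κ f * g⁻¹ = κ (Θ g f)) ?_ ?_ ?_ ?_ hg
    |>.2
  · intro i hi
    have : (MulAut.conj (σ i)).toMonoidHom.comp κ = κ.comp (Θ (σ i)).toMonoidHom := by
      refine FreeGroup.ext_hom _ _ fun j => ?_
      simpa [Θ, evalTuple_σ braidTuple_rankTwo hi] using κ_conj_σ i hi j
    exact ⟨σ_mem hi, fun f => DFunLike.congr_fun this f⟩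
  · exact ⟨one_mem _, fun f => by simp [homOn_Θ.one]⟩
  · rintro x y ⟨hx, h1⟩ ⟨hy, h2⟩
    refine ⟨mul_mem hx hy, fun f => ?_⟩
    rw [homOn_Θ x hx y hy, MulAut.mul_apply, ← h1, ← h2]
    group
  · rintro x ⟨hx, h1⟩
    refine ⟨inv_mem hx, fun f => ?_⟩
    have := h1 ((Θ x)⁻¹ f)
    rw [MulAut.apply_inv_self] at this
    rw [homOn_Θ.inv hx, ← this]
    group

theorem Θ_κ (f : FreeGroup (Fin 2)) : Θ (κ f) = MulAut.conj f := by
  have hΘ := homOn_Θ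
  have m0 : σ 0 ∈ Bn 4 := σ_mem (by norm_num)
  have m1 : σ 1 ∈ Bn 4 := σ_mem (by norm_num)
  have m2 : σ 2 ∈ Bn 4 := σ_mem (by norm_num)
  have h1 : Θ (κ (of 1)) = MulAut.conj (of 1) := by
    rw [κ_one, hΘ _ m2 _ (inv_mem m0), hΘ.inv m0, Θ_zero, Θ_two, mul_inv_eq_iff_eq_mul]
    refine mulAut_ext' fun j => ?_
    fin_cases j <;> simp [rankTwoEven_apply, rankTwoLast_apply, mul_assoc]
  have h0 : Θ (κ (of 0)) = MulAut.conj (of 0) := by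
    have : κ (of 0) = σ 1 * κ (of 1)⁻¹ * (σ 1)⁻¹ := by simp
    rw [this, hΘ.conj m1 (κ_mem _), map_inv, hΘ.inv (κ_mem _), h1, Θ_one, mul_inv_eq_iff_eq_mul]
    refine mulAut_ext' fun j => ?_
    fin_cases j <;> simp [rankTwoOdd_apply, mul_assoc, MulAut.inv_apply]
  induction f using FreeGroup.induction_on with
  | C1 => rw [map_one, map_one, hΘ.one]
  | of i => fin_cases i; exacts [h0, h1]
  | inv_of i h => rw [map_inv, map_inv, hΘ.inv (κ_mem _), h]
  | mul x y hx hy => rw [map_mul, map_mul, hΘ _ (κ_mem _) _ (κ_mem _), hx, hy]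

theorem κ_injective : Function.Injective κ := by
  rw [injective_iff_map_eq_one]
  intro f hf
  by_contra h
  have h1 := Θ_κ f
  rw [hf, homOn_Θ.one] at h1
  have h2 := subsingleton_of_central h fun g => by
    have := DFunLike.congr_fun h1 g
    rw [MulAut.one_apply, MulAut.conj_apply] at this
    exact (mul_inv_eq_iff_eq_mul.1 this.symm)
  exact absurd (h2.elim 0 1) (by decide)

theorem exists_κ_mul {g : Br} (hg : g ∈ Bn 4) : ∃ f, ∃ b ∈ Bn 3, g = κ f * b := by
  have hle : Bn 3 ≤ Bn 4 := gens_mono (by norm_num)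
  refine gens_induction (p := fun g => ∃ f, ∃ b ∈ Bn 3, g = κ f * b) ?_ ?_ ?_ ?_ hg
  · intro i hi
    obtain rfl | rfl | rfl : i = 0 ∨ i = 1 ∨ i = 2 := by omega
    · exact ⟨1, σ 0, σ_mem (by norm_num), by simp⟩
    · exact ⟨1, σ 1, σ_mem (by norm_num), by simp⟩
    · exact ⟨of 1, σ 0, σ_mem (by norm_num), by simp⟩
  · exact ⟨1, 1, one_mem _, by simp⟩
  · rintro _ _ ⟨f, b, hb, rfl⟩ ⟨f', b', hb', rfl⟩
    refine ⟨f * Θ b f', b * b', mul_mem hb hb', ?_⟩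
    rw [map_mul, ← κ_conj (hle hb)]
    group
  · rintro _ ⟨f, b, hb, rfl⟩
    refine ⟨Θ b⁻¹ f⁻¹, b⁻¹, inv_mem hb, ?_⟩
    rw [← κ_conj (inv_mem (hle hb)), map_inv]
    group

/-- The commutator of the two generators. -/
def com : FreeGroup (Fin 2) := of 0 * of 1 * (of 0)⁻¹ * (of 1)⁻¹

theorem T_three_sq : T 3 ^ 2 = κ com * T 4 := by
  have h : T 3 = κ com * J 3 := by
    have a : ∀ i j, j = i + 1 → artin i (of j) = of i := fun i _ h => h ▸ artin_succ i
    have b : ∀ i j, j = i + 1 → (artin i).symm (of j) = (of j)⁻¹ * of i * of j := fun i _ h =>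
      h ▸ artin_symm_succ i
    refine eq_of_act (n := 4) (gens_mono (by norm_num) (T_mem 3)) (mul_mem (κ_mem _) (J_mem 3))
      fun k hk => ?_
    interval_cases k <;> simp [com, J_succ, J_zero, T, a, b, artin_of_ne, artin_symm_of_ne,
      artin_symm_self, mul_assoc]
  rw [T_succ 3, sq]
  nth_rw 1 [h]
  rw [mul_assoc, (commute_J (T_mem 3)).eq]

end rankTwo

end BraidInj

namespace BraidInj

open FreeGroup (of lift norm)
open Matrix

section linear

/-- The abelianization of the free group of rank two. -/
def ab (f : FreeGroup (Fin 2)) : Fin 2 → ℤ := fun i => (expo i f).toAdd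

@[simp] theorem ab_one : ab 1 = 0 := by ext i; simp [ab]

@[simp] theorem ab_mul (f g : FreeGroup (Fin 2)) : ab (f * g) = ab f + ab g := by
  ext i; simp [ab]

@[simp] theorem ab_inv (f : FreeGroup (Fin 2)) : ab f⁻¹ = -ab f := by ext i; simp [ab]

@[simp] theorem ab_zpow (f : FreeGroup (Fin 2)) (k : ℤ) : ab (f ^ k) = k • ab f := by
  ext i; simp [ab]

theorem ab_of (i : Fin 2) : ab (of i) = Pi.single i 1 := by
  ext j
  by_cases h : i = j
  · subst h; simp [ab]
  · simp [ab, h, Ne.symm h]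

@[simp] theorem ab_of_zero : ab (of 0) = ![1, 0] := by rw [ab_of]; decide
@[simp] theorem ab_of_one : ab (of 1) = ![0, 1] := by rw [ab_of]; decide

/-- The matrix of an automorphism on the abelianization. -/
def matFun (α : MulAut (FreeGroup (Fin 2))) : Matrix (Fin 2) (Fin 2) ℤ :=
  Matrix.of fun i j => ab (of' j) i
where of' (j : Fin 2) : FreeGroup (Fin 2) := α (of j)

theorem ab_apply (α : MulAut (FreeGroup (Fin 2))) (f : FreeGroup (Fin 2)) :
    ab (α f) = matFun α *ᵥ ab f := by
  induction f using FreeGroup.induction_on with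
  | C1 => simp
  | of j => ext i; rw [ab_of, mulVec_single_one]; rfl
  | inv_of j h => rw [map_inv, ab_inv, h, ab_inv, mulVec_neg]
  | mul x y hx hy => rw [map_mul, ab_mul, hx, hy, ab_mul, mulVec_add]

def mat : MulAut (FreeGroup (Fin 2)) →* Matrix (Fin 2) (Fin 2) ℤ where
  toFun := matFun
  map_one' := by
    ext i j
    change ab (of j) i = _
    rw [ab_of, one_apply, Pi.single_apply]
  map_mul' α β := by
    ext i j
    have := congrFun (ab_apply α (β (of j))) i
    exact this

theorem ab_mat (α : MulAut (FreeGroup (Fin 2))) (f : FreeGroup (Fin 2)) :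
    ab (α f) = mat α *ᵥ ab f := ab_apply α f

theorem mat_apply (α : MulAut (FreeGroup (Fin 2))) (i j : Fin 2) :
    mat α i j = ab (α (of j)) i := rfl

theorem mat_conj (f : FreeGroup (Fin 2)) : mat (MulAut.conj f) = 1 := by
  ext i j
  rw [mat_apply, MulAut.conj_apply, ab_mul, ab_mul, ab_inv, ab_of, one_apply]
  simp [Pi.single_apply]

theorem mat_inv_mul (α : MulAut (FreeGroup (Fin 2))) : mat α⁻¹ * mat α = 1 := by
  rw [← map_mul, inv_mul_cancel, map_one]

theorem mat_mul_inv (α : MulAut (FreeGroup (Fin 2))) : mat α * mat α⁻¹ = 1 := by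
  rw [← map_mul, mul_inv_cancel, map_one]

theorem mat_even : mat rankTwoEven = !![1, 0; 1, 1] := by
  ext i j; fin_cases i <;> fin_cases j <;> simp [mat_apply, rankTwoEven_apply]

theorem mat_odd : mat rankTwoOdd = !![2, -1; 1, 0] := by
  ext i j; fin_cases i <;> fin_cases j <;> simp [mat_apply, rankTwoOdd_apply]

theorem mat_last : mat rankTwoLast = !![1, 0; 1, 1] := by
  ext i j; fin_cases i <;> fin_cases j <;> simp [mat_apply, rankTwoLast_apply]

theorem eq_of_mat_mul {A B C : Matrix (Fin 2) (Fin 2) ℤ} (h : A * B = 1) (h' : B * C = 1) :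
    A = C := by
  rw [← mul_one A, ← h', ← mul_assoc, h, one_mul]

theorem mat_even_inv : mat rankTwoEven⁻¹ = !![1, 0; -1, 1] := by
  refine eq_of_mat_mul (mat_inv_mul _) ?_
  rw [mat_even]; ext i j; fin_cases i <;> fin_cases j <;> simp

theorem mat_odd_inv : mat rankTwoOdd⁻¹ = !![0, 1; -1, 2] := by
  refine eq_of_mat_mul (mat_inv_mul _) ?_
  rw [mat_odd]; ext i j; fin_cases i <;> fin_cases j <;> simp

theorem det_mat_Θ {g : Br} (hg : g ∈ Bn 4) : (mat (Θ g)).det = 1 := by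
  have hΘ := homOn_Θ
  refine (gens_induction (p := fun g => g ∈ Bn 4 ∧ (mat (Θ g)).det = 1) ?_ ?_ ?_ ?_ hg).2
  · intro i hi
    refine ⟨σ_mem hi, ?_⟩
    obtain rfl | rfl | rfl : i = 0 ∨ i = 1 ∨ i = 2 := by omega
    · rw [Θ_zero, mat_even]; simp [det_fin_two]
    · rw [Θ_one, mat_odd]; simp [det_fin_two]
    · rw [Θ_two, mat_last]; simp [det_fin_two]
  · exact ⟨one_mem _, by rw [hΘ.one, map_one, det_one]⟩
  · rintro x y ⟨hx, h1⟩ ⟨hy, h2⟩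
    exact ⟨mul_mem hx hy, by rw [hΘ x hx y hy, map_mul, det_mul, h1, h2, one_mul]⟩
  · rintro x ⟨hx, h1⟩
    refine ⟨inv_mem hx, ?_⟩
    have := congrArg det (mat_inv_mul (Θ x))
    rwa [det_mul, h1, mul_one, det_one, ← hΘ.inv hx] at this

/-- The matrix of an automorphism on the abelianization, modulo two. -/
def matTwo : MulAut (FreeGroup (Fin 2)) →* Matrix (Fin 2) (Fin 2) (ZMod 2) :=
  (Int.castRingHom (ZMod 2)).mapMatrix.toMonoidHom.comp mat

/-- The points of the affine plane over the field with two elements, numbered from 0 to 3. -/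
def pt (i : ℕ) : Fin 2 → ZMod 2 := ![(i / 2 : ℕ), i]

theorem matTwo_apply (α : MulAut (FreeGroup (Fin 2))) (i j : Fin 2) :
    matTwo α i j = (mat α i j : ZMod 2) := rfl

theorem matTwo_Θ {g : Br} (hg : g ∈ Bn 4) : ∀ i < 4, ∀ j < 4,
    matTwo (Θ g) *ᵥ (pt i + pt j) = pt (perm g i) + pt (perm g j) := by
  have hΘ := homOn_Θ
  refine (gens_induction (p := fun g => g ∈ Bn 4 ∧ ∀ i < 4, ∀ j < 4,
    matTwo (Θ g) *ᵥ (pt i + pt j) = pt (perm g i) + pt (perm g j)) ?_ ?_ ?_ ?_ hg).2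
  · intro k hk
    refine ⟨σ_mem hk, ?_⟩
    have e : matTwo (Θ (σ 0)) = !![1, 0; 1, 1] := by
      ext i j; rw [matTwo_apply, Θ_zero, mat_even]; fin_cases i <;> fin_cases j <;> simp
    have o : matTwo (Θ (σ 1)) = !![0, 1; 1, 0] := by
      ext i j; rw [matTwo_apply, Θ_one, mat_odd]; fin_cases i <;> fin_cases j <;> decide
    have l : matTwo (Θ (σ 2)) = !![1, 0; 1, 1] := by
      ext i j; rw [matTwo_apply, Θ_two, mat_last]; fin_cases i <;> fin_cases j <;> simp
    obtain rfl | rfl | rfl : k = 0 ∨ k = 1 ∨ k = 2 := by omega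
    · rw [e, perm_σ]; decide
    · rw [o, perm_σ]; decide
    · rw [l, perm_σ]; decide
  · exact ⟨one_mem _, by simp [hΘ.one]⟩
  · rintro x y ⟨hx, h1⟩ ⟨hy, h2⟩
    refine ⟨mul_mem hx hy, fun i hi j hj => ?_⟩
    rw [hΘ x hx y hy, map_mul, ← mulVec_mulVec, h2 i hi j hj,
      h1 _ ((perm_lt_iff hy i).2 hi) _ ((perm_lt_iff hy j).2 hj), map_mul]
    rfl
  · rintro x ⟨hx, h1⟩
    refine ⟨inv_mem hx, fun i hi j hj => ?_⟩
    have := h1 (perm x⁻¹ i) ((perm_lt_iff (inv_mem hx) i).2 hi) (perm x⁻¹ j)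
      ((perm_lt_iff (inv_mem hx) j).2 hj)
    rw [← Equiv.Perm.mul_apply, ← Equiv.Perm.mul_apply, ← map_mul, mul_inv_cancel, map_one,
      Equiv.Perm.one_apply, Equiv.Perm.one_apply] at this
    rw [← this, mulVec_mulVec, hΘ.inv hx, ← map_mul, inv_mul_cancel, map_one, one_mulVec]

theorem perm_eq_one_of_mat {g : Br} (hg : g ∈ Bn 3) (h : mat (Θ g) = 1) : perm g = 1 := by
  have hg4 : g ∈ Bn 4 := gens_mono (by norm_num) hg
  have h1 : matTwo (Θ g) = 1 := by rw [matTwo, MonoidHom.comp_apply, h, map_one]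
  have h3 : perm g 3 = 3 := perm_lt hg 3 le_rfl
  ext i
  by_cases hi : i < 4
  · have h2 := matTwo_Θ hg4 i hi 3 (by norm_num)
    rw [h1, one_mulVec, h3] at h2
    have h4 := add_right_cancel h2
    have h5 := (perm_lt_iff hg4 i).2 hi
    generalize perm g i = k at h4 h5
    revert h4
    interval_cases i <;> interval_cases k <;> decide
  · exact perm_lt hg4 i (by omega)

/-- The action on nonzero integral vectors. -/
def linPerm : MulAut (FreeGroup (Fin 2)) →* Equiv.Perm {v : Fin 2 → ℤ // v ≠ 0} where
  toFun α :=
    { toFun := fun v => ⟨mat α *ᵥ v, fun h => v.2 (by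
        have : mat α⁻¹ *ᵥ (mat α *ᵥ v.1) = mat α⁻¹ *ᵥ 0 := congrArg (mat α⁻¹ *ᵥ ·) h
        rwa [mulVec_mulVec, mat_inv_mul, one_mulVec, mulVec_zero] at this)⟩
      invFun := fun v => ⟨mat α⁻¹ *ᵥ v, fun h => v.2 (by
        have : mat α *ᵥ (mat α⁻¹ *ᵥ v.1) = mat α *ᵥ 0 := congrArg (mat α *ᵥ ·) h
        rwa [mulVec_mulVec, mat_mul_inv, one_mulVec, mulVec_zero] at this)⟩
      left_inv := fun v => Subtype.ext (by
        change mat α⁻¹ *ᵥ (mat α *ᵥ v.1) = v.1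
        rw [mulVec_mulVec, mat_inv_mul, one_mulVec])
      right_inv := fun v => Subtype.ext (by
        change mat α *ᵥ (mat α⁻¹ *ᵥ v.1) = v.1
        rw [mulVec_mulVec, mat_mul_inv, one_mulVec]) }
  map_one' := by ext1 v; exact Subtype.ext (by change mat 1 *ᵥ v.1 = v.1; simp)
  map_mul' α β := by
    ext1 v
    exact Subtype.ext (by change mat (α * β) *ᵥ v.1 = mat α *ᵥ (mat β *ᵥ v.1); rw [map_mul, mulVec_mulVec])

theorem linPerm_val (α : MulAut (FreeGroup (Fin 2))) (v : {v : Fin 2 → ℤ // v ≠ 0}) :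
    (linPerm α v).1 = mat α *ᵥ v.1 := rfl

theorem linPerm_eq_one {α : MulAut (FreeGroup (Fin 2))} (h : mat α = 1) : linPerm α = 1 := by
  ext1 v; exact Subtype.ext (by rw [linPerm_val, h, one_mulVec]; rfl)

theorem linear_pingPong {a : Fin 2 → Equiv.Perm {v : Fin 2 → ℤ // v ≠ 0}}
    (h0 : ∀ v, (a 0 v).1 = ![-3 * v.1 0 + 2 * v.1 1, -8 * v.1 0 + 5 * v.1 1])
    (h1 : ∀ v, (a 1 v).1 = ![-v.1 0 + 2 * v.1 1, -2 * v.1 0 + 3 * v.1 1]) :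
    Function.Injective (lift a) := by
  let u : {v : Fin 2 → ℤ // v ≠ 0} → ℤ := fun v => 2 * v.1 0 - v.1 1
  let w : {v : Fin 2 → ℤ // v ≠ 0} → ℤ := fun v => v.1 1 - v.1 0
  have huw : ∀ v, u v = 0 → w v ≠ 0 := fun v hu hw => v.2 (by
    simp only [u, w] at hu hw
    ext i; fin_cases i <;> simp <;> omega)
  have hu0 : ∀ v, u (a 0 v) = u v := fun v => by simp [u, h0]; ring
  have hw0 : ∀ v, w (a 0 v) = w v - 2 * u v := fun v => by simp [u, w, h0]; ring
  have hu1 : ∀ v, u (a 1 v) = u v + 2 * w v := fun v => by simp [u, w, h1]; ring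
  have hw1 : ∀ v, w (a 1 v) = w v := fun v => by simp [w, h1]; ring
  let X : Fin 2 → Set {v : Fin 2 → ℤ // v ≠ 0} :=
    ![{v | w v * u v ≤ -(u v * u v) ∧ u v ≠ 0}, {v | w v * w v ≤ w v * u v}]
  let Y : Fin 2 → Set {v : Fin 2 → ℤ // v ≠ 0} :=
    ![{v | u v * u v < w v * u v ∨ u v = 0}, {v | w v * u v < -(w v * w v)}]
  have sq := fun x : ℤ => mul_self_nonneg x
  have sqp : ∀ x : ℤ, x ≠ 0 → 0 < x * x := fun x hx => mul_self_pos.2 hx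
  have dX : Disjoint (X 0) (X 1) := Set.disjoint_left.2 fun v hv hv' => by
    replace hv : w v * u v ≤ -(u v * u v) ∧ u v ≠ 0 := hv
    replace hv' : w v * w v ≤ w v * u v := hv'
    have := sq (w v); have := sqp _ hv.2; linarith [hv.1]
  have dY : Disjoint (Y 0) (Y 1) := Set.disjoint_left.2 fun v hv hv' => by
    replace hv : u v * u v < w v * u v ∨ u v = 0 := hv
    replace hv' : w v * u v < -(w v * w v) := hv'
    rcases hv with hv | hv
    · have := sq (w v); have := sq (u v); linarith
    · rw [hv, mul_zero] at hv'; have := sq (w v); linarith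
  refine FreeGroup.injective_lift_of_ping_pong a X Y ?_ ?_ ?_ ?_ ?_ ?_
  · intro i
    fin_cases i
    · exact ⟨⟨![0, -1], by decide⟩, by simp [X, u, w]⟩
    · exact ⟨⟨![1, 1], by decide⟩, by simp [X, u, w]⟩
  · intro i j hij
    fin_cases i <;> fin_cases j
    exacts [absurd rfl hij, dX, dX.symm, absurd rfl hij]
  · intro i j hij
    fin_cases i <;> fin_cases j
    exacts [absurd rfl hij, dY, dY.symm, absurd rfl hij]
  · intro i j
    refine Set.disjoint_left.2 fun v => ?_
    have s1 := sq (w v)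
    have s2 := sq (u v)
    have s3 := sq (w v + u v)
    have s4 := sq (w v - u v)
    fin_cases i <;> fin_cases j
    · rintro (⟨hv, hv'⟩ : w v * u v ≤ -(u v * u v) ∧ u v ≠ 0)
        (hv2 | hv2 : u v * u v < w v * u v ∨ u v = 0)
      · linarith
      · exact hv' hv2
    · intro hv hv2
      replace hv : w v * u v ≤ -(u v * u v) ∧ u v ≠ 0 := hv
      replace hv2 : w v * u v < -(w v * w v) := hv2
      nlinarith [hv.1]
    · intro hv hv2
      replace hv : w v * w v ≤ w v * u v := hv
      replace hv2 : u v * u v < w v * u v ∨ u v = 0 := hv2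
      rcases hv2 with hv2 | hv2
      · nlinarith
      · rw [hv2] at hv
        have := sqp _ (huw v hv2)
        linarith
    · intro hv hv2
      replace hv : w v * w v ≤ w v * u v := hv
      replace hv2 : w v * u v < -(w v * w v) := hv2
      linarith
  · intro i
    fin_cases i
    · rintro _ ⟨v, hv, rfl⟩
      change ¬(u v * u v < w v * u v ∨ u v = 0) at hv
      change w (a 0 v) * u (a 0 v) ≤ -(u (a 0 v) * u (a 0 v)) ∧ u (a 0 v) ≠ 0
      rw [hu0, hw0]
      push Not at hv
      exact ⟨by linarith [hv.1], hv.2⟩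
    · rintro _ ⟨v, hv, rfl⟩
      change ¬(w v * u v < -(w v * w v)) at hv
      change w (a 1 v) * w (a 1 v) ≤ w (a 1 v) * u (a 1 v)
      rw [hu1, hw1]
      linarith
  · intro i
    fin_cases i
    · rintro _ ⟨v, hv, rfl⟩
      obtain ⟨y, rfl⟩ := (a 0).surjective v
      change (a 0)⁻¹ (a 0 y) ∈ Y 0
      rw [← Equiv.Perm.mul_apply, inv_mul_cancel, Equiv.Perm.one_apply]
      change ¬(w (a 0 y) * u (a 0 y) ≤ -(u (a 0 y) * u (a 0 y)) ∧ u (a 0 y) ≠ 0) at hv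
      rw [hu0, hw0] at hv
      change u y * u y < w y * u y ∨ u y = 0
      by_contra h
      push Not at h
      exact hv ⟨by linarith [h.1], h.2⟩
    · rintro _ ⟨v, hv, rfl⟩
      obtain ⟨y, rfl⟩ := (a 1).surjective v
      change (a 1)⁻¹ (a 1 y) ∈ Y 1
      rw [← Equiv.Perm.mul_apply, inv_mul_cancel, Equiv.Perm.one_apply]
      change ¬(w (a 1 y) * w (a 1 y) ≤ w (a 1 y) * u (a 1 y)) at hv
      rw [hu1, hw1] at hv
      change w y * u y < -(w y * w y)
      linarith

theorem push_two_mat {f : FreeGroup ℕ} (hf : f ∈ Fr 2) (h : mat (Θ (push 2 f)) = 1) : f = 1 := by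
  have hΘ := homOn_Θ
  have m0 : σ 0 ∈ Bn 4 := σ_mem (by norm_num)
  have m1 : σ 1 ∈ Bn 4 := σ_mem (by norm_num)
  have m1' : (σ 1 * σ 1)⁻¹ ∈ Bn 4 := inv_mem (mul_mem m1 m1)
  have h34 : Bn 3 ≤ Bn 4 := gens_mono (by norm_num)
  let a : Fin 2 → Equiv.Perm {v : Fin 2 → ℤ // v ≠ 0} := fun i => linPerm (Θ (push 2 (of i.1)))
  have ha : ∀ f : FreeGroup (Fin 2), FreeGroup.map Fin.val f ∈ Fr 2 ∧
      lift a f = linPerm (Θ (push 2 (FreeGroup.map Fin.val f))) := by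
    intro f
    induction f using FreeGroup.induction_on with
    | C1 => simp [hΘ.one, one_mem]
    | of i => simp only [FreeGroup.map.of, FreeGroup.lift_apply_of]; exact ⟨of_mem_Fr i.2, rfl⟩
    | inv_of i h =>
      refine ⟨by rw [map_inv]; exact inv_mem h.1, ?_⟩
      rw [map_inv, h.2, map_inv, map_inv, hΘ.inv (h34 (push_mem h.1)), map_inv]
    | mul x y hx hy =>
      refine ⟨by rw [map_mul]; exact mul_mem hx.1 hy.1, ?_⟩
      rw [map_mul, hx.2, hy.2, map_mul, map_mul,
        hΘ _ (h34 (push_mem hx.1)) _ (h34 (push_mem hy.1)), map_mul]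
  obtain ⟨f', rfl⟩ : ∃ f' : FreeGroup (Fin 2), FreeGroup.map Fin.val f' = f :=
    (Fr_le (K := (FreeGroup.map Fin.val).range)).2
      (fun i hi => ⟨of ⟨i, hi⟩, by simp⟩) hf
  have e1 : mat (Θ (push 2 (of 1))) = !![-1, 2; -2, 3] := by
    rw [push_of, pureFam_last (by norm_num), hΘ.inv (mul_mem m1 m1), hΘ _ m1 _ m1, Θ_one,
      _root_.mul_inv_rev, map_mul, mat_odd_inv]
    ext i j; fin_cases i <;> fin_cases j <;> simp
  have e0 : mat (Θ (push 2 (of 0))) = !![-3, 2; -8, 5] := by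
    rw [push_of, pureFam_rec (by norm_num), ← push_of, hΘ.conj m0 (h34 (push_mem
      (of_mem_Fr (by norm_num)))), map_mul, map_mul, e1, Θ_zero, mat_even, mat_even_inv]
    ext i j; fin_cases i <;> fin_cases j <;> simp
  have hinj : Function.Injective (lift a) := by
    refine linear_pingPong (fun v => ?_) fun v => ?_
    · change mat (Θ (push 2 (of 0))) *ᵥ v.1 = _
      rw [e0]; ext i; fin_cases i <;> simp [mulVec, dotProduct, Fin.sum_univ_two]
    · change mat (Θ (push 2 (of 1))) *ᵥ v.1 = _
      rw [e1]; ext i; fin_cases i <;> simp [mulVec, dotProduct, Fin.sum_univ_two]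
  have := (ha f').2
  rw [linPerm_eq_one h] at this
  rw [(injective_iff_map_eq_one _).1 hinj f' this, map_one]

end linear

end BraidInj

namespace BraidInj

open FreeGroup (of lift norm)
open Matrix

section scalar

theorem T_two : T 2 = σ 0 * σ 0 := by
  simp [T_succ, J_succ, show T 0 = 1 from rfl]

theorem mat_T_three : mat (Θ (T 3)) = -1 := by
  have hΘ := homOn_Θ
  have m0 : σ 0 ∈ Bn 4 := σ_mem (by norm_num)
  have m1 : σ 1 ∈ Bn 4 := σ_mem (by norm_num)
  have e : T 3 = σ 0 * σ 0 * (σ 1 * (σ 0 * σ 0) * σ 1) := by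
    simp [T_succ, J_succ, show T 0 = 1 from rfl]
  rw [e, hΘ _ (mul_mem m0 m0) _ (mul_mem (mul_mem m1 (mul_mem m0 m0)) m1), hΘ _ m0 _ m0,
    hΘ _ (mul_mem m1 (mul_mem m0 m0)) _ m1, hΘ _ m1 _ (mul_mem m0 m0), hΘ _ m0 _ m0, Θ_zero, Θ_one]
  simp only [map_mul, mat_even, mat_odd]
  ext i j; fin_cases i <;> fin_cases j <;> simp

theorem neg_one_zpow_cases (M : (Matrix (Fin 2) (Fin 2) ℤ)ˣ) (h : M.1 = -1) (k : ℤ) :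
    (M ^ k).1 = 1 ∨ (M ^ k).1 = -1 := by
  obtain rfl : M = -1 := Units.ext h
  rcases Int.even_or_odd k with hk | hk
  · exact .inl (by rw [hk.neg_one_zpow]; rfl)
  · exact .inr (by rw [hk.neg_one_zpow]; rfl)

theorem mat_zpow_cases {α : MulAut (FreeGroup (Fin 2))} (h : mat α = -1) (k : ℤ) :
    mat (α ^ k) = 1 ∨ mat (α ^ k) = -1 := by
  have := neg_one_zpow_cases (Units.map mat (toUnits α)) h k
  rwa [← map_zpow, ← map_zpow] at this

theorem T_three_mem : T 3 ∈ Bn 4 := gens_mono (by norm_num) (T_mem 3)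

theorem mat_T_three_zpow (k : ℤ) : mat (Θ (T 3 ^ k)) = 1 ∨ mat (Θ (T 3 ^ k)) = -1 := by
  rw [homOn_Θ.zpow T_three_mem]; exact mat_zpow_cases mat_T_three k

theorem exists_push_two {g : Br} (hg : g ∈ Bn 3) (hp : perm g = 1) :
    ∃ f ∈ Fr 2, ∃ k : ℤ, g = push 2 f * T 3 ^ k := by
  obtain ⟨f, hf, b, hb, rfl⟩ := exists_push hg (by rw [hp]; rfl)
  rw [map_mul, perm_push hf, one_mul] at hp
  obtain ⟨m, rfl⟩ : b ∈ Subgroup.zpowers (σ 0) := by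
    refine gens_le.2 (fun i hi => ?_) hb
    obtain rfl : i = 0 := by omega
    exact Subgroup.mem_zpowers _
  change perm (σ 0 ^ m) = 1 at hp
  obtain ⟨j, rfl⟩ : Even m := by
    by_contra h
    obtain ⟨j, rfl⟩ := Int.not_even_iff_odd.1 h
    rw [map_zpow, perm_σ, _root_.zpow_add, _root_.zpow_mul, zpow_one, zpow_ofNat, pow_two,
      Equiv.swap_mul_self, _root_.one_zpow, one_mul] at hp
    simpa using congrArg (· 0) hp
  have e : σ 0 ^ (j + j) = push 2 (D 2) ^ j * T 3 ^ j := by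
    have h1 : T 2 = push 2 (D 2) * T 3 := by
      have : T 3 = T 2 * J 2 := T_succ 2
      rw [this, (commute_J (T_mem 2)).eq, J_eq_push, map_inv]; group
    have h2 : Commute (push 2 (D 2)) (T 3) := commute_T (push_mem (D_mem_Fr 2))
    rw [← h2.mul_zpow, ← h1, T_two, Commute.mul_zpow rfl, _root_.zpow_add]
  exact ⟨f * D 2 ^ j, mul_mem hf (zpow_mem (D_mem_Fr 2) j), j, by
    change push 2 f * σ 0 ^ (j + j) = _
    rw [e, map_mul, map_zpow, mul_assoc]⟩

theorem eq_T_three_zpow {g : Br} (hg : g ∈ Bn 3) (h : mat (Θ g) = 1 ∨ mat (Θ g) = -1) :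
    ∃ k : ℤ, g = T 3 ^ k := by
  have hΘ := homOn_Θ
  have h34 : Bn 3 ≤ Bn 4 := gens_mono (by norm_num)
  have hp : perm g = 1 := by
    rcases h with h | h
    · exact perm_eq_one_of_mat hg h
    · have := perm_eq_one_of_mat (mul_mem hg (T_mem 3))
        (by rw [hΘ _ (h34 hg) _ T_three_mem, map_mul, h, mat_T_three]; simp)
      rwa [map_mul, perm_T, mul_one] at this
  obtain ⟨f, hf, k, rfl⟩ := exists_push_two hg hp
  have hf4 := h34 (push_mem hf)
  have hf1 : mat (Θ (push 2 f)) = 1 ∨ mat (Θ (push 2 f)) = -1 := by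
    rw [hΘ _ hf4 _ (zpow_mem T_three_mem k), map_mul] at h
    rcases mat_T_three_zpow k with hk | hk <;> rw [hk] at h
    · simpa using h
    · rcases h with h | h
      · right; rw [mul_neg, mul_one] at h; rw [← h, neg_neg]
      · left; rw [mul_neg, mul_one] at h; exact neg_injective h
  have hf2 : f * f = 1 := by
    refine push_two_mat (mul_mem hf hf) ?_
    rw [map_mul, hΘ _ hf4 _ hf4, map_mul]
    rcases hf1 with h | h <;> rw [h] <;> simp
  have hf3 : f = 1 := by
    rwa [← pow_two, pow_eq_one_iff_left two_ne_zero] at hf2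
  exact ⟨k, by rw [hf3, map_one, one_mul]⟩

end scalar

section finite

variable {A B : Matrix (Fin 2) (Fin 2) ℤ}

/-- A matrix commuting with two noncommuting matrices is scalar. -/
theorem scalar_of_commute {M : Matrix (Fin 2) (Fin 2) ℤ} (h : A * B ≠ B * A) (hA : M * A = A * M)
    (hB : M * B = B * M) (hd : M.det = 1) : M = 1 ∨ M = -1 := by
  have hA' := fun i j => congrFun (congrFun hA i) j
  have hB' := fun i j => congrFun (congrFun hB i) j
  simp only [mul_apply, Fin.sum_univ_two] at hA' hB'
  have a1 := hA' 0 0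
  have a2 := hA' 0 1
  have a3 := hA' 1 0
  have b1 := hB' 0 0
  have b2 := hB' 0 1
  have b3 := hB' 1 0
  rw [det_fin_two] at hd
  suffices key : M 0 1 = 0 ∧ M 1 0 = 0 ∧ M 0 0 - M 1 1 = 0 by
    obtain ⟨h01, h10, hs⟩ := key
    replace hs := sub_eq_zero.1 hs
    rw [h01, zero_mul, sub_zero, ← hs] at hd
    rcases Int.mul_eq_one_iff_eq_one_or_neg_one.1 hd with ⟨h1, -⟩ | ⟨h1, -⟩
    · left; ext i j; fin_cases i <;> fin_cases j <;> simp_all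
    · right; ext i j; fin_cases i <;> fin_cases j <;> simp_all
  have c1 : A 1 0 * M 0 1 = M 1 0 * A 0 1 := by linarith
  have c2 : (A 0 0 - A 1 1) * M 0 1 = (M 0 0 - M 1 1) * A 0 1 := by linarith
  have c3 : (A 0 0 - A 1 1) * M 1 0 = (M 0 0 - M 1 1) * A 1 0 := by linarith
  have d1 : B 1 0 * M 0 1 = M 1 0 * B 0 1 := by linarith
  have d2 : (B 0 0 - B 1 1) * M 0 1 = (M 0 0 - M 1 1) * B 0 1 := by linarith
  have d3 : (B 0 0 - B 1 1) * M 1 0 = (M 0 0 - M 1 1) * B 1 0 := by linarith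
  by_contra hne
  apply h
  suffices key : A 0 1 * B 1 0 = B 0 1 * A 1 0 ∧ (A 0 0 - A 1 1) * B 0 1 = (B 0 0 - B 1 1) * A 0 1 ∧
      (A 0 0 - A 1 1) * B 1 0 = (B 0 0 - B 1 1) * A 1 0 by
    obtain ⟨k1, k2, k3⟩ := key
    ext i j
    fin_cases i <;> fin_cases j <;> simp [mul_apply, Fin.sum_univ_two] <;> linarith
  by_cases h01 : M 0 1 = 0
  · by_cases h10 : M 1 0 = 0
    · by_cases hs : M 0 0 - M 1 1 = 0
      · exact absurd ⟨h01, h10, hs⟩ hne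
      · refine ⟨?_, ?_, ?_⟩ <;> apply mul_left_cancel₀ hs <;> grind
    · refine ⟨?_, ?_, ?_⟩ <;> apply mul_left_cancel₀ h10 <;> grind
  · refine ⟨?_, ?_, ?_⟩ <;> apply mul_left_cancel₀ h01 <;> grind

theorem form_eq {S : Finset (Fin 2 → ℤ)} {g : Matrix (Fin 2) (Fin 2) ℤ} (hd : g.det = 1)
    (hg : ∀ v ∈ S, g *ᵥ v ∈ S) :
    (g 0 0 - g 1 1) * ∑ v ∈ S, v 0 * v 0 = -2 * g 0 1 * ∑ v ∈ S, v 0 * v 1 ∧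
    g 0 1 * ∑ v ∈ S, v 1 * v 1 = -(g 1 0 * ∑ v ∈ S, v 0 * v 0) ∧
    (g 0 0 - g 1 1) * ∑ v ∈ S, v 1 * v 1 = 2 * g 1 0 * ∑ v ∈ S, v 0 * v 1 := by
  have hinj : Function.Injective (g *ᵥ · : (Fin 2 → ℤ) → Fin 2 → ℤ) :=
    mulVec_injective_of_isUnit ((isUnit_iff_isUnit_det g).2 (by rw [hd]; exact isUnit_one))
  have himg : S.image (g *ᵥ ·) = S :=
    Finset.eq_of_subset_of_card_le (Finset.image_subset_iff.2 hg)
      (Finset.card_image_of_injective S hinj).ge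
  have key : ∀ i j, ∑ v ∈ S, v i * v j = ∑ v ∈ S, (g i 0 * v 0 + g i 1 * v 1) *
      (g j 0 * v 0 + g j 1 * v 1) := fun i j => by
    conv_lhs => rw [← himg, Finset.sum_image fun _ _ _ _ h => hinj h]
    simp [mulVec, dotProduct, Fin.sum_univ_two]
  have expand : ∀ i j, ∑ v ∈ S, v i * v j = g i 0 * g j 0 * ∑ v ∈ S, v 0 * v 0 +
      (g i 0 * g j 1 + g i 1 * g j 0) * ∑ v ∈ S, v 0 * v 1 +
      g i 1 * g j 1 * ∑ v ∈ S, v 1 * v 1 := fun i j => by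
    rw [key, Finset.mul_sum, Finset.mul_sum, Finset.mul_sum, ← Finset.sum_add_distrib,
      ← Finset.sum_add_distrib]
    exact Finset.sum_congr rfl fun v _ => by ring
  have e1 := expand 0 0
  have e2 := expand 0 1
  have e3 := expand 1 1
  rw [det_fin_two] at hd
  generalize ∑ v ∈ S, v 0 * v 0 = P at *
  generalize ∑ v ∈ S, v 0 * v 1 = Q at *
  generalize ∑ v ∈ S, v 1 * v 1 = R at *
  refine ⟨?_, ?_, ?_⟩
  · linear_combination -(g 1 1) * e1 + g 0 1 * e2 - (g 0 0 * P + g 0 1 * Q) * hd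
  · linear_combination g 1 0 * e1 - g 0 0 * e2 - (g 0 0 * Q + g 0 1 * R) * hd
  · linear_combination g 0 0 * e3 - g 1 0 * e2 + (g 1 1 * R + g 1 0 * Q) * hd

/-- Unimodular matrices preserving a finite set of vectors which is not contained in the origin
commute with each other. -/
theorem commute_of_finite {S : Finset (Fin 2 → ℤ)} {v : Fin 2 → ℤ} (hv : v ∈ S) (hv0 : v ≠ 0)
    (hA : A.det = 1) (hAS : ∀ v ∈ S, A *ᵥ v ∈ S) (hB : B.det = 1) (hBS : ∀ v ∈ S, B *ᵥ v ∈ S) :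
    A * B = B * A := by
  obtain ⟨a1, a2, a3⟩ := form_eq hA hAS
  obtain ⟨b1, b2, b3⟩ := form_eq hB hBS
  have pos : ∀ i, v i ≠ 0 → ∑ v ∈ S, v i * v i ≠ 0 := fun i hi =>
    (Finset.sum_pos' (f := fun v : Fin 2 → ℤ => v i * v i) (fun v _ => mul_self_nonneg (v i))
      ⟨v, hv, mul_self_pos.2 hi⟩).ne'
  have hPR : ∑ v ∈ S, v 0 * v 0 ≠ 0 ∨ ∑ v ∈ S, v 1 * v 1 ≠ 0 := by
    by_cases h : v 0 = 0
    · exact .inr (pos 1 fun h' => hv0 (by ext i; fin_cases i <;> simp [h, h']))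
    · exact .inl (pos 0 h)
  generalize ∑ v ∈ S, v 0 * v 0 = P at *
  generalize ∑ v ∈ S, v 0 * v 1 = Q at *
  generalize ∑ v ∈ S, v 1 * v 1 = R at *
  suffices key : A 0 1 * B 1 0 = B 0 1 * A 1 0 ∧ (A 0 0 - A 1 1) * B 0 1 = (B 0 0 - B 1 1) * A 0 1 ∧
      (A 0 0 - A 1 1) * B 1 0 = (B 0 0 - B 1 1) * A 1 0 by
    obtain ⟨k1, k2, k3⟩ := key
    ext i j
    fin_cases i <;> fin_cases j <;> simp [mul_apply, Fin.sum_univ_two] <;> linarith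
  rcases hPR with h | h <;> refine ⟨?_, ?_, ?_⟩ <;> apply mul_left_cancel₀ h <;> grind

end finite

end BraidInj

namespace BraidInj

open FreeGroup (of lift norm)
open scoped Matrix

section label

open Classical in
/-- The endomorphism of a free group killing the letters outside of a set. -/
noncomputable def keep {α : Type*} (T : Finset α) : FreeGroup α →* FreeGroup α :=
  lift fun a => if a ∈ T then of a else 1

/-- An element is peripheral if it is conjugate to a power of a letter. -/
def Peripheral {α : Type*} (w : FreeGroup α) : Prop :=
  w = 1 ∨ ∃ a, ∃ k : ℤ, IsConj (of a ^ k) w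

variable {α : Type*}

theorem keep_of_mem {T : Finset α} {a : α} (h : a ∈ T) : keep T (of a) = of a := by
  simp [keep, h]

theorem keep_of_notMem {T : Finset α} {a : α} (h : a ∉ T) : keep T (of a) = 1 := by
  simp [keep, h]

theorem isConj_map {G H : Type*} [Group G] [Group H] (f : G →* H) {a b : G} (h : IsConj a b) :
    IsConj (f a) (f b) := by
  obtain ⟨c, hc⟩ := isConj_iff.1 h
  exact isConj_iff.2 ⟨f c, by rw [← hc]; simp⟩

theorem isConj_one_left {G : Type*} [Group G] {a : G} (h : IsConj 1 a) : a = 1 := by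
  obtain ⟨c, hc⟩ := isConj_iff.1 h
  rw [← hc]; simp

theorem isConj_zpow {G : Type*} [Group G] {a b : G} (h : IsConj a b) (k : ℤ) :
    IsConj (a ^ k) (b ^ k) := by
  obtain ⟨c, hc⟩ := isConj_iff.1 h
  exact isConj_iff.2 ⟨c, by rw [← hc, conj_zpow]⟩

theorem Peripheral.keep {w : FreeGroup α} (h : Peripheral w) (T : Finset α) :
    Peripheral (keep T w) := by
  rcases h with rfl | ⟨a, k, h⟩
  · exact .inl (map_one _)
  · have := isConj_map (BraidInj.keep T) h
    rw [map_zpow] at this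
    by_cases ha : a ∈ T
    · rw [keep_of_mem ha] at this; exact .inr ⟨a, k, this⟩
    · rw [keep_of_notMem ha, one_zpow] at this
      exact .inl (isConj_one_left this)

theorem Peripheral.map {w : FreeGroup α} (h : Peripheral w) (f : FreeGroup α →* FreeGroup α)
    (p : α → α) (hf : ∀ a, IsConj (f (of a)) (of (p a))) : Peripheral (f w) := by
  rcases h with rfl | ⟨a, k, h⟩
  · exact .inl (map_one _)
  · have := isConj_map f h
    rw [map_zpow] at this
    exact .inr ⟨p a, k, (isConj_zpow (hf a) k).symm.trans this⟩

open Classical in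
theorem keep_keep (S T : Finset α) (w : FreeGroup α) : keep S (keep T w) = keep (S ∩ T) w := by
  refine DFunLike.congr_fun (FreeGroup.ext_hom ((keep S).comp (keep T)) (keep (S ∩ T)) fun a => ?_) w
  by_cases hT : a ∈ T <;> by_cases hS : a ∈ S <;> simp [keep, hT, hS]

theorem exists_keep_eq (w : FreeGroup α) : ∃ T : Finset α, keep T w = w := by
  classical
  have key : ∀ (T : Finset α) (w : FreeGroup α),
      (∃ S : Finset α, S ⊆ T ∧ keep S w = w) → keep T w = w := by
    rintro T w ⟨S, hST, hS⟩
    rw [← hS, keep_keep, Finset.inter_eq_right.2 hST, hS]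
  induction w using FreeGroup.induction_on with
  | C1 => exact ⟨∅, map_one _⟩
  | of a => exact ⟨{a}, keep_of_mem (by simp)⟩
  | inv_of a h => exact ⟨{a}, by rw [map_inv, keep_of_mem (by simp)]⟩
  | mul x y hx hy =>
    obtain ⟨S, hS⟩ := hx
    obtain ⟨T, hT⟩ := hy
    refine ⟨S ∪ T, ?_⟩
    rw [map_mul, key _ x ⟨S, Finset.subset_union_left, hS⟩, key _ y ⟨T, Finset.subset_union_right, hT⟩]

/-- An element which is not peripheral can only be fixed by automorphisms permuting the conjugacy
classes of letters in a bounded way. -/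
theorem exists_bounded_labels {w : FreeGroup α} (hw : ¬ Peripheral w) :
    ∃ T : Finset α, ∃ a b : α, a ≠ b ∧ ∀ (f : MulAut (FreeGroup α)) (p : Equiv.Perm α),
      (∀ a, IsConj (f (of a)) (of (p a))) → f w = w → p a ∈ T ∧ p b ∈ T := by
  classical
  obtain ⟨T₀, hT₀⟩ := exists_keep_eq w
  have hex : ∃ n, ∃ T : Finset α, T.card = n ∧ ¬ Peripheral (keep T w) :=
    ⟨_, T₀, rfl, by rwa [hT₀]⟩
  obtain ⟨T, hTn, hT⟩ := Nat.find_spec hex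
  have hmin : ∀ S : Finset α, ¬ Peripheral (keep S w) → T.card ≤ S.card := fun S hS =>
    hTn.le.trans (Nat.find_min' hex ⟨S, rfl, hS⟩)
  have hcard : 1 < T.card := by
    by_contra hle
    apply hT
    rcases isEmpty_or_nonempty α with _ | _
    · exact .inl (Subsingleton.elim _ _)
    obtain ⟨a, ha⟩ := Finset.card_le_one_iff_subset_singleton.1 (not_lt.1 hle)
    have hz : (keep T).range ≤ Subgroup.zpowers (of a) := by
      rintro _ ⟨x, rfl⟩
      induction x using FreeGroup.induction_on with
      | C1 => rw [map_one]; exact one_mem _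
      | of b =>
        by_cases hb : b ∈ T
        · rw [keep_of_mem hb, Finset.mem_singleton.1 (ha hb)]; exact Subgroup.mem_zpowers _
        · rw [keep_of_notMem hb]; exact one_mem _
      | inv_of b h => rw [map_inv]; exact inv_mem h
      | mul x y hx hy => rw [map_mul]; exact mul_mem hx hy
    obtain ⟨k, hk⟩ := hz ⟨w, rfl⟩
    exact .inr ⟨a, k, by rw [← hk]⟩
  obtain ⟨a, ha, b, hb, hab⟩ := Finset.one_lt_card.1 hcard
  refine ⟨T₀, a, b, hab, fun f p hp hf => ?_⟩
  have hp' : ∀ a, IsConj (f.symm (of a)) (of (p.symm a)) := fun a => by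
    have := isConj_map f.symm.toMonoidHom (hp (p.symm a))
    simpa using this.symm
  have h1 : keep T w = keep T (f.symm (keep (T.map p.toEmbedding) w)) := by
    have h2 : f.symm w = w := by rw [MulEquiv.symm_apply_eq, hf]
    conv_lhs => rw [← h2]
    refine DFunLike.congr_fun (FreeGroup.ext_hom ((keep T).comp f.symm.toMonoidHom)
      (((keep T).comp f.symm.toMonoidHom).comp (keep (T.map p.toEmbedding))) fun c => ?_) w
    by_cases hc : c ∈ T.map p.toEmbedding
    · simp [keep_of_mem hc]
    · have hc' : p.symm c ∉ T := fun h => hc (Finset.mem_map.2 ⟨_, h, by simp⟩)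
      have := isConj_map (keep T) (hp' c)
      rw [keep_of_notMem hc'] at this
      simpa [keep_of_notMem hc] using isConj_one_left this.symm
  have h2 : ¬ Peripheral (keep (T.map p.toEmbedding) w) := fun h => by
    refine hT ?_
    rw [h1]
    exact (h.map f.symm.toMonoidHom p.symm hp').keep T
  rw [← hT₀, keep_keep] at h2
  have h3 := hmin _ h2
  have h4 : T.map p.toEmbedding ⊆ T₀ := by
    have := Finset.eq_of_subset_of_card_le Finset.inter_subset_left
      ((Finset.card_map (s := T) p.toEmbedding).le.trans h3)
    exact Finset.inter_eq_left.1 this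
  exact ⟨h4 (Finset.mem_map_of_mem _ ha), h4 (Finset.mem_map_of_mem _ hb)⟩

end label

end BraidInj

namespace BraidInj

open FreeGroup (of lift norm)
open scoped Matrix

section commutatorSubgroup

/-- The product of the values of a function on the integers from `0` to `j - 1`. -/
def intProd {G : Type*} [Group G] (c : ℤ → G) : ℤ → G
  | Int.ofNat k => k.rec 1 fun i p => p * c i
  | Int.negSucc k => (k + 1).rec 1 fun i p => p * (c (Int.negSucc i))⁻¹

@[simp] theorem intProd_zero {G : Type*} [Group G] (c : ℤ → G) : intProd c 0 = 1 := rfl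

theorem intProd_succ {G : Type*} [Group G] (c : ℤ → G) (j : ℤ) :
    intProd c (j + 1) = intProd c j * c j := by
  rcases j with k | k
  · rfl
  · rcases k with _ | k
    · change 1 = 1 * (c (Int.negSucc 0))⁻¹ * c (Int.negSucc 0)
      simp
    · change intProd c (Int.negSucc k) =
        intProd c (Int.negSucc k) * (c (Int.negSucc (k + 1)))⁻¹ * c (Int.negSucc (k + 1))
      simp

theorem eq_of_succ {G : Type*} [Group G] {c A B : ℤ → G} (h0 : A 0 = B 0)
    (hA : ∀ j, A (j + 1) = A j * c j) (hB : ∀ j, B (j + 1) = B j * c j) (j : ℤ) : A j = B j := by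
  induction j using Int.induction_on with
  | zero => exact h0
  | succ i h => rw [hA, hB, h]
  | pred i h =>
    have h1 := hA (-i - 1)
    have h2 := hB (-i - 1)
    rw [sub_add_cancel] at h1 h2
    rw [h1, h2] at h
    exact mul_right_cancel h

/-- The free basis of the commutator subgroup of the free group of rank two. -/
def basis : FreeGroup (Fin 2 → ℤ) →* FreeGroup (Fin 2) :=
  lift fun v => of 1 ^ v 1 * of 0 ^ v 0 * com * (of 1 ^ v 1 * of 0 ^ v 0)⁻¹

/-- The product of the letters in a column. -/
def colProd : ℤ → FreeGroup (Fin 2 → ℤ) := intProd fun j => of ![0, j]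

def colProd' (j : ℤ) : FreeGroup (Fin 2 → ℤ) := (intProd (fun j => (of ![-1, j])⁻¹) j)⁻¹

theorem colProd_succ (j : ℤ) : colProd (j + 1) = colProd j * of ![0, j] := intProd_succ _ j

theorem colProd'_succ (j : ℤ) : colProd' (j + 1) = of ![-1, j] * colProd' j := by
  rw [colProd', intProd_succ, mul_inv_rev, inv_inv]; rfl

theorem colProd_zero : colProd 0 = 1 := rfl

theorem colProd'_zero : colProd' 0 = 1 := rfl

/-- The endomorphism of the commutator subgroup given by conjugation by the first letter. -/
def shiftHom : FreeGroup (Fin 2 → ℤ) →* FreeGroup (Fin 2 → ℤ) :=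
  lift fun v => colProd (v 1) * of (v + ![1, 0]) * (colProd (v 1))⁻¹

def shiftHom' : FreeGroup (Fin 2 → ℤ) →* FreeGroup (Fin 2 → ℤ) :=
  lift fun v => (colProd' (v 1))⁻¹ * of (v - ![1, 0]) * colProd' (v 1)

theorem shiftHom_of (v : Fin 2 → ℤ) :
    shiftHom (of v) = colProd (v 1) * of (v + ![1, 0]) * (colProd (v 1))⁻¹ := by simp [shiftHom]

theorem shiftHom'_of (v : Fin 2 → ℤ) :
    shiftHom' (of v) = (colProd' (v 1))⁻¹ * of (v - ![1, 0]) * colProd' (v 1) := by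
  simp [shiftHom']

theorem shiftHom_colProd' (j : ℤ) : shiftHom (colProd' j) = colProd j := by
  have key : ∀ j, shiftHom (colProd' (j + 1)) = colProd j * of ![0, j] *
      (colProd j)⁻¹ * shiftHom (colProd' j) := fun j => by
    rw [colProd'_succ, map_mul, shiftHom_of]
    congr 3
    simp
  refine inv_injective (eq_of_succ (c := fun j => (colProd j * of ![0, j] * (colProd j)⁻¹)⁻¹)
    (A := fun j => (shiftHom (colProd' j))⁻¹) (B := fun j => (colProd j)⁻¹) (by
      simp [colProd_zero, colProd'_zero]) (fun j => ?_) (fun j => ?_) j)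
  · rw [key, mul_inv_rev]
  · rw [colProd_succ]; group

theorem shiftHom'_colProd (j : ℤ) : shiftHom' (colProd j) = colProd' j := by
  refine eq_of_succ (c := fun j => (colProd' j)⁻¹ * of ![-1, j] * colProd' j)
    (A := fun j => shiftHom' (colProd j)) (by simp [colProd_zero, colProd'_zero])
    (fun j => ?_) (fun j => ?_) j
  · rw [colProd_succ, map_mul, shiftHom'_of]
    congr 3
    simp
  · rw [colProd'_succ]; group

theorem vec_eta (v : Fin 2 → ℤ) : ![Matrix.vecHead v, Matrix.vecHead (Matrix.vecTail v)] = v := by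
  ext i; fin_cases i <;> rfl

/-- Conjugation by the first letter. -/
def shift : MulAut (FreeGroup (Fin 2 → ℤ)) :=
  MonoidHom.toMulEquiv shiftHom shiftHom'
    (FreeGroup.ext_hom _ _ fun v => by
      change shiftHom' (shiftHom (of v)) = of v
      rw [shiftHom_of, map_mul, map_mul, map_inv, shiftHom'_of, shiftHom'_colProd]
      simp [mul_assoc, vec_eta])
    (FreeGroup.ext_hom _ _ fun v => by
      change shiftHom (shiftHom' (of v)) = of v
      rw [shiftHom'_of, map_mul, map_mul, map_inv, shiftHom_of, shiftHom_colProd']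
      simp [mul_assoc, vec_eta])

theorem shift_of (v : Fin 2 → ℤ) :
    shift (of v) = colProd (v 1) * of (v + ![1, 0]) * (colProd (v 1))⁻¹ := shiftHom_of v

/-- Conjugation by the second letter. -/
def lift1 : MulAut (FreeGroup (Fin 2 → ℤ)) :=
  FreeGroup.freeGroupCongr (Equiv.addRight (![0, 1] : Fin 2 → ℤ))

theorem lift1_of (v : Fin 2 → ℤ) : lift1 (of v) = of (v + ![0, 1]) := by
  simp [lift1]

/-- The action of the free group of rank two on its commutator subgroup. -/
def comAct : FreeGroup (Fin 2) →* MulAut (FreeGroup (Fin 2 → ℤ)) := lift ![shift, lift1]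

theorem colProd_succ' (j : ℤ) : colProd (j + 1) = of 0 * lift1 (colProd j) := by
  refine eq_of_succ (c := fun j => of ![0, j + 1]) (A := fun j => colProd (j + 1))
    (B := fun j => of 0 * lift1 (colProd j)) ?_ (fun j => ?_) (fun j => ?_) j
  · rw [colProd_succ, colProd_zero, map_one, one_mul, mul_one]
    congr 1; ext i; fin_cases i <;> rfl
  · rw [colProd_succ]
  · rw [colProd_succ, map_mul, lift1_of, mul_assoc]; simp

theorem comAct_com : comAct com = MulAut.conj (of 0) := by
  have h : shift * lift1 = MulAut.conj (of 0) * (lift1 * shift) := by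
    refine mulAut_ext fun v => ?_
    simp only [MulAut.mul_apply, MulAut.conj_apply, lift1_of, shift_of, map_mul, map_inv]
    have : (v + (![0, 1] : Fin 2 → ℤ)) 1 = v 1 + 1 := by simp
    rw [this, colProd_succ', add_right_comm]
    group
  rw [com]
  simp only [comAct, map_mul, map_inv, FreeGroup.lift_apply_of, Matrix.cons_val_zero,
    Matrix.cons_val_one]
  rw [h]; group

theorem comAct_basis (k : FreeGroup (Fin 2 → ℤ)) : comAct (basis k) = MulAut.conj k := by
  refine DFunLike.congr_fun (FreeGroup.ext_hom (comAct.comp basis) MulAut.conj fun v => ?_) k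
  have h1 : ∀ (j : ℤ) (v : Fin 2 → ℤ), (lift1 ^ j) (of v) = of (v + ![0, j]) := by
    intro j
    induction j using Int.induction_on with
    | zero => intro v; simp [vec_eta]
    | succ i h =>
      intro v
      rw [zpow_add, zpow_one, MulAut.mul_apply, lift1_of, h, add_assoc]
      simp [add_comm]
    | pred i h =>
      intro v
      have h2 : lift1⁻¹ (of v) = of (v - ![0, 1]) := by
        change lift1.symm (of v) = _
        rw [MulEquiv.symm_apply_eq, lift1_of, sub_add_cancel]
      rw [zpow_sub, zpow_one, MulAut.mul_apply, h2, h, sub_add_eq_add_sub, add_sub_assoc]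
      simp
  have h2 : ∀ i : ℤ, (shift ^ i) (of 0) = of ![i, 0] := by
    have h3 : ∀ i : ℤ, shift (of ![i, 0]) = of ![i + 1, 0] := fun i => by
      rw [shift_of]; simp [colProd_zero]
    intro i
    induction i using Int.induction_on with
    | zero => simp only [zpow_zero, MulAut.one_apply]; congr 1; ext i; fin_cases i <;> rfl
    | succ i h => rw [add_comm, zpow_add, zpow_one, MulAut.mul_apply, h, h3, add_comm]
    | pred i h =>
      rw [sub_eq_neg_add, zpow_add, zpow_neg_one, MulAut.mul_apply, h]
      change shift.symm _ = _
      rw [MulEquiv.symm_apply_eq, h3]; simp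
  have h4 : comAct (of 1 ^ v 1 * of 0 ^ v 0) (of 0) = of v := by
    simp only [comAct, map_mul, map_zpow, FreeGroup.lift_apply_of, Matrix.cons_val_zero,
      Matrix.cons_val_one, MulAut.mul_apply]
    rw [h2, h1]
    congr 1; ext i; fin_cases i <;> simp
  rw [MonoidHom.comp_apply, basis, FreeGroup.lift_apply_of, map_mul, map_mul, comAct_com, map_inv]
  refine mulAut_ext fun u => ?_
  rw [MulAut.mul_apply, MulAut.mul_apply, MulAut.conj_apply, map_mul, map_mul, map_inv, h4,
    ← MulAut.mul_apply, mul_inv_cancel, MulAut.one_apply, MulAut.conj_apply]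

theorem basis_injective : Function.Injective basis := by
  refine (injective_iff_map_eq_one _).2 fun k hk => ?_
  have h1 := comAct_basis k
  rw [hk, map_one] at h1
  by_contra hne
  have := subsingleton_of_central hne fun g => by
    have := DFunLike.congr_fun h1 g
    rw [MulAut.one_apply, MulAut.conj_apply, eq_mul_inv_iff_mul_eq] at this
    exact this.symm
  have := congrFun (Subsingleton.elim (0 : Fin 2 → ℤ) 1) 0
  simp at this

theorem basis_of (v : Fin 2 → ℤ) :
    basis (of v) = of 1 ^ v 1 * of 0 ^ v 0 * com * (of 1 ^ v 1 * of 0 ^ v 0)⁻¹ := by simp [basis]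

theorem basis_zero : basis (of 0) = com := by simp [basis]

theorem ab_rep (v : Fin 2 → ℤ) : ab (of 1 ^ v 1 * of 0 ^ v 0) = v := by
  rw [ab_mul, ab_zpow, ab_zpow]
  ext i; fin_cases i <;> simp

theorem ab_com : ab com = 0 := by
  rw [com, ab_mul, ab_mul, ab_mul, ab_inv, ab_inv]; abel

theorem ab_basis (k : FreeGroup (Fin 2 → ℤ)) : ab (basis k) = 0 := by
  induction k using FreeGroup.induction_on with
  | C1 => simp
  | of v => rw [basis_of, ab_mul, ab_mul, ab_com, ab_inv]; abel
  | inv_of v h => rw [map_inv, ab_inv, h, neg_zero]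
  | mul x y hx hy => rw [map_mul, ab_mul, hx, hy, add_zero]

theorem basis_range_normal : basis.range.Normal := by
  set N := basis.range with hN
  have conj_of : ∀ g : FreeGroup (Fin 2), (∀ v, g * basis (of v) * g⁻¹ ∈ N) →
      ∀ x ∈ N, g * x * g⁻¹ ∈ N := by
    rintro g hg _ ⟨k, rfl⟩
    induction k using FreeGroup.induction_on with
    | C1 => simp
    | of v => exact hg v
    | inv_of v h => rw [map_inv, ← conj_inv]; exact inv_mem h
    | mul x y hx hy => rw [map_mul, ← conj_mul]; exact mul_mem hx hy
  have hb : ∀ j : ℤ, ∀ x ∈ N, of 1 ^ j * x * (of 1 ^ j)⁻¹ ∈ N := fun j =>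
    conj_of _ fun v => ⟨of ![v 0, j + v 1], by
      rw [basis_of, basis_of]; simp [zpow_add, mul_assoc]⟩
  have ha : ∀ g : FreeGroup (Fin 2), g * of 1 * g⁻¹ * (of 1)⁻¹ ∈ N →
      ∀ j : ℤ, g * of 1 ^ j * g⁻¹ * (of 1 ^ j)⁻¹ ∈ N := by
    intro g hg j
    have step : ∀ j : ℤ, g * of 1 ^ (j + 1) * g⁻¹ * (of 1 ^ (j + 1))⁻¹ =
        g * of 1 ^ j * g⁻¹ * (of 1 ^ j)⁻¹ *
          (of 1 ^ j * (g * of 1 * g⁻¹ * (of 1)⁻¹) * (of 1 ^ j)⁻¹) := fun j => by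
      rw [zpow_add, zpow_one]; group
    induction j using Int.induction_on with
    | zero => simp
    | succ i h => rw [step]; exact mul_mem h (hb _ _ hg)
    | pred i h =>
      have := step (-i - 1)
      rw [sub_add_cancel] at this
      rw [this] at h
      exact (Subgroup.mul_mem_cancel_right _ (hb _ _ hg)).1 h
  have hcom : ∀ v : Fin 2 → ℤ, of 1 ^ v 1 * of 0 ^ v 0 * com * (of 1 ^ v 1 * of 0 ^ v 0)⁻¹ ∈ N :=
    fun v => ⟨of v, basis_of v⟩
  have hc : ∀ k : ℤ, (of 0 ^ k) * of 1 * (of 0 ^ k)⁻¹ * (of 1)⁻¹ ∈ N → ∀ x ∈ N,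
      of 0 ^ k * x * (of 0 ^ k)⁻¹ ∈ N := fun k hk => conj_of _ fun v => by
    have h1 := ha _ hk (v 1)
    have h2 := hcom ![k + v 0, v 1]
    have h3 := mul_mem (mul_mem h1 h2) (inv_mem h1)
    convert h3 using 1
    rw [basis_of]
    simp only [Matrix.cons_val_zero, Matrix.cons_val_one, zpow_add]
    group
  have h0 : ∀ x ∈ N, of 0 * x * (of 0)⁻¹ ∈ N := by
    have := hc 1 (by
      have := hcom 0
      simpa [com] using this)
    simpa using this
  have h0' : ∀ x ∈ N, (of 0)⁻¹ * x * of 0 ∈ N := by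
    have := hc (-1) (by
      have := inv_mem (hcom ![-1, 0])
      simpa [com, mul_assoc] using this)
    simpa using this
  refine ⟨fun x hx g => ?_⟩
  induction g using FreeGroup.induction_on generalizing x with
  | C1 => simpa using hx
  | of i =>
    fin_cases i
    · exact h0 x hx
    · simpa using hb 1 x hx
  | inv_of i h =>
    fin_cases i
    · simpa using h0' x hx
    · simpa using hb (-1) x hx
  | mul f g hf hg =>
    have : f * g * x * (f * g)⁻¹ = f * (g * x * g⁻¹) * f⁻¹ := by group
    rw [this]; exact hf _ (hg _ hx)

theorem mul_rep_inv_mem (f : FreeGroup (Fin 2)) :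
    f * (of 1 ^ ab f 1 * of 0 ^ ab f 0)⁻¹ ∈ basis.range := by
  have hN := basis_range_normal
  let N := basis.range
  have hc : Commute (QuotientGroup.mk (s := N) (of 0)) (QuotientGroup.mk (of 1)) := by
    have : QuotientGroup.mk (s := N) com = 1 :=
      (QuotientGroup.eq_one_iff _).2 ⟨of 0, basis_zero⟩
    rw [com, QuotientGroup.mk_mul, QuotientGroup.mk_inv, mul_inv_eq_one, QuotientGroup.mk_mul,
      QuotientGroup.mk_inv, mul_inv_eq_iff_eq_mul, QuotientGroup.mk_mul] at this
    exact this
  rw [← QuotientGroup.eq_one_iff, QuotientGroup.mk_mul, QuotientGroup.mk_inv, mul_inv_eq_one]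
  induction f using FreeGroup.induction_on with
  | C1 => simp
  | of i => fin_cases i <;> simp [ab_of]
  | inv_of i h => fin_cases i <;> simp [ab_of]
  | mul x y hx hy =>
    rw [QuotientGroup.mk_mul, hx, hy]
    simp only [ab_mul, Pi.add_apply, zpow_add, QuotientGroup.mk_mul, QuotientGroup.mk_zpow]
    generalize QuotientGroup.mk (s := N) (of 0) = A at *
    generalize QuotientGroup.mk (s := N) (of 1) = B at *
    have := (hc.zpow_zpow (ab x 0) (ab y 1)).eq
    rw [mul_assoc, ← mul_assoc (A ^ _) (B ^ _), this]
    simp only [mul_assoc]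

theorem exists_basis_eq {f : FreeGroup (Fin 2)} (h : ab f = 0) : ∃ k, basis k = f := by
  have := mul_rep_inv_mem f
  rw [h] at this
  simpa using this

end commutatorSubgroup

end BraidInj

namespace BraidInj

open FreeGroup (of lift norm)
open scoped Matrix

section core

theorem exists_basis_lift (α : MulAut (FreeGroup (Fin 2))) :
    ∃ f : MulAut (FreeGroup (Fin 2 → ℤ)), ∀ k, basis (f k) = α (basis k) := by
  have key : ∀ α : MulAut (FreeGroup (Fin 2)),
      ∃ f : FreeGroup (Fin 2 → ℤ) →* FreeGroup (Fin 2 → ℤ), ∀ k, basis (f k) = α (basis k) := by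
    intro α
    have : ∀ v, ∃ k, basis k = α (basis (of v)) := fun v =>
      exists_basis_eq (by rw [ab_mat, ab_basis, Matrix.mulVec_zero])
    choose k hk using this
    refine ⟨lift k, fun x => DFunLike.congr_fun (FreeGroup.ext_hom (basis.comp (lift k))
      (α.toMonoidHom.comp basis) fun v => ?_) x⟩
    simp [hk]
  obtain ⟨f, hf⟩ := key α
  obtain ⟨g, hg⟩ := key α⁻¹
  refine ⟨MonoidHom.toMulEquiv f g (MonoidHom.ext fun x => basis_injective ?_)
    (MonoidHom.ext fun x => basis_injective ?_), hf⟩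
  · rw [MonoidHom.comp_apply, hg, hf, ← MulAut.mul_apply, inv_mul_cancel]; rfl
  · rw [MonoidHom.comp_apply, hf, hg, ← MulAut.mul_apply, mul_inv_cancel]; rfl

theorem isConj_label {α : MulAut (FreeGroup (Fin 2))} {h : FreeGroup (Fin 2)}
    (hα : α com = h * com * h⁻¹) {f : MulAut (FreeGroup (Fin 2 → ℤ))}
    (hf : ∀ k, basis (f k) = α (basis k)) (v : Fin 2 → ℤ) :
    IsConj (f (of v)) (of (mat α *ᵥ v + ab h)) := by
  have h1 : ab (α (of 1 ^ v 1 * of 0 ^ v 0) * h) = mat α *ᵥ v + ab h := by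
    rw [ab_mul, ab_mat, ab_rep]
  obtain ⟨k, hk⟩ := mul_rep_inv_mem (α (of 1 ^ v 1 * of 0 ^ v 0) * h)
  rw [h1] at hk
  refine (isConj_iff.2 ⟨k, basis_injective ?_⟩).symm
  rw [map_mul, map_mul, map_inv, hk, hf, basis_of, basis_of]
  generalize (of 1 ^ v 1 * of 0 ^ v 0 : FreeGroup (Fin 2)) = r
  rw [map_mul, map_mul, hα, map_inv]
  group

theorem eq_conj_com_zpow {s : Set (MulAut (FreeGroup (Fin 2)))} {w : FreeGroup (Fin 2)}
    (hmul : ∀ α ∈ s, ∀ β ∈ s, α * β ∈ s) (hdet : ∀ α ∈ s, (mat α).det = 1)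
    (hcom : ∀ α ∈ s, ∃ h, α com = h * com * h⁻¹) (hw : ∀ α ∈ s, α w = w)
    {α β : MulAut (FreeGroup (Fin 2))} (hα : α ∈ s) (hβ : β ∈ s)
    (hne : mat α * mat β ≠ mat β * mat α) : ∃ h, ∃ k : ℤ, w = h * com ^ k * h⁻¹ := by
  have h0 : ab w = 0 := by
    by_contra h0
    have : ∀ α ∈ s, ∀ v ∈ ({ab w} : Finset (Fin 2 → ℤ)), mat α *ᵥ v ∈ ({ab w} : Finset _) := by
      intro α hα v hv
      rw [Finset.mem_singleton.1 hv, Finset.mem_singleton, ← ab_mat, hw α hα]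
    exact hne (commute_of_finite (Finset.mem_singleton_self _) h0 (hdet α hα) (this α hα)
      (hdet β hβ) (this β hβ))
  obtain ⟨x, rfl⟩ := exists_basis_eq h0
  by_cases hx : Peripheral x
  · rcases hx with rfl | ⟨v, k, hk⟩
    · exact ⟨1, 0, by simp⟩
    · obtain ⟨c, hc⟩ := isConj_iff.1 hk
      refine ⟨basis c * (of 1 ^ v 1 * of 0 ^ v 0), k, ?_⟩
      rw [← hc, map_mul, map_mul, map_inv, map_zpow, basis_of, conj_zpow]
      group
  · exfalso
    obtain ⟨T, a, b, hab, hT⟩ := exists_bounded_labels hx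
    have key : ∀ α ∈ s, ∃ t ∈ T, ∃ t' ∈ T, mat α *ᵥ (a - b) = t - t' := by
      intro α hα
      obtain ⟨h, hh⟩ := hcom α hα
      obtain ⟨f, hf⟩ := exists_basis_lift α
      let p : Equiv.Perm (Fin 2 → ℤ) :=
        { toFun := fun v => mat α *ᵥ v + ab h
          invFun := fun v => mat α⁻¹ *ᵥ (v - ab h)
          left_inv := fun v => by
            simp only [add_sub_cancel_right, Matrix.mulVec_mulVec, mat_inv_mul, Matrix.one_mulVec]
          right_inv := fun v => by
            simp only [Matrix.mulVec_mulVec, mat_mul_inv, Matrix.one_mulVec, sub_add_cancel] }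
      have := hT f p (isConj_label hh hf) (basis_injective (by rw [hf, hw α hα]))
      exact ⟨_, this.1, _, this.2, by
        change _ = (mat α *ᵥ a + ab h) - (mat α *ᵥ b + ab h)
        rw [Matrix.mulVec_sub]; abel⟩
    have hfin : {v | ∃ α ∈ s, mat α *ᵥ (a - b) = v}.Finite := by
      refine ((T ×ˢ T).image fun t => t.1 - t.2).finite_toSet.subset ?_
      rintro _ ⟨α, hα, rfl⟩
      obtain ⟨t, ht, t', ht', h⟩ := key α hα
      rw [h]
      exact Finset.mem_coe.2 (Finset.mem_image.2 ⟨(t, t'), Finset.mem_product.2 ⟨ht, ht'⟩, rfl⟩)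
    have hinv : ∀ β ∈ s, ∀ v ∈ hfin.toFinset, mat β *ᵥ v ∈ hfin.toFinset := by
      intro β hβ v hv
      rw [Set.Finite.mem_toFinset] at hv ⊢
      obtain ⟨α, hα, rfl⟩ := hv
      exact ⟨β * α, hmul _ hβ _ hα, by rw [map_mul, Matrix.mulVec_mulVec]⟩
    have hmem : mat α *ᵥ (a - b) ∈ hfin.toFinset :=
      (Set.Finite.mem_toFinset hfin).2 ⟨α, hα, rfl⟩
    refine hne (commute_of_finite hmem (fun h => ?_) (hdet α hα) (hinv α hα) (hdet β hβ)
      (hinv β hβ))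
    have h2 := congrArg (mat α⁻¹ *ᵥ ·) h
    simp only [Matrix.mulVec_mulVec, mat_inv_mul, Matrix.one_mulVec, Matrix.mulVec_zero] at h2
    exact hab (sub_eq_zero.1 h2)

theorem exists_Θ_com {y : Br} (hy : y ∈ Bn 4) : ∃ h, Θ y com = h * com * h⁻¹ := by
  refine (gens_induction (p := fun y => y ∈ Bn 4 ∧ ∃ h, Θ y com = h * com * h⁻¹) ?_ ?_ ?_ ?_ hy).2
  · intro i hi
    refine ⟨σ_mem hi, ?_⟩
    obtain rfl | rfl | rfl : i = 0 ∨ i = 1 ∨ i = 2 := by omega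
    · exact ⟨1, by rw [Θ_zero, rankTwoEven_apply]; simp [com, mul_assoc]⟩
    · exact ⟨1, by rw [Θ_one, rankTwoOdd_apply]; simp [com, mul_assoc]⟩
    · exact ⟨of 1, by rw [Θ_two, rankTwoLast_apply]; simp [com, mul_assoc]⟩
  · exact ⟨one_mem _, 1, by simp [homOn_Θ.one]⟩
  · rintro x y ⟨hx, h, hxh⟩ ⟨hy, k, hyk⟩
    refine ⟨mul_mem hx hy, Θ x k * h, ?_⟩
    rw [homOn_Θ x hx y hy, MulAut.mul_apply, hyk, map_mul, map_mul, hxh, map_inv]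
    group
  · rintro x ⟨hx, h, hxh⟩
    refine ⟨inv_mem hx, (Θ x)⁻¹ h⁻¹, ?_⟩
    rw [homOn_Θ.inv hx]
    have : com = (Θ x)⁻¹ h * (Θ x)⁻¹ com * ((Θ x)⁻¹ h)⁻¹ := by
      rw [← map_inv, ← map_mul, ← map_mul, ← hxh, ← MulAut.mul_apply, inv_mul_cancel]; rfl
    rw [map_inv, inv_inv]
    nth_rewrite 2 [this]
    group

theorem com_ne_one : com ≠ 1 := by
  intro h
  rw [← basis_zero] at h
  exact FreeGroup.of_ne_one _ (basis_injective (h.trans (map_one _).symm))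

theorem eq_com_zpow_of_commute {f : FreeGroup (Fin 2)} (h : Commute f com) : ∃ j : ℤ, f = com ^ j := by
  obtain ⟨r, hr, hcent⟩ := exists_root_of_centralizer com_ne_one
  obtain ⟨m, hm⟩ := hcent com rfl
  obtain ⟨n, hn⟩ := hcent f h
  change r ^ m = com at hm
  change r ^ n = f at hn
  have hm0 : m ≠ 0 := by rintro rfl; exact com_ne_one (by rw [← hm, zpow_zero])
  have h1 : ab r = 0 := by
    have := ab_com
    rw [← hm, ab_zpow] at this
    exact (smul_eq_zero.1 this).resolve_left hm0
  obtain ⟨k, rfl⟩ : ∃ k, basis k = f := exists_basis_eq (by rw [← hn, ab_zpow, h1, smul_zero])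
  obtain ⟨j, hj⟩ := zpowers_of_commute_of (a := (0 : Fin 2 → ℤ)) (f := k) (by
    refine basis_injective ?_
    rw [map_mul, map_mul, basis_zero]; exact h)
  change of 0 ^ j = k at hj
  exact ⟨j, by rw [← hj, map_zpow, basis_zero]⟩

theorem T_four_mem : T 4 ∈ Bn 4 := T_mem 4

theorem T_three_zpow_two_mul (k : ℤ) : T 3 ^ (2 * k) = κ com ^ k * T 4 ^ k := by
  rw [← (commute_T (κ_mem com)).mul_zpow, ← T_three_sq, ← zpow_natCast, ← zpow_mul]; rfl

theorem κ_mul_T_three_sq (f : FreeGroup (Fin 2)) (k : ℤ) :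
    (κ f * T 3 ^ k) ^ 2 = κ (f * Θ (T 3 ^ k) f * com ^ k) * T 4 ^ k := by
  rw [map_mul, map_mul, map_zpow, mul_assoc, ← T_three_zpow_two_mul,
    ← κ_conj (zpow_mem T_three_mem k), two_mul, zpow_add, pow_two]
  group

theorem exists_κ_mul_T_three {x : Br} (hx : x ∈ Bn 4) (h : mat (Θ x) = 1 ∨ mat (Θ x) = -1) :
    ∃ f, ∃ k : ℤ, x = κ f * T 3 ^ k := by
  obtain ⟨f, b, hb, rfl⟩ := exists_κ_mul hx
  have hb1 : mat (Θ b) = 1 ∨ mat (Θ b) = -1 := by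
    rwa [homOn_Θ _ (κ_mem f) _ (gens_mono (by norm_num) hb), Θ_κ, map_mul, mat_conj, one_mul] at h
  obtain ⟨k, rfl⟩ := eq_T_three_zpow hb hb1
  exact ⟨f, k, rfl⟩

/-- Elements of `B_4` with a large centralizer are reducible or of order two modulo the center. -/
theorem reducible_of_commute {x y₀ y₁ : Br} (hx : x ∈ Bn 4) (h₀ : y₀ ∈ Bn 4) (h₁ : y₁ ∈ Bn 4)
    (hc₀ : Commute y₀ x) (hc₁ : Commute y₁ x)
    (hne : mat (Θ y₀) * mat (Θ y₁) ≠ mat (Θ y₁) * mat (Θ y₀)) :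
    (∃ k : ℤ, x ^ 2 = T 4 ^ (2 * k + 1)) ∨
      ∃ h ∈ Bn 4, ∃ l j : ℤ, x = h * T 3 ^ l * h⁻¹ * T 4 ^ j := by
  have hΘ := homOn_Θ
  have hΘc : ∀ y ∈ Bn 4, Commute y x → Commute (Θ y) (Θ x) := fun y hy h => by
    show _ * _ = _ * _
    rw [← hΘ y hy x hx, h.eq, hΘ x hx y hy]
  have hscal : mat (Θ x) = 1 ∨ mat (Θ x) = -1 := by
    refine scalar_of_commute hne ?_ ?_ (det_mat_Θ hx)
    · rw [← map_mul, ← map_mul, (hΘc y₀ h₀ hc₀).eq]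
    · rw [← map_mul, ← map_mul, (hΘc y₁ h₁ hc₁).eq]
  obtain ⟨f, k, rfl⟩ := exists_κ_mul_T_three hx hscal
  have hT3k : T 3 ^ k ∈ Bn 4 := zpow_mem T_three_mem k
  have hT4 : ∀ j : ℤ, ∀ g ∈ Bn 4, Commute (T 4 ^ j) g := fun j g hg =>
    ((commute_T hg).zpow_right j).symm
  have hcκ : Commute (T 3) (κ com) := by
    rw [show κ com = T 3 ^ 2 * (T 4)⁻¹ by rw [T_three_sq]; group]
    exact (Commute.self_pow _ _).mul_right (commute_T T_three_mem).inv_right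
  have hT3com : Θ (T 3 ^ k) com = com := κ_injective (by
    rw [← κ_conj hT3k, (hcκ.zpow_left k).eq, mul_inv_cancel_right])
  have hsq := κ_mul_T_three_sq f k
  set w := f * Θ (T 3 ^ k) f * com ^ k with hw
  obtain ⟨h, k', hwk⟩ : ∃ h, ∃ k : ℤ, w = h * com ^ k * h⁻¹ := by
    refine eq_conj_com_zpow (s := {α | ∃ y ∈ Bn 4, Commute y (κ f * T 3 ^ k) ∧ Θ y = α})
      ?_ ?_ ?_ ?_ ⟨y₀, h₀, hc₀, rfl⟩ ⟨y₁, h₁, hc₁, rfl⟩ hne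
    · rintro _ ⟨y, hy, hyc, rfl⟩ _ ⟨z, hz, hzc, rfl⟩
      exact ⟨y * z, mul_mem hy hz, hyc.mul_left hzc, hΘ y hy z hz⟩
    · rintro _ ⟨y, hy, -, rfl⟩; exact det_mat_Θ hy
    · rintro _ ⟨y, hy, -, rfl⟩; exact exists_Θ_com hy
    · rintro _ ⟨y, hy, hyc, rfl⟩
      have h1 := (hyc.pow_right 2)
      rw [hsq] at h1
      have h2 : Commute y (κ w) := by
        have := h1.mul_right ((hT4 (-k) y hy).symm)
        rwa [mul_assoc, ← zpow_add, add_neg_cancel, zpow_zero, mul_one] at this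
      exact κ_injective (by rw [← κ_conj hy, h2.eq, mul_inv_cancel_right])
  by_cases hk' : k' = 0
  · rw [hwk, hk', zpow_zero, mul_one, mul_inv_cancel, map_one, one_mul] at hsq
    rcases Int.even_or_odd' k with ⟨c, rfl | rfl⟩
    · right
      rw [T_three_zpow_two_mul] at hsq ⊢
      rw [← map_zpow, ← mul_assoc, ← map_mul] at hsq ⊢
      rw [(hT4 c _ (κ_mem _)).symm.mul_pow, ← zpow_natCast (T 4 ^ c), ← zpow_mul, mul_comm c,
        ← map_pow] at hsq
      have h1 := κ_injective ((mul_eq_right.1 hsq).trans (map_one κ).symm)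
      rw [pow_eq_one_iff_left two_ne_zero] at h1
      exact ⟨1, one_mem _, 0, c, by rw [h1]; simp⟩
    · exact .inl ⟨c, hsq⟩
  · right
    set f' := h⁻¹ * f * Θ (T 3 ^ k) h with hf'
    have hx' : (κ h)⁻¹ * (κ f * T 3 ^ k) * κ h = κ f' * T 3 ^ k := by
      rw [hf', map_mul, map_mul, map_inv, ← κ_conj hT3k]; group
    have hsq' : (κ f' * T 3 ^ k) ^ 2 = κ (com ^ k') * T 4 ^ k := by
      rw [← hx', show (κ h)⁻¹ * (κ f * T 3 ^ k) * κ h =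
        (κ h)⁻¹ * (κ f * T 3 ^ k) * ((κ h)⁻¹)⁻¹ by rw [inv_inv], conj_pow, hsq, hwk, map_mul,
        map_mul, map_inv, inv_inv, mul_assoc _ _ (κ h), mul_assoc _ (T 4 ^ k) (κ h),
        (hT4 k _ (κ_mem h)).eq]
      group
    have hx'm : κ f' * T 3 ^ k ∈ Bn 4 := mul_mem (κ_mem _) hT3k
    have h1 : Commute (κ f' * T 3 ^ k) (κ (com ^ k')) := by
      have h2 : Commute (κ f' * T 3 ^ k) ((κ f' * T 3 ^ k) ^ 2 * T 4 ^ (-k)) :=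
        (Commute.self_pow _ _).mul_right (hT4 (-k) _ hx'm).symm
      rwa [hsq', mul_assoc, ← zpow_add, add_neg_cancel, zpow_zero, mul_one] at h2
    have h2 : Θ (κ f' * T 3 ^ k) com ^ k' = com ^ k' := by
      rw [← map_zpow]
      exact κ_injective (by rw [← κ_conj hx'm, h1.eq, mul_inv_cancel_right])
    have h3 := zpow_left_injective hk' h2
    rw [hΘ _ (κ_mem f') _ hT3k, Θ_κ, MulAut.mul_apply, hT3com, MulAut.conj_apply,
      mul_inv_eq_iff_eq_mul] at h3
    obtain ⟨j, hj⟩ := eq_com_zpow_of_commute h3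
    refine ⟨κ h, κ_mem h, 2 * j + k, -j, ?_⟩
    have h4 : κ f' = T 3 ^ (2 * j) * T 4 ^ (-j) := by
      have : κ com = T 3 ^ (2 : ℤ) * (T 4)⁻¹ := by
        rw [show T 3 ^ (2 : ℤ) = T 3 ^ 2 from rfl, T_three_sq]; group
      rw [hj, map_zpow, this, ((commute_T (zpow_mem T_three_mem 2)).inv_right).mul_zpow, ← zpow_mul,
        inv_zpow']
    have h5 : κ f * T 3 ^ k = κ h * (κ f' * T 3 ^ k) * (κ h)⁻¹ := by rw [← hx']; group
    rw [h5, h4, mul_assoc _ _ (T 3 ^ k), (hT4 (-j) _ hT3k).eq, ← mul_assoc (T 3 ^ _), ← zpow_add,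
      ← mul_assoc, mul_assoc _ _ (κ h)⁻¹, (hT4 (-j) _ (inv_mem (κ_mem h))).eq, ← mul_assoc]

end core

end BraidInj

namespace BraidInj

open FreeGroup (of lift norm)
open scoped Matrix

section four

theorem mat_T_four : mat (Θ (T 4)) = 1 := by
  have h := congrArg (fun g => mat (Θ g)) T_three_sq
  simp only [pow_two] at h
  rw [homOn_Θ _ T_three_mem _ T_three_mem, homOn_Θ _ (κ_mem _) _ T_four_mem, map_mul, map_mul, Θ_κ,
    mat_conj, mat_T_three, one_mul] at h
  rw [← h]; simp

/-- Conjugation-invariant equality test for the generators of a group generated by a braid tuple. -/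
theorem BraidTuple.eq_of_commute {H : Type*} [Group H] {s : ℕ → H} (h : BraidTuple 4 s)
    (hc : Commute (s 0) (s 1)) : ∀ i, i + 1 < 4 → s i = s 0 := by
  have h01 : s 1 = s 0 := by
    have h1 := h.braid 0 (by norm_num)
    rw [zero_add, hc.eq, mul_assoc, mul_assoc] at h1
    have := mul_left_cancel h1
    rw [hc.eq] at this
    exact (mul_right_cancel this).symm
  have h02 : s 2 = s 0 := by
    have h1 : s 1 * s 2 * s 1 = s 2 * s 1 * s 2 := h.braid 1 (by norm_num)
    have h2 : s 0 * s 2 = s 2 * s 0 := h.comm 0 2 (by norm_num) (by norm_num)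
    rw [h01, h2, mul_assoc, mul_assoc] at h1
    have := mul_left_cancel h1
    exact (mul_left_cancel this).symm
  intro i hi
  obtain rfl | rfl | rfl : i = 0 ∨ i = 1 ∨ i = 2 := by omega
  · rfl
  · exact h01
  · exact h02

theorem Central.lk_eq {n : ℕ} (hn : 3 ≤ n) {g : Br} (h : Central n g) :
    ∃ m : ℤ, ∀ i j, i < j → j < n → lk g i j = 2 * m := by
  obtain ⟨m, hm⟩ := h.mem_zpowers hn
  change T n ^ m = g at hm
  refine ⟨m, fun i j hij hj => ?_⟩
  rw [← hm, lk_zpow (perm_T n), lk_T n i j hij, if_pos hj, mul_comm]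

theorem exists_zpow_eq_of_commute {F : Type*} [Group F] [IsFreeGroup F] {u v : F}
    (h : Commute u v) : ∃ a b : ℤ, (a ≠ 0 ∨ b ≠ 0) ∧ u ^ a = v ^ b := by
  by_cases hu : u = 1
  · exact ⟨1, 0, .inl one_ne_zero, by simp [hu]⟩
  obtain ⟨r, hr, hc⟩ := exists_root_of_centralizer hu
  obtain ⟨m, hm⟩ := hc u rfl
  obtain ⟨k, hk⟩ := hc v h.symm
  change r ^ m = u at hm
  change r ^ k = v at hk
  have hm0 : m ≠ 0 := by rintro rfl; exact hu (by rw [← hm, zpow_zero])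
  exact ⟨k, m, .inr hm0, by rw [← hm, ← hk, ← zpow_mul, ← zpow_mul, mul_comm]⟩

variable {R : Br → Br}

theorem not_commute_of_injective (h : HomOn (Bn 4) R) (hm : ∀ g ∈ Bn 4, R g ∈ Bn 4)
    (hinj : ∀ g ∈ Bn 4, Central 4 (R g) → Central 4 g) (hT : Central 4 (R (T 4))) :
    mat (Θ (R (σ 0))) * mat (Θ (R (σ 1))) ≠ mat (Θ (R (σ 1))) * mat (Θ (R (σ 0))) := by
  intro hcomm
  set U : Br → (Matrix (Fin 2) (Fin 2) ℤ)ˣ := fun g => mat.toHomUnits (Θ (R g)) with hU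
  have hUh : HomOn (Bn 4) U := fun x hx y hy => by
    rw [hU]
    simp only [h x hx y hy, homOn_Θ _ (hm x hx) _ (hm y hy), map_mul]
  have hUval : ∀ g, ((U g : (Matrix (Fin 2) (Fin 2) ℤ)ˣ) : Matrix (Fin 2) (Fin 2) ℤ) = mat (Θ (R g)) :=
    fun g => rfl
  have hσ := hUh.braidTuple.eq_of_commute (Units.ext hcomm)
  have hexp : ∀ g ∈ Bn 4, U g = zpowersHom _ (U (σ 0)) (expSum g) := fun g hg =>
    hUh.eqOn_gens (homOn_monoidHom ((zpowersHom _ (U (σ 0))).comp expSum) _)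
      (fun i hi => by simpa using hσ i hi) hg
  have h12 : U (σ 0) ^ (12 : ℤ) = 1 := by
    have h1 := hexp _ T_four_mem
    rw [expSum_T] at h1
    obtain ⟨j, hj⟩ := hT.mem_zpowers (by norm_num)
    change T 4 ^ j = _ at hj
    have h2 : U (T 4) = 1 := Units.ext <| by
      rw [hUval, ← hj, homOn_Θ.zpow T_four_mem, Units.val_one]
      have h3 : mat.toHomUnits (Θ (T 4)) = 1 := Units.ext mat_T_four
      change ((mat.toHomUnits (Θ (T 4) ^ j) : (Matrix (Fin 2) (Fin 2) ℤ)ˣ) : Matrix (Fin 2) (Fin 2) ℤ) = _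
      rw [map_zpow, h3, one_zpow, Units.val_one]
    rw [h2] at h1
    rw [h1, zpowersHom_apply]
    norm_num
  have hker : ∀ i, i + 1 < 4 → ∃ w, ∃ k : ℤ, R (σ i) ^ (24 : ℤ) = κ w * T 4 ^ k := by
    intro i hi
    have h1 : mat (Θ (R (σ i ^ (12 : ℤ)))) = 1 := by
      rw [← hUval, hUh.zpow (σ_mem hi), hσ i hi, h12, Units.val_one]
    obtain ⟨f, k, hf⟩ := exists_κ_mul_T_three (hm _ (zpow_mem (σ_mem hi) _)) (.inl h1)
    refine ⟨_, k, Eq.trans ?_ (κ_mul_T_three_sq f k)⟩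
    rw [← hf, h.zpow (σ_mem hi), ← zpow_natCast, ← zpow_mul]; rfl
  obtain ⟨u, k, hu⟩ := hker 0 (by norm_num)
  obtain ⟨v, k', hv⟩ := hker 2 (by norm_num)
  have hT4 : ∀ j : ℤ, ∀ g ∈ Bn 4, Commute (T 4 ^ j) g := fun j g hg =>
    ((commute_T hg).zpow_right j).symm
  have huv : Commute u v := by
    have h1 : Commute (R (σ 0)) (R (σ 2)) := h.braidTuple.comm 0 2 (by norm_num) (by norm_num)
    have h2 := (h1.zpow_zpow 24 24)
    have e : ∀ w (k : ℤ), κ w = (κ w * T 4 ^ k) * T 4 ^ (-k) := fun w k => by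
      rw [mul_assoc, ← zpow_add, add_neg_cancel, zpow_zero, mul_one]
    rw [hu, hv] at h2
    have h3 : Commute (κ u) (κ v) := by
      rw [e u k, e v k']
      have := fun (w : FreeGroup (Fin 2)) (k j : ℤ) => hT4 j _ (mul_mem (κ_mem w) (zpow_mem T_four_mem k))
      exact ((h2.mul_right (this u k _).symm).mul_left ((this v k' (-k)).mul_right
        ((Commute.refl _).zpow_zpow _ _)))
    exact κ_injective (by rw [map_mul, map_mul, h3.eq])
  obtain ⟨a, b, hab, huvab⟩ := exists_zpow_eq_of_commute huv
  have h0 : σ 0 ∈ Bn 4 := σ_mem (by norm_num)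
  have h2 : σ 2 ∈ Bn 4 := σ_mem (by norm_num)
  have hc : Central 4 (R (σ 0 ^ (24 * a) * (σ 2 ^ (24 * b))⁻¹)) := by
    rw [h _ (zpow_mem h0 _) _ (inv_mem (zpow_mem h2 _)), h.inv (zpow_mem h2 _), h.zpow h0,
      h.zpow h2, zpow_mul, zpow_mul, hu, hv, (hT4 k _ (κ_mem u)).symm.mul_zpow,
      (hT4 k' _ (κ_mem v)).symm.mul_zpow, ← map_zpow, ← map_zpow, huvab]
    have : κ (v ^ b) * (T 4 ^ k) ^ a * (κ (v ^ b) * (T 4 ^ k') ^ b)⁻¹ = T 4 ^ (k * a - k' * b) := by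
      rw [← zpow_mul, ← zpow_mul, mul_inv_rev, ← mul_assoc, mul_assoc (κ _), ← zpow_neg, ← zpow_add,
        ← (hT4 _ _ (κ_mem _)).eq, mul_inv_cancel_right]
      rfl
    rw [this]
    exact (central_T 4).zpow _
  obtain ⟨m, hlk⟩ := (hinj _ (mul_mem (zpow_mem h0 _) (inv_mem (zpow_mem h2 _))) hc).lk_eq (by norm_num)
  have hsq : ∀ i, perm (σ i ^ (2 : ℤ)) = 1 := fun i => by
    rw [map_zpow, perm_σ]; exact (pow_two _).trans (Equiv.swap_mul_self _ _)
  have hpow : ∀ i (a : ℤ), σ i ^ (24 * a) = (σ i ^ (2 : ℤ)) ^ (12 * a) := fun i a => by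
    rw [← zpow_mul]; congr 1; ring
  have hlk' : ∀ i j, lk (σ 0 ^ (24 * a) * (σ 2 ^ (24 * b))⁻¹) i j =
      12 * a * lk (σ 0 ^ (2 : ℤ)) i j - 12 * b * lk (σ 2 ^ (2 : ℤ)) i j := fun i j => by
    have hp : perm (σ 2 ^ (-(24 * b))) = 1 := by
      rw [← mul_neg, hpow, map_zpow, hsq, one_zpow]
    rw [← zpow_neg, lk_mul_of_pure hp, ← mul_neg, hpow, hpow, lk_zpow (hsq _), lk_zpow (hsq _)]
    ring
  have hlk2 : ∀ i p q, lk (σ i ^ (2 : ℤ)) p q = crossing i p q +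
      crossing i (Equiv.swap i (i + 1) p) (Equiv.swap i (i + 1) q) := fun i p q => by
    rw [show σ i ^ (2 : ℤ) = σ i * σ i by rw [zpow_two], lk_mul, lk_σ, lk_σ, perm_σ]
  have e01 := hlk 0 1 (by norm_num) (by norm_num)
  have e02 := hlk 0 2 (by norm_num) (by norm_num)
  have e23 := hlk 2 3 (by norm_num) (by norm_num)
  rw [hlk', hlk2, hlk2] at e01 e02 e23
  simp [crossing, pairInd, Equiv.swap_apply_def] at e01 e02 e23
  omega

theorem finish_four (h : HomOn (Bn 4) R) (hm : ∀ g ∈ Bn 4, R g ∈ Bn 4) (hT : Central 4 (R (T 4)))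
    {c : Br} (hc : c ∈ Bn 4) {l j : ℤ} (hl : l ≠ 0) (hR : R (T 3) = c * T 3 ^ l * c⁻¹ * T 4 ^ j) :
    ∃ b : Qn 4, (∀ x ∈ Bn 4, q 4 (R x) = b * q 4 x * b⁻¹) ∨
      ∀ x ∈ Bn 4, q 4 (R x) = b * q 4 (mirror x) * b⁻¹ := by
  have hq := homOn_q 4
  have hTl : T 3 ^ l ∈ Bn 4 := zpow_mem T_three_mem l
  refine finish (m := 3) (by norm_num) (ρ := fun x => q 4 (R x)) (g := q 4 c)
    (fun x hx y hy => by simp only [h x hx y hy]; exact hq _ (hm x hx) _ (hm y hy)) hl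
    ((q_eq_one_iff (hm _ T_four_mem)).2 hT) ?_
  simp only [hR]
  rw [hq _ (mul_mem (mul_mem hc hTl) (inv_mem hc)) _ (zpow_mem T_four_mem j), hq.conj hc hTl,
    hq.zpow T_three_mem, (q_eq_one_iff (zpow_mem T_four_mem j)).2 ((central_T 4).zpow j), mul_one]

theorem geometric_of_injective_four (h : HomOn (Bn 4) R) (hm : ∀ g ∈ Bn 4, R g ∈ Bn 4)
    (hinj : ∀ g ∈ Bn 4, Central 4 (R g) → Central 4 g) (hT : Central 4 (R (T 4))) :
    ∃ b : Qn 4, (∀ x ∈ Bn 4, q 4 (R x) = b * q 4 x * b⁻¹) ∨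
      ∀ x ∈ Bn 4, q 4 (R x) = b * q 4 (mirror x) * b⁻¹ := by
  have hT3 : ∀ k : ℤ, Central 4 (R (T 3 ^ k)) → k = 0 := by
    intro k hk
    obtain ⟨m, hlk⟩ := (hinj _ (zpow_mem T_three_mem k) hk).lk_eq (by norm_num)
    have e01 := hlk 0 1 (by norm_num) (by norm_num)
    have e03 := hlk 0 3 (by norm_num) (by norm_num)
    rw [lk_zpow (perm_T 3), lk_T _ _ _ (by norm_num)] at e01 e03
    norm_num at e01 e03
    omega
  have hσ : ∀ i, i + 1 < 4 → R (σ i) ∈ Bn 4 := fun i hi => hm _ (σ_mem hi)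
  have hcomm : ∀ i, i + 1 < 3 → Commute (R (σ i)) (R (T 3)) := fun i hi => by
    have h1 : σ i ∈ Bn 4 := σ_mem (by omega)
    show _ * _ = _ * _
    rw [← h _ h1 _ T_three_mem, (commute_T (σ_mem hi)).eq, h _ T_three_mem _ h1]
  rcases reducible_of_commute (hm _ T_three_mem) (hσ 0 (by norm_num)) (hσ 1 (by norm_num))
    (hcomm 0 (by norm_num)) (hcomm 1 (by norm_num)) (not_commute_of_injective h hm hinj hT) with
    ⟨k, hk⟩ | ⟨c, hc, l, j, hx⟩
  · refine absurd (hT3 2 ?_) two_ne_zero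
    rw [h.zpow T_three_mem, zpow_two, ← pow_two, hk]
    exact (central_T 4).zpow _
  · refine finish_four h hm hT hc (l := l) ?_ hx
    rintro rfl
    refine absurd (hT3 1 ?_) one_ne_zero
    rw [zpow_one, hx, zpow_zero, mul_one, mul_inv_cancel, one_mul]
    exact (central_T 4).zpow _

end four

end BraidInj

namespace BraidInj

open FreeGroup (of lift norm)
open scoped Matrix

section four

variable {s : ℕ → Br}

theorem Std.mat_ne (h : Std 4 s) :
    mat (Θ (s 0)) * mat (Θ (s 1)) ≠ mat (Θ (s 1)) * mat (Θ (s 0)) := by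
  intro hc
  have h0 := h.mem 0 (by norm_num)
  have h1 := h.mem 1 (by norm_num)
  have h2 : matTwo (Θ (s 0 * s 1)) = matTwo (Θ (s 1 * s 0)) := by
    rw [matTwo, MonoidHom.comp_apply, MonoidHom.comp_apply, homOn_Θ _ h0 _ h1, homOn_Θ _ h1 _ h0,
      map_mul mat, map_mul mat, hc]
  have h3 := matTwo_Θ (mul_mem h0 h1) 0 (by norm_num) 3 (by norm_num)
  rw [h2, matTwo_Θ (mul_mem h1 h0) 0 (by norm_num) 3 (by norm_num), map_mul, map_mul,
    h.perm_eq 0 (by norm_num), h.perm_eq 1 (by norm_num)] at h3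
  simp only [Equiv.Perm.mul_apply, Equiv.swap_apply_def] at h3
  revert h3
  decide

theorem reducible_of_pure {x y₀ y₁ : Br} (hx : x ∈ Bn 4) (hp : perm x = 1) (h₀ : y₀ ∈ Bn 4)
    (h₁ : y₁ ∈ Bn 4) (hc₀ : Commute y₀ x) (hc₁ : Commute y₁ x)
    (hne : mat (Θ y₀) * mat (Θ y₁) ≠ mat (Θ y₁) * mat (Θ y₀)) :
    ∃ h ∈ Bn 4, ∃ l j : ℤ, x = h * T 3 ^ l * h⁻¹ * T 4 ^ j := by
  refine (reducible_of_commute hx h₀ h₁ hc₀ hc₁ hne).resolve_left ?_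
  rintro ⟨k, hk⟩
  have h1 := congrArg (lk · 0 1) hk
  change lk (x ^ 2) 0 1 = lk (T 4 ^ (2 * k + 1)) 0 1 at h1
  rw [lk_zpow (perm_T 4), lk_T _ _ _ (by norm_num), if_pos (by norm_num), pow_two,
    lk_mul_of_pure hp] at h1
  have h2 := (even_lk_iff x 0 1 (by norm_num)).2 (by simp [hp])
  obtain ⟨a, ha⟩ := h2
  omega

/-- The total linking numbers of the first three strands with each other and with the last one. -/
def lkInner (g : Br) : ℤ := lk g 0 1 + lk g 0 2 + lk g 1 2

def lkOuter (g : Br) : ℤ := lk g 0 3 + lk g 1 3 + lk g 2 3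

theorem lkInner_mul (g : Br) {h : Br} (hh : perm h = Equiv.swap 0 1 ∨ perm h = Equiv.swap 1 2) :
    lkInner (g * h) = lkInner g + lkInner h ∧ lkOuter (g * h) = lkOuter g + lkOuter h := by
  have h10 := lk_symm g 1 0
  have h21 := lk_symm g 2 1
  simp only [lkInner, lkOuter, lk_mul]
  rcases hh with e | e <;> rw [e] <;> simp [Equiv.swap_apply_def] <;> constructor <;> linarith

theorem T_three_eq : T 3 = σ 0 * σ 0 * σ 1 * σ 0 * σ 0 * σ 1 := by
  rw [T_succ, T_two, J_succ, J_succ, J_zero]; group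

theorem lk_T_four (j : ℤ) {a b : ℕ} (ha : a < 4) (hb : b < 4) (hab : a ≠ b) :
    lk (T 4 ^ j) a b = 2 * j := by
  rw [lk_zpow (perm_T 4)]
  rcases hab.lt_or_gt with h | h
  · rw [lk_T _ _ _ h, if_pos hb, mul_comm]
  · rw [lk_symm, lk_T _ _ _ h, if_pos ha, mul_comm]

theorem Std.map_T_four (h : Std 4 s) : Central 4 (evalTuple h.tuple (T 4)) := by
  have hρ := homOn_evalTuple h.tuple
  set z := evalTuple h.tuple (T 4) with hz
  have hp : perm z = 1 := by rw [hz, h.perm_evalTuple T_four_mem, perm_T]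
  have hc : ∀ i, i + 1 < 4 → Commute (s i) z := fun i hi => by
    rw [← evalTuple_σ h.tuple hi]
    show _ * _ = _ * _
    rw [hz, ← hρ _ (σ_mem hi) _ T_four_mem, (commute_T (σ_mem hi)).eq,
      hρ _ T_four_mem _ (σ_mem hi)]
  have hsym : ∀ i, i + 1 < 4 → ∀ a b, lk z a b = lk z (Equiv.swap i (i + 1) a) (Equiv.swap i (i + 1) b) := by
    intro i hi a b
    have h1 := lk_conj (g := s i) hp a b
    rwa [(hc i hi).eq, mul_inv_cancel_right, map_inv, h.perm_eq i hi, Equiv.swap_inv] at h1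
  have h12 : lk z 0 1 = lk z 0 2 := by simpa [Equiv.swap_apply_def] using hsym 1 (by norm_num) 0 1
  have h23 : lk z 0 2 = lk z 0 3 := by simpa [Equiv.swap_apply_def] using hsym 2 (by norm_num) 0 2
  have h02 : lk z 0 2 = lk z 1 2 := by simpa [Equiv.swap_apply_def] using hsym 0 (by norm_num) 0 2
  have h03 : lk z 0 3 = lk z 1 3 := by simpa [Equiv.swap_apply_def] using hsym 0 (by norm_num) 0 3
  have h13 : lk z 1 3 = lk z 2 3 := by simpa [Equiv.swap_apply_def] using hsym 1 (by norm_num) 1 3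
  have hall : ∀ a < 4, ∀ b < 4, a ≠ b → lk z a b = lk z 0 1 := by
    have key : ∀ a b, a < b → b < 4 → lk z a b = lk z 0 1 := by
      intro a b hab hb
      interval_cases b <;> interval_cases a <;> omega
    intro a ha b hb hab
    rcases hab.lt_or_gt with h | h
    · exact key a b h hb
    · rw [lk_symm]; exact key b a h ha
  obtain ⟨c, hcm, l, j, e⟩ := reducible_of_pure (h.evalTuple_mem T_four_mem) hp
    (h.mem 0 (by norm_num)) (h.mem 1 (by norm_num)) (hc 0 (by norm_num)) (hc 1 (by norm_num)) h.mat_ne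
  have hlk : ∀ a < 4, ∀ b < 4, a ≠ b → lk z (perm c a) (perm c b) = lk (T 3 ^ l) a b + 2 * j := by
    intro a ha b hb hab
    rw [hz, e, lk_mul_of_pure (by simp), lk_conj (by simp), lk_T_four j ((perm_lt_iff hcm a).2 ha)
      ((perm_lt_iff hcm b).2 hb) (by simpa using hab), map_inv, ← Equiv.Perm.mul_apply, ← Equiv.Perm.mul_apply,
      inv_mul_cancel, Equiv.Perm.one_apply, Equiv.Perm.one_apply]
  have hall' : ∀ a < 4, ∀ b < 4, a ≠ b → lk z (perm c a) (perm c b) = lk z 0 1 :=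
    fun a ha b hb hab => hall _ ((perm_lt_iff hcm a).2 ha) _ ((perm_lt_iff hcm b).2 hb) (by simpa using hab)
  have e01 := hlk 0 (by norm_num) 1 (by norm_num) (by norm_num)
  have e03 := hlk 0 (by norm_num) 3 (by norm_num) (by norm_num)
  rw [hall' _ (by norm_num) _ (by norm_num) (by norm_num), lk_zpow (perm_T 3),
    lk_T _ _ _ (by norm_num)] at e01 e03
  norm_num at e01 e03
  obtain rfl : l = 0 := by omega
  rw [hz, e, zpow_zero, mul_one, mul_inv_cancel, one_mul]
  exact (central_T 4).zpow j

theorem Std.geo_four (h : Std 4 s) : Geo 4 s := by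
  have hρ := homOn_evalTuple h.tuple
  set z := evalTuple h.tuple (T 3) with hz
  have hp : perm z = 1 := by rw [hz, h.perm_evalTuple T_three_mem, perm_T]
  have hs : ∀ i, i + 1 < 4 → evalTuple h.tuple (σ i) = s i := fun i hi => evalTuple_σ h.tuple hi
  have hc : ∀ i, i + 1 < 3 → Commute (s i) z := fun i hi => by
    have h1 : σ i ∈ Bn 4 := σ_mem (by omega)
    rw [← hs i (by omega)]
    show _ * _ = _ * _
    rw [hz, ← hρ _ h1 _ T_three_mem, (commute_T (σ_mem hi)).eq, hρ _ T_three_mem _ h1]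
  obtain ⟨c, hcm, l, j, e⟩ := reducible_of_pure (h.evalTuple_mem T_three_mem) hp
    (h.mem 0 (by norm_num)) (h.mem 1 (by norm_num)) (hc 0 (by norm_num)) (hc 1 (by norm_num)) h.mat_ne
  have hl : l ≠ 0 := by
    rintro rfl
    rw [zpow_zero, mul_one, mul_inv_cancel, one_mul] at e
    have p0 := h.perm_eq 0 (by norm_num)
    have p1 := h.perm_eq 1 (by norm_num)
    have p2 := h.perm_eq 2 (by norm_num)
    norm_num at p0 p1 p2
    have hz' : z = s 0 * s 0 * s 1 * s 0 * s 0 * s 1 := by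
      rw [hz, T_three_eq, ← hs 0 (by norm_num), ← hs 1 (by norm_num)]
      have m0 : σ 0 ∈ Bn 4 := σ_mem (by norm_num)
      have m1 : σ 1 ∈ Bn 4 := σ_mem (by norm_num)
      rw [hρ _ (mul_mem (mul_mem (mul_mem (mul_mem m0 m0) m1) m0) m0) _ m1,
        hρ _ (mul_mem (mul_mem (mul_mem m0 m0) m1) m0) _ m0,
        hρ _ (mul_mem (mul_mem m0 m0) m1) _ m0, hρ _ (mul_mem m0 m0) _ m1, hρ _ m0 _ m0]
    have m0 := fun g => lkInner_mul g (h := s 0) (.inl p0)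
    have m1 := fun g => lkInner_mul g (h := s 1) (.inr p1)
    have hbr : s 0 * s 1 * s 0 = s 1 * s 0 * s 1 := h.tuple.braid 0 (by norm_num)
    have hI := congrArg lkInner hbr
    have hO := congrArg lkOuter hbr
    have hI6 := congrArg lkInner (hz'.symm.trans e)
    have hO6 := congrArg lkOuter (hz'.symm.trans e)
    have hTI : lkInner (T 4 ^ j) = 6 * j := by
      simp only [lkInner]
      rw [lk_T_four, lk_T_four, lk_T_four] <;> first | (norm_num; done) | ring1
    have hTO : lkOuter (T 4 ^ j) = 6 * j := by
      simp only [lkOuter]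
      rw [lk_T_four, lk_T_four, lk_T_four] <;> first | (norm_num; done) | ring1
    simp only [(m0 _).1, (m1 _).1, hTI] at hI hI6
    simp only [(m0 _).2, (m1 _).2, hTO] at hO hO6
    have hcomm : s 0 * s 2 = s 2 * s 0 := h.tuple.comm 0 2 (by norm_num) (by norm_num)
    have c02 := congrArg (lk · 0 2) hcomm
    have c12 := congrArg (lk · 1 2) hcomm
    simp only [lk_mul, p0, p2, Equiv.swap_apply_def] at c02 c12
    norm_num at c02 c12
    have v01 := (even_lk_iff (s 0) 0 1 (by norm_num)).1
    have v23 := (even_lk_iff (s 0) 2 3 (by norm_num)).2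
    simp only [p0, Equiv.swap_apply_def] at v01 v23
    norm_num at v01 v23
    simp only [lkInner, lkOuter] at hI hO hI6 hO6
    obtain ⟨a, ha⟩ := v01
    obtain ⟨b, hb⟩ := v23
    omega
  obtain ⟨b, hb⟩ := finish_four hρ (fun g hg => h.evalTuple_mem hg) h.map_T_four hcm hl e
  obtain ⟨c, hc, t, ε, hε, hg⟩ := geo_of_quotient (by norm_num) hρ (fun g hg => h.evalTuple_mem hg) hb
  exact ⟨c, hc, t, ε, hε, fun i hi => by rw [← hs i hi]; exact hg i hi⟩

end four

theorem Std.geo {n : ℕ} (hn : 4 ≤ n) : ∀ s, Std n s → Geo n s := by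
  induction n, hn using Nat.le_induction with
  | base => exact fun s h => h.geo_four
  | succ m hm ih => exact fun s h => h.step hm ih

end BraidInj

namespace BraidInj

open FreeGroup (of lift norm)

namespace BraidTuple

variable {H : Type*} [Group H] {n m : ℕ} {s : ℕ → H}

theorem shift (h : BraidTuple n s) (k : ℕ) : BraidTuple (n - k) fun i => s (i + k) :=
  ⟨fun i hi => by simpa only [Nat.add_right_comm] using h.braid (i + k) (by omega),
    fun i j hij hj => h.comm (i + k) (j + k) (by omega) (by omega)⟩

theorem succ_eq_of_commute (h : BraidTuple n s) {i : ℕ} (hi : i + 2 < n)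
    (hc : Commute (s i) (s (i + 1))) : s (i + 1) = s i := by
  have h1 := h.braid i hi
  rw [hc.eq, mul_assoc, mul_assoc] at h1
  exact (mul_left_cancel (mul_left_cancel h1)).symm

/-- A braid tuple two consecutive terms of which commute is constant. -/
theorem eq_zero_of_commute (h : BraidTuple n s) {i : ℕ} (hi : i + 2 < n)
    (hc : Commute (s i) (s (i + 1))) : ∀ j, j + 1 < n → s j = s 0 := by
  have up : ∀ k, i + k + 2 < n → s (i + k + 1) = s (i + k) := by
    intro k
    induction k with
    | zero => exact fun _ => h.succ_eq_of_commute hi hc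
    | succ k ih =>
      intro hk
      have h1 := h.comm (i + k) (i + k + 2) le_rfl (by omega)
      rw [← ih (by omega)] at h1
      exact h.succ_eq_of_commute hk h1
  have down : ∀ k ≤ i, s (i - k + 1) = s (i - k) := by
    intro k
    induction k with
    | zero => exact fun _ => up 0 hi
    | succ k ih =>
      intro hk
      have h1 := h.comm (i - (k + 1)) (i - k + 1) (by omega) (by omega)
      rw [ih (by omega), show i - k = i - (k + 1) + 1 by omega] at h1
      exact h.succ_eq_of_commute (by omega) h1
  intro j
  induction j with
  | zero => exact fun _ => rfl
  | succ j ih =>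
    intro hj
    rw [← ih (by omega)]
    rcases le_total i j with hij | hij
    · obtain ⟨k, rfl⟩ := Nat.exists_eq_add_of_le hij
      exact up k (by omega)
    · have := down (i - j) (by omega)
      rwa [Nat.sub_sub_self hij] at this

theorem eq_zero_of_eq (h : BraidTuple n s) {i : ℕ} (hi : i + 2 < n) (he : s (i + 1) = s i) :
    ∀ j, j + 1 < n → s j = s 0 :=
  h.eq_zero_of_commute hi (he ▸ Commute.refl _)

theorem eq_zero_of_commute_div (h : BraidTuple n s) (hn : 5 ≤ n)
    (hc : Commute (s 0 * (s 1)⁻¹) (s 3 * (s 0)⁻¹)) : ∀ j, j + 1 < n → s j = s 0 := by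
  have h3 : Commute (s 0 * (s 1)⁻¹) (s 3) :=
    ((h.comm 0 3 (by omega) (by omega)).mul_left (h.comm 1 3 (by omega) (by omega)).inv_left)
  have h0 : Commute (s 0 * (s 1)⁻¹) (s 0) := by
    have := (h3.inv_right.mul_right hc).inv_right
    simpa using this
  have h1 : Commute (s 1)⁻¹ (s 0) := by
    have := (Commute.refl (s 0)).inv_left.mul_left h0
    simpa using this
  refine h.eq_zero_of_commute (i := 0) (by omega) ?_
  simpa using h1.inv_left.symm

theorem eq_zero_of_eq_of_le (h : BraidTuple n s) (hn : 5 ≤ n) {i j : ℕ} (hij : i + 2 ≤ j)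
    (hj : j + 1 < n) (he : s i = s j) : ∀ j, j + 1 < n → s j = s 0 := by
  rcases hij.eq_or_lt with rfl | hlt
  · rcases i.eq_zero_or_pos with rfl | hi
    · refine h.eq_zero_of_commute (i := 2) (by omega) ?_
      rw [← he]
      exact h.comm 0 3 (by omega) (by omega)
    · obtain ⟨i, rfl⟩ := Nat.exists_eq_add_of_lt hi
      refine h.eq_zero_of_commute (i := i) (by omega) ?_
      rw [show i + 1 = 0 + i + 1 by omega, he]
      exact h.comm i _ (by omega) (by omega)
  · refine h.eq_zero_of_commute (i := i) (by omega) ?_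
    rw [he]
    exact (h.comm (i + 1) j (by omega) (by omega)).symm

end BraidTuple

section coxeter

variable {H : Type*} [Group H] {m : ℕ} {s : ℕ → H}

/-- The product `s 0 * s 1 * ⋯ * s (k - 1)`. -/
def cc (s : ℕ → H) : ℕ → H
  | 0 => 1
  | k + 1 => cc s k * s k

@[simp] theorem cc_zero (s : ℕ → H) : cc s 0 = 1 := rfl

theorem cc_succ (s : ℕ → H) (k : ℕ) : cc s (k + 1) = cc s k * s k := rfl

theorem map_cc {K : Type*} [Group K] (f : H →* K) (s : ℕ → H) (k : ℕ) :
    f (cc s k) = cc (fun i => f (s i)) k := by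
  induction k with
  | zero => exact map_one f
  | succ k ih => rw [cc_succ, cc_succ, map_mul, ih]

theorem cc_mem {K : Subgroup H} {k : ℕ} (h : ∀ i < k, s i ∈ K) : cc s k ∈ K := by
  induction k with
  | zero => exact one_mem _
  | succ k ih => exact mul_mem (ih fun i hi => h i (by omega)) (h k (by omega))

namespace BraidTuple

theorem commute_cc (h : BraidTuple (m + 1) s) {i : ℕ} (hi : i < m) {k : ℕ} (hk : k + 1 ≤ i) :
    Commute (cc s k) (s i) := by
  induction k with
  | zero => exact Commute.one_left _
  | succ k ih => exact (ih (by omega)).mul_left (h.comm k i (by omega) (by omega))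

theorem cc_mul (h : BraidTuple (m + 1) s) {k : ℕ} (hk : k ≤ m) :
    ∀ i, i + 1 < k → cc s k * s i = s (i + 1) * cc s k := by
  induction k with
  | zero => intro i hi; omega
  | succ k ih =>
    intro i hi
    rcases Nat.lt_or_ge (i + 1) k with hik | hik
    · rw [cc_succ, mul_assoc, ← (h.comm i k (by omega) (by omega)).eq, ← mul_assoc,
        ih (by omega) i hik, mul_assoc]
    · obtain rfl : k = i + 1 := by omega
      have h1 := h.braid i (by omega)
      have h2 := (h.commute_cc (i := i + 1) (k := i) (by omega) le_rfl).eq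
      calc cc s i * s i * s (i + 1) * s i = cc s i * (s i * s (i + 1) * s i) := by group
        _ = (cc s i * s (i + 1)) * (s i * s (i + 1)) := by rw [h1]; group
        _ = s (i + 1) * (cc s i * s i * s (i + 1)) := by rw [h2]; group

theorem zero_mul_cc_mul (h : BraidTuple (m + 1) s) {k : ℕ} (hk : k + 1 ≤ m) :
    s 0 * (cc s m * cc s k) = cc s (k + 1) * cc s m := by
  induction k with
  | zero => simp [cc_succ]
  | succ k ih =>
    rw [cc_succ s k, ← mul_assoc, ← mul_assoc, mul_assoc (s 0), ih (by omega), mul_assoc,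
      h.cc_mul le_rfl k (by omega), cc_succ s (k + 1)]
    group

theorem cc_sq_mul (h : BraidTuple (m + 2) s) :
    cc s (m + 1) * cc s (m + 1) * s m = s 0 * (cc s (m + 1) * cc s (m + 1)) := by
  have h1 := h.zero_mul_cc_mul (k := m) le_rfl
  calc _ = s 0 * (cc s (m + 1) * cc s m) * s m := by rw [h1]
    _ = s 0 * (cc s (m + 1) * (cc s m * s m)) := by group
    _ = _ := by rw [← cc_succ]

theorem cc_pow_mul (h : BraidTuple (m + 1) s) (k : ℕ) :
    ∀ i, i + k < m → cc s m ^ k * s i = s (i + k) * cc s m ^ k := by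
  induction k with
  | zero => simp
  | succ k ih =>
    intro i hi
    rw [pow_succ', mul_assoc, ih i (by omega), ← mul_assoc, h.cc_mul le_rfl _ (by omega), mul_assoc,
      add_assoc]

theorem commute_cc_pow (h : BraidTuple (m + 1) s) : Commute (cc s m ^ (m + 1)) (s 0) := by
  rcases m with - | m
  · simp
  · have h1 := h.cc_pow_mul m 0 (by omega)
    rw [zero_add] at h1
    show _ = _
    calc cc s (m + 1) ^ (m + 1 + 1) * s 0
        = cc s (m + 1) * cc s (m + 1) * (cc s (m + 1) ^ m * s 0) := by
          rw [pow_succ', pow_succ']; group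
      _ = cc s (m + 1) * cc s (m + 1) * s m * cc s (m + 1) ^ m := by rw [h1]; group
      _ = s 0 * cc s (m + 1) ^ (m + 1 + 1) := by rw [h.cc_sq_mul, pow_succ', pow_succ']; group

theorem commute_cc_pow_gens (h : BraidTuple (m + 1) s) {g : H} (hg : g ∈ gens (m + 1) s) :
    Commute g (cc s m ^ (m + 1)) := by
  refine commute_gens (fun i hi => ?_) hg
  have h1 := h.cc_pow_mul i 0 (by omega)
  rw [zero_add] at h1
  rw [← mul_inv_eq_iff_eq_mul.2 h1]
  have h2 : Commute (cc s m ^ i) (cc s m ^ (m + 1)) := (Commute.refl _).pow_pow _ _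
  exact (h2.mul_left h.commute_cc_pow.symm).mul_left h2.inv_left

theorem zero_mul_cc_pow (h : BraidTuple (m + 1) s) {k : ℕ} (hk : k ≤ m) :
    (s 0 * cc s m) ^ k = cc s k * cc s m ^ k := by
  induction k with
  | zero => simp
  | succ k ih =>
    rw [pow_succ', ih (by omega), pow_succ' (cc s m), ← mul_assoc, ← mul_assoc, mul_assoc (s 0),
      h.zero_mul_cc_mul hk]

theorem zero_mul_cc_pow_self (h : BraidTuple (m + 1) s) :
    (s 0 * cc s m) ^ m = cc s m ^ (m + 1) := by
  rw [h.zero_mul_cc_pow le_rfl, pow_succ']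

theorem eq_zero_of_commute_cc (h : BraidTuple (m + 1) s) (hm : 2 ≤ m)
    (hc : Commute (cc s m) (s 0)) : ∀ j, j + 1 < m + 1 → s j = s 0 := by
  refine h.eq_zero_of_eq (i := 0) (by omega) ?_
  have := h.cc_mul le_rfl 0 (by omega)
  rw [hc.eq] at this
  exact (mul_right_cancel this).symm

end BraidTuple

theorem mem_zpowers_pow_of_coprime {G : Type*} [Group G] [Finite G] {g : G} {k : ℕ}
    (h : (orderOf g).Coprime k) : g ∈ Subgroup.zpowers (g ^ k) := by
  obtain ⟨j, hj⟩ := exists_pow_eq_self_of_coprime h.symm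
  exact ⟨j, by simpa using hj⟩

namespace BraidTuple

variable [Finite H]

theorem eq_zero_of_coprime_cc (h : BraidTuple (m + 1) s) (hm : 2 ≤ m)
    (hc : (orderOf (cc s m)).Coprime (m + 1)) : ∀ j, j + 1 < m + 1 → s j = s 0 := by
  refine h.eq_zero_of_commute_cc hm ?_
  obtain ⟨k, hk⟩ := mem_zpowers_pow_of_coprime hc
  rw [← hk]
  exact h.commute_cc_pow.zpow_left k

theorem eq_zero_of_coprime_zero_mul_cc (h : BraidTuple (m + 1) s) (hm : 2 ≤ m)
    (hc : (orderOf (s 0 * cc s m)).Coprime m) : ∀ j, j + 1 < m + 1 → s j = s 0 := by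
  refine h.eq_zero_of_commute_cc hm ?_
  obtain ⟨k, hk⟩ := mem_zpowers_pow_of_coprime hc
  have h1 : Commute (s 0 * cc s m) (s 0) := by
    rw [← hk, h.zero_mul_cc_pow_self]
    exact h.commute_cc_pow.zpow_left k
  have := (Commute.refl (s 0)).inv_left.mul_left h1
  simpa using this

end BraidTuple

end coxeter

end BraidInj

namespace BraidInj

open FreeGroup (of lift norm)
open scoped commutatorElement

section perfect

variable {C : Type*} [Group C]

theorem perfect_eq_one_of_free (hC : commutator C = ⊤) {F : Type*} [Group F] [IsFreeGroup F]
    (φ : C →* F) (x : C) : φ x = 1 := by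
  let e := IsFreeGroup.toFreeGroup φ.range
  let p : FreeGroup (IsFreeGroup.Generators φ.range) →* Multiplicative ℤ :=
    lift fun _ => Multiplicative.ofAdd 1
  have hp : ∀ y, p (e (φ.rangeRestrict y)) = 1 := fun y => by
    have h1 : y ∈ commutator C := hC ▸ Subgroup.mem_top y
    exact Abelianization.commutator_subset_ker
      ((p.comp e.toMonoidHom).comp φ.rangeRestrict) h1
  have : IsEmpty (IsFreeGroup.Generators φ.range) := ⟨fun i => by
    obtain ⟨y, hy⟩ := φ.rangeRestrict_surjective (e.symm (of i))
    have := hp y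
    rw [hy, e.apply_symm_apply, FreeGroup.lift_apply_of] at this
    exact absurd (ofAdd_eq_one.1 this) one_ne_zero⟩
  have h1 : e (φ.rangeRestrict x) = e 1 := Subsingleton.elim _ _
  exact congrArg Subtype.val (e.injective h1)

/-- Pure braid groups contain no nontrivial perfect subgroups. -/
theorem perfect_eq_one_of_pure (hC : commutator C = ⊤) (k : ℕ) : ∀ φ : C →* Br, (∀ x, φ x ∈ Bn k) →
    (∀ x, perm (φ x) = 1) → ∀ x, φ x = 1 := by
  induction k with
  | zero =>
    intro φ h _ x
    have : Bn 0 ≤ ⊥ := gens_le.2 fun i hi => absurd hi (by omega)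
    exact this (h x)
  | succ k ih =>
    intro φ h hp
    have hf : ∀ x, φ x ∈ fixLast k := fun x => ⟨h x, by rw [hp]; rfl⟩
    let ψ : C →* Br :=
      { toFun x := forget k (φ x)
        map_one' := by rw [map_one]; exact homOn_forget.one
        map_mul' x y := by rw [map_mul]; exact homOn_forget _ (hf x) _ (hf y) }
    have hψ := ih ψ (fun x => forget_mem (hf x)) fun x => (perm_forget (hf x)).trans (hp x)
    choose f hfm hfe using fun x => exists_of_forget_eq_one (hf x) (hψ x)
    have inj : ∀ u ∈ Fr k, ∀ v ∈ Fr k, push k u = push k v → u = v := fun u hu v hv huv => by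
      rw [← mul_inv_eq_one] at huv ⊢
      rw [← map_inv, ← map_mul] at huv
      exact push_injOn (mul_mem hu (inv_mem hv)) huv
    let θ : C →* FreeGroup ℕ := MonoidHom.mk' f fun x y =>
      inj _ (hfm _) _ (mul_mem (hfm x) (hfm y)) (by rw [map_mul, ← hfe, ← hfe, ← hfe, map_mul])
    intro x
    have : f x = 1 := perfect_eq_one_of_free hC θ x
    rw [hfe, this, map_one]

end perfect

section commutator

variable {G : Type*} [Group G] {n : ℕ} {s : ℕ → G}

theorem BraidTuple.div_mem_commutator (h : BraidTuple n s) (hn : 3 ≤ n) :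
    s 0 * (s 1)⁻¹ ∈ commutator G := by
  have : s 0 * (s 1)⁻¹ = ⁅s 0, s 0 * s 1⁆ := by
    have h1 : s 1 = (s 0 * s 1) * s 0 * (s 0 * s 1)⁻¹ := by
      rw [h.braid 0 (by omega)]; group
    rw [commutatorElement_def]
    conv_lhs => rw [h1]
    group
  rw [this]
  exact Subgroup.commutator_mem_commutator (Subgroup.mem_top _) (Subgroup.mem_top _)

/-- A group generated by a braid tuple of at least five strands has perfect derived subgroup. -/
theorem BraidTuple.commutator_perfect (h : BraidTuple n s) (hn : 5 ≤ n)
    (hs : ∀ g, g ∈ gens n s) : commutator (commutator G) = ⊤ := by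
  have hN : (derivedSeries G 2).Normal := derivedSeries_normal G 2
  let p := QuotientGroup.mk' (derivedSeries G 2)
  have hc : ∀ x ∈ commutator G, ∀ y ∈ commutator G, Commute (p x) (p y) := by
    intro x hx y hy
    rw [← commutatorElement_eq_one_iff_commute, ← map_commutatorElement]
    refine (QuotientGroup.eq_one_iff _).2 ?_
    rw [derivedSeries_succ, derivedSeries_one]
    exact Subgroup.commutator_mem_commutator hx hy
  have h01 := h.div_mem_commutator (by omega)
  have h30 : s 3 * (s 0)⁻¹ ∈ commutator G := by
    have hA := (h.map (Abelianization.of (G := G))).eq_zero_of_comm 3 (by omega)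
    rw [← Abelianization.ker_of, MonoidHom.mem_ker, map_mul, map_inv, hA, mul_inv_cancel]
  have hconst := (h.map p).eq_zero_of_commute_div hn (by
    simpa only [map_mul, map_inv] using hc _ h01 _ h30)
  have hz : ∀ g, p g ∈ Subgroup.zpowers (p (s 0)) := fun g =>
    gens_induction (p := fun g => p g ∈ Subgroup.zpowers (p (s 0)))
      (fun i hi => by rw [hconst i hi]; exact Subgroup.mem_zpowers _)
      (by rw [map_one]; exact one_mem _) (fun x y hx hy => by rw [map_mul]; exact mul_mem hx hy)
      (fun x hx => by rw [map_inv]; exact inv_mem hx) (hs g)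
  have hle : commutator G ≤ derivedSeries G 2 := by
    rw [commutator_def, Subgroup.commutator_le]
    intro x _ y _
    rw [← QuotientGroup.eq_one_iff]
    change p ⁅x, y⁆ = 1
    rw [map_commutatorElement, commutatorElement_eq_one_iff_commute]
    obtain ⟨a, ha⟩ := hz x
    obtain ⟨b, hb⟩ := hz y
    rw [← ha, ← hb]
    exact (Commute.refl (p (s 0))).zpow_zpow a b
  rw [eq_top_iff]
  rintro ⟨x, hx⟩ -
  have := hle hx
  rw [derivedSeries_succ, derivedSeries_one] at this
  change _ ∈ ⁅(⊤ : Subgroup (commutator G)), ⊤⁆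
  have hm := Subgroup.map_commutator (⊤ : Subgroup (commutator G)) ⊤ (commutator G).subtype
  rw [← MonoidHom.range_eq_map, Subgroup.range_subtype] at hm
  rw [← hm] at this
  obtain ⟨y, hy, hyx⟩ := this
  rwa [show (⟨x, hx⟩ : commutator G) = y from Subtype.ext hyx.symm]

end commutator

/-- Permutations of the strands given by a braid tuple injective modulo the center are not all
equal. -/
theorem BraidTuple.perm_not_const {n : ℕ} (hn : 5 ≤ n) {s : ℕ → Br} (h : BraidTuple n s)
    (hmem : ∀ i, i + 1 < n → s i ∈ Bn n)
    (hinj : ∀ g ∈ Bn n, Central n (evalTuple h g) → Central n g) :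
    ¬ ∀ j, j + 1 < n → perm (s j) = perm (s 0) := by
  intro hc
  let t : ℕ → Bn n := fun i => if hi : i + 1 < n then ⟨σ i, σ_mem hi⟩ else 1
  have ht : ∀ i (hi : i + 1 < n), t i = ⟨σ i, σ_mem hi⟩ := fun i hi => dif_pos hi
  have htup : BraidTuple n t := by
    have hσ := braidTuple_σ n
    constructor
    · intro i hi
      rw [ht i (by omega), ht (i + 1) (by omega)]
      exact Subtype.ext (hσ.braid i hi)
    · intro i j hij hj
      rw [ht i (by omega), ht j hj]
      exact Subtype.ext (hσ.comm i j hij hj)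
  have hgen : ∀ g, g ∈ gens n t := by
    rintro ⟨g, hg⟩
    have : Bn n ≤ (gens n t).map (Bn n).subtype := gens_le.2 fun i hi =>
      ⟨t i, mem_gens hi, by rw [ht i hi]; rfl⟩
    obtain ⟨y, hy, rfl⟩ := this hg
    exact hy
  have hperf := htup.commutator_perfect hn hgen
  have hR := homOn_evalTuple h
  let φ : Bn n →* Br := hR.toHom
  have hφ : ∀ i (hi : i + 1 < n), φ (t i) = s i := fun i hi => by
    rw [ht i hi]; exact evalTuple_σ h hi
  have hz : ∀ g, perm (φ g) ∈ Subgroup.zpowers (perm (s 0)) := fun g =>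
    gens_induction (p := fun g => perm (φ g) ∈ Subgroup.zpowers (perm (s 0)))
      (fun i hi => by rw [hφ i hi, hc i hi]; exact Subgroup.mem_zpowers _)
      (by rw [map_one, map_one]; exact one_mem _)
      (fun x y hx hy => by rw [map_mul, map_mul]; exact mul_mem hx hy)
      (fun x hx => by rw [map_inv, map_inv]; exact inv_mem hx) (hgen g)
  have hle : commutator (Bn n) ≤ (perm.comp φ).ker := by
    rw [commutator_def, Subgroup.commutator_le]
    intro x _ y _
    rw [MonoidHom.mem_ker, map_commutatorElement, commutatorElement_eq_one_iff_commute]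
    obtain ⟨a, ha⟩ := hz x
    obtain ⟨b, hb⟩ := hz y
    change Commute (perm (φ x)) (perm (φ y))
    rw [← ha, ← hb]
    exact (Commute.refl (perm (s 0))).zpow_zpow a b
  have hone := perfect_eq_one_of_pure hperf n (φ.comp (commutator (Bn n)).subtype)
    (fun x => hR.mem (fun i hi => by rw [evalTuple_σ h hi]; exact hmem i hi) x.1.2)
    (fun x => hle x.2)
  have h01 := hone ⟨_, htup.div_mem_commutator (by omega)⟩
  have hg : σ 0 * (σ 1)⁻¹ ∈ Bn n := mul_mem (σ_mem (by omega)) (inv_mem (σ_mem (by omega)))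
  have h1 : evalTuple h (σ 0 * (σ 1)⁻¹) = 1 := by
    rw [← h01]
    change _ = φ (t 0 * (t 1)⁻¹)
    rw [ht 0 (by omega), ht 1 (by omega)]
    rfl
  have h2 := (hinj _ hg (h1 ▸ central_one n)).eq_one (by omega) (by simp)
  have h3 := congrArg (fun g => perm g 0) h2
  simp [Equiv.swap_apply_def] at h3

end BraidInj

namespace BraidInj

open FreeGroup (of lift norm)
open Equiv

namespace BraidTuple

section spokes

variable {H : Type*} [Group H] {m : ℕ} {s : ℕ → H}

theorem braid_iff_conj {a b c : H} : a * b * a = b * a * b ↔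
    c * a * c⁻¹ * (c * b * c⁻¹) * (c * a * c⁻¹) = c * b * c⁻¹ * (c * a * c⁻¹) * (c * b * c⁻¹) := by
  have h1 : ∀ x y : H, c * x * c⁻¹ * (c * y * c⁻¹) * (c * x * c⁻¹) = MulAut.conj c (x * y * x) := by
    intro x y; rw [MulAut.conj_apply]; group
  rw [h1, h1, (MulAut.conj c).injective.eq_iff]

theorem zero_mul_cc_conj (h : BraidTuple (m + 1) s) {i : ℕ} (hi : i + 1 < m) :
    s 0 * cc s m * s i * (s 0 * cc s m)⁻¹ = s 0 * s (i + 1) * (s 0)⁻¹ := by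
  have := h.cc_mul le_rfl i hi
  rw [mul_assoc (s 0), this]
  group

theorem zero_mul_cc_conj_sq (h : BraidTuple (m + 1) s) (hm : 3 ≤ m) :
    s 0 * cc s m * (s 0 * cc s m) * s 0 * (s 0 * cc s m * (s 0 * cc s m))⁻¹ =
      s 0 * (s 1 * s 2 * (s 1)⁻¹) * (s 0)⁻¹ := by
  have h0 := h.zero_mul_cc_conj (i := 0) (by omega)
  have h1 := h.zero_mul_cc_conj (i := 1) (by omega)
  generalize s 0 * cc s m = d at *
  calc d * d * s 0 * (d * d)⁻¹ = d * (d * s 0 * d⁻¹) * d⁻¹ := by group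
    _ = d * (s 0 * s 1 * (s 0)⁻¹) * d⁻¹ := by rw [h0]
    _ = (d * s 0 * d⁻¹) * (d * s 1 * d⁻¹) * (d * s 0 * d⁻¹)⁻¹ := by group
    _ = _ := by rw [h0, h1]; group

theorem braid_zero_mul_cc (h : BraidTuple (m + 1) s) (hm : 3 ≤ m) {d : H}
    (hd : d = s 0 * cc s m) :
    s 0 * (d * s 0 * d⁻¹) * s 0 = d * s 0 * d⁻¹ * s 0 * (d * s 0 * d⁻¹) := by
  have h0 := h.zero_mul_cc_conj (i := 0) (by omega)
  have hb := braid_iff_conj (c := s 0).1 (h.braid 0 (by omega))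
  rw [hd, h0]
  simpa using hb

theorem braid_zero_mul_cc_sq (h : BraidTuple (m + 1) s) (hm : 3 ≤ m) {d : H}
    (hd : d = s 0 * cc s m) :
    s 0 * (d * d * s 0 * (d * d)⁻¹) * s 0 = d * d * s 0 * (d * d)⁻¹ * s 0 * (d * d * s 0 * (d * d)⁻¹) := by
  have h0 := h.zero_mul_cc_conj_sq hm
  have h12 : s 1 * s 2 * (s 1)⁻¹ = (s 2)⁻¹ * s 1 * s 2 := by
    rw [mul_inv_eq_iff_eq_mul, mul_assoc, mul_assoc, eq_inv_mul_iff_mul_eq, ← mul_assoc, ← mul_assoc]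
    exact (h.braid 1 (by omega)).symm
  have h02 : (s 2)⁻¹ * s 0 * s 2 = s 0 := by
    rw [(h.comm 0 2 le_rfl (by omega)).symm.inv_left.eq, inv_mul_cancel_right]
  have hb := braid_iff_conj (c := (s 2)⁻¹).1 (h.braid 0 (by omega))
  rw [zero_add, inv_inv, h02, ← h12] at hb
  have hb' := braid_iff_conj (c := s 0).1 hb
  rw [hd, h0]
  simpa using hb'

end spokes

end BraidTuple

section five

variable {α : Type*} [Fintype α]

theorem cycleType_of_five_dvd [DecidableEq α] (hα : Fintype.card α ≤ 6) {c : Perm α} (h : 5 ∣ orderOf c) :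
    c.cycleType = {5} := by
  have h5 : Prime 5 := Nat.prime_iff.1 (by norm_num)
  have hsum := c.sum_cycleType.trans_le (Finset.card_le_univ _)
  obtain ⟨k, hk, hdvd⟩ : ∃ k ∈ c.cycleType, 5 ∣ k := by
    rw [← c.lcm_cycleType] at h
    have h2 := h.trans (Multiset.lcm_dvd.2 fun k hk => Multiset.dvd_prod hk)
    exact h5.exists_mem_multiset_dvd h2
  obtain ⟨t, ht⟩ := Multiset.exists_cons_of_mem hk
  rw [ht, Multiset.sum_cons] at hsum
  have hk2 := Perm.two_le_of_mem_cycleType hk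
  obtain rfl : k = 5 := by omega
  rw [ht]
  have : t = 0 := by
    rw [Multiset.eq_zero_iff_forall_notMem]
    intro a ha
    have h1 := Multiset.le_sum_of_mem ha
    have h2 := Perm.two_le_of_mem_cycleType (σ := c) (n := a) (ht ▸ Multiset.mem_cons_of_mem ha)
    omega
  rw [this]; rfl

theorem coprime_five_of_card_lt [DecidableEq α] (hα : Fintype.card α < 5) (c : Perm α) :
    (orderOf c).Coprime 5 := by
  rw [Nat.coprime_comm, Nat.Prime.coprime_iff_not_dvd (by norm_num)]
  intro h
  have h1 := h.trans (orderOf_dvd_card (x := c))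
  rw [Fintype.card_perm, Nat.Prime.dvd_factorial (by norm_num)] at h1
  omega

theorem exists_equiv_of_five_dvd {k : ℕ} (hk : k ≤ 6) (hα : Fintype.card α = k) {c : Perm α}
    (h : 5 ∣ orderOf c) {r : Perm (Fin k)} (hr : orderOf r = 5) :
    ∃ e : α ≃ Fin k, e.permCongrHom c = r := by
  classical
  let e := Fintype.equivFinOfCardEq hα
  have h1 : (e.permCongrHom c).cycleType = {5} :=
    cycleType_of_five_dvd (by simpa) (by rwa [MulEquiv.orderOf_eq])
  have h2 : r.cycleType = {5} := cycleType_of_five_dvd (by simpa) (dvd_of_eq hr.symm)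
  obtain ⟨τ, hτ⟩ := isConj_iff.1 (Perm.isConj_iff_cycleType_eq.2 (h1.trans h2.symm))
  exact ⟨e.trans τ, by rw [← hτ]; ext; rfl⟩

theorem isSwap_permCongrHom {α β : Type*} [DecidableEq α] [DecidableEq β] (e : α ≃ β) {s : Perm α}
    (h : (e.permCongrHom s).IsSwap) : s.IsSwap := by
  obtain ⟨x, y, hxy, h⟩ := h
  refine ⟨e.symm x, e.symm y, e.symm.injective.ne hxy, e.permCongrHom.injective ?_⟩
  rw [h]
  ext z
  simp [Equiv.swap_apply_def]
  grind

end five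

end BraidInj

namespace BraidInj

open FreeGroup (of lift norm)
open Equiv

section tables

def turn : Fin 6 → Fin 6
  | 0 => 1 | 1 => 2 | 2 => 3 | 3 => 4 | 4 => 0 | 5 => 5

def unturn : Fin 6 → Fin 6
  | 0 => 4 | 1 => 0 | 2 => 1 | 3 => 2 | 4 => 3 | 5 => 5

def word (a b c d e f : Fin 6) : Fin 6 → Fin 6
  | 0 => a | 1 => b | 2 => c | 3 => d | 4 => e | 5 => f

/-- The two braid relations between a function and its conjugates by `turn` and its square leave
only three possibilities. -/
def Spoke (s : Fin 6 → Fin 6) : Prop :=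
  (∀ x, s (turn (s (unturn (s x)))) = turn (s (unturn (s (turn (s (unturn x))))))) →
  (∀ x, s (turn (turn (s (unturn (unturn (s x)))))) =
    turn (turn (s (unturn (unturn (s (turn (turn (s (unturn (unturn x))))))))))) →
  (∀ x, s x = turn (s (unturn x))) ∨
  (∃ x y, x ≠ y ∧ ∀ z, s z = if z = x then y else if z = y then x else z) ∨
  (∃ x y, x ≠ y ∧ turn x = s y ∧ turn y = s x) ∧
    ∃ u v w, u ≠ v ∧ turn u = s v ∧ turn v = s w ∧ turn w = s u

instance : DecidablePred Spoke := fun s => by unfold Spoke; infer_instance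

set_option synthInstance.maxHeartbeats 400000 in
set_option synthInstance.maxSize 4000 in
theorem spoke_word : ∀ a b : Fin 6, a = b ∨ ∀ c, c ∈ [a, b] ∨ ∀ d, d ∈ [a, b, c] ∨
    ∀ e, e ∈ [a, b, c, d] ∨ ∀ f, f ∈ [a, b, c, d, e] ∨ Spoke (word a b c d e f) := by
  decide +kernel

theorem spoke_perm (s : Perm (Fin 6)) : Spoke s := by
  have h := spoke_word (s 0) (s 1)
  simp only [List.mem_cons, List.not_mem_nil, s.injective.eq_iff, or_false, zero_ne_one,
    false_or] at h
  replace h := h (s 2)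
  simp only [s.injective.eq_iff, (by decide : ¬((2 : Fin 6) = 0 ∨ (2 : Fin 6) = 1)), false_or] at h
  replace h := h (s 3)
  simp only [s.injective.eq_iff,
    (by decide : ¬((3 : Fin 6) = 0 ∨ (3 : Fin 6) = 1 ∨ (3 : Fin 6) = 2)), false_or] at h
  replace h := h (s 4)
  simp only [s.injective.eq_iff,
    (by decide : ¬((4 : Fin 6) = 0 ∨ (4 : Fin 6) = 1 ∨ (4 : Fin 6) = 2 ∨ (4 : Fin 6) = 3)),
    false_or] at h
  replace h := h (s 5)
  simp only [s.injective.eq_iff,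
    (by decide : ¬((5 : Fin 6) = 0 ∨ (5 : Fin 6) = 1 ∨ (5 : Fin 6) = 2 ∨ (5 : Fin 6) = 3 ∨
      (5 : Fin 6) = 4)), false_or] at h
  have e : word (s 0) (s 1) (s 2) (s 3) (s 4) (s 5) = s := by
    funext i; fin_cases i <;> rfl
  rwa [e] at h

def turnPerm : Perm (Fin 6) where
  toFun := turn
  invFun := unturn
  left_inv := by unfold Function.LeftInverse; decide
  right_inv := by unfold Function.RightInverse Function.LeftInverse; decide

theorem orderOf_turnPerm : orderOf turnPerm = 5 :=
  have : Fact (Nat.Prime 5) := ⟨by norm_num⟩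
  orderOf_eq_prime (Equiv.ext (by decide)) (fun h => by
    have := congrArg (fun f : Perm (Fin 6) => f 0) h
    revert this; decide)

theorem orderOf_finRotate_five : orderOf (finRotate 5) = 5 :=
  have : Fact (Nat.Prime 5) := ⟨by norm_num⟩
  orderOf_eq_prime (Equiv.ext (by decide)) (fun h => by
    have := congrArg (fun f : Perm (Fin 5) => f 0) h
    revert this; decide)

theorem isSwap_of_commute_rotate : ∀ s : Perm (Fin 5),
    (∀ x, s (s (x - 2) + 2) = s (s x - 2) + 2) →
    (∀ x, s (x + 1) = s x + 1) ∨ ∃ x y, x ≠ y ∧ s = swap x y := by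
  decide +kernel

theorem eq_of_braid_rotate : ∀ s : Perm (Fin 5),
    (∀ x, s (s (s x - 1) + 1) = s (s (s (x - 1) + 1) - 1) + 1) →
    (∀ x, s (s (s x - 2) + 2) = s (s (s (x - 2) + 2) - 2) + 2) → ∀ x, s (x + 1) = s x + 1 := by
  decide +kernel

end tables

section small

variable {α : Type*} [Fintype α] [DecidableEq α] {s : ℕ → Perm α}

theorem BraidTuple.eq_zero_of_card_lt_five (h : BraidTuple 5 s) (hα : Fintype.card α < 5) :
    ∀ j, j + 1 < 5 → s j = s 0 :=
  BraidTuple.eq_zero_of_coprime_cc (m := 4) h (by norm_num) (coprime_five_of_card_lt hα _)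

theorem BraidTuple.eq_zero_of_perm_finRotate {s : ℕ → Perm (Fin 5)} (h : BraidTuple 5 s)
    (hc : cc s 4 = finRotate 5) : (∀ j, j + 1 < 5 → s j = s 0) ∨ (s 0).IsSwap := by
  have h1 := h.cc_mul (m := 4) le_rfl 0 (by norm_num)
  have h2 := h.cc_mul (m := 4) le_rfl 1 (by norm_num)
  rw [hc] at h1 h2
  have a1 : ∀ x, s 1 x = s 0 (x - 1) + 1 := fun x => by
    have := congrArg (fun f : Perm (Fin 5) => f (x - 1)) h1
    simpa using this.symm
  have a2 : ∀ x, s 2 x = s 0 (x - 2) + 2 := fun x => by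
    have := congrArg (fun f : Perm (Fin 5) => f (x - 1)) h2
    simp only [Perm.mul_apply, finRotate_apply, a1, sub_add_cancel] at this
    rw [← this, sub_sub, add_assoc]; rfl
  rcases isSwap_of_commute_rotate (s 0) (fun x => by
    have := congrArg (fun f : Perm (Fin 5) => f x) (h.comm 0 2 le_rfl (by norm_num)).eq
    simpa [a2] using this) with h3 | h3
  · refine .inl (h.eq_zero_of_eq (i := 0) (by norm_num) (Equiv.ext fun x => ?_))
    have := h3 (x - 1)
    rw [sub_add_cancel] at this
    rw [this]; exact a1 x
  · exact .inr h3

theorem BraidTuple.isSwap_of_card_five (h : BraidTuple 5 s) (hα : Fintype.card α = 5) :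
    (∀ j, j + 1 < 5 → s j = s 0) ∨ (s 0).IsSwap := by
  by_cases hd : 5 ∣ orderOf (cc s 4)
  · obtain ⟨e, he⟩ := exists_equiv_of_five_dvd (by norm_num) hα hd orderOf_finRotate_five
    have h1 := h.map e.permCongrHom.toMonoidHom
    have h2 := h1.eq_zero_of_perm_finRotate ((map_cc e.permCongrHom.toMonoidHom s 4).symm.trans he)
    exact h2.imp (fun h3 j hj => e.permCongrHom.injective (h3 j hj)) (isSwap_permCongrHom e)
  · exact .inl (BraidTuple.eq_zero_of_coprime_cc (m := 4) h (by norm_num)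
      ((Nat.Prime.coprime_iff_not_dvd (by norm_num)).2 hd).symm)

theorem BraidTuple.eq_zero_of_perm_zero_mul_cc_finRotate {s : ℕ → Perm (Fin 5)}
    (h : BraidTuple 6 s) (hd : finRotate 5 = s 0 * cc s 5) : ∀ j, j + 1 < 6 → s j = s 0 := by
  have b0 := h.zero_mul_cc_conj (m := 5) (i := 0) (by norm_num)
  have b1 := h.braid_zero_mul_cc (m := 5) (by norm_num) hd
  have b2 := h.braid_zero_mul_cc_sq (m := 5) (by norm_num) hd
  have hi : ∀ x, (finRotate 5)⁻¹ x = x - 1 := by decide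
  have h1 := eq_of_braid_rotate (s 0)
    (fun x => by
      simpa only [Perm.mul_apply, hi, finRotate_apply] using congrArg (fun f : Perm (Fin 5) => f x) b1)
    (fun x => by
      have := congrArg (fun f : Perm (Fin 5) => f x) b2
      simp only [Perm.mul_apply, mul_inv_rev, hi, finRotate_apply, sub_sub, add_assoc] at this
      exact this)
  refine h.eq_zero_of_eq (i := 0) (by norm_num) ?_
  have h2 : finRotate 5 * s 0 * (finRotate 5)⁻¹ = s 0 := by
    rw [mul_inv_eq_iff_eq_mul]
    exact Equiv.ext fun x => by simpa using (h1 x).symm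
  rw [← hd, h2] at b0
  exact (mul_left_cancel (mul_inv_eq_iff_eq_mul.1 b0.symm))

theorem BraidTuple.eq_zero_of_card_lt_six (h : BraidTuple 6 s) (hα : Fintype.card α < 6) :
    ∀ j, j + 1 < 6 → s j = s 0 := by
  by_cases hd : 5 ∣ orderOf (s 0 * cc s 5)
  · have hα' : Fintype.card α = 5 := by
      by_contra hne
      have := coprime_five_of_card_lt (show Fintype.card α < 5 by omega) (s 0 * cc s 5)
      exact (Nat.Prime.coprime_iff_not_dvd (by norm_num)).1 this.symm hd
    obtain ⟨e, he⟩ := exists_equiv_of_five_dvd (by norm_num) hα' hd orderOf_finRotate_five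
    have h1 := h.map e.permCongrHom.toMonoidHom
    have hd' : finRotate 5 = e.permCongrHom (s 0) * cc (fun i => e.permCongrHom (s i)) 5 := by
      rw [← he, map_mul]; congr 1; exact map_cc e.permCongrHom.toMonoidHom s 5
    exact fun j hj => e.permCongrHom.injective
      (h1.eq_zero_of_perm_zero_mul_cc_finRotate hd' j hj)
  · exact BraidTuple.eq_zero_of_coprime_zero_mul_cc (m := 5) h (by norm_num)
      ((Nat.Prime.coprime_iff_not_dvd (by norm_num)).2 hd).symm

/-- Permutations with a 2-cycle and a 3-cycle. -/
def Exotic {β : Type*} (c : Perm β) : Prop :=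
  (∃ x y, x ≠ y ∧ c x = y ∧ c y = x) ∧ ∃ u v w, u ≠ v ∧ c u = v ∧ c v = w ∧ c w = u

theorem exotic_permCongrHom {α β : Type*} (e : α ≃ β) {c : Perm α} (h : Exotic (e.permCongrHom c)) :
    Exotic c := by
  have key : ∀ x y, e.permCongrHom c x = y ↔ c (e.symm x) = e.symm y := fun x y => by
    rw [Equiv.eq_symm_apply]; rfl
  obtain ⟨⟨x, y, h1, h2, h3⟩, u, v, w, h4, h5, h6, h7⟩ := h
  exact ⟨⟨_, _, e.symm.injective.ne h1, (key _ _).1 h2, (key _ _).1 h3⟩,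
    _, _, _, e.symm.injective.ne h4, (key _ _).1 h5, (key _ _).1 h6, (key _ _).1 h7⟩

theorem BraidTuple.isSwap_or_exotic {s : ℕ → Perm (Fin 6)} (h : BraidTuple 6 s)
    (hd : turnPerm = s 0 * cc s 5) :
    (∀ j, j + 1 < 6 → s j = s 0) ∨ (s 0).IsSwap ∨ Exotic (cc s 5) := by
  have b0 := h.zero_mul_cc_conj (m := 5) (i := 0) (by norm_num)
  have b1 := h.braid_zero_mul_cc (m := 5) (by norm_num) hd
  have b2 := h.braid_zero_mul_cc_sq (m := 5) (by norm_num) hd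
  rcases spoke_perm (s 0) (fun x => congrArg (fun f : Perm (Fin 6) => f x) b1)
    (fun x => congrArg (fun f : Perm (Fin 6) => f x) b2) with h1 | h1 | h1
  · left
    refine h.eq_zero_of_eq (i := 0) (by norm_num) ?_
    have h2 : turnPerm * s 0 * turnPerm⁻¹ = s 0 := Equiv.ext fun x => (h1 x).symm
    rw [← hd, h2] at b0
    exact (mul_left_cancel (mul_inv_eq_iff_eq_mul.1 b0.symm))
  · obtain ⟨x, y, hxy, h2⟩ := h1
    exact .inr (.inl ⟨x, y, hxy, Equiv.ext fun z => by rw [h2, swap_apply_def]⟩)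
  · have key : ∀ x y, turn x = s 0 y → cc s 5 x = y := fun x y hxy => by
      have h2 := congrArg (fun f : Perm (Fin 6) => f x) hd
      exact (s 0).injective (h2.symm.trans hxy)
    obtain ⟨⟨x, y, h1, h2, h3⟩, u, v, w, h4, h5, h6, h7⟩ := h1
    exact .inr (.inr ⟨⟨x, y, h1, key _ _ h2, key _ _ h3⟩, u, v, w, h4, key _ _ h5, key _ _ h6,
      key _ _ h7⟩)

theorem BraidTuple.isSwap_or_exotic_of_card_six (h : BraidTuple 6 s) (hα : Fintype.card α = 6) :
    (∀ j, j + 1 < 6 → s j = s 0) ∨ (s 0).IsSwap ∨ Exotic (cc s 5) := by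
  by_cases hd : 5 ∣ orderOf (s 0 * cc s 5)
  · obtain ⟨e, he⟩ := exists_equiv_of_five_dvd (by norm_num) hα hd orderOf_turnPerm
    have h1 := h.map e.permCongrHom.toMonoidHom
    have hcc := map_cc e.permCongrHom.toMonoidHom s 5
    have hd' : turnPerm = e.permCongrHom (s 0) * cc (fun i => e.permCongrHom (s i)) 5 := by
      rw [← he, map_mul]; congr 1
    refine (h1.isSwap_or_exotic hd').imp (fun h3 j hj => e.permCongrHom.injective (h3 j hj))
      (Or.imp (isSwap_permCongrHom e) fun h3 => exotic_permCongrHom e ?_)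
    rw [← hcc] at h3
    exact h3
  · exact .inl (BraidTuple.eq_zero_of_coprime_zero_mul_cc (m := 5) h (by norm_num)
      ((Nat.Prime.coprime_iff_not_dvd (by norm_num)).2 hd).symm)

end small

end BraidInj

namespace BraidInj

open Equiv

section centralizer

variable {α : Type*} [Fintype α] [DecidableEq α]

theorem commute_of_commute_cycles {g a b : Perm α} (ha : ∀ x, g x = x → a x = x)
    (hb : ∀ x, g x = x → b x = x) (hac : ∀ c ∈ g.cycleFactorsFinset, Commute a c)
    (hbc : ∀ c ∈ g.cycleFactorsFinset, Commute b c) : Commute a b := by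
  refine Equiv.ext fun x => ?_
  by_cases hx : g x = x
  · simp [ha x hx, hb x hx]
  have hc : g.cycleOf x ∈ g.cycleFactorsFinset :=
    Perm.cycleOf_mem_cycleFactorsFinset_iff.mpr (Perm.mem_support.mpr hx)
  have hcyc : (g.cycleOf x).IsCycle := (Perm.mem_cycleFactorsFinset_iff.mp hc).1
  have hxs : x ∈ (g.cycleOf x).support :=
    Perm.mem_support_cycleOf_iff.mpr ⟨Perm.SameCycle.refl _ _, Perm.mem_support.mpr hx⟩
  have key : ∀ f : Perm α, Commute f (g.cycleOf x) → ∃ i : ℤ, (g.cycleOf x ^ i) x = f x :=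
    fun f hf => hcyc.sameCycle (Perm.mem_support.mp hxs)
      (Perm.mem_support.mp ((Perm.mem_support_iff_of_commute hf x).mpr hxs))
  obtain ⟨i, hi⟩ := key a (hac _ hc)
  obtain ⟨j, hj⟩ := key b (hbc _ hc)
  rw [Perm.mul_apply, Perm.mul_apply, ← hi, ← hj, ← Perm.mul_apply, ← Perm.mul_apply,
    ((hac _ hc).zpow_right j).eq, ((hbc _ hc).zpow_right i).eq, Perm.mul_apply, Perm.mul_apply,
    ← hi, ← hj, ← Perm.mul_apply, ← Perm.mul_apply, zpow_mul_comm]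

theorem card_cycleFactorsFinset_le (g : Perm α) :
    2 * g.cycleFactorsFinset.card ≤ Fintype.card α := by
  have h : g.cycleType.card = g.cycleFactorsFinset.card := by simp [Perm.cycleType_def]
  have := Multiset.card_nsmul_le_sum (s := g.cycleType) (a := 2)
    fun x hx => Perm.two_le_of_mem_cycleType hx
  rw [Perm.sum_cycleType, smul_eq_mul, h] at this
  have := Finset.card_le_univ g.support
  omega

/-- The action of the centralizer of a permutation on its fixed points. -/
def fixedPointsHom (g : Perm α) : Subgroup.centralizer {g} →* Perm {x // g x = x} where
  toFun k := k.1.subtypePerm fun x => by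
    have := Subgroup.mem_centralizer_singleton_iff.mp k.2
    rw [← Perm.mul_apply, ← this, Perm.mul_apply, EmbeddingLike.apply_eq_iff_eq]
  map_one' := rfl
  map_mul' _ _ := rfl

theorem card_fixedPoints (g : Perm α) :
    Fintype.card {x // g x = x} = Fintype.card α - g.support.card := by
  have : Fintype.card {x // g x ≠ x} = g.support.card := by
    rw [Fintype.card_subtype]; rfl
  rw [← this, Fintype.card_subtype_compl]
  have := Fintype.card_subtype_le fun x => g x = x
  omega

end centralizer

universe u

/-- All braid tuples of length `n` of permutations of at most `k` points are constant. -/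
def Rigid (n k : ℕ) : Prop :=
  ∀ (β : Type u) [Fintype β] [DecidableEq β], Fintype.card β < k → ∀ s : ℕ → Perm β,
    BraidTuple n s → ∀ j, j + 1 < n → s j = s 0

theorem BraidTuple.exists_restrict {H : Type*} [Group H] {n : ℕ} {s : ℕ → H} (h : BraidTuple n s)
    (K : Subgroup H) (hK : ∀ i, i + 1 < n → s i ∈ K) :
    ∃ t : ℕ → K, BraidTuple n t ∧ ∀ i, i + 1 < n → (t i : H) = s i := by
  have ht : ∀ i (hi : i + 1 < n), (if hi : i + 1 < n then ⟨s i, hK i hi⟩ else 1 : K) = s i :=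
    fun i hi => by simp [hi]
  refine ⟨fun i => if hi : i + 1 < n then ⟨s i, hK i hi⟩ else 1,
    ⟨fun i hi => Subtype.ext ?_, fun i j hij hj => Subtype.ext ?_⟩, ht⟩
  · simp only [Subgroup.coe_mul, ht i (by omega), ht (i + 1) (by omega)]
    exact h.braid i hi
  · simp only [Subgroup.coe_mul, ht i (by omega), ht j (by omega)]
    exact h.comm i j hij hj

theorem BraidTuple.eq_zero_or_le_card_fixedPoints {α : Type u} [Fintype α] [DecidableEq α] {n : ℕ}
    {s : ℕ → Perm α} (h : BraidTuple n s) (hn : 7 ≤ n) (hα : Fintype.card α ≤ n)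
    (ih : Rigid.{u} (n - 2) (n - 2)) :
    (∀ j, j + 1 < n → s j = s 0) ∨ n - 2 ≤ Fintype.card {x // s 0 x = x} := by
  refine or_iff_not_imp_right.mpr fun hfix => ?_
  push Not at hfix
  have ht := h.shift 2
  obtain ⟨t, htt, htv⟩ := ht.exists_restrict (Subgroup.centralizer {s 0}) fun i hi =>
    Subgroup.mem_centralizer_singleton_iff.mpr (h.comm 0 (i + 2) (by omega) (by omega)).symm.eq
  have h1 := ih _ hfix _ (htt.map (fixedPointsHom (s 0)))
  have hcard : Fintype.card (s 0).cycleFactorsFinset < n - 2 := by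
    have := card_cycleFactorsFinset_le (s 0)
    rw [Fintype.card_coe]
    omega
  have h2 := ih _ hcard _ (htt.map (Perm.OnCycleFactors.toPermHom (s 0)))
  have fix : ∀ i j, i + 1 < n - 2 → j + 1 < n - 2 →
      (∀ x, s 0 x = x → (s (i + 2) * (s (j + 2))⁻¹) x = x) ∧
      ∀ c ∈ (s 0).cycleFactorsFinset, Commute (s (i + 2) * (s (j + 2))⁻¹) c := by
    intro i j hi hj
    have e1 : fixedPointsHom (s 0) (t i * (t j)⁻¹) = 1 := by
      rw [map_mul, map_inv, h1 i hi, h1 j hj, mul_inv_cancel]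
    have e2 : t i * (t j)⁻¹ ∈ (Perm.OnCycleFactors.toPermHom (s 0)).ker := by
      rw [MonoidHom.mem_ker, map_mul, map_inv, h2 i hi, h2 j hj, mul_inv_cancel]
    rw [Perm.OnCycleFactors.mem_ker_toPermHom_iff] at e2
    rw [← htv i hi, ← htv j hj]
    refine ⟨fun x hx => ?_, e2⟩
    exact congrArg Subtype.val (DFunLike.congr_fun e1 ⟨x, hx⟩)
  obtain ⟨a1, a2⟩ := fix 0 1 (by omega) (by omega)
  obtain ⟨b1, b2⟩ := fix 3 0 (by omega) (by omega)
  have hconst := ht.eq_zero_of_commute_div (by omega) (commute_of_commute_cycles a1 b1 a2 b2)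
  exact h.eq_zero_of_eq (i := 2) (by omega) (hconst 1 (by omega))

theorem BraidTuple.eq_zero_of_zero_eq_one {H : Type*} [Group H] {n : ℕ} {s : ℕ → H}
    (h : BraidTuple n s) (hn : 3 ≤ n) (h0 : s 0 = 1) : ∀ j, j + 1 < n → s j = s 0 :=
  h.eq_zero_of_commute (i := 0) (by omega) (h0 ▸ Commute.one_left _)

theorem rigid : ∀ n, 5 ≤ n → Rigid.{u} n n := by
  intro n
  induction n using Nat.strong_induction_on with
  | _ n ih =>
    intro hn β _ _ hβ s h
    rcases (by omega : n = 5 ∨ n = 6 ∨ 7 ≤ n) with rfl | rfl | h7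
    · exact h.eq_zero_of_card_lt_five hβ
    · exact h.eq_zero_of_card_lt_six hβ
    · rcases h.eq_zero_or_le_card_fixedPoints h7 hβ.le (ih (n - 2) (by omega) (by omega)) with h1 | h1
      · exact h1
      · refine h.eq_zero_of_zero_eq_one (by omega) (Perm.card_support_le_one.mp ?_)
        rw [card_fixedPoints] at h1
        omega

/-- A braid tuple of length `n` of permutations of `n` points is constant or begins with a swap,
with the exception of the tuples of length six arising from the exotic automorphism of the
symmetric group. -/
theorem BraidTuple.isSwap_of_card {α : Type u} [Fintype α] [DecidableEq α] {n : ℕ}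
    {s : ℕ → Perm α} (h : BraidTuple n s) (hn : 5 ≤ n) (hα : Fintype.card α = n)
    (hs : ¬ ∀ j, j + 1 < n → s j = s 0) : (s 0).IsSwap ∨ n = 6 ∧ Exotic (cc s 5) := by
  rcases (by omega : n = 5 ∨ n = 6 ∨ 7 ≤ n) with rfl | rfl | h7
  · exact Or.inl ((h.isSwap_of_card_five hα).resolve_left hs)
  · simpa using (h.isSwap_or_exotic_of_card_six hα).resolve_left hs
  · have h1 := (h.eq_zero_or_le_card_fixedPoints h7 hα.le (rigid _ (by omega))).resolve_left hs
    rw [card_fixedPoints] at h1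
    have h2 : (s 0).support.card ≠ 1 := Perm.card_support_ne_one _
    have h3 : ¬ (s 0).support.card ≤ 1 := fun h3 =>
      hs (h.eq_zero_of_zero_eq_one (by omega) (Perm.card_support_le_one.mp h3))
    exact Or.inl (Perm.card_support_eq_two.mp (by omega))

end BraidInj

namespace BraidInj

open Equiv

section chain

variable {α : Type*} [DecidableEq α]

theorem eq_of_commute_swap {x y z : α} (hxy : x ≠ y) (hyz : y ≠ z)
    (hc : Commute (swap x y) (swap y z)) : x = z := by
  by_contra hxz
  have h1 := DFunLike.congr_fun hc.eq z
  rw [Perm.mul_apply, Perm.mul_apply, swap_apply_right, swap_apply_right,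
    swap_apply_of_ne_of_ne (Ne.symm hxz) hyz.symm, swap_apply_right] at h1
  exact hxy h1

variable {m : ℕ} {u : ℕ → Perm α}

theorem BraidTuple.eq_swap (h : BraidTuple (m + 1) u) {a b : α} (h0 : u 0 = swap a b) :
    ∀ i < m, u i = swap ((cc u m ^ i) a) ((cc u m ^ i) b) := by
  intro i hi
  have h1 := h.cc_pow_mul i 0 (by omega)
  rw [zero_add, h0] at h1
  rw [mul_swap_eq_swap_mul] at h1
  exact (mul_right_cancel h1).symm

/-- A chain of swaps. -/
theorem BraidTuple.injOn_chain (h : BraidTuple (m + 1) u) (hm : 4 ≤ m)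
    (hu : ¬ ∀ j, j + 1 < m + 1 → u j = u 0) {c : Perm α} {a : α}
    (hc : ∀ i < m, u i = swap ((c ^ i) a) ((c ^ (i + 1)) a)) :
    Set.InjOn (fun i : ℕ => (c ^ i) a) (Set.Iic m) := by
  have hne : c a ≠ a := fun h1 => hu (h.eq_zero_of_eq (i := 0) (by omega) (by
    have h2 : (c * c) a = a := by rw [Perm.mul_apply, h1, h1]
    rw [hc 0 (by omega), hc 1 (by omega)]
    simp [pow_succ, h1, h2]))
  have hlt : ∀ d < m, 0 < d → (c ^ d) a ≠ a := by
    intro d hd h0 hda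
    have e1 : (c ^ (d + 1)) a = c a := by rw [pow_succ', Perm.mul_apply, hda]
    rcases (by omega : d = 1 ∨ 2 ≤ d) with rfl | h2
    · exact hne (by simpa using hda)
    · refine hu (h.eq_zero_of_eq_of_le (by omega) (i := 0) (j := d) (by omega) (by omega) ?_)
      rw [hc 0 (by omega), hc d hd, hda, e1]
      simp
  have hle : ∀ d ≤ m, 0 < d → (c ^ d) a ≠ a := by
    intro d hd h0 hda
    obtain rfl : d = m := by
      by_contra hne
      exact hlt d (by omega) h0 hda
    have h1 := h.comm 0 (d - 1) (by omega) (by omega)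
    rw [hc 0 (by omega), hc (d - 1) (by omega), show d - 1 + 1 = d by omega, hda, swap_comm,
      pow_zero, Perm.one_apply, zero_add, pow_one, swap_comm ((c ^ (d - 1)) a)] at h1
    have h2 := eq_of_commute_swap hne (hlt (d - 1) (by omega) (by omega)).symm h1
    have h3 : (c ^ (d - 2)) a = a := by
      apply c.injective
      rw [← Perm.mul_apply, ← pow_succ', show d - 2 + 1 = d - 1 by omega, h2]
    exact hlt (d - 2) (by omega) (by omega) h3
  have hij : ∀ i j, i < j → j ≤ m → (c ^ i) a ≠ (c ^ j) a := by
    intro i j hij hj he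
    refine hle (j - i) (by omega) (by omega) ?_
    apply (c ^ i).injective
    rw [← Perm.mul_apply, ← pow_add, Nat.add_sub_cancel' hij.le, he]
  intro i hi j hj he
  rcases lt_trichotomy i j with h1 | h1 | h1
  · exact absurd he (hij i j h1 hj)
  · exact h1
  · exact absurd he.symm (hij j i h1 hi)

/-- A nonconstant braid tuple of permutations beginning with a swap is a chain of swaps. -/
theorem BraidTuple.exists_chain (h : BraidTuple (m + 1) u) (hm : 4 ≤ m)
    (hu : ¬ ∀ j, j + 1 < m + 1 → u j = u 0) (h0 : (u 0).IsSwap) :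
    ∃ p : ℕ → α, Set.InjOn p (Set.Iic m) ∧ ∀ i < m, u i = swap (p i) (p (i + 1)) := by
  suffices key : ∃ a b, u 0 = swap a b ∧ cc u m a = b by
    obtain ⟨a, b, hab, hb⟩ := key
    have hc : ∀ i < m, u i = swap ((cc u m ^ i) a) ((cc u m ^ (i + 1)) a) := by
      intro i hi
      rw [h.eq_swap hab i hi, pow_succ, Perm.mul_apply, hb]
    exact ⟨_, h.injOn_chain hm hu hc, hc⟩
  obtain ⟨a, b, hab, h0⟩ := h0
  have fix : ∀ a b, a ≠ b → u 0 = swap a b → cc u m a ≠ a := by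
    intro a b hab h0 ha
    have h2 := h.eq_swap h0 2 (by omega)
    have ha2 : (cc u m ^ 2) a = a := by rw [pow_two, Perm.mul_apply, ha, ha]
    rw [ha2] at h2
    have hc := h.comm 0 2 (by omega) (by omega)
    rw [h0, h2, swap_comm] at hc
    have := eq_of_commute_swap hab.symm
      (fun h3 => hab ((cc u m ^ 2).injective (ha2.trans h3))) hc
    refine hu (h.eq_zero_of_eq_of_le (by omega) (i := 0) (j := 2) (by omega) (by omega) ?_)
    rw [h0, h2, ← this]
  by_cases h1 : cc u m a = b
  · exact ⟨a, b, h0, h1⟩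
  by_cases h2 : cc u m b = a
  · exact ⟨b, a, by rw [h0, swap_comm], h2⟩
  refine absurd (h.eq_zero_of_commute (i := 0) (by omega) ?_) hu
  have h3 := fix a b hab h0
  have h4 := fix b a hab.symm (by rw [h0, swap_comm])
  rw [h.eq_swap h0 1 (by omega), h0, pow_one]
  refine (Perm.disjoint_swap_swap ?_).commute
  have := (cc u m).injective.ne hab
  simp only [List.nodup_cons, List.mem_cons, List.not_mem_nil, or_false, not_or,
    not_false_eq_true, List.nodup_nil, and_true]
  exact ⟨⟨hab, Ne.symm h3, Ne.symm h2⟩, ⟨Ne.symm h1, Ne.symm h4⟩, this⟩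

end chain

end BraidInj

namespace BraidInj

open Equiv

/-- The permutation of the first `n` strands underlying a braid on them. -/
def permFin (n : ℕ) : Bn n →* Perm (Fin n) where
  toFun g :=
    { toFun := fun i => ⟨perm g i, (perm_lt_iff g.2 i).mpr i.2⟩
      invFun := fun i => ⟨perm (g⁻¹ : Bn n) i, (perm_lt_iff (g⁻¹).2 i).mpr i.2⟩
      left_inv := fun i => Fin.ext (by simp)
      right_inv := fun i => Fin.ext (by simp) }
  map_one' := Equiv.ext fun i => Fin.ext (by simp)
  map_mul' g h := Equiv.ext fun i => Fin.ext (by simp)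

theorem permFin_apply {n : ℕ} (g : Bn n) (i : Fin n) : (permFin n g i : ℕ) = perm g i := rfl

theorem perm_eq_of_permFin {n : ℕ} {g h : Bn n} (e : permFin n g = permFin n h) :
    perm g = perm h := by
  ext i
  rcases lt_or_ge i n with hi | hi
  · exact congrArg Fin.val (DFunLike.congr_fun e ⟨i, hi⟩)
  · rw [perm_lt g.2 i hi, perm_lt h.2 i hi]

theorem permFin_σ {n i : ℕ} (hi : i + 1 < n) :
    permFin n ⟨σ i, σ_mem hi⟩ = swap ⟨i, by omega⟩ ⟨i + 1, hi⟩ := by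
  ext j
  rw [permFin_apply, perm_σ, swap_apply_def, swap_apply_def]
  simp only [Fin.ext_iff]
  split_ifs <;> rfl

theorem permFin_surjective (n : ℕ) : Function.Surjective (permFin n) := by
  rcases n with - | n
  · exact Function.surjective_to_subsingleton _
  · rw [← MonoidHom.mrange_eq_top, ← top_le_iff, ← Perm.mclosure_swap_castSucc_succ n, Submonoid.closure_le]
    rintro _ ⟨i, rfl⟩
    exact ⟨⟨σ i, σ_mem (by omega)⟩, permFin_σ (by omega)⟩

/-- The sixth power of a braid whose permutation contains a two-cycle and a three-cycle is not a
power of the full twist. -/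
theorem not_exotic_of_pow_six {n : ℕ} {g : Bn n} {e : ℤ} (h : (g : Br) ^ 6 = T n ^ e) :
    ¬ Exotic (permFin n g) := by
  rintro ⟨⟨x, y, hxy, hx, hy⟩, u, v, w, huv, hu, hv, hw⟩
  have lkT : ∀ i j, i < j → j < n → lk ((g : Br) ^ 6) i j = e * 2 := fun i j hij hj => by
    rw [h, lk_zpow (perm_T n), lk_T n i j hij, if_pos hj]
  have odd : ∀ x y : ℕ, x < y → y < n → perm g x = y → perm g y = x → ∃ L, Odd L ∧ e = 3 * L := by
    intro x y hxy hyn hx hy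
    have h1 : ¬ Even (lk g x y) := by rw [even_lk_iff _ _ _ hxy, hx, hy]; omega
    refine ⟨_, Int.not_even_iff_odd.mp h1, ?_⟩
    have h2 := lkT x y hxy hyn
    simp only [pow_succ, pow_zero, one_mul, lk_mul, hx, hy,
      lk_symm (g : Br) y x] at h2
    omega
  have even : ∀ x y : ℕ, x < y → y < n → perm ((g : Br) ^ 3) x = x → perm ((g : Br) ^ 3) y = y →
      Even e := by
    intro x y hxy hyn hx hy
    have h1 := lkT x y hxy hyn
    rw [show (g : Br) ^ 6 = g ^ 3 * g ^ 3 by group, lk_mul, hx, hy] at h1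
    have h2 : Even (lk ((g : Br) ^ 3) x y) := by rwa [even_lk_iff _ _ _ hxy, hx, hy]
    rwa [show e = lk ((g : Br) ^ 3) x y by omega]
  have odd_e : Odd e := by
    obtain ⟨L, hL, rfl⟩ : ∃ L, Odd L ∧ e = 3 * L := by
      have hx' := congrArg Fin.val hx
      have hy' := congrArg Fin.val hy
      rcases lt_or_gt_of_ne (Fin.val_ne_of_ne hxy) with h1 | h1
      · exact odd x y h1 y.2 hx' hy'
      · exact odd y x h1 x.2 hy' hx'
    exact Odd.mul (by decide) hL
  refine Int.not_even_iff_odd.mpr odd_e ?_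
  have hu3 : perm ((g : Br) ^ 3) u = u := by
    have := congrArg Fin.val (show (permFin n g ^ 3) u = u by simp [pow_succ, hu, hv, hw])
    rwa [← map_pow, permFin_apply] at this
  have hv3 : perm ((g : Br) ^ 3) v = v := by
    have := congrArg Fin.val (show (permFin n g ^ 3) v = v by simp [pow_succ, hu, hv, hw])
    rwa [← map_pow, permFin_apply] at this
  rcases lt_or_gt_of_ne (Fin.val_ne_of_ne huv) with h1 | h1
  · exact even u v h1 v.2 hu3 hv3
  · exact even v u h1 u.2 hv3 hu3

theorem central_cc_σ {m : ℕ} : Central (m + 1) (cc σ m ^ (m + 1)) :=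
  ⟨pow_mem (cc_mem fun i hi => σ_mem (by omega)) _, fun g hg =>
    ((braidTuple_σ (m + 1)).commute_cc_pow_gens hg).symm⟩

theorem evalTuple_cc {H : Type*} [Group H] {n : ℕ} {s : ℕ → H} (h : BraidTuple n s) {k : ℕ}
    (hk : k < n) : evalTuple h (cc σ k) = cc s k := by
  induction k with
  | zero => exact (homOn_evalTuple h).one
  | succ k ih =>
    rw [cc_succ, cc_succ, homOn_evalTuple h _ (cc_mem fun i hi => σ_mem (by omega)) _ (σ_mem hk),
      ih (by omega), evalTuple_σ h hk]

theorem cc_congr {H : Type*} [Group H] {s t : ℕ → H} {k : ℕ} (h : ∀ i < k, s i = t i) :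
    cc s k = cc t k := by
  induction k with
  | zero => rfl
  | succ k ih => rw [cc_succ, cc_succ, ih fun i hi => h i (by omega), h k (by omega)]

theorem BraidTuple.geo_of_central {n : ℕ} (hn : 5 ≤ n) {s : ℕ → Br} (h : BraidTuple n s)
    (hs : ∀ i, i + 1 < n → s i ∈ Bn n) (hT : Central n (evalTuple h (T n)))
    (hinj : ∀ g ∈ Bn n, Central n (evalTuple h g) → Central n g) : Geo n s := by
  obtain ⟨m, rfl⟩ : ∃ m, n = m + 1 := ⟨n - 1, by omega⟩
  obtain ⟨t, ht, hts⟩ := h.exists_restrict (Bn (m + 1)) hs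
  have hu := ht.map (permFin (m + 1))
  have hnc : ¬ ∀ j, j + 1 < m + 1 → permFin (m + 1) (t j) = permFin (m + 1) (t 0) := fun hc =>
    h.perm_not_const hn hs hinj fun j hj => by
      rw [← hts j hj, ← hts 0 (by omega)]
      exact perm_eq_of_permFin (hc j hj)
  have hswap : (permFin (m + 1) (t 0)).IsSwap := by
    refine (hu.isSwap_of_card hn (Fintype.card_fin _) hnc).resolve_right ?_
    rintro ⟨hm, hex⟩
    obtain rfl : m = 5 := by omega
    rw [← map_cc] at hex
    have hR := homOn_evalTuple h
    have hcc : ((cc t 5 : Bn 6) : Br) = evalTuple h (cc σ 5) := by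
      rw [evalTuple_cc h (by omega), ← cc_congr fun i hi => hts i (by omega)]
      exact map_cc (Bn 6).subtype t 5
    obtain ⟨k, hk⟩ := (central_cc_σ (m := 5)).mem_zpowers (by omega)
    obtain ⟨l, hl⟩ := hT.mem_zpowers (by omega)
    change T 6 ^ k = _ at hk
    change T 6 ^ l = _ at hl
    refine not_exotic_of_pow_six (e := l * k) ?_ hex
    rw [hcc, zpow_mul, hl, ← hR.zpow (T_mem 6), hk, ← zpow_natCast, ← zpow_natCast,
      hR.zpow (cc_mem fun i hi => σ_mem (by omega))]
  obtain ⟨p, hp, hpu⟩ := hu.exists_chain (by omega) hnc hswap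
  have hbij : Function.Bijective fun i : Fin (m + 1) => p i :=
    Finite.injective_iff_bijective.mp fun i j hij => Fin.ext (hp (by simp; omega) (by simp; omega) hij)
  obtain ⟨c, hc⟩ := permFin_surjective _ (Equiv.ofBijective _ hbij).symm
  have hstd : Std (m + 1) fun i => (c : Br) * s i * (c : Br)⁻¹ := by
    refine ⟨h.map (MulAut.conj (c : Br)).toMonoidHom, fun i hi =>
      mul_mem (mul_mem c.2 (hs i hi)) (inv_mem c.2), fun i hi => ?_⟩
    have hpi : ∀ i (hi : i < m + 1), permFin (m + 1) c (p i) = ⟨i, hi⟩ := fun i hi => by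
      rw [hc]
      exact (Equiv.ofBijective _ hbij).symm_apply_apply ⟨i, hi⟩
    rw [← perm_σ, ← hts i hi]
    refine perm_eq_of_permFin (g := c * t i * c⁻¹) (h := ⟨σ i, σ_mem hi⟩) ?_
    rw [permFin_σ hi, map_mul, map_mul, map_inv, hpu i (by omega), ← swap_apply_apply,
      hpi, hpi]
  obtain ⟨d, hd, k, e, he, hg⟩ := hstd.geo (by omega)
  beta_reduce at hg
  refine ⟨(c : Br)⁻¹ * d, mul_mem (inv_mem c.2) hd, k, e, he, fun i hi => ?_⟩
  calc s i = (c : Br)⁻¹ * (c * s i * (c : Br)⁻¹) * c := by group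
    _ = (c : Br)⁻¹ * (d * σ i ^ e * d⁻¹) * (T (m + 1) ^ k * c) := by rw [hg i hi]; group
    _ = _ := by rw [← (T_zpow_comm c.2 k).eq]; group

end BraidInj

namespace BraidInj

/-- Homomorphisms from a braid group to a braid group modulo its center lift. -/
theorem exists_lift {n : ℕ} (hn : 3 ≤ n) {ρ : Br → Qn n} (h : HomOn (Bn n) ρ) :
    ∃ s, BraidTuple n s ∧ ∀ i, i + 1 < n → s i ∈ Bn n ∧ q n (s i) = ρ (σ i) := by
  have hq := homOn_q n
  have hρ := h.braidTuple
  have step : ∀ i g, i + 2 < n → g ∈ Bn n → q n g = ρ (σ i) →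
      ∃ g' ∈ Bn n, q n g' = ρ (σ (i + 1)) ∧ g * g' * g = g' * g * g' := by
    intro i g hi hg hgρ
    obtain ⟨w, hw, hwρ⟩ := exists_q (ρ (σ (i + 1)))
    have m1 := mul_mem (mul_mem hg hw) hg
    have m2 := mul_mem (mul_mem hw hg) hw
    have hz : Central n (g * w * g * (w * g * w)⁻¹) := by
      rw [← q_eq_iff m1 m2, hq _ (mul_mem hg hw) _ hg, hq _ hg _ hw, hq _ (mul_mem hw hg) _ hw,
        hq _ hw _ hg, hgρ, hwρ]
      exact hρ.braid i hi
    obtain ⟨z, hz, e⟩ : ∃ z, Central n z ∧ g * w * g = z * (w * g * w) := ⟨_, hz, by group⟩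
    refine ⟨w * z, mul_mem hw hz.1, ?_, ?_⟩
    · rw [hq _ hw _ hz.1, (q_eq_one_iff hz.1).mpr hz, mul_one, hwρ]
    · have c1 := (hz.2 g hg).eq
      have c2 := (hz.2 w hw).eq
      calc g * (w * z) * g = g * w * (z * g) := by group
        _ = g * w * g * z := by rw [c1]; group
        _ = z * w * g * w * z := by rw [e]; group
        _ = _ := by rw [c2]; group
  choose! F hF hFρ hFb using step
  obtain ⟨r, hr, hrρ⟩ := exists_q (ρ (σ 0))
  let s : ℕ → Br := fun i => Nat.rec r F i
  have hs : ∀ i, i + 1 < n → s i ∈ Bn n ∧ q n (s i) = ρ (σ i) := by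
    intro i
    induction i with
    | zero => exact fun _ => ⟨hr, hrρ⟩
    | succ i ih =>
      intro hi
      obtain ⟨h1, h2⟩ := ih (by omega)
      exact ⟨hF i _ hi h1 h2, hFρ i _ hi h1 h2⟩
  refine ⟨s, ⟨fun i hi => hFb i _ hi (hs i (by omega)).1 (hs i (by omega)).2,
    fun i j hij hj => ?_⟩, hs⟩
  obtain ⟨mi, ei⟩ := hs i (by omega)
  obtain ⟨mj, ej⟩ := hs j hj
  have hz : Central n (s i * s j * (s j * s i)⁻¹) := by
    rw [← q_eq_iff (mul_mem mi mj) (mul_mem mj mi), hq _ mi _ mj, hq _ mj _ mi, ei, ej]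
    exact hρ.comm i j hij hj
  refine mul_inv_eq_one.mp (hz.eq_one hn ?_)
  rw [map_mul, map_inv, map_mul, map_mul, mul_comm (expSum (s j)), mul_inv_cancel]

/-- The injective endomorphisms of a braid group modulo its center, for the inductive model of the
braid group. -/
theorem geometric_of_injective {n : ℕ} (hn : 4 ≤ n) {ρ : Qn n →* Qn n}
    (hρ : Function.Injective ρ) :
    ∃ b : Qn n, (∀ x ∈ Bn n, ρ (q n x) = b * q n x * b⁻¹) ∨
      ∀ x ∈ Bn n, ρ (q n x) = b * q n (mirror x) * b⁻¹ := by
  have hq := homOn_q n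
  obtain ⟨s, hs, hsρ⟩ := exists_lift (by omega) (hq.map ρ)
  have hR := homOn_evalTuple hs
  have hm : ∀ g ∈ Bn n, evalTuple hs g ∈ Bn n := fun g hg =>
    hR.mem (fun i hi => by rw [evalTuple_σ hs hi]; exact (hsρ i hi).1) hg
  have hqR : ∀ g ∈ Bn n, q n (evalTuple hs g) = ρ (q n g) := by
    intro g hg
    refine HomOn.eqOn_gens (ρ := fun g => q n (evalTuple hs g))
      (fun x hx y hy => ?_) (hq.map ρ) (fun i hi => ?_) hg
    · simp only [hR x hx y hy, hq _ (hm x hx) _ (hm y hy)]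
    · simp only [evalTuple_σ hs hi, (hsρ i hi).2]
  have hinj : ∀ g ∈ Bn n, Central n (evalTuple hs g) → Central n g := fun g hg hc => by
    rw [← q_eq_one_iff (hm g hg), hqR g hg, map_eq_one_iff ρ hρ] at hc
    exact (q_eq_one_iff hg).mp hc
  have hT : Central n (evalTuple hs (T n)) := by
    rw [← q_eq_one_iff (hm _ (T_mem n)), hqR _ (T_mem n), q_T, map_one]
  rcases hn.eq_or_lt with rfl | h5
  · obtain ⟨b, hb⟩ := geometric_of_injective_four hR hm hinj hT
    exact ⟨b, hb.imp (fun hb x hx => by rw [← hqR x hx, hb x hx])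
      fun hb x hx => by rw [← hqR x hx, hb x hx]⟩
  obtain ⟨c, hc, t, e, he, hg⟩ := hs.geo_of_central h5 (fun i hi => (hsρ i hi).1) hT hinj
  have hσ : ∀ i, i + 1 < n → ρ (q n (σ i)) = q n c * q n (σ i ^ e) * (q n c)⁻¹ := by
    intro i hi
    have m1 := zpow_mem (σ_mem hi) e
    have m2 := mul_mem (mul_mem hc m1) (inv_mem hc)
    have m3 := (central_T n).zpow t
    rw [← (hsρ i hi).2, hg i hi, hq _ m2 _ m3.1, (q_eq_one_iff m3.1).mpr m3, mul_one,
      hq.conj hc m1]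
  refine ⟨q n c, ?_⟩
  rcases he with rfl | rfl
  · refine Or.inl fun x hx => ?_
    refine (hq.map ρ).eqOn_gens (hq.conjBy (q n c)) (fun i hi => ?_) hx
    simp only [hσ i hi, zpow_one]
  · refine Or.inr fun x hx => ?_
    refine (hq.map ρ).eqOn_gens ((hq.comp_hom (f := mirror) (L := Bn n)
      fun _ => mirror_mem).conjBy (q n c)) (fun i hi => ?_) hx
    simp only [hσ i hi, mirror_σ, zpow_neg_one]

theorem presEquiv_inversion {n : ℕ} {χ : MulAut (BraidGroup n)}
    (hχ : ∀ i, χ (braidσ n i) = (braidσ n i)⁻¹) (g : BraidGroup n) :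
    (presEquiv n (χ g) : Br) = mirror (presEquiv n g) := by
  have : ((Bn n).subtype.comp (presEquiv n).toMonoidHom).comp χ.toMonoidHom =
      mirror.comp ((Bn n).subtype.comp (presEquiv n).toMonoidHom) := by
    refine PresentedGroup.ext fun i => ?_
    change (presEquiv n (χ (braidσ n i)) : Br) = mirror (presEquiv n (braidσ n i))
    rw [hχ, map_inv, presEquiv_braidσ, mirror_σ]
    rfl
  exact DFunLike.congr_fun this g

/-- The presented braid group modulo its center is isomorphic to `Qn n`. -/
noncomputable def centerEquiv (n : ℕ) : BraidGroup n ⧸ Subgroup.center (BraidGroup n) ≃* Qn n :=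
  QuotientGroup.congr _ _ (presEquiv n) (by
    ext x
    refine Subgroup.mem_map_equiv.trans ?_
    simp only [Subgroup.mem_center_iff]
    exact ⟨fun h y => by simpa using congrArg (presEquiv n) (h ((presEquiv n).symm y)),
      fun h y => by simpa using congrArg (presEquiv n).symm (h (presEquiv n y))⟩)

theorem centerEquiv_mk (n : ℕ) (g : BraidGroup n) :
    centerEquiv n (QuotientGroup.mk g) = q n (presEquiv n g) :=
  (q_of_mem (presEquiv n g).2).symm

end BraidInj

theorem braidModCenter_inj_endo_geometric (n : ℕ) (hn : 4 ≤ n)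
    (χ : MulAut (BraidGroup n))
    (hχ : ∀ i : Fin (n - 1), χ (braidσ n i) = (braidσ n i)⁻¹)
    (χb : MulAut (BraidGroup n ⧸ Subgroup.center (BraidGroup n)))
    (hχb : ∀ g : BraidGroup n,
      χb (QuotientGroup.mk g) = QuotientGroup.mk (χ g))
    (ρ : BraidGroup n ⧸ Subgroup.center (BraidGroup n) →*
         BraidGroup n ⧸ Subgroup.center (BraidGroup n))
    (hρ : Function.Injective ρ) :
    ∃ (c : BraidGroup n ⧸ Subgroup.center (BraidGroup n)) (e : ℕ),
      (e = 0 ∨ e = 1) ∧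
      ∀ x, ρ x = c * (χb ^ e) x * c⁻¹ := by
  open BraidInj in
  let φ := centerEquiv n
  have hφ : ∀ g, φ (QuotientGroup.mk g) = q n (presEquiv n g) := centerEquiv_mk n
  have hinj : Function.Injective ((φ.toMonoidHom.comp ρ).comp φ.symm.toMonoidHom) :=
    (φ.injective.comp hρ).comp φ.symm.injective
  obtain ⟨b, hb⟩ := geometric_of_injective hn hinj
  have hb' : (∀ g, φ (ρ (QuotientGroup.mk g)) = b * φ (QuotientGroup.mk g) * b⁻¹) ∨
      ∀ g, φ (ρ (QuotientGroup.mk g)) = b * φ (χb (QuotientGroup.mk g)) * b⁻¹ := by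
    refine hb.imp (fun h g => ?_) fun h g => ?_
    · have := h _ (presEquiv n g).2
      rw [← hφ] at this
      simpa using this
    · have := h _ (presEquiv n g).2
      rw [← hφ, ← presEquiv_inversion hχ, ← hφ, ← hχb] at this
      simpa using this
  rcases hb' with h | h
  · refine ⟨φ.symm b, 0, Or.inl rfl, fun x => φ.injective ?_⟩
    obtain ⟨g, rfl⟩ := QuotientGroup.mk_surjective x
    simpa using h g
  · refine ⟨φ.symm b, 1, Or.inr rfl, fun x => φ.injective ?_⟩
    obtain ⟨g, rfl⟩ := QuotientGroup.mk_surjective x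
    simpa using h g
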